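/- Integrality of normalized twisted traces: let p be a prime with p−1 dividing 24, and D > 1, −d < 0 coprime fundamental discriminants both congruent to squares mod 4p. Then (1/√D)·t^{(p)}(D,d) is a rational integer, where t^{(p)}(D,d) = ∑_{Q ∈ Q_{dD,p,β}/Γ₀(p)} χ(Q)·j_p*(α_Q). -/

import Mathlib

open Complex

/-- An integral binary quadratic form `[a,b,c] = aX² + bXY + cY²`. -/
structure BQF where
  a : ℤ
  b : ℤ
  c : ℤ
deriving DecidableEq

/-- The discriminant `b² − 4ac` of a binary quadratic form. -/
def BQF.disc (Q : BQF) : ℤ := Q.b ^ 2 - 4 * Q.a * Q.c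

/-- Positive definiteness of a binary quadratic form. -/
def BQF.IsPosDef (Q : BQF) : Prop := 0 < Q.a ∧ Q.disc < 0

/-- The (right) action `Q ∘ g` of `SL₂(ℤ)` on binary quadratic forms,
`(Q ∘ g)(x,y) = Q(αx + βy, γx + δy)` for `g = (α,β;γ,δ)`. -/
def BQF.act (Q : BQF) (g : Matrix.SpecialLinearGroup (Fin 2) ℤ) : BQF :=
  ⟨Q.a * (g.1 0 0) ^ 2 + Q.b * (g.1 0 0) * (g.1 1 0) + Q.c * (g.1 1 0) ^ 2,
   2 * Q.a * (g.1 0 0) * (g.1 0 1) + Q.b * ((g.1 0 0) * (g.1 1 1) + (g.1 0 1) * (g.1 1 0))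
     + 2 * Q.c * (g.1 1 0) * (g.1 1 1),
   Q.a * (g.1 0 1) ^ 2 + Q.b * (g.1 0 1) * (g.1 1 1) + Q.c * (g.1 1 1) ^ 2⟩

/-- `Q ∈ 𝒬_d`: positive definite of discriminant `−d`. -/
def BQF.mem (d : ℤ) (Q : BQF) : Prop := Q.IsPosDef ∧ Q.disc = -d

/-- `Q ∈ 𝒬_{d,N,β}`: positive definite of discriminant `−d` with `N ∣ a` and
`b ≡ β (mod 2N)`. -/
def BQF.memN (d : ℤ) (N : ℕ) (β : ℤ) (Q : BQF) : Prop :=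
  Q.mem d ∧ (N : ℤ) ∣ Q.a ∧ Q.b ≡ β [ZMOD (2 * N)]

/-- Equivalence of forms under a subgroup `G` of `SL₂(ℤ)`. -/
def BQF.equiv (G : Subgroup (Matrix.SpecialLinearGroup (Fin 2) ℤ)) (Q Q' : BQF) : Prop :=
  ∃ g ∈ G, Q.act g = Q'

/-- The root `α_Q ∈ 𝔥` of a positive definite form `Q = [a,b,c]`. -/
noncomputable def BQF.root (Q : BQF) : ℂ :=
  (-(Q.b : ℂ) + Complex.I * Real.sqrt (-(Q.disc : ℝ))) / (2 * Q.a)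

/-- A natural number `q` is represented by the form `Q`. -/
def BQF.Represents (Q : BQF) (q : ℕ) : Prop :=
  ∃ x y : ℤ, Q.a * x ^ 2 + Q.b * x * y + Q.c * y ^ 2 = (q : ℤ)

/-- The Kronecker symbol `(a/2)`. -/
def kroneckerAtTwo (a : ℤ) : ℤ :=
  if a % 2 = 0 then 0 else if a % 8 = 1 ∨ a % 8 = 7 then 1 else -1

/-- The Kronecker symbol `(a/n)`. -/
def kronecker (a : ℤ) (n : ℕ) : ℤ :=
  if n = 0 then (if a = 1 ∨ a = -1 then 1 else 0)
  else n.factorization.prod fun p k =>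
    (if p = 2 then kroneckerAtTwo a else jacobiSym a p) ^ k

/-- `D` is a fundamental discriminant. -/
def IsFundamentalDiscriminant (D : ℤ) : Prop :=
  (D % 4 = 1 ∧ Squarefree D) ∨
    (D % 4 = 0 ∧ Squarefree (D / 4) ∧ ((D / 4) % 4 = 2 ∨ (D / 4) % 4 = 3))

/-- The Dedekind eta function (without the standard normalization issues):
`η(τ) = q^{1/24} ∏_{n≥1} (1 − qⁿ)`, `q = e^{2πiτ}`. -/
noncomputable def dedekindEta (τ : ℂ) : ℂ :=
  Complex.exp (2 * Real.pi * Complex.I * τ / 24) *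
    ∏' n : ℕ, (1 - Complex.exp (2 * Real.pi * Complex.I * (n + 1) * τ))

/-- For `p − 1 ∣ 24`, the Hauptmodul of `Γ₀(p)*`:
`j_p* = (η(τ)/η(pτ))^{24/(p−1)} + 24/(p−1) + p^{12/(p−1)} (η(pτ)/η(τ))^{24/(p−1)}`. -/
noncomputable def jpStar (p : ℕ) (τ : ℂ) : ℂ :=
  (dedekindEta τ / dedekindEta (p * τ)) ^ (24 / (p - 1)) + (24 / (p - 1) : ℕ) +
    (p : ℂ) ^ (12 / (p - 1)) * (dedekindEta (p * τ) / dedekindEta τ) ^ (24 / (p - 1))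

theorem HasSum.congr_fun' {ι : Type*} {f g : ι → ℂ} {a : ℂ} (hg : HasSum g a)
    (h : ∀ i, f i = g i) : HasSum f a := (funext h : f = g) ▸ hg

/-! ### Functions on the unit disc given by power series over a ring -/

section PowerSeriesOnDisc

variable {A : Type*} [CommRing A] [Algebra A ℂ]

/-- `u` is given on the open unit disc by the power series `P`. -/
def Ser (P : PowerSeries A) (u : ℂ → ℂ) : Prop :=
  ∀ y : ℂ, ‖y‖ < 1 → HasSum (fun n => algebraMap A ℂ (P.coeff n) * y ^ n) (u y)

theorem Ser.summable_norm {P : PowerSeries A} {u : ℂ → ℂ} (h : Ser P u) {y : ℂ}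
    (hy : ‖y‖ < 1) : Summable fun n => ‖algebraMap A ℂ (P.coeff n) * y ^ n‖ :=
  (h y hy).summable.norm

theorem Ser.congr {P : PowerSeries A} {u v : ℂ → ℂ} (h : Ser P u)
    (huv : ∀ y, ‖y‖ < 1 → u y = v y) : Ser P v := fun y hy => huv y hy ▸ h y hy

theorem Ser.add {P Q : PowerSeries A} {u v : ℂ → ℂ} (hu : Ser P u) (hv : Ser Q v) :
    Ser (P + Q) (fun y => u y + v y) := fun y hy => by
  simpa [add_mul] using (hu y hy).add (hv y hy)

theorem Ser.neg {P : PowerSeries A} {u : ℂ → ℂ} (hu : Ser P u) :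
    Ser (-P) (fun y => -u y) := fun y hy => by
  simpa using (hu y hy).neg

theorem Ser.mul {P Q : PowerSeries A} {u v : ℂ → ℂ} (hu : Ser P u) (hv : Ser Q v) :
    Ser (P * Q) (fun y => u y * v y) := fun y hy => by
  have h1 := hu.summable_norm hy
  have h2 := hv.summable_norm hy
  have h3 := (summable_norm_sum_mul_antidiagonal_of_summable_norm h1 h2).of_norm.hasSum
  rw [← tsum_mul_tsum_eq_tsum_sum_antidiagonal_of_summable_norm h1 h2, (hu y hy).tsum_eq,
    (hv y hy).tsum_eq] at h3
  refine h3.congr_fun' fun n => ?_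
  rw [PowerSeries.coeff_mul, map_sum, Finset.sum_mul]
  refine Finset.sum_congr rfl fun x hx => ?_
  rw [← (Finset.HasAntidiagonal.mem_antidiagonal.1 hx), map_mul, pow_add]
  ring

theorem Ser.const (c : A) : Ser (PowerSeries.C c) (fun _ => algebraMap A ℂ c) := fun y _ => by
  convert hasSum_single 0 fun n hn => ?_
  · simp
  · simp [PowerSeries.coeff_C, hn]

theorem Ser.one : Ser (1 : PowerSeries A) (fun _ => 1) := by
  simpa using Ser.const (1 : A)

theorem Ser.id : Ser (PowerSeries.X : PowerSeries A) (fun y => y) := fun y _ => by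
  convert hasSum_single 1 fun n hn => ?_
  · simp
  · simp [PowerSeries.coeff_X, hn]

theorem Ser.pow {P : PowerSeries A} {u : ℂ → ℂ} (hu : Ser P u) (n : ℕ) :
    Ser (P ^ n) (fun y => u y ^ n) := by
  induction n with
  | zero => simpa using Ser.one
  | succ n ih => simpa [pow_succ] using ih.mul hu

theorem Ser.rescale {P : PowerSeries A} {u : ℂ → ℂ} (hu : Ser P u) (ζ : A)
    (hζ : ‖algebraMap A ℂ ζ‖ ≤ 1) :
    Ser (PowerSeries.rescale ζ P) (fun y => u (algebraMap A ℂ ζ * y)) := fun y hy => by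
  convert hu (algebraMap A ℂ ζ * y) ?_ using 2 with n
  · simp [PowerSeries.coeff_rescale, mul_pow]; ring
  · rw [norm_mul]
    exact (mul_le_of_le_one_left (norm_nonneg _) hζ).trans_lt hy

theorem Ser.expand {P : PowerSeries A} {u : ℂ → ℂ} (hu : Ser P u) (k : ℕ) (hk : k ≠ 0) :
    Ser (P.expand k hk) (fun y => u (y ^ k)) := fun y hy => by
  have h := hu (y ^ k) (by rw [norm_pow]; exact pow_lt_one₀ (norm_nonneg _) hy hk)
  rw [← (mul_right_injective₀ hk).hasSum_iff]
  · convert h using 2 with n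
    simp [pow_mul]
  · intro n hn
    rw [PowerSeries.coeff_expand_of_not_dvd, map_zero, zero_mul]
    rintro ⟨m, rfl⟩
    exact hn ⟨m, rfl⟩

theorem Ser.map {B : Type*} [CommRing B] [Algebra B ℂ] (f : A →+* B)
    (hf : (algebraMap B ℂ).comp f = algebraMap A ℂ)
    {P : PowerSeries A} {u : ℂ → ℂ} (hu : Ser P u) : Ser (P.map f) u := fun y hy => by
  convert hu y hy using 3 with n
  rw [← hf]; simp

theorem Ser.zero_eq {P : PowerSeries A} {u : ℂ → ℂ} (hu : Ser P u) :
    u 0 = algebraMap A ℂ P.constantCoeff := by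
  have h := hu 0 (by simp)
  rw [h.unique (hasSum_single 0 fun n hn => by simp [hn])]
  simp

theorem Ser.hasFPowerSeriesOnBall {P : PowerSeries A} {u : ℂ → ℂ} (hu : Ser P u) :
    HasFPowerSeriesOnBall u
      (FormalMultilinearSeries.ofScalars ℂ fun n => algebraMap A ℂ (P.coeff n)) 0 1 where
  r_le := by
    refine ENNReal.le_of_forall_nnreal_lt fun r hr => ?_
    refine FormalMultilinearSeries.le_radius_of_summable_norm _ ?_
    have hr' : (r : ℝ) < 1 := by exact_mod_cast hr
    have := hu.summable_norm (y := (r : ℂ)) (by simpa using hr')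
    simpa [FormalMultilinearSeries.ofScalars_norm] using this
  r_pos := one_pos
  hasSum := fun {y} hy => by
    have hy' : ‖y‖ < 1 := by
      rw [Metric.mem_eball, edist_zero_right] at hy
      simpa [← ofReal_norm] using hy
    simpa [FormalMultilinearSeries.ofScalars_apply_eq, mul_comm] using hu y hy'

theorem Ser.differentiableOn {P : PowerSeries A} {u : ℂ → ℂ} (hu : Ser P u) :
    DifferentiableOn ℂ u (Metric.ball 0 1) := by
  have := hu.hasFPowerSeriesOnBall.differentiableOn
  rwa [← ENNReal.coe_one, Metric.eball_coe, NNReal.coe_one] at this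

theorem Ser.unique {P Q : PowerSeries ℂ} {u : ℂ → ℂ} (hP : Ser P u) (hQ : Ser Q u) :
    P = Q := by
  ext n
  have := hP.hasFPowerSeriesOnBall.hasFPowerSeriesAt.eq_formalMultilinearSeries
    hQ.hasFPowerSeriesOnBall.hasFPowerSeriesAt
  have h2 := FormalMultilinearSeries.ofScalars_series_injective ℂ ℂ this
  exact congrFun h2 n

theorem ser_of_differentiableOn {u : ℂ → ℂ} (hu : DifferentiableOn ℂ u (Metric.ball 0 1)) :
    ∃ P : PowerSeries ℂ, Ser P u := by
  refine ⟨PowerSeries.mk fun n => (n.factorial : ℂ)⁻¹ * iteratedDeriv n u 0, fun y hy => ?_⟩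
  have := Complex.hasSum_taylorSeries_on_ball hu (z := y) (by simpa using hy)
  refine this.congr_fun' fun n => ?_
  simp only [PowerSeries.coeff_mk, Algebra.algebraMap_self, RingHom.id_apply, sub_zero,
    smul_eq_mul]
  ring

/-- The inverse of a nonvanishing function given by a power series with constant coefficient 1. -/
theorem Ser.inv {P : PowerSeries A} {u : ℂ → ℂ} (hu : Ser P u) (h1 : P.constantCoeff = 1)
    (h0 : ∀ y, ‖y‖ < 1 → u y ≠ 0) :
    Ser (P.invOfUnit 1) (fun y => (u y)⁻¹) := by
  obtain ⟨Q, hQ⟩ := ser_of_differentiableOn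
    (hu.differentiableOn.inv fun y hy => h0 y (by simpa using hy))
  have hP' : Ser (P.map (algebraMap A ℂ)) u := hu.map _ (by ext; simp)
  have h2 : P.map (algebraMap A ℂ) * Q = 1 := by
    refine ((hP'.mul hQ).congr fun y hy => ?_).unique Ser.one
    exact mul_inv_cancel₀ (h0 y hy)
  have h3 : P.map (algebraMap A ℂ) * (P.invOfUnit 1).map (algebraMap A ℂ) = 1 := by
    rw [← map_mul, PowerSeries.mul_invOfUnit _ _ (by simpa using h1), map_one]
  have h4 : Q = (P.invOfUnit 1).map (algebraMap A ℂ) := by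
    calc Q = (P.map (algebraMap A ℂ) * (P.invOfUnit 1).map (algebraMap A ℂ)) * Q := by
          rw [h3, one_mul]
      _ = (P.map (algebraMap A ℂ) * Q) * (P.invOfUnit 1).map (algebraMap A ℂ) := by ring
      _ = _ := by rw [h2, one_mul]
  intro y hy
  have := hQ y hy
  rw [h4] at this
  simpa using this

end PowerSeriesOnDisc

/-! ### The Euler product -/

/-- The Euler function `∏ (1 - x ^ (n + 1))`. -/
noncomputable def euler (x : ℂ) : ℂ := ∏' n : ℕ, (1 - x ^ (n + 1))

theorem euler_ne_zero {x : ℂ} (hx : ‖x‖ < 1) : euler x ≠ 0 := by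
  have := tprod_one_add_ne_zero_of_summable (f := fun n : ℕ => -x ^ (n + 1)) (fun n => ?_) ?_
  · simpa [euler, sub_eq_add_neg] using this
  · rw [← sub_eq_add_neg, sub_ne_zero]
    intro h
    have h2 : ‖x ^ (n + 1)‖ < 1 := by
      rw [norm_pow]; exact pow_lt_one₀ (norm_nonneg _) hx (by simp)
    rw [← h] at h2; simp at h2
  · simpa using (summable_nat_add_iff 1).mpr (summable_geometric_of_lt_one (norm_nonneg _) hx)

theorem exists_ser_euler : ∃ P : PowerSeries ℤ, P.constantCoeff = 1 ∧ Ser P euler := by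
  let w : Finset ℕ → ℕ := fun s => ∑ n ∈ s, (n + 1)
  have hfin : ∀ k, (w ⁻¹' {k}).Finite := fun k => by
    refine (Finset.finite_toSet (Finset.range k).powerset).subset fun s hs => ?_
    simp only [Finset.coe_powerset, Set.mem_preimage, Set.mem_powerset_iff]
    intro n hn
    have : n + 1 ≤ w s := Finset.single_le_sum (f := fun n => n + 1) (by simp) hn
    have hs' : w s = k := hs
    simp; omega
  let a : ℕ → ℤ := fun k => ∑ s ∈ (hfin k).toFinset, (-1) ^ s.card
  have hS : Ser (PowerSeries.mk a) euler := fun y hy => by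
    have hs : Summable fun s : Finset ℕ => ∏ n ∈ s, -y ^ (n + 1) := by
      refine summable_finsetProd_of_summable_norm ?_
      simpa using (summable_nat_add_iff 1).mpr (summable_geometric_of_lt_one (norm_nonneg _) hy)
    have h1 : euler y = ∑' s : Finset ℕ, ∏ n ∈ s, -y ^ (n + 1) := by
      rw [← tprod_one_add hs]; simp [euler, sub_eq_add_neg]
    have h2 := hs.hasSum.tsum_fiberwise w
    rw [← h1] at h2
    refine h2.congr_fun' fun k => ?_
    have : ∀ s : w ⁻¹' {k}, ∏ n ∈ s.1, -y ^ (n + 1) = (-1) ^ s.1.card * y ^ k := by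
      rintro ⟨s, hs⟩
      obtain rfl : w s = k := hs
      rw [Finset.prod_neg, Finset.prod_pow_eq_pow_sum]
    rw [tsum_congr this]
    have := (hfin k).fintype
    rw [tsum_fintype, PowerSeries.coeff_mk, ← Finset.sum_mul]
    congr 1
    simp only [a, eq_intCast, Int.cast_sum, Int.cast_pow, Int.cast_neg, Int.cast_one]
    rw [← Finset.sum_subtype (f := fun s : Finset ℕ => ((-1) ^ s.card : ℂ))]
    simp
  refine ⟨_, ?_, hS⟩
  have := hS.zero_eq
  rw [show euler 0 = 1 by simp [euler]] at this
  simpa using this.symm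

/-! ### Möbius transformations -/

/-- The Möbius transformation with integral coefficients. -/
noncomputable def mob (a b c d : ℤ) (τ : ℂ) : ℂ := (a * τ + b) / (c * τ + d)

theorem den_ne_zero {τ : ℂ} (hτ : 0 < τ.im) {c d : ℤ} (h : c ≠ 0 ∨ d ≠ 0) :
    (c * τ + d : ℂ) ≠ 0 := by
  intro h0
  have him := congrArg Complex.im h0
  have hre := congrArg Complex.re h0
  simp at him hre
  rcases him with hc | hc
  · subst hc; simp at hre h; exact h hre
  · exact hτ.ne' hc

theorem ne_zero_or_of_det {a b c d : ℤ} (h : a * d - b * c ≠ 0) : c ≠ 0 ∨ d ≠ 0 := by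
  by_contra! h2
  simp [h2] at h

theorem mob_im (a b c d : ℤ) (τ : ℂ) :
    (mob a b c d τ).im = (a * d - b * c) * τ.im / normSq (c * τ + d) := by
  rw [mob, div_im]
  by_cases h : normSq (c * τ + d) = 0
  · simp [h]
  field_simp
  simp
  ring

theorem mob_im_pos {τ : ℂ} (hτ : 0 < τ.im) {a b c d : ℤ} (h : 0 < a * d - b * c) :
    0 < (mob a b c d τ).im := by
  rw [mob_im]
  have h1 : (0 : ℝ) < a * d - b * c := by exact_mod_cast h
  have h2 := normSq_pos.2 (den_ne_zero hτ (ne_zero_or_of_det h.ne'))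
  positivity

theorem den_mob (c d a' b' c' d' : ℤ) {τ : ℂ} (h : (c' * τ + d' : ℂ) ≠ 0) :
    (c * mob a' b' c' d' τ + d : ℂ) =
      ((c * a' + d * c' : ℤ) * τ + (c * b' + d * d' : ℤ)) / (c' * τ + d') := by
  rw [mob, mul_div_assoc', div_add' _ _ _ h]
  congr 1; push_cast; ring

theorem mob_mob (a b c d a' b' c' d' : ℤ) {τ : ℂ} (h : (c' * τ + d' : ℂ) ≠ 0) :
    mob a b c d (mob a' b' c' d' τ) =
      mob (a * a' + b * c') (a * b' + b * d') (c * a' + d * c') (c * b' + d * d') τ := by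
  rw [mob, den_mob _ _ _ _ _ _ h, den_mob _ _ _ _ _ _ h, mob, div_div_div_cancel_right₀ h]

theorem mob_smul {a b c d : ℤ} (n : ℤ) (hn : n ≠ 0) (τ : ℂ) :
    mob (n * a) (n * b) (n * c) (n * d) τ = mob a b c d τ := by
  have : (n : ℂ) ≠ 0 := by exact_mod_cast hn
  rw [mob, mob, ← mul_div_mul_left (a * τ + b) _ this]
  push_cast
  congr 1 <;> ring

/-! ### The eta function -/

/-- The nome `exp (2πiτ)`. -/
noncomputable def ex (τ : ℂ) : ℂ := exp (2 * Real.pi * I * τ)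

theorem ex_add (s t : ℂ) : ex (s + t) = ex s * ex t := by rw [ex, ex, ex, ← exp_add]; ring_nf

theorem ex_ne_zero (τ : ℂ) : ex τ ≠ 0 := exp_ne_zero _

theorem ex_int (n : ℤ) : ex n = 1 := by
  rw [ex, exp_eq_one_iff]; exact ⟨n, by ring⟩

theorem ex_nat_mul (n : ℕ) (τ : ℂ) : ex (n * τ) = ex τ ^ n := by
  rw [ex, ex, ← exp_nat_mul]; ring_nf

theorem norm_ex (τ : ℂ) : ‖ex τ‖ = Real.exp (-2 * Real.pi * τ.im) := by
  rw [ex, norm_exp]; simp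

theorem norm_ex_lt_one {τ : ℂ} (hτ : 0 < τ.im) : ‖ex τ‖ < 1 := by
  rw [norm_ex, Real.exp_lt_one_iff]
  nlinarith [Real.pi_pos, mul_pos Real.pi_pos hτ]

theorem dedekindEta_eq (τ : ℂ) : dedekindEta τ = ex (τ / 24) * euler (ex τ) := by
  rw [dedekindEta, euler, ex, mul_div_assoc]
  congr 2; funext n
  rw [ex, ← exp_nat_mul]; push_cast; ring_nf

theorem dedekindEta_eq_eta (τ : ℂ) : dedekindEta τ = ModularForm.eta τ := by
  rw [dedekindEta, ModularForm.eta]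
  congr 1
  congr 1; funext n; rw [ModularForm.eta_q_eq_cexp]

theorem dedekindEta_ne_zero {τ : ℂ} (hτ : 0 < τ.im) : dedekindEta τ ≠ 0 := by
  rw [dedekindEta_eq]
  exact mul_ne_zero (ex_ne_zero _) (euler_ne_zero (norm_ex_lt_one hτ))

theorem differentiableAt_dedekindEta {τ : ℂ} (hτ : 0 < τ.im) :
    DifferentiableAt ℂ dedekindEta τ := by
  rw [show dedekindEta = ModularForm.eta from funext dedekindEta_eq_eta]
  exact ModularForm.differentiableAt_eta_of_mem_upperHalfPlaneSet hτ

theorem dedekindEta_S_sq {τ : ℂ} (hτ : 0 < τ.im) :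
    dedekindEta (-1 / τ) ^ 2 = -I * τ * dedekindEta τ ^ 2 := by
  have h := ModularForm.eta_comp_eq_csqrt_I_inv hτ
  simp only [Function.comp, Pi.smul_apply, Pi.mul_apply, smul_eq_mul] at h
  rw [dedekindEta_eq_eta, dedekindEta_eq_eta, h, mul_pow, mul_pow, inv_pow]
  have hs : ∀ z : ℂ, z ≠ 0 → Complex.sqrt z ^ 2 = z := fun z hz => by
    rw [sqrt_eq_exp hz, ← exp_nat_mul]
    convert exp_log hz using 2
    push_cast; ring
  rw [hs _ I_ne_zero, hs, inv_I, mul_assoc]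
  rintro rfl
  simp at hτ

/-- The discriminant function, as the 24th power of the eta function. -/
noncomputable def dl (τ : ℂ) : ℂ := dedekindEta τ ^ 24

theorem dl_ne_zero {τ : ℂ} (hτ : 0 < τ.im) : dl τ ≠ 0 := pow_ne_zero _ (dedekindEta_ne_zero hτ)

theorem dl_eq (τ : ℂ) : dl τ = ex τ * euler (ex τ) ^ 24 := by
  rw [dl, dedekindEta_eq, mul_pow, ← ex_nat_mul]
  congr 2; push_cast; ring

theorem dl_mob {τ : ℂ} (hτ : 0 < τ.im) {a b c d : ℤ} (h : a * d - b * c = 1) :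
    dl (mob a b c d τ) = (c * τ + d) ^ 12 * dl τ := by
  let g : Matrix.SpecialLinearGroup (Fin 2) ℤ := ⟨!![a, b; c, d], by simp [Matrix.det_fin_two, h]⟩
  have := SlashInvariantForm.slash_action_eqn' (CuspForm.discriminant) 
    (γ := (g : GL (Fin 2) ℝ)) (by exact ⟨g, rfl⟩) ⟨τ, hτ⟩
  have h1 : ∀ z : UpperHalfPlane, CuspForm.discriminant z = dl z := fun z => by
    rw [dl, dedekindEta_eq_eta]; rfl
  rw [h1, h1] at this
  have h3 : ((c : ℂ) * τ + d) =
      (((g : GL (Fin 2) ℝ) 1 0 : ℝ) : ℂ) * τ + (((g : GL (Fin 2) ℝ) 1 1 : ℝ) : ℂ) := by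
    have e1 : (((g : GL (Fin 2) ℝ) 1 0 : ℝ) : ℂ) = c := by
      change (((c : ℤ) : ℝ) : ℂ) = c
      simp
    have e2 : (((g : GL (Fin 2) ℝ) 1 1 : ℝ) : ℂ) = d := by
      change (((d : ℤ) : ℝ) : ℂ) = d
      simp
    rw [e1, e2]
  have h2 : (((g : GL (Fin 2) ℝ) • (⟨τ, hτ⟩ : UpperHalfPlane) : UpperHalfPlane) : ℂ) =
      mob a b c d τ := by
    have := UpperHalfPlane.coe_specialLinearGroup_apply g ⟨τ, hτ⟩
    change ((g • (⟨τ, hτ⟩ : UpperHalfPlane) : UpperHalfPlane) : ℂ) = _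
    simpa [g, mob] using this
  rw [h2] at this
  rw [h3]
  exact_mod_cast this

/-! ### The Hauptmodul -/

/-- The primes `p` with `p - 1 ∣ 24`. -/
def Good (p : ℕ) : Prop := p = 2 ∨ p = 3 ∨ p = 5 ∨ p = 7 ∨ p = 13

theorem good_of_dvd {p : ℕ} (hp : p.Prime) (h : (p : ℤ) - 1 ∣ 24) : Good p := by
  have h1 := Int.le_of_dvd (by norm_num) h
  have h2 : p ≤ 25 := by omega
  unfold Good
  interval_cases p <;> revert hp h <;> norm_num

theorem Good.prime {p : ℕ} (h : Good p) : p.Prime := by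
  rcases h with rfl | rfl | rfl | rfl | rfl <;> norm_num

theorem Good.pos {p : ℕ} (h : Good p) : 0 < p := h.prime.pos

theorem Good.mul_eq {p : ℕ} (h : Good p) : (p - 1) * (24 / (p - 1)) = 24 := by
  rcases h with rfl | rfl | rfl | rfl | rfl <;> norm_num

theorem Good.two_mul_eq {p : ℕ} (h : Good p) : 24 / (p - 1) = 2 * (12 / (p - 1)) := by
  rcases h with rfl | rfl | rfl | rfl | rfl <;> norm_num

theorem im_natCast_mul_pos {p : ℕ} (h : 0 < p) {τ : ℂ} (hτ : 0 < τ.im) :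
    0 < ((p : ℂ) * τ).im := by
  have : (0 : ℝ) < p := by exact_mod_cast h
  simpa using mul_pos this hτ

/-- The Hauptmodul `(η(τ)/η(pτ))^(24/(p-1))` of `Γ₀(p)`. -/
noncomputable def hm (p : ℕ) (τ : ℂ) : ℂ :=
  (dedekindEta τ / dedekindEta (p * τ)) ^ (24 / (p - 1))

theorem jpStar_eq (p : ℕ) (τ : ℂ) :
    jpStar p τ = hm p τ + (24 / (p - 1) : ℕ) + (p : ℂ) ^ (12 / (p - 1)) * (hm p τ)⁻¹ := by
  rw [jpStar, hm, ← inv_pow, inv_div]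

section

variable {p : ℕ} (hp : Good p) {τ : ℂ} (hτ : 0 < τ.im)

include hp hτ

theorem hm_ne_zero : hm p τ ≠ 0 :=
  pow_ne_zero _ (div_ne_zero (dedekindEta_ne_zero hτ)
    (dedekindEta_ne_zero (im_natCast_mul_pos hp.pos hτ)))

omit hτ in
theorem hm_pow : hm p τ ^ (p - 1) = dl τ / dl (p * τ) := by
  rw [hm, ← pow_mul, Nat.mul_comm (24 / (p - 1)), hp.mul_eq, div_pow, dl, dl]

omit hτ in
theorem hm_eq (τ : ℂ) :
    hm p τ = (ex τ)⁻¹ * (euler (ex τ) * (euler (ex τ ^ p))⁻¹) ^ (24 / (p - 1)) := by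
  have h1 : (ex (τ / 24) / ex (p * τ / 24)) ^ (24 / (p - 1)) = (ex τ)⁻¹ := by
    rw [div_pow, ← ex_nat_mul, ← ex_nat_mul, div_eq_iff (ex_ne_zero _), ← div_eq_inv_mul,
      eq_div_iff (ex_ne_zero _), ← ex_add]
    congr 1
    have h2 : ((p - 1 : ℕ) : ℂ) * (24 / (p - 1) : ℕ) = 24 := by exact_mod_cast hp.mul_eq
    rw [Nat.cast_sub hp.prime.one_le] at h2
    linear_combination (-τ / 24) * h2
  rw [hm, dedekindEta_eq, dedekindEta_eq, ex_nat_mul, mul_div_mul_comm, mul_pow, h1,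
    div_eq_mul_inv]

theorem differentiableAt_hm : DifferentiableAt ℂ (hm p) τ := by
  have h2 := im_natCast_mul_pos hp.pos hτ
  have h3 : DifferentiableAt ℂ (fun τ : ℂ => dedekindEta (p * τ)) τ :=
    DifferentiableAt.comp (g := dedekindEta) (f := fun τ : ℂ => (p : ℂ) * τ) τ
      (differentiableAt_dedekindEta h2) (by fun_prop)
  exact ((differentiableAt_dedekindEta hτ).fun_div h3 (dedekindEta_ne_zero h2)).fun_pow _

omit hτ in
theorem hm_add_int (n : ℤ) (τ : ℂ) : hm p (τ + n) = hm p τ := by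
  rw [hm_eq hp, hm_eq hp, ex_add, ex_int, mul_one]

theorem hm_W : hm p (-1 / (p * τ)) = p ^ (12 / (p - 1)) / hm p τ := by
  have hp0 : (p : ℂ) ≠ 0 := by exact_mod_cast hp.pos.ne'
  have h2 := im_natCast_mul_pos hp.pos hτ
  have hτ0 : τ ≠ 0 := by rintro rfl; simp at hτ
  rw [hm, hm, hp.two_mul_eq, pow_mul, pow_mul, ← div_pow]
  congr 1
  rw [div_pow, div_pow, show (p : ℂ) * (-1 / (p * τ)) = -1 / τ by field_simp,
    dedekindEta_S_sq h2, dedekindEta_S_sq hτ]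
  have h3 := dedekindEta_ne_zero hτ
  have h4 := dedekindEta_ne_zero h2
  field_simp

omit hp hτ in
theorem p_mul_mob (a b c d : ℤ) (τ : ℂ) :
    p * mob a b (p * c) d τ = mob a (p * b) c d (p * τ) := by
  rw [mob, mob]; push_cast; ring_nf

theorem dl_p_mob {a b c d : ℤ} (h : a * d - b * (p * c) = 1) :
    dl (p * mob a b (p * c) d τ) = ((p * c : ℤ) * τ + d) ^ 12 * dl (p * τ) := by
  rw [p_mul_mob, dl_mob (im_natCast_mul_pos hp.pos hτ) (by linarith)]
  push_cast; ring_nf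

omit hτ in
theorem exists_hm_mob (a b c d : ℤ) (h : a * d - b * (p * c) = 1) :
    ∃ ε : ℂ, ∀ τ : ℂ, 0 < τ.im → hm p (mob a b (p * c) d τ) = ε * hm p τ := by
  let S : Set ℂ := {τ | 0 < τ.im}
  have hS : IsPreconnected S := (convex_halfSpace_im_gt 0).isPreconnected
  have hm1 : ∀ τ ∈ S, 0 < (mob a b (p * c) d τ).im := fun τ hτ => mob_im_pos hτ (by omega)
  have hden : ∀ τ ∈ S, ((p * c : ℤ) * τ + d : ℂ) ≠ 0 := fun τ hτ =>
    den_ne_zero hτ (ne_zero_or_of_det (a := a) (b := b) (by omega))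
  let g : ℂ → ℂ := fun τ => hm p (mob a b (p * c) d τ) / hm p τ
  have hg : ContinuousOn g S := fun τ hτ => by
    refine ContinuousAt.continuousWithinAt (ContinuousAt.div ?_
      (differentiableAt_hm hp hτ).continuousAt (hm_ne_zero hp hτ))
    have h1 : ContinuousAt (fun τ => mob a b (p * c) d τ) τ := by
      unfold mob
      exact ContinuousAt.div (by fun_prop) (by fun_prop) (hden τ hτ)
    exact ContinuousAt.comp (g := hm p) (f := fun τ => mob a b (p * c) d τ)
      (differentiableAt_hm hp (hm1 τ hτ)).continuousAt h1
  have hp1 : p - 1 ≠ 0 := by have := hp.prime.two_le; omega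
  let T : Set ℂ := {z | z ^ (p - 1) = 1}
  have hT : T.Finite := by
    refine (Polynomial.nthRoots (p - 1) (1 : ℂ)).toFinset.finite_toSet.subset fun z hz => ?_
    change z ^ (p - 1) = 1 at hz
    simpa [Polynomial.mem_nthRoots (Nat.pos_of_ne_zero hp1)] using hz
  have hmaps : Set.MapsTo g S T := fun τ hτ => by
    have h2 := im_natCast_mul_pos hp.pos hτ
    change (_ / _) ^ (p - 1) = (1 : ℂ)
    rw [div_pow, hm_pow hp, hm_pow hp, dl_p_mob hp hτ h, dl_mob hτ (by linarith)]
    have h3 := hden τ hτ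
    have h4 := dl_ne_zero hτ
    have h5 := dl_ne_zero h2
    generalize dl (p * τ) = P at *
    field_simp
  have hI : (I : ℂ) ∈ S := by simp [S]
  refine ⟨g I, fun σ hσ => ?_⟩
  rw [← hS.constant_of_mapsTo hT.isDiscrete hg hmaps hσ hI]
  exact (div_mul_cancel₀ _ (hm_ne_zero hp hσ)).symm

end

/-- The Hauptmodul is invariant under the matrices in `Γ₀(p)` with the given first row and last
row. -/
def HmInv (p : ℕ) (a b c d : ℤ) : Prop :=
  ∀ τ : ℂ, 0 < τ.im → hm p (mob a b (p * c) d τ) = hm p τ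

section

variable {p : ℕ} (hp : Good p)

include hp

omit hp in
theorem HmInv.mul {a b c d a' b' c' d' : ℤ} (h : HmInv p a b c d) (h' : HmInv p a' b' c' d')
    (hdet : a' * d' - b' * (p * c') = 1) :
    HmInv p (a * a' + b * (p * c')) (a * b' + b * d') (c * a' + d * c') (p * c * b' + d * d') := by
  intro τ hτ
  have h1 := h _ (mob_im_pos (a := a') (b := b') (c := p * c') (d := d') hτ (by omega))
  rw [h' τ hτ, mob_mob _ _ _ _ _ _ _ _
    (den_ne_zero hτ (ne_zero_or_of_det (a := a') (b := b') (by omega)))] at h1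
  rw [← h1]
  congr 2; ring

theorem HmInv.cancel {a b c d a' b' c' d' : ℤ} (h' : HmInv p a' b' c' d')
    (hdet' : a' * d' - b' * (p * c') = 1) (hdet : a * d - b * (p * c) = 1)
    (h : HmInv p (a * a' + b * (p * c')) (a * b' + b * d') (c * a' + d * c')
      (p * c * b' + d * d')) : HmInv p a b c d := by
  obtain ⟨ε, hε⟩ := exists_hm_mob hp a b c d hdet
  intro τ hτ
  have h1 := hε _ (mob_im_pos (a := a') (b := b') (c := p * c') (d := d') hτ (by omega))
  have h2 := h τ hτ
  rw [mob_mob _ _ _ _ _ _ _ _ (den_ne_zero hτ (ne_zero_or_of_det (a := a') (b := b') (by omega))),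
    h' τ hτ] at h1
  rw [show (p : ℤ) * (c * a' + d * c') = p * c * a' + d * (p * c') by ring, h1] at h2
  have hε1 : ε = 1 := mul_right_cancel₀ (hm_ne_zero hp hτ) (h2.trans (one_mul _).symm)
  rw [hε τ hτ, hε1, one_mul]

omit hp in
theorem HmInv.neg {a b c d : ℤ} (h : HmInv p a b c d) : HmInv p (-a) (-b) (-c) (-d) := by
  intro τ hτ
  rw [← h τ hτ, ← mob_smul (-1) (by norm_num)]
  congr 2 <;> ring

theorem hmInv_T (n : ℤ) : HmInv p 1 n 0 1 := fun τ _ => by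
  rw [← hm_add_int hp n τ]; simp [mob]

theorem hmInv_lower (n : ℤ) : HmInv p 1 0 n 1 := fun τ hτ => by
  have hp0 : (p : ℂ) ≠ 0 := by exact_mod_cast hp.pos.ne'
  have hτ0 : τ ≠ 0 := by rintro rfl; simp at hτ
  have hW : ∀ σ : ℂ, 0 < σ.im → 0 < (-1 / (p * σ)).im := fun σ hσ => by
    have := mob_im_pos (a := 0) (b := -1) (c := p) (d := 0) hσ (by have := hp.pos; omega)
    simpa [mob] using this
  have h1 : mob 1 0 (p * n) 1 τ = -1 / (p * (-1 / (p * τ) + (-n : ℤ))) := by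
    have h2 := den_ne_zero hτ (c := p * n) (d := 1) (by simp)
    have h3 : (p : ℂ) * (-1 / (p * τ) + (-n : ℤ)) = -((p * n : ℤ) * τ + (1 : ℤ)) / τ := by
      push_cast; field_simp; ring
    rw [h3, mob]
    field_simp
    push_cast; ring
  have h4 : 0 < (-1 / (p * τ) + (-n : ℤ) : ℂ).im := by
    simpa using hW τ hτ
  rw [h1, hm_W hp h4, hm_add_int hp, hm_W hp hτ]
  have := hm_ne_zero hp hτ
  field_simp

theorem hmInv_elliptic {a b c d : ℤ} (hdet : a * d - b * (p * c) = 1) (hc : 0 < c)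
    (htr : (a + d) ^ 2 < 4) : HmInv p a b c d := by
  obtain ⟨ε, hε⟩ := exists_hm_mob hp a b c d hdet
  let C : ℝ := p * c
  have hC : 0 < C := mul_pos (by exact_mod_cast hp.pos) (by exact_mod_cast hc)
  let w : ℝ := Real.sqrt (4 - (a + d) ^ 2)
  have hw0 : (0 : ℝ) < 4 - (a + d) ^ 2 := by
    have : ((a + d) ^ 2 : ℝ) < 4 := by exact_mod_cast htr
    linarith
  have hw : w ^ 2 = 4 - (a + d) ^ 2 := Real.sq_sqrt hw0.le
  let τ : ℂ := ⟨(a - d) / (2 * C), w / (2 * C)⟩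
  have hτ : 0 < τ.im := div_pos (Real.sqrt_pos.2 hw0) (by positivity)
  have hτeq : τ = ((a - d) + w * I) / (2 * C) := by
    apply Complex.ext
    · simp [τ, div_re, normSq]; field_simp
    · simp [τ, div_im, normSq]; field_simp
  have hfix : mob a b (p * c) d τ = τ := by
    have h2 := den_ne_zero hτ (c := p * c) (d := d)
      (ne_zero_or_of_det (a := a) (b := b) (by omega))
    rw [mob, div_eq_iff h2, hτeq]
    have hC' : ((p * c : ℤ) : ℂ) = C := by simp [C]
    have hC0 : (C : ℂ) ≠ 0 := by exact_mod_cast hC.ne'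
    have hw' : (w : ℂ) ^ 2 = 4 - (a + d) ^ 2 := by exact_mod_cast hw
    have hdet' : (a * d - b * C : ℂ) = 1 := by rw [← hC']; exact_mod_cast hdet
    rw [hC']
    field_simp
    linear_combination (-1 : ℂ) * hw' * I ^ 2 + (-4 + (a + d) ^ 2) * I_sq - 4 * hdet'
  have h1 := hε τ hτ
  rw [hfix] at h1
  have hε1 : ε = 1 := by
    refine mul_right_cancel₀ (hm_ne_zero hp hτ) ?_
    rw [← h1, one_mul]
  intro σ hσ
  rw [hε σ hσ, hε1, one_mul]

end

section

variable {p : ℕ} (hp : Good p)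

include hp

theorem hmInv_of_modEq {a₀ b₀ d₀ : ℤ} (h : HmInv p a₀ b₀ 1 d₀) (h0 : a₀ * d₀ - b₀ * p = 1)
    {a b d : ℤ} (hdet : a * d - b * p = 1) (ha : (p : ℤ) ∣ a - a₀) : HmInv p a b 1 d := by
  obtain ⟨j, hj⟩ := ha
  have hcop : IsCoprime (p : ℤ) a₀ := ⟨-b₀, d₀, by linarith⟩
  obtain ⟨k, hk⟩ : (p : ℤ) ∣ d - d₀ := by
    refine hcop.dvd_of_dvd_mul_left ⟨b - b₀ - j * d, ?_⟩
    linear_combination hdet - h0 - d * hj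
  have hpz : (p : ℤ) ≠ 0 := by exact_mod_cast hp.pos.ne'
  have h1 := ((hmInv_T hp j).mul h (by linarith)).mul (hmInv_T hp k) (by simp)
  have ha' : a = a₀ + j * p := by linarith
  have hd' : d = d₀ + p * k := by linarith
  convert h1 using 1
  · rw [ha']; ring
  · refine mul_right_cancel₀ hpz ?_
    rw [ha', hd'] at hdet
    linear_combination -hdet + h0
  · ring
  · rw [hd']; ring

theorem hmInv_one {a b d : ℤ} (hdet : a * d - b * p = 1) : HmInv p a b 1 d := by
  have hneg : HmInv p (-1) 0 1 (-1) := by simpa using (hmInv_lower hp (-1)).neg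
  have key : ∀ {a₀ b₀ d₀ : ℤ}, a₀ * d₀ - b₀ * p = 1 → (p : ℤ) ∣ a - a₀ → HmInv p a₀ b₀ 1 d₀ →
    HmInv p a b 1 d := fun h0 h1 h => hmInv_of_modEq hp h h0 hdet h1
  have ell : ∀ {a₀ b₀ d₀ : ℤ}, a₀ * d₀ - b₀ * p = 1 → (a₀ + d₀) ^ 2 < 4 → (p : ℤ) ∣ a - a₀ →
    HmInv p a b 1 d := fun h0 h2 h1 =>
      key h0 h1 (hmInv_elliptic hp (by linarith) one_pos h2)
  have hone : (p : ℤ) ∣ a - 1 → HmInv p a b 1 d := fun h => key (by simp) h (hmInv_lower hp 1)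
  have hmone : (p : ℤ) ∣ a + 1 → HmInv p a b 1 d := fun h =>
    key (a₀ := -1) (by simp) (by simpa using h) hneg
  have hnd : ¬ (p : ℤ) ∣ a := fun h => by
    have h1 : (p : ℤ) ∣ 1 := hdet ▸ dvd_sub (h.mul_right d) (dvd_mul_left _ _)
    exact hp.prime.one_lt.ne' (by exact_mod_cast Int.eq_one_of_dvd_one (by positivity) h1)
  rcases hp with rfl | rfl | rfl | rfl | rfl
  · exact hone (by omega)
  · rcases (by omega : a % 3 = 1 ∨ a % 3 = 2) with h | h
    · exact hone (by omega)
    · exact hmone (by omega)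
  · rcases (by omega : a % 5 = 1 ∨ a % 5 = 2 ∨ a % 5 = 3 ∨ a % 5 = 4) with h | h | h | h
    · exact hone (by omega)
    · exact ell (a₀ := 2) (b₀ := -1) (d₀ := -2) (by norm_num) (by norm_num) (by omega)
    · exact ell (a₀ := 3) (b₀ := -2) (d₀ := -3) (by norm_num) (by norm_num) (by omega)
    · exact hmone (by omega)
  · rcases (by omega : a % 7 = 1 ∨ a % 7 = 2 ∨ a % 7 = 3 ∨ a % 7 = 4 ∨ a % 7 = 5 ∨ a % 7 = 6)
      with h | h | h | h | h | h
    · exact hone (by omega)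
    · exact ell (a₀ := 2) (b₀ := -1) (d₀ := -3) (by norm_num) (by norm_num) (by omega)
    · exact ell (a₀ := 3) (b₀ := -1) (d₀ := -2) (by norm_num) (by norm_num) (by omega)
    · exact ell (a₀ := 4) (b₀ := -3) (d₀ := -5) (by norm_num) (by norm_num) (by omega)
    · exact ell (a₀ := 5) (b₀ := -3) (d₀ := -4) (by norm_num) (by norm_num) (by omega)
    · exact hmone (by omega)
  · have hg : Good 13 := by simp [Good]
    have el : ∀ {a₀ b₀ d₀ : ℤ}, a₀ * d₀ - b₀ * 13 = 1 → (a₀ + d₀) ^ 2 < 4 →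
      HmInv 13 a₀ b₀ 1 d₀ := fun h0 h2 =>
        hmInv_elliptic hg (by push_cast; linarith) one_pos h2
    have el' : ∀ {a₀ b₀ d₀ a b d : ℤ}, a₀ * d₀ - b₀ * 13 = 1 → (a₀ + d₀) ^ 2 < 4 →
      a * d - b * 13 = 1 → (13 : ℤ) ∣ a - a₀ → HmInv 13 a b 1 d := fun h0 h2 h3 h4 =>
        hmInv_of_modEq hg (el h0 h2) (by exact_mod_cast h0) (by exact_mod_cast h3)
          (by exact_mod_cast h4)
    have h3 : HmInv 13 3 2 1 9 :=
      el' (a₀ := 3) (b₀ := -1) (d₀ := -4) (by norm_num) (by norm_num) (by norm_num) (by norm_num)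
    have h5 : HmInv 13 (-8) (-5) 1 8 := el (by norm_num) (by norm_num)
    have h8 : HmInv 13 8 3 1 5 :=
      el' (a₀ := 8) (b₀ := -5) (d₀ := -8) (by norm_num) (by norm_num) (by norm_num) (by norm_num)
    have h9 : HmInv 13 (-4) (-1) 1 3 := el (by norm_num) (by norm_num)
    have h2 : HmInv 13 2 1 1 7 := by simpa using h3.mul h5 (by norm_num)
    have h7 : HmInv 13 7 1 1 2 := by simpa using h8.mul h9 (by norm_num)
    have hI : HmInv 13 1 0 0 1 := hmInv_T hg 0
    have h6 : HmInv 13 (-7) 1 1 (-2) := by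
      have : HmInv 13 7 (-1) (-1) 2 :=
        HmInv.cancel hg h2 (by norm_num) (by norm_num) (by simpa using hI)
      simpa using this.neg
    have h11 : HmInv 13 (-2) 1 1 (-7) := by
      have : HmInv 13 2 (-1) (-1) 7 :=
        HmInv.cancel hg h7 (by norm_num) (by norm_num) (by simpa using hI)
      simpa using this.neg
    rcases (by omega : a % 13 = 1 ∨ a % 13 = 2 ∨ a % 13 = 3 ∨ a % 13 = 4 ∨ a % 13 = 5 ∨
      a % 13 = 6 ∨ a % 13 = 7 ∨ a % 13 = 8 ∨ a % 13 = 9 ∨ a % 13 = 10 ∨ a % 13 = 11 ∨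
      a % 13 = 12) with h | h | h | h | h | h | h | h | h | h | h | h
    · exact hone (by omega)
    · exact key (by norm_num) (by omega) h2
    · exact key (by norm_num) (by omega) h3
    · exact ell (a₀ := 4) (b₀ := -1) (d₀ := -3) (by norm_num) (by norm_num) (by omega)
    · exact key (by norm_num) (by omega) h5
    · exact key (by norm_num) (by omega) h6
    · exact key (by norm_num) (by omega) h7
    · exact key (by norm_num) (by omega) h8
    · exact key (by norm_num) (by omega) h9
    · exact ell (a₀ := 10) (b₀ := -7) (d₀ := -9) (by norm_num) (by norm_num) (by omega)
    · exact key (by norm_num) (by omega) h11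
    · exact hmone (by omega)

theorem exists_coprime_reduce {a b c d : ℤ} (hdet : a * d - b * (p * c) = 1) (hc : c ≠ 0) :
    ∃ a₀ : ℤ, ¬ (p : ℤ) ∣ a₀ ∧ (c * a₀ + d).natAbs < c.natAbs := by
  have h1 := Int.emod_nonneg d hc
  have h2 := Int.emod_lt_abs d hc
  have h3 := Int.mul_ediv_add_emod d c
  by_cases h : (p : ℤ) ∣ -(d / c)
  · rcases eq_or_ne (d % c) 0 with h0 | h0
    · exfalso
      have h4 : (p : ℤ) ∣ d := by
        rw [← h3, h0, add_zero]
        exact (Int.dvd_neg.1 h).mul_left c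
      have h5 : (p : ℤ) ∣ 1 := hdet ▸ dvd_sub (h4.mul_left a) ⟨b * c, by ring⟩
      exact hp.prime.one_lt.ne' (by exact_mod_cast Int.eq_one_of_dvd_one (by positivity) h5)
    · refine ⟨-(d / c) - c.sign, fun h' => ?_, ?_⟩
      · have h6 : (p : ℤ) ∣ c.sign := by simpa using dvd_sub h h'
        have h7 := Int.natAbs_dvd_natAbs.2 h6
        rw [Int.natAbs_sign_of_ne_zero hc, Int.natAbs_natCast, Nat.dvd_one] at h7
        exact hp.prime.one_lt.ne' h7
      · have h8 : c * (-(d / c) - c.sign) + d = d % c - |c| := by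
          have h9 : c * c.sign = |c| := by rw [Int.mul_sign_self, Int.abs_eq_natAbs]
          linear_combination -h3 - h9
        rw [h8]
        rw [Int.abs_eq_natAbs] at h2 ⊢
        generalize d % c = r at *
        omega
  · refine ⟨-(d / c), h, ?_⟩
    rw [show c * -(d / c) + d = d % c by linear_combination -h3]
    rw [Int.abs_eq_natAbs] at h2
    generalize d % c = r at *
    omega

theorem hmInv {a b c d : ℤ} (hdet : a * d - b * (p * c) = 1) : HmInv p a b c d := by
  obtain ⟨n, hn⟩ : ∃ n, c.natAbs ≤ n := ⟨_, le_rfl⟩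
  induction n generalizing a b c d with
  | zero =>
    obtain rfl : c = 0 := by omega
    rcases Int.mul_eq_one_iff_eq_one_or_neg_one.1 (by linarith : a * d = 1) with ⟨rfl, rfl⟩ | ⟨rfl, rfl⟩
    · exact hmInv_T hp b
    · simpa using (hmInv_T hp (-b)).neg
  | succ n ih =>
    rcases eq_or_ne c 0 with rfl | hc
    · exact ih hdet (by simp)
    obtain ⟨a₀, ha₀, hlt⟩ := exists_coprime_reduce hp hdet hc
    obtain ⟨u, v, huv⟩ : IsCoprime a₀ (p : ℤ) :=
      ((Nat.prime_iff_prime_int.1 hp.prime).coprime_iff_not_dvd.2 ha₀).symm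
    refine HmInv.cancel hp (a' := a₀) (b' := -v) (c' := 1) (d' := u) (hmInv_one hp (by linarith))
      (by linarith) hdet (ih ?_ (by rw [mul_one]; omega))
    linear_combination hdet * (a₀ * u + v * p) + huv

theorem jpStar_mob {a b c d : ℤ} (hdet : a * d - b * (p * c) = 1) {τ : ℂ} (hτ : 0 < τ.im) :
    jpStar p (mob a b (p * c) d τ) = jpStar p τ := by
  rw [jpStar_eq, jpStar_eq, hmInv hp hdet τ hτ]

theorem jpStar_W {τ : ℂ} (hτ : 0 < τ.im) : jpStar p (-1 / (p * τ)) = jpStar p τ := by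
  have h1 := hm_ne_zero hp hτ
  have hp0 : (p : ℂ) ≠ 0 := by exact_mod_cast hp.pos.ne'
  rw [jpStar_eq, jpStar_eq, hm_W hp hτ]
  field_simp
  ring

theorem differentiableAt_jpStar {τ : ℂ} (hτ : 0 < τ.im) : DifferentiableAt ℂ (jpStar p) τ := by
  have h := differentiableAt_hm hp hτ
  rw [show jpStar p = _ from funext (jpStar_eq p)]
  exact ((h.add_const _)).add ((h.inv (hm_ne_zero hp hτ)).const_mul _)

end

/-- The cusp form `Δ(τ) Δ(pτ)` of weight `24` on `Γ₀(p)`. -/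
noncomputable def dd (p : ℕ) (τ : ℂ) : ℂ := dl τ * dl (p * τ)

section

variable {p : ℕ} (hp : 0 < p) {τ : ℂ} (hτ : 0 < τ.im)

include hp hτ

theorem dd_ne_zero : dd p τ ≠ 0 :=
  mul_ne_zero (dl_ne_zero hτ) (dl_ne_zero (im_natCast_mul_pos hp hτ))

theorem differentiableAt_dd : DifferentiableAt ℂ (dd p) τ := by
  have h2 := im_natCast_mul_pos hp hτ
  have h3 : DifferentiableAt ℂ (fun τ : ℂ => dedekindEta (p * τ)) τ :=
    DifferentiableAt.comp (g := dedekindEta) (f := fun τ : ℂ => (p : ℂ) * τ) τ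
      (differentiableAt_dedekindEta h2) (by fun_prop)
  exact ((differentiableAt_dedekindEta hτ).fun_pow 24).fun_mul (h3.fun_pow 24)

omit hp hτ in
theorem dd_eq (τ : ℂ) : dd p τ = ex τ ^ (p + 1) * (euler (ex τ) * euler (ex τ ^ p)) ^ 24 := by
  rw [dd, dl_eq, dl_eq, ex_nat_mul]; ring

theorem dd_mob {a b c d : ℤ} (h : a * d - b * (p * c) = 1) :
    dd p (mob a b (p * c) d τ) = ((p * c : ℤ) * τ + d) ^ 24 * dd p τ := by
  have h1 : p * mob a b (p * c) d τ = mob a (p * b) c d (p * τ) := p_mul_mob a b c d τ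
  rw [dd, dd, h1, dl_mob hτ (by linarith), dl_mob (im_natCast_mul_pos hp hτ) (by linarith)]
  push_cast; ring

omit hp in
theorem dl_S : dl (-1 / τ) = τ ^ 12 * dl τ := by
  have := dl_mob (a := 0) (b := -1) (c := 1) (d := 0) hτ (by norm_num)
  simpa [mob] using this

theorem dd_W : dd p (-1 / (p * τ)) = p ^ 12 * τ ^ 24 * dd p τ := by
  have h2 := im_natCast_mul_pos hp hτ
  have hp0 : (p : ℂ) ≠ 0 := by exact_mod_cast hp.ne'
  have hτ0 : τ ≠ 0 := by rintro rfl; simp at hτ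
  rw [dd, dd, show (p : ℂ) * (-1 / (p * τ)) = -1 / τ by field_simp, dl_S h2, dl_S hτ]
  ring

end

/-! ### Modular functions for `Γ₀(p)*` -/

/-- Holomorphic functions on the upper half plane invariant under `Γ₀(p)*`. -/
structure InvF (p : ℕ) (g : ℂ → ℂ) : Prop where
  diff : ∀ τ : ℂ, 0 < τ.im → DifferentiableAt ℂ g τ
  inv : ∀ a b c d : ℤ, a * d - b * (p * c) = 1 → ∀ τ : ℂ, 0 < τ.im →
    g (mob a b (p * c) d τ) = g τ
  W : ∀ τ : ℂ, 0 < τ.im → g (-1 / (p * τ)) = g τ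

theorem im_W_pos {p : ℕ} (hp : 0 < p) {τ : ℂ} (hτ : 0 < τ.im) : 0 < (-1 / (p * τ)).im := by
  have := mob_im_pos (a := 0) (b := -1) (c := p) (d := 0) hτ (by omega)
  simpa [mob] using this

theorem invF_jpStar {p : ℕ} (hp : Good p) : InvF p (jpStar p) where
  diff _ h := differentiableAt_jpStar hp h
  inv _ _ _ _ h _ hτ := jpStar_mob hp h hτ
  W _ h := jpStar_W hp h

theorem InvF.add_int {p : ℕ} {g : ℂ → ℂ} (hg : InvF p g) {τ : ℂ} (hτ : 0 < τ.im) (n : ℤ) :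
    g (τ + n) = g τ := by
  simpa [mob] using hg.inv 1 n 0 1 (by simp) τ hτ

theorem InvF.exists_bound {p : ℕ} (hp : p.Prime) {g : ℂ → ℂ} (hg : InvF p g)
    {A C : ℝ} (hb : ∀ τ : ℂ, 0 < τ.im → A ≤ τ.im → ‖g τ‖ ≤ C) {a b c d : ℤ}
    (hdet : a * d - b * c = 1) :
    ∃ B : ℝ, ∀ τ : ℂ, 0 < τ.im → B ≤ τ.im → ‖g (mob a b c d τ)‖ ≤ C := by
  have hp0 : (p : ℂ) ≠ 0 := by exact_mod_cast hp.pos.ne'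
  by_cases hc : (p : ℤ) ∣ c
  · obtain ⟨c, rfl⟩ := hc
    exact ⟨A, fun τ hτ h => by rw [hg.inv _ _ _ _ hdet _ hτ]; exact hb _ hτ h⟩
  · obtain ⟨u, v, huv⟩ := (Nat.prime_iff_prime_int.1 hp).coprime_iff_not_dvd.2 hc
    refine ⟨A * p, fun τ hτ h => ?_⟩
    have h1 : 0 < (τ + (v * d : ℤ)).im := by simpa using hτ
    have h2 : 0 < (-1 / (τ + (v * d : ℤ))).im := by
      have := im_W_pos one_pos h1
      simpa using this
    have h3 : mob a b c d τ = mob (v * d * a - b) a (p * (-d * u)) c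
        (-1 / (τ + (v * d : ℤ))) := by
      have h4 : mob 0 (-1) 1 (v * d) τ = -1 / (τ + (v * d : ℤ)) := by simp [mob]
      rw [← h4, mob_mob]
      · congr 1
        · ring
        · ring
        · ring
        · linear_combination -d * huv
      · have := den_ne_zero hτ (c := 1) (d := v * d) (by simp)
        simpa using this
    have hpp : (0 : ℝ) < p := by exact_mod_cast hp.pos
    have h5 : ((τ + (v * d : ℤ)) / p).im = τ.im / p := by
      rw [div_natCast_im]; simp
    have h6 : 0 < ((τ + (v * d : ℤ)) / p).im := by rw [h5]; positivity
    rw [h3, hg.inv _ _ _ _ (by linear_combination hdet + a * d * huv) _ h2,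
      show -1 / (τ + (v * d : ℤ)) = -1 / (p * ((τ + (v * d : ℤ)) / p)) by field_simp,
      hg.W _ h6]
    refine hb _ h6 ?_
    rw [h5, le_div_iff₀ hpp]
    exact h

open UpperHalfPlane CongruenceSubgroup ModularForm in
theorem InvF.eq_const {p : ℕ} (hp : p.Prime) {g : ℂ → ℂ} (hg : InvF p g)
    {A C : ℝ} (hb : ∀ τ : ℂ, 0 < τ.im → A ≤ τ.im → ‖g τ‖ ≤ C) :
    ∃ c : ℂ, ∀ τ : ℂ, 0 < τ.im → g τ = c := by
  have : NeZero p := ⟨hp.ne_zero⟩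
  have hsl : ∀ (γ : Matrix.SpecialLinearGroup (Fin 2) ℤ) (τ : ℍ),
      ((fun τ : ℍ => g τ) ∣[(0 : ℤ)] γ) τ = g (mob (γ 0 0) (γ 0 1) (γ 1 0) (γ 1 1) τ) :=
    fun γ τ => by
      rw [ModularForm.SL_slash_apply, neg_zero, zpow_zero, mul_one,
        UpperHalfPlane.coe_specialLinearGroup_apply]
      simp [mob]
  have hdet : ∀ γ : Matrix.SpecialLinearGroup (Fin 2) ℤ,
      γ 0 0 * γ 1 1 - γ 0 1 * γ 1 0 = 1 := fun γ => by
    rw [← Matrix.det_fin_two]; exact γ.2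
  let F : ModularForm (Gamma0 p) 0 :=
    { toFun := fun τ : ℍ => g τ
      slash_action_eq' := by
        rintro _ ⟨γ, hγ, rfl⟩
        have hγ' : (p : ℤ) ∣ γ 1 0 := (ZMod.intCast_zmod_eq_zero_iff_dvd _ _).1 (Gamma0_mem.1 hγ)
        obtain ⟨c, hc⟩ := hγ'
        ext τ
        refine (hsl γ τ).trans ?_
        rw [hc]
        exact hg.inv _ _ _ _ (by rw [← hc]; exact hdet γ) _ τ.2
      holo' := by
        rw [UpperHalfPlane.mdifferentiable_iff]
        refine DifferentiableOn.congr (f := g)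
          (fun z hz => (hg.diff z hz).differentiableWithinAt) fun z hz => ?_
        simp [ofComplex_apply_of_im_pos hz]
      bdd_at_cusps' := by
        intro c hc
        rw [Subgroup.IsArithmetic.isCusp_iff_isCusp_SL2Z] at hc
        rw [OnePoint.isBoundedAt_iff_forall_SL2Z hc]
        intro γ _
        rw [UpperHalfPlane.isBoundedAtImInfty_iff]
        obtain ⟨B, hB⟩ := hg.exists_bound hp hb (hdet γ)
        exact ⟨C, B, fun z hz => by rw [hsl]; exact hB _ z.2 hz⟩ }
  obtain ⟨c, hc⟩ := ModularForm.eq_const_of_weight_zero F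
  exact ⟨c, fun τ hτ => congr_fun hc ⟨τ, hτ⟩⟩

/-! ### Expansions at the cusp -/

/-- The ring of algebraic integers in `ℂ`. -/
abbrev Zb : Subalgebra ℤ ℂ := integralClosure ℤ ℂ

section

variable {A : Type*} [CommRing A] [Algebra A ℂ]

/-- The function `g` has the expansion `y⁻ᴺ P(y)` with `y = exp(2πiτ/m)`. -/
def ExpP (m N : ℕ) (P : PowerSeries A) (g : ℂ → ℂ) : Prop :=
  ∃ u : ℂ → ℂ, Ser P u ∧ ∀ τ : ℂ, 0 < τ.im → ex (τ / m) ^ N * g τ = u (ex (τ / m))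

theorem im_div_pos {m : ℕ} (hm : m ≠ 0) {τ : ℂ} (hτ : 0 < τ.im) : 0 < (τ / m).im := by
  rw [div_natCast_im]
  have : (0 : ℝ) < m := by positivity
  positivity

variable {m N N' : ℕ} {P P' : PowerSeries A} {g g' : ℂ → ℂ}

theorem ExpP.congr (h : ExpP m N P g) (hg : ∀ τ : ℂ, 0 < τ.im → g' τ = g τ) :
    ExpP m N P g' := by
  obtain ⟨u, hu, h⟩ := h
  exact ⟨u, hu, fun τ hτ => by rw [hg τ hτ, h τ hτ]⟩

theorem ExpP.mul (h : ExpP m N P g) (h' : ExpP m N' P' g') :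
    ExpP m (N + N') (P * P') (fun τ => g τ * g' τ) := by
  obtain ⟨u, hu, h⟩ := h
  obtain ⟨u', hu', h'⟩ := h'
  exact ⟨_, hu.mul hu', fun τ hτ => by rw [← h τ hτ, ← h' τ hτ]; ring⟩

theorem ExpP.shift (h : ExpP m N P g) (k : ℕ) :
    ExpP m (k + N) (PowerSeries.X ^ k * P) g := by
  obtain ⟨u, hu, h⟩ := h
  exact ⟨_, (Ser.id.pow k).mul hu, fun τ hτ => by rw [← h τ hτ]; ring⟩

theorem ExpP.add (h : ExpP m N P g) (h' : ExpP m N P' g') :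
    ExpP m N (P + P') (fun τ => g τ + g' τ) := by
  obtain ⟨u, hu, h⟩ := h
  obtain ⟨u', hu', h'⟩ := h'
  exact ⟨_, hu.add hu', fun τ hτ => by rw [← h τ hτ, ← h' τ hτ]; ring⟩

theorem ExpP.neg (h : ExpP m N P g) : ExpP m N (-P) (fun τ => -g τ) := by
  obtain ⟨u, hu, h⟩ := h
  exact ⟨_, hu.neg, fun τ hτ => by rw [← h τ hτ]; ring⟩

theorem ExpP.sub (h : ExpP m N P g) (h' : ExpP m N P' g') :
    ExpP m N (P - P') (fun τ => g τ - g' τ) := by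
  simpa [sub_eq_add_neg] using h.add h'.neg

theorem ExpP.const (m : ℕ) (c : A) :
    ExpP m 0 (PowerSeries.C c) (fun _ => algebraMap A ℂ c) :=
  ⟨_, Ser.const c, fun τ _ => by simp⟩

theorem ExpP.pow (h : ExpP m N P g) (k : ℕ) : ExpP m (k * N) (P ^ k) (fun τ => g τ ^ k) := by
  obtain ⟨u, hu, h⟩ := h
  exact ⟨_, hu.pow k, fun τ hτ => by rw [← h τ hτ, mul_pow, ← pow_mul, mul_comm N]⟩

theorem ExpP.prod {ι : Type*} (s : Finset ι) {N : ι → ℕ} {P : ι → PowerSeries A} {g : ι → ℂ → ℂ}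
    (h : ∀ i ∈ s, ExpP m (N i) (P i) (g i)) :
    ExpP m (∑ i ∈ s, N i) (∏ i ∈ s, P i) (fun τ => ∏ i ∈ s, g i τ) := by
  classical
  induction s using Finset.induction_on with
  | empty => simpa using ExpP.const m (1 : A)
  | insert i s hi ih =>
    simp only [Finset.sum_insert hi, Finset.prod_insert hi]
    exact (h i (by simp)).mul (ih fun j hj => h j (by simp [hj]))

theorem ExpP.map {B : Type*} [CommRing B] [Algebra B ℂ] (f : A →+* B)
    (hf : (algebraMap B ℂ).comp f = algebraMap A ℂ) (h : ExpP m N P g) :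
    ExpP m N (P.map f) g := by
  obtain ⟨u, hu, h⟩ := h
  exact ⟨u, hu.map f hf, h⟩

theorem ExpP.toZb {P : PowerSeries ℤ} (h : ExpP m N P g) :
    ExpP m N (P.map (algebraMap ℤ Zb)) g := h.map _ (RingHom.ext_int _ _)

theorem Ser.of_X_mul {u : ℂ → ℂ} (h : Ser (PowerSeries.X * P) u) :
    ∃ v : ℂ → ℂ, Ser P v ∧ ∀ y : ℂ, ‖y‖ < 1 → u y = y * v y := by
  have key : ∀ y : ℂ, ‖y‖ < 1 → Summable fun n => algebraMap A ℂ (P.coeff n) * y ^ n := by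
    intro y hy
    rcases eq_or_ne y 0 with rfl | hy0
    · exact (hasSum_single 0 fun n hn => by simp [hn]).summable
    · have h1 := (summable_nat_add_iff 1).2 (h y hy).summable
      simp only [PowerSeries.coeff_succ_X_mul] at h1
      refine (h1.mul_left y⁻¹).congr fun n => ?_
      rw [pow_succ]; field_simp
  refine ⟨fun y => ∑' n, algebraMap A ℂ (P.coeff n) * y ^ n, fun y hy => (key y hy).hasSum,
    fun y hy => (h y hy).unique ?_⟩
  have h2 := (Ser.id (A := A)).mul (P := PowerSeries.X) (Q := P)
    (v := fun y => ∑' n, algebraMap A ℂ (P.coeff n) * y ^ n) (fun y hy => (key y hy).hasSum)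
  exact h2 y hy

theorem ExpP.of_X_mul (hm : m ≠ 0) (h : ExpP m (N + 1) (PowerSeries.X * P) g) :
    ExpP m N P g := by
  obtain ⟨u, hu, h⟩ := h
  obtain ⟨v, hv, huv⟩ := hu.of_X_mul
  refine ⟨v, hv, fun τ hτ => mul_left_cancel₀ (ex_ne_zero (τ / m)) ?_⟩
  rw [← huv _ (norm_ex_lt_one (im_div_pos hm hτ)), ← h τ hτ]
  ring

theorem ExpP.comp_mul {q : ℕ} (hq : q ≠ 0) (h : ExpP 1 N P g) :
    ExpP 1 (q * N) (P.expand q hq) (fun τ => g (q * τ)) := by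
  obtain ⟨u, hu, h⟩ := h
  refine ⟨_, hu.expand q hq, fun τ hτ => ?_⟩
  have := h (q * τ) (im_natCast_mul_pos (Nat.pos_of_ne_zero hq) hτ)
  simp only [Nat.cast_one, div_one, ex_nat_mul] at this ⊢
  rw [← this, pow_mul]

theorem ExpP.up {q : ℕ} (hq : q ≠ 0) (h : ExpP 1 N P g) :
    ExpP q (q * N) (P.expand q hq) g := by
  obtain ⟨u, hu, h⟩ := h
  refine ⟨_, hu.expand q hq, fun τ hτ => ?_⟩
  have h1 : ex (τ / q) ^ q = ex τ := by
    rw [← ex_nat_mul]; congr 1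
    have : (q : ℂ) ≠ 0 := by exact_mod_cast hq
    field_simp
  have := h τ hτ
  simp only [Nat.cast_one, div_one] at this
  rw [pow_mul, h1, this]

end

theorem ex_one_div_pow {m : ℕ} (hm : m ≠ 0) : ex (1 / m) ^ m = 1 := by
  have h0 : (m : ℂ) ≠ 0 := by exact_mod_cast hm
  rw [← ex_nat_mul, mul_one_div_cancel h0]
  simpa using ex_int 1

/-- The root of unity `exp(2πi/m)` as an algebraic integer. -/
noncomputable def zt (m : ℕ) : Zb := ⟨ex (1 / m), by
  rcases eq_or_ne m 0 with rfl | hm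
  · simp [ex]
  · exact IsIntegral.of_pow (Nat.pos_of_ne_zero hm) (by rw [ex_one_div_pow hm]; exact isIntegral_one)⟩

theorem coe_zt (m : ℕ) : algebraMap Zb ℂ (zt m) = ex (1 / m) := rfl

theorem zt_pow {m : ℕ} (hm : m ≠ 0) : zt m ^ m = 1 := Subtype.ext (ex_one_div_pow hm)

theorem norm_zt (m : ℕ) : ‖ex (1 / m)‖ = 1 := by
  rcases eq_or_ne m 0 with rfl | hm
  · simp [ex]
  · exact norm_eq_one_of_pow_eq_one (ex_one_div_pow hm) hm

theorem ExpP.frac {N q : ℕ} (hq : q ≠ 0) {P : PowerSeries Zb} {g : ℂ → ℂ} (h : ExpP 1 N P g)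
    (b : ℕ) :
    ExpP q N (PowerSeries.C (zt q ^ ((q - 1) * (b * N))) * PowerSeries.rescale (zt q ^ b) P)
      (fun τ => g ((τ + b) / q)) := by
  obtain ⟨u, hu, h⟩ := h
  have hb : ex (b / q) = ex (1 / q) ^ b := by rw [← ex_nat_mul]; congr 1; ring
  refine ⟨_, (Ser.const _).mul (hu.rescale (zt q ^ b) ?_), fun τ hτ => ?_⟩
  · rw [map_pow, coe_zt, norm_pow, norm_zt, one_pow]
  · have h2 : 0 < (τ + b).im := by simpa using hτ
    have h1 := h _ (im_div_pos hq h2)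
    simp only [Nat.cast_one, div_one] at h1
    rw [add_div, ex_add, hb, mul_comm (ex (τ / q))] at h1
    simp only [map_pow, coe_zt]
    rw [← h1, add_div]
    have h3 : ex (1 / q) ^ ((q - 1) * (b * N)) * (ex (1 / q) ^ b) ^ N = 1 := by
      rw [← pow_mul, ← pow_add]
      have : (q - 1) * (b * N) + b * N = q * (b * N) := by
        obtain ⟨k, rfl⟩ := Nat.exists_eq_succ_of_ne_zero hq
        simp; ring
      rw [this, pow_mul, ex_one_div_pow hq, one_pow]
    linear_combination (-(ex (τ / q) ^ N * g (τ / q + b / q))) * h3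

theorem ser_of_invariant {m : ℕ} (hm : m ≠ 0) {P : PowerSeries Zb} {u : ℂ → ℂ} (hu : Ser P u)
    (hinv : ∀ y : ℂ, y ≠ 0 → ‖y‖ < 1 → u (ex (1 / m) * y) = u y) :
    ∃ (P' : PowerSeries Zb) (u' : ℂ → ℂ), P'.constantCoeff = P.constantCoeff ∧ Ser P' u' ∧
      ∀ y : ℂ, ‖y‖ < 1 → u y = u' (y ^ m) := by
  have h1 : Ser (PowerSeries.rescale (zt m) P) u := by
    refine (hu.rescale (zt m) (by rw [coe_zt, norm_zt])).congr fun y hy => ?_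
    rcases eq_or_ne y 0 with rfl | hy0
    · simp
    · exact hinv y hy0 hy
  have hcoeff : ∀ n, ¬ m ∣ n → P.coeff n = 0 := fun n hn => by
    have h2 := (h1.map (algebraMap Zb ℂ) rfl).unique (hu.map (algebraMap Zb ℂ) rfl)
    have h3 := congr_arg (PowerSeries.coeff n) h2
    simp only [PowerSeries.coeff_map, PowerSeries.coeff_rescale, map_mul, map_pow, coe_zt] at h3
    have h4 : ex (1 / m) ^ n ≠ 1 := fun h => hn (by
      rw [ex, ← Complex.exp_nat_mul] at h
      obtain ⟨k, hk⟩ := Complex.exp_eq_one_iff.1 h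
      have h0 : (m : ℂ) ≠ 0 := by exact_mod_cast hm
      have hpi := Complex.two_pi_I_ne_zero
      have h5 : (n : ℂ) = m * k := by
        field_simp at hk
        exact hk
      have h6 : (n : ℤ) = m * k := by exact_mod_cast h5
      exact_mod_cast Dvd.intro _ h6.symm)
    have h5 : algebraMap Zb ℂ (P.coeff n) = 0 := by
      have : (ex (1 / m) ^ n - 1) * algebraMap Zb ℂ (P.coeff n) = 0 := by
        rw [sub_mul, h3, one_mul, sub_self]
      exact (mul_eq_zero.1 this).resolve_left (sub_ne_zero.2 h4)
    exact Subtype.ext h5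
  let P' : PowerSeries Zb := PowerSeries.mk fun n => P.coeff (m * n)
  have key : ∀ y : ℂ, ‖y‖ < 1 →
      HasSum (fun n => algebraMap Zb ℂ (P'.coeff n) * (y ^ m) ^ n) (u y) := fun y hy => by
    have h2 := hu y hy
    rw [← (mul_right_injective₀ hm).hasSum_iff] at h2
    · simpa [P', Function.comp_def, pow_mul] using h2
    · intro n hn
      rw [hcoeff n fun ⟨k, hk⟩ => hn ⟨k, hk.symm⟩]
      simp
  refine ⟨P', fun x => ∑' n, algebraMap Zb ℂ (P'.coeff n) * x ^ n, ?_, fun x hx => ?_,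
    fun y hy => (key y hy).tsum_eq.symm⟩
  · rw [← PowerSeries.coeff_zero_eq_constantCoeff_apply, PowerSeries.coeff_mk, mul_zero,
      PowerSeries.coeff_zero_eq_constantCoeff_apply]
  obtain ⟨y, rfl⟩ := IsAlgClosed.exists_pow_nat_eq x (Nat.pos_of_ne_zero hm)
  have hy : ‖y‖ < 1 := by
    rw [norm_pow] at hx
    exact (pow_lt_one_iff_of_nonneg (norm_nonneg _) hm).1 hx
  exact (key y hy).summable.hasSum

theorem exists_ex_eq {y : ℂ} (hy0 : y ≠ 0) (hy : ‖y‖ < 1) : ∃ τ : ℂ, 0 < τ.im ∧ ex τ = y := by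
  refine ⟨log y / (2 * Real.pi * I), ?_, ?_⟩
  · have h1 : (log y / (2 * Real.pi * I)) =
        ⟨(log y).im / (2 * Real.pi), -(log y).re / (2 * Real.pi)⟩ := by
      have hpi : (Real.pi : ℂ) ≠ 0 := by exact_mod_cast Real.pi_ne_zero
      rw [div_eq_iff (by simp [Real.pi_ne_zero])]
      apply Complex.ext <;> simp
    rw [h1]
    have : Real.log ‖y‖ < 0 := Real.log_neg (norm_pos_iff.2 hy0) hy
    simp only [log_re]
    have := Real.pi_pos
    apply div_pos <;> linarith
  · rw [ex, mul_div_cancel₀ _ (by simp [Real.pi_ne_zero]), exp_log hy0]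

theorem ExpP.descend_mul {m K : ℕ} (hm : m ≠ 0) {P : PowerSeries Zb} {g : ℂ → ℂ}
    (h : ExpP m (m * K) P g) (hg : ∀ τ : ℂ, 0 < τ.im → g (τ + 1) = g τ) :
    ∃ P' : PowerSeries Zb, P'.constantCoeff = P.constantCoeff ∧ ExpP 1 K P' g := by
  have h0 : (m : ℂ) ≠ 0 := by exact_mod_cast hm
  obtain ⟨u, hu, h⟩ := h
  obtain ⟨P', u', hP, hu', huu⟩ := ser_of_invariant hm hu fun y hy0 hy => by
    obtain ⟨σ, hσ, rfl⟩ := exists_ex_eq hy0 hy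
    have hσ' := im_natCast_mul_pos (Nat.pos_of_ne_zero hm) hσ
    have h1 : (m * σ) / m = σ := by field_simp
    have h2 : (m * σ + 1) / m = 1 / m + σ := by field_simp; ring
    have h3 := h (m * σ + 1) (by simpa using hσ')
    have h4 := h (m * σ) hσ'
    rw [h1] at h4
    rw [h2, hg _ hσ'] at h3
    rw [← ex_add, ← h3, ← h4, ex_add, mul_pow, pow_mul (ex (1 / m)), ex_one_div_pow hm, one_pow,
      one_mul]
  refine ⟨P', hP, u', hu', fun τ hτ => ?_⟩
  have h5 : ex (τ / m) ^ m = ex τ := by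
    rw [← ex_nat_mul]; congr 1; field_simp
  have h6 := h τ hτ
  rw [huu _ (norm_ex_lt_one (im_div_pos hm hτ)), pow_mul, h5] at h6
  simpa using h6

theorem ExpP.descend {m N : ℕ} (hm : m ≠ 0) {P : PowerSeries Zb} {g : ℂ → ℂ}
    (h : ExpP m N P g) (hg : ∀ τ : ℂ, 0 < τ.im → g (τ + 1) = g τ) :
    ∃ (K : ℕ) (P' : PowerSeries Zb), ExpP 1 K P' g := by
  obtain ⟨j, hj⟩ : ∃ j, j + N = m * N := ⟨(m - 1) * N, by
    obtain ⟨k, rfl⟩ := Nat.exists_eq_succ_of_ne_zero hm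
    simp; ring⟩
  obtain ⟨P', -, h'⟩ := (hj ▸ h.shift j : ExpP m (m * N) _ g).descend_mul hm hg
  exact ⟨_, _, h'⟩

theorem exists_expP_jpStar {p : ℕ} (hp : Good p) :
    ∃ P : PowerSeries ℤ, P.constantCoeff = 1 ∧ ExpP 1 1 P (jpStar p) := by
  obtain ⟨E, hE1, hE⟩ := exists_ser_euler
  have hE0 : ∀ y : ℂ, ‖y‖ < 1 → euler y ≠ 0 := fun y hy => euler_ne_zero hy
  have hpE : (E.expand p hp.prime.ne_zero).constantCoeff = 1 := by
    rw [PowerSeries.constantCoeff_expand, hE1]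
  have hpE0 : ∀ y : ℂ, ‖y‖ < 1 → euler (y ^ p) ≠ 0 := fun y hy => euler_ne_zero (by
    rw [norm_pow]; exact pow_lt_one₀ (norm_nonneg _) hy hp.prime.ne_zero)
  have hE' := hE.expand p hp.prime.ne_zero
  have hEinv := hE.inv hE1 hE0
  have hE'inv := hE'.inv hpE hpE0
  have h1 := (hE.mul hE'inv).pow (24 / (p - 1))
  have h2 := (hE'.mul hEinv).pow (24 / (p - 1))
  have h3 := (h1.add ((Ser.const ((24 / (p - 1) : ℕ) : ℤ)).mul Ser.id)).add
    (((Ser.const ((p : ℤ) ^ (12 / (p - 1)))).mul (Ser.id.pow 2)).mul h2)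
  refine ⟨_, ?_, _, h3, fun τ hτ => ?_⟩
  · simp [hE1]
  · have hx := ex_ne_zero τ
    have h4 := hE0 _ (norm_ex_lt_one hτ)
    have h5 := hpE0 _ (norm_ex_lt_one hτ)
    simp only [Nat.cast_one, div_one, pow_one]
    rw [jpStar_eq, hm_eq hp, mul_inv, inv_inv, ← inv_pow, mul_inv, inv_inv,
      mul_comm (euler (ex τ))⁻¹]
    simp only [algebraMap_int_eq, eq_intCast, Int.cast_natCast, Int.cast_pow]
    field_simp

theorem exists_expP_dd {p : ℕ} (hp : 0 < p) :
    ∃ P P' : PowerSeries ℤ, P.constantCoeff = 1 ∧ P'.constantCoeff = 1 ∧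
      ExpP 1 0 (PowerSeries.X ^ (p + 1) * P) (dd p) ∧
      ExpP 1 (p + 1) P' (fun τ => (dd p τ)⁻¹) := by
  obtain ⟨E, hE1, hE⟩ := exists_ser_euler
  have hE0 : ∀ y : ℂ, ‖y‖ < 1 → euler y ≠ 0 := fun y hy => euler_ne_zero hy
  have hpE0 : ∀ y : ℂ, ‖y‖ < 1 → euler (y ^ p) ≠ 0 := fun y hy => euler_ne_zero (by
    rw [norm_pow]; exact pow_lt_one₀ (norm_nonneg _) hy hp.ne')
  have h1 := (hE.mul (hE.expand p hp.ne')).pow 24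
  have h2 : ((E * E.expand p hp.ne') ^ 24).constantCoeff = 1 := by
    simp [PowerSeries.constantCoeff_expand, hE1]
  have h3 := h1.inv h2 fun y hy => pow_ne_zero _ (mul_ne_zero (hE0 y hy) (hpE0 y hy))
  refine ⟨_, _, h2, ?_, ⟨_, (Ser.id.pow (p + 1)).mul h1, fun τ hτ => ?_⟩, ⟨_, h3, fun τ hτ => ?_⟩⟩
  · simp
  · simp only [Nat.cast_one, div_one]
    rw [dd_eq]; ring
  · have hx := ex_ne_zero τ
    simp only [Nat.cast_one, div_one]
    rw [dd_eq, mul_inv, mul_inv_cancel_left₀ (pow_ne_zero _ hx)]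

theorem ExpP.bound {A : Type*} [CommRing A] [Algebra A ℂ] {m : ℕ} (hm : m ≠ 0)
    {P : PowerSeries A} {g : ℂ → ℂ} (h : ExpP m 0 P g) :
    ∃ C : ℝ, ∀ τ : ℂ, 0 < τ.im → (m : ℝ) ≤ τ.im → ‖g τ‖ ≤ C := by
  obtain ⟨u, hu, h⟩ := h
  have h1 : Real.exp (-2 * Real.pi) < 1 := by
    rw [Real.exp_lt_one_iff]; have := Real.pi_pos; linarith
  have hc : ContinuousOn u (Metric.closedBall 0 (Real.exp (-2 * Real.pi))) :=
    hu.differentiableOn.continuousOn.mono (Metric.closedBall_subset_ball h1)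
  obtain ⟨C, hC⟩ := (isCompact_closedBall _ _).exists_bound_of_continuousOn hc
  refine ⟨C, fun τ hτ h2 => ?_⟩
  have h3 := h τ hτ
  simp only [pow_zero, one_mul] at h3
  rw [h3]
  refine hC _ ?_
  rw [mem_closedBall_zero_iff, norm_ex, Real.exp_le_exp, div_natCast_im]
  have := Real.pi_pos
  have h4 : 1 ≤ τ.im / m := by rwa [one_le_div (by positivity)]
  nlinarith

theorem InvF.eq_constantCoeff {p : ℕ} (hp : p.Prime) {g : ℂ → ℂ} (hg : InvF p g) {m : ℕ}
    (hm : m ≠ 0) {P : PowerSeries Zb} (h : ExpP m 0 P g) {τ : ℂ} (hτ : 0 < τ.im) :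
    g τ = algebraMap Zb ℂ P.constantCoeff := by
  obtain ⟨C, hC⟩ := h.bound hm
  obtain ⟨c, hc⟩ := hg.eq_const hp hC
  obtain ⟨u, hu, h⟩ := h
  have h1 : ∀ y : ℂ, y ≠ 0 → ‖y‖ < 1 → u y = c := fun y hy0 hy => by
    obtain ⟨σ, hσ, rfl⟩ := exists_ex_eq hy0 hy
    have hσ' := im_natCast_mul_pos (Nat.pos_of_ne_zero hm) hσ
    have := h _ hσ'
    rw [pow_zero, one_mul, hc _ hσ', mul_div_cancel_left₀ _ (by exact_mod_cast hm)] at this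
    exact this.symm
  rw [← hu.zero_eq, hc τ hτ]
  have h2 : ContinuousAt u 0 := (hu.differentiableOn.differentiableAt
    (Metric.ball_mem_nhds _ one_pos)).continuousAt
  refine tendsto_nhds_unique ?_ (h2.tendsto.mono_left nhdsWithin_le_nhds :
    Filter.Tendsto u (nhdsWithin 0 {0}ᶜ) (nhds (u 0)))
  refine tendsto_const_nhds.congr' ?_
  filter_upwards [self_mem_nhdsWithin, nhdsWithin_le_nhds (Metric.ball_mem_nhds (0 : ℂ) one_pos)]
    with y hy0 hy
  exact (h1 y hy0 (by simpa using hy)).symm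

theorem InvF.const (p : ℕ) (c : ℂ) : InvF p (fun _ => c) := ⟨by simp, by simp, by simp⟩

theorem InvF.mul {p : ℕ} {g g' : ℂ → ℂ} (h : InvF p g) (h' : InvF p g') :
    InvF p (fun τ => g τ * g' τ) where
  diff τ hτ := (h.diff τ hτ).mul (h'.diff τ hτ)
  inv a b c d hd τ hτ := by rw [h.inv a b c d hd τ hτ, h'.inv a b c d hd τ hτ]
  W τ hτ := by rw [h.W τ hτ, h'.W τ hτ]

theorem InvF.sub {p : ℕ} {g g' : ℂ → ℂ} (h : InvF p g) (h' : InvF p g') :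
    InvF p (fun τ => g τ - g' τ) where
  diff τ hτ := (h.diff τ hτ).sub (h'.diff τ hτ)
  inv a b c d hd τ hτ := by rw [h.inv a b c d hd τ hτ, h'.inv a b c d hd τ hτ]
  W τ hτ := by rw [h.W τ hτ, h'.W τ hτ]

theorem InvF.pow {p : ℕ} {g : ℂ → ℂ} (h : InvF p g) (n : ℕ) :
    InvF p (fun τ => g τ ^ n) where
  diff τ hτ := (h.diff τ hτ).fun_pow n
  inv a b c d hd τ hτ := by rw [h.inv a b c d hd τ hτ]
  W τ hτ := by rw [h.W τ hτ]

theorem exists_expP_jpStar_Zb {p : ℕ} (hp : Good p) :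
    ∃ P : PowerSeries Zb, P.constantCoeff = 1 ∧ ExpP 1 1 P (jpStar p) := by
  obtain ⟨J, hJ1, hJ⟩ := exists_expP_jpStar hp
  refine ⟨_, ?_, hJ.toZb⟩
  rw [← PowerSeries.coeff_zero_eq_constantCoeff_apply, PowerSeries.coeff_map,
    PowerSeries.coeff_zero_eq_constantCoeff_apply, hJ1, map_one]

/-- A holomorphic function invariant under `Γ₀(p)*` whose expansion at the cusp has algebraic
integer coefficients is a polynomial over the algebraic integers in the Hauptmodul. -/
theorem InvF.exists_polynomial {p : ℕ} (hp : Good p) {K : ℕ} {P : PowerSeries Zb} {g : ℂ → ℂ}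
    (hg : InvF p g) (h : ExpP 1 K P g) :
    ∃ R : Polynomial Zb, R.natDegree ≤ K ∧ R.coeff K = P.constantCoeff ∧
      ∀ τ : ℂ, 0 < τ.im → g τ = Polynomial.aeval (jpStar p τ) R := by
  induction K generalizing P g with
  | zero =>
    exact ⟨Polynomial.C P.constantCoeff, by simp, by simp, fun τ hτ => by
      rw [hg.eq_constantCoeff hp.prime one_ne_zero h hτ, Polynomial.aeval_C]⟩
  | succ K ih =>
    obtain ⟨J, hJ1, hJ⟩ := exists_expP_jpStar_Zb hp
    set c := P.constantCoeff with hc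
    have h0 := (ExpP.const 1 c).mul (hJ.pow (K + 1))
    rw [mul_one, zero_add] at h0
    have h1 := h.sub h0
    obtain ⟨Q, hQ⟩ := PowerSeries.X_dvd_iff.2 (show (P - PowerSeries.C c *
      J ^ (K + 1)).constantCoeff = 0 by
        rw [map_sub, map_mul, map_pow, hJ1, PowerSeries.constantCoeff_C]; simp [← hc])
    rw [hQ] at h1
    obtain ⟨R, hR1, hR2, hR3⟩ := ih
      (hg.sub ((InvF.const p c).mul ((invF_jpStar hp).pow (K + 1)))) (h1.of_X_mul one_ne_zero)
    refine ⟨R + Polynomial.C c * Polynomial.X ^ (K + 1), ?_, ?_, fun τ hτ => ?_⟩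
    · refine (Polynomial.natDegree_add_le _ _).trans (max_le (hR1.trans K.le_succ) ?_)
      exact Polynomial.natDegree_C_mul_X_pow_le _ _
    · rw [Polynomial.coeff_add, Polynomial.coeff_eq_zero_of_natDegree_lt (by omega)]
      simp
    · have := hR3 τ hτ
      rw [map_add, ← this]
      simp

/-! ### Hecke correspondences -/

/-- Upper left entries of the representatives of matrices of determinant `q`. -/
def hA (q : ℕ) : Option (Fin q) → ℤ
  | none => q
  | some _ => 1

/-- Upper right entries of the representatives of matrices of determinant `q`. -/
def hB (q : ℕ) : Option (Fin q) → ℤ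
  | none => 0
  | some b => (b : ℕ)

/-- Lower right entries of the representatives of matrices of determinant `q`. -/
def hD (q : ℕ) : Option (Fin q) → ℤ
  | none => 1
  | some _ => q

theorem hA_mul_hD (q : ℕ) (i : Option (Fin q)) : hA q i * hD q i = q := by
  cases i <;> simp [hA, hD]

theorem hA_pos {q : ℕ} (hq : 0 < q) (i : Option (Fin q)) : 0 < hA q i := by
  cases i <;> simp [hA, hq]

theorem hD_pos {q : ℕ} (hq : 0 < q) (i : Option (Fin q)) : 0 < hD q i := by
  cases i <;> simp [hD, hq]

theorem hecke_ext {q : ℕ} (hq : 1 < q) {i j : Option (Fin q)} (hA' : hA q i = hA q j)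
    (hB' : (q : ℤ) ∣ hB q i - hB q j) : i = j := by
  rcases i with _ | i <;> rcases j with _ | j <;> simp only [hA, hB] at *
  · omega
  · omega
  · obtain ⟨k, hk⟩ := hB'
    have := i.2
    have := j.2
    have : k = 0 := by
      by_contra h0
      have h1 : 1 ≤ |k| := Int.one_le_abs h0
      have h2 : |(i : ℕ) - (j : ℕ) - (0 : ℤ)| < q := by rw [abs_lt]; constructor <;> omega
      rw [sub_zero, hk, abs_mul, Nat.abs_cast] at h2
      nlinarith
    subst this
    congr 1
    ext
    omega

theorem exists_hecke_decomp {p q : ℕ} (hq : q.Prime) {A B C D : ℤ}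
    (h : A * D - B * (p * C) = q) (hpq : p.Coprime q) :
    ∃ (i : Option (Fin q)) (a b c d : ℤ), a * d - b * (p * c) = 1 ∧ A = a * hA q i ∧
      B = a * hB q i + b * hD q i ∧ C = c * hA q i ∧ D = p * c * hB q i + d * hD q i := by
  have hq0 : (0 : ℤ) < q := by exact_mod_cast hq.pos
  have hqp : Prime (q : ℤ) := Nat.prime_iff_prime_int.1 hq
  have hpq' : ¬ (q : ℤ) ∣ p := fun h => hq.one_lt.ne'
    ((Nat.coprime_comm.1 hpq).eq_one_of_dvd (Int.natCast_dvd_natCast.1 h))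
  have inv : ∀ x : ℤ, ¬ (q : ℤ) ∣ x → ∀ y : ℤ, ∃ b0 : Fin q, (q : ℤ) ∣ y - x * (b0 : ℕ) := by
    intro x hx y
    obtain ⟨u, v, huv⟩ := (hqp.coprime_iff_not_dvd.2 hx).symm
    have h1 := Int.emod_nonneg (u * y) hq0.ne'
    have h2 := Int.emod_lt_of_pos (u * y) hq0
    refine ⟨⟨(u * y % q).toNat, by omega⟩, ?_⟩
    rw [Int.toNat_of_nonneg h1, Int.emod_def]
    exact ⟨v * y + x * (u * y / q), by linear_combination (-y) * huv⟩
  have key : ∀ b0 : Fin q, (q : ℤ) ∣ B - A * (b0 : ℕ) → (q : ℤ) ∣ D - p * C * (b0 : ℕ) →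
      ∃ (i : Option (Fin q)) (a b c d : ℤ), a * d - b * (p * c) = 1 ∧ A = a * hA q i ∧
      B = a * hB q i + b * hD q i ∧ C = c * hA q i ∧ D = p * c * hB q i + d * hD q i := by
    rintro b0 ⟨b, hb⟩ ⟨d, hd⟩
    refine ⟨some b0, A, b, C, d, ?_, ?_, ?_, ?_, ?_⟩ <;> try simp only [hA, hB, hD]
    · apply mul_left_cancel₀ hq0.ne'
      linear_combination h - A * hd + p * C * hb
    · ring
    · linear_combination hb
    · ring
    · linear_combination hd
  by_cases hqA : (q : ℤ) ∣ A
  · by_cases hqC : (q : ℤ) ∣ C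
    · obtain ⟨a, rfl⟩ := hqA
      obtain ⟨c, rfl⟩ := hqC
      refine ⟨none, a, B, c, D, ?_, ?_, ?_, ?_, ?_⟩ <;> try simp only [hA, hB, hD]
      · apply mul_left_cancel₀ hq0.ne'
        linear_combination h
      all_goals ring
    · have hx : ¬ (q : ℤ) ∣ p * C := fun h => (hqp.dvd_or_dvd h).elim hpq' hqC
      obtain ⟨b0, k, hk⟩ := inv _ hx D
      obtain ⟨a, ha⟩ := hqA
      refine key b0 ((hqp.dvd_or_dvd (?_ : (q : ℤ) ∣ p * C * _)).resolve_left hx) ⟨k, hk⟩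
      exact ⟨A * k - 1, by linear_combination A * hk - h⟩
  · obtain ⟨b0, k, hk⟩ := inv _ hqA B
    refine key b0 ⟨k, hk⟩ ((hqp.dvd_or_dvd (?_ : (q : ℤ) ∣ A * _)).resolve_left hqA)
    exact ⟨1 + p * C * k, by linear_combination h + p * C * hk⟩

/-- Left multiplication by `Γ₀(p)` moves any family of representatives to the standard one. -/
theorem exists_hecke_perm {p q : ℕ} (hq : q.Prime) (hpq : p.Coprime q)
    (A B C D : Option (Fin q) → ℤ) (hdet : ∀ i, A i * D i - B i * (p * C i) = q)
    (hinj : ∀ (i i' : Option (Fin q)) (a b c d : ℤ), a * d - b * (p * c) = 1 →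
      A i' = a * A i + b * (p * C i) → B i' = a * B i + b * D i → C i' = c * A i + d * C i →
      D i' = p * c * B i + d * D i → i = i') :
    ∃ σ : Equiv.Perm (Option (Fin q)), ∀ i, ∃ a b c d : ℤ, a * d - b * (p * c) = 1 ∧
      A i = a * hA q (σ i) ∧ B i = a * hB q (σ i) + b * hD q (σ i) ∧ C i = c * hA q (σ i) ∧
      D i = p * c * hB q (σ i) + d * hD q (σ i) := by
  choose σ a b c d h1 h2 h3 h4 h5 using fun i => exists_hecke_decomp hq (hdet i) hpq
  have hσ : Function.Injective σ := fun i j hij => by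
    have e1 := h1 i
    have e1' := h1 j
    have e2 := h2 i
    have e2' := h2 j
    have e3 := h3 i
    have e3' := h3 j
    have e4 := h4 i
    have e4' := h4 j
    have e5 := h5 i
    have e5' := h5 j
    rw [← hij] at e2' e3' e4' e5'
    refine hinj i j (a j * d i - b j * (p * c i)) (b j * a i - a j * b i)
      (c j * d i - d j * c i) (d j * a i - p * c j * b i) ?_ ?_ ?_ ?_ ?_
    · linear_combination (a j * d j - b j * (p * c j)) * e1 + e1'
    · rw [e2', e2, e4]; linear_combination (-(a j * hA q (σ i))) * e1
    · rw [e3', e3, e5]; linear_combination (-(a j * hB q (σ i) + b j * hD q (σ i))) * e1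
    · rw [e4', e2, e4]; linear_combination (-(c j * hA q (σ i))) * e1
    · rw [e5', e3, e5]
      linear_combination (-(p * c j * hB q (σ i) + d j * hD q (σ i))) * e1
  exact ⟨Equiv.ofBijective σ (Finite.injective_iff_bijective.1 hσ),
    fun i => ⟨a i, b i, c i, d i, h1 i, h2 i, h3 i, h4 i, h5 i⟩⟩

/-- The points of the Hecke orbit. -/
noncomputable def hpt (q : ℕ) (i : Option (Fin q)) (τ : ℂ) : ℂ := mob (hA q i) (hB q i) 0 (hD q i) τ

theorem hpt_none (q : ℕ) (τ : ℂ) : hpt q none τ = q * τ := by simp [hpt, mob, hA, hB, hD]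

theorem hpt_some (q : ℕ) (b : Fin q) (τ : ℂ) : hpt q (some b) τ = (τ + (b : ℕ)) / q := by
  simp [hpt, mob, hA, hB, hD]

theorem hpt_im_pos {q : ℕ} (hq : 0 < q) (i : Option (Fin q)) {τ : ℂ} (hτ : 0 < τ.im) :
    0 < (hpt q i τ).im :=
  mob_im_pos hτ (by rw [mul_zero, sub_zero, hA_mul_hD]; exact_mod_cast hq)

/-- The multiplier attached to a matrix of determinant `q`. -/
noncomputable def mult (p q : ℕ) (A B C D : ℤ) (τ : ℂ) : ℂ :=
  (q / (C * τ + D)) ^ 24 * dd p (mob A B C D τ) / dd p τ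

/-- The multipliers of the Hecke orbit. -/
noncomputable def hph (p q : ℕ) (i : Option (Fin q)) (τ : ℂ) : ℂ :=
  mult p q (hA q i) (hB q i) 0 (hD q i) τ

theorem hph_none (p q : ℕ) (τ : ℂ) : hph p q none τ = q ^ 24 * dd p (q * τ) / dd p τ := by
  simp [hph, mult, mob, hA, hB, hD]

theorem hph_some {q : ℕ} (p : ℕ) (hq : 0 < q) (b : Fin q) (τ : ℂ) :
    hph p q (some b) τ = dd p ((τ + (b : ℕ)) / q) / dd p τ := by
  have : (q : ℂ) ≠ 0 := by exact_mod_cast hq.ne'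
  simp [hph, mult, mob, hA, hB, hD, this]

theorem mult_left {p q : ℕ} (hp : 0 < p) {a b c d A B C D : ℤ} (h : a * d - b * (p * c) = 1)
    (hdet : 0 < A * D - B * C) {τ : ℂ} (hτ : 0 < τ.im) :
    mult p q (a * A + b * C) (a * B + b * D) (p * c * A + d * C) (p * c * B + d * D) τ =
      mult p q A B C D τ := by
  have hd := den_ne_zero hτ (ne_zero_or_of_det hdet.ne')
  have hτ' := mob_im_pos hτ hdet
  have hd' : ((p * c : ℤ) * mob A B C D τ + d : ℂ) ≠ 0 :=
    den_ne_zero hτ' (ne_zero_or_of_det (by omega : a * d - b * (p * c) ≠ 0))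
  have h1 := dd_mob hp hτ' h
  rw [mob_mob _ _ _ _ _ _ _ _ hd] at h1
  have h2 := den_mob (p * c) d A B C D hd
  rw [mult, h1, mult]
  rw [h2] at hd' ⊢
  have h3 := (div_ne_zero_iff.1 hd').1
  field_simp

theorem mult_right {p q : ℕ} (hp : 0 < p) {a b c d A B C D : ℤ} (h : a * d - b * (p * c) = 1)
    {τ : ℂ} (hτ : 0 < τ.im) :
    mult p q A B C D (mob a b (p * c) d τ) =
      mult p q (A * a + B * (p * c)) (A * b + B * d) (C * a + D * (p * c)) (C * b + D * d) τ := by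
  have hd : ((p * c : ℤ) * τ + d : ℂ) ≠ 0 :=
    den_ne_zero hτ (ne_zero_or_of_det (by omega : a * d - b * (p * c) ≠ 0))
  rw [mult, dd_mob hp hτ h, mob_mob _ _ _ _ _ _ _ _ hd, den_mob _ _ _ _ _ _ hd, mult]
  have := dd_ne_zero hp hτ
  rw [div_div_eq_mul_div, div_pow, mul_pow]
  field_simp

theorem mult_W {p q : ℕ} (hp : 0 < p) {A B C D : ℤ} (hdet : 0 < A * D - B * (p * C))
    {τ : ℂ} (hτ : 0 < τ.im) :
    mult p q A B (p * C) D (-1 / (p * τ)) = mult p q D (-C) (p * -B) A τ ∧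
    mob A B (p * C) D (-1 / (p * τ)) = -1 / (p * mob D (-C) (p * -B) A τ) := by
  have hp' : (p : ℂ) ≠ 0 := by exact_mod_cast hp.ne'
  have hτ0 : τ ≠ 0 := by rintro rfl; simp at hτ
  have hdet' : 0 < D * A - -C * (p * -B) := by linarith
  have hN := mob_im_pos hτ hdet'
  have hN0 : mob D (-C) (p * -B) A τ ≠ 0 := fun h => by rw [h] at hN; simp at hN
  have hd := den_ne_zero hτ (ne_zero_or_of_det hdet'.ne')
  have e : mob A B (p * C) D (-1 / (p * τ)) = -1 / (p * mob D (-C) (p * -B) A τ) := by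
    rw [mob, mob] at *
    have hn := (div_ne_zero_iff.1 hN0).1
    have : ((p * C : ℤ) * (-1 / (p * τ)) + D : ℂ) = (D * τ + (-C : ℤ)) / τ := by
      push_cast; field_simp; ring
    rw [this]
    push_cast at *
    field_simp
    ring
  refine ⟨?_, e⟩
  rw [mult, e, dd_W hp hN, dd_W hp hτ, mult]
  have h0 := dd_ne_zero hp hτ
  have : ((p * C : ℤ) * (-1 / (p * τ)) + D : ℂ) = mob D (-C) (p * -B) A τ *
      ((p * -B : ℤ) * τ + A) / τ := by
    rw [mob, div_mul_cancel₀ _ hd]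
    push_cast; field_simp; ring
  rw [this]
  field_simp

/-- The group `Γ₀(p)` permutes the Hecke orbit. -/
theorem hecke_mob {p q : ℕ} (hp : Good p) (hq : q.Prime) (hpq : p.Coprime q) {a b c d : ℤ}
    (h : a * d - b * (p * c) = 1) :
    ∃ σ : Equiv.Perm (Option (Fin q)), ∀ i (τ : ℂ), 0 < τ.im →
      jpStar p (hpt q i (mob a b (p * c) d τ)) = jpStar p (hpt q (σ i) τ) ∧
      hph p q i (mob a b (p * c) d τ) = hph p q (σ i) τ := by
  obtain ⟨σ, hσ⟩ := exists_hecke_perm hq hpq (fun i => hA q i * a + hB q i * (p * c))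
    (fun i => hA q i * b + hB q i * d) (fun i => hD q i * c) (fun i => hD q i * d)
    (fun i => by
      rw [← hA_mul_hD q i]
      linear_combination (hA q i * hD q i) * h) (by
    intro i j a' b' c' d' h' e1 e2 e3 e4
    have hAi := hA_pos hq.pos i
    have hAj := hA_pos hq.pos j
    have hDi := hD_pos hq.pos i
    have k1 : hA q j = a' * hA q i := by
      linear_combination d * e1 - p * c * e2 - (hA q j - a' * hA q i) * h
    have k2 : hB q j = a' * hB q i + b' * hD q i := by
      linear_combination a * e2 - b * e1 - (hB q j - a' * hB q i - b' * hD q i) * h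
    have k3 : c' * hA q i = 0 := by
      linear_combination -d * e3 + c * e4 - c' * hA q i * h
    have k4 : hD q j = p * c' * hB q i + d' * hD q i := by
      linear_combination a * e4 - p * b * e3 - (hD q j - p * c' * hB q i - d' * hD q i) * h
    have k5 : c' = 0 := (mul_eq_zero.1 k3).resolve_right hAi.ne'
    subst k5
    have k6 : a' * d' = 1 := by linarith
    have k7 : 0 < a' := by
      by_contra! h0
      nlinarith
    have k8 : a' = 1 := by
      rcases Int.eq_one_or_neg_one_of_mul_eq_one k6 with h | h <;> omega
    subst k8
    rcases i with _ | i
    · rcases j with _ | j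
      · rfl
      · simp only [hA] at k1
        have := hq.one_lt
        omega
    refine hecke_ext hq.one_lt (by rw [k1, one_mul]) ⟨-b', ?_⟩
    rw [k2]; simp only [hD]; ring)
  refine ⟨σ, fun i τ hτ => ?_⟩
  obtain ⟨a', b', c', d', h', e1, e2, e3, e4⟩ := hσ i
  have hd : ((p * c : ℤ) * τ + d : ℂ) ≠ 0 :=
    den_ne_zero hτ (ne_zero_or_of_det (by omega : a * d - b * (p * c) ≠ 0))
  have hq0 : (0 : ℤ) < q := by exact_mod_cast hq.pos
  have hdet : 0 < hA q (σ i) * hD q (σ i) - hB q (σ i) * 0 := by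
    rw [mul_zero, sub_zero, hA_mul_hD]; exact hq0
  have e3' : 0 * a + hD q i * (p * c) = p * c' * hA q (σ i) + d' * 0 := by
    linear_combination (p : ℤ) * e3
  have e4' : 0 * b + hD q i * d = p * c' * hB q (σ i) + d' * hD q (σ i) := by
    linear_combination e4
  have e1' : hA q i * a + hB q i * (p * c) = a' * hA q (σ i) + b' * 0 := by
    linear_combination e1
  constructor
  · rw [hpt, mob_mob _ _ _ _ _ _ _ _ hd, e1', e2, e3', e4', ← mob_mob _ _ _ _ _ _ _ _
      (den_ne_zero hτ (ne_zero_or_of_det hdet.ne')), ← hpt, jpStar_mob hp h' (hpt_im_pos hq.pos _ hτ)]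
  · rw [hph, mult_right hp.pos h hτ, e1', e2, e3', e4', mult_left hp.pos h' hdet hτ, hph]

/-- The Fricke involution permutes the Hecke orbit. -/
theorem hecke_W {p q : ℕ} (hp : Good p) (hq : q.Prime) (hpq : p.Coprime q) :
    ∃ σ : Equiv.Perm (Option (Fin q)), ∀ i (τ : ℂ), 0 < τ.im →
      jpStar p (hpt q i (-1 / (p * τ))) = jpStar p (hpt q (σ i) τ) ∧
      hph p q i (-1 / (p * τ)) = hph p q (σ i) τ := by
  have hp0 : (p : ℤ) ≠ 0 := by exact_mod_cast hp.pos.ne'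
  obtain ⟨σ, hσ⟩ := exists_hecke_perm hq hpq (hD q) (fun _ => 0) (fun i => -hB q i) (hA q)
    (fun i => by rw [← hA_mul_hD q i]; ring) (by
    intro i j a b c d h e1 e2 e3 e4
    have hAi := hA_pos hq.pos i
    have hAj := hA_pos hq.pos j
    have hDi := hD_pos hq.pos i
    have hDj := hD_pos hq.pos j
    have hb : b = 0 := by
      have : b * hA q i = 0 := by linarith
      exact (mul_eq_zero.1 this).resolve_right hAi.ne'
    subst hb
    have k6 : a * d = 1 := by linarith
    have k1 : hD q j = a * hD q i := by linarith
    have k7 : 0 < a := by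
      by_contra! h0
      nlinarith
    have k8 : a = 1 := by
      rcases Int.eq_one_or_neg_one_of_mul_eq_one k6 with h | h <;> omega
    subst k8
    have k9 : d = 1 := by linarith
    subst k9
    have k2 : hA q i = hA q j := by linarith
    rcases i with _ | i
    · rcases j with _ | j
      · rfl
      · simp only [hA] at k2
        have := hq.one_lt
        omega
    refine hecke_ext hq.one_lt k2 ⟨c, ?_⟩
    simp only [hD] at e3
    linarith)
  refine ⟨σ, fun i τ hτ => ?_⟩
  obtain ⟨a', b', c', d', h', e1, e2, e3, e4⟩ := hσ i
  have hq0 : (0 : ℤ) < q := by exact_mod_cast hq.pos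
  have hdet : 0 < hA q (σ i) * hD q (σ i) - hB q (σ i) * 0 := by
    rw [mul_zero, sub_zero, hA_mul_hD]; exact hq0
  have hdet' : 0 < hA q i * hD q i - hB q i * (p * 0) := by
    rw [mul_zero, mul_zero, sub_zero, hA_mul_hD]; exact hq0
  obtain ⟨m1, m2⟩ := mult_W (q := q) hp.pos hdet' hτ
  have e3' : p * -hB q i = p * c' * hA q (σ i) + d' * 0 := by
    linear_combination (p : ℤ) * e3
  have e1' : hD q i = a' * hA q (σ i) + b' * 0 := by
    linear_combination e1
  have e2' : -(0 : ℤ) = a' * hB q (σ i) + b' * hD q (σ i) := by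
    linear_combination e2
  rw [mul_zero, e1', e2', e3', e4] at m1 m2
  constructor
  · rw [← mob_mob _ _ _ _ _ _ _ _ (den_ne_zero hτ (ne_zero_or_of_det hdet.ne')), ← hpt] at m2
    have h1 := hpt_im_pos hq.pos (σ i) hτ
    have h2 : 0 < (mob a' b' (p * c') d' (hpt q (σ i) τ)).im := mob_im_pos h1 (by omega)
    rw [hpt]
    have h3 : jpStar p (-1 / (p * mob a' b' (p * c') d' (hpt q (σ i) τ))) =
      jpStar p (hpt q (σ i) τ) := by rw [jpStar_W hp h2, jpStar_mob hp h' h1]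
    rw [← h3, ← m2, ← e1', ← e4]
  · rw [mult_left hp.pos h' hdet hτ] at m1
    rw [hph, hph, ← m1, ← e1', ← e4]

/-! ### Integrality of special values -/

/-- Holomorphic functions on the upper half plane with an expansion in `exp(2πiτ/m)` having
algebraic integer coefficients. -/
def ES (m : ℕ) : Subring (ℂ → ℂ) where
  carrier := {g | (∃ N P, ExpP (A := Zb) m N P g) ∧ ∀ τ : ℂ, 0 < τ.im → DifferentiableAt ℂ g τ}
  mul_mem' := by
    rintro g g' ⟨⟨N, P, h⟩, hd⟩ ⟨⟨N', P', h'⟩, hd'⟩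
    exact ⟨⟨_, _, h.mul h'⟩, fun τ hτ => (hd τ hτ).mul (hd' τ hτ)⟩
  one_mem' := ⟨⟨0, PowerSeries.C 1, (ExpP.const m 1).congr (by simp)⟩,
    fun _ _ => differentiableAt_const (1 : ℂ)⟩
  add_mem' := by
    rintro g g' ⟨⟨N, P, h⟩, hd⟩ ⟨⟨N', P', h'⟩, hd'⟩
    refine ⟨⟨N' + N, _, (h.shift N').add (?_ : ExpP m _ (PowerSeries.X ^ N * P') g')⟩,
      fun τ hτ => (hd τ hτ).add (hd' τ hτ)⟩
    rw [add_comm N']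
    exact h'.shift N
  zero_mem' := ⟨⟨0, PowerSeries.C 0, (ExpP.const m 0).congr (by simp)⟩,
    fun _ _ => differentiableAt_const (0 : ℂ)⟩
  neg_mem' := by
    rintro g ⟨⟨N, P, h⟩, hd⟩
    exact ⟨⟨_, _, h.neg⟩, fun τ hτ => (hd τ hτ).neg⟩

theorem differentiableAt_hpt (q : ℕ) (i : Option (Fin q)) (τ : ℂ) :
    DifferentiableAt ℂ (hpt q i) τ := by
  unfold hpt mob
  simp only [Int.cast_zero, zero_mul, zero_add]
  fun_prop

theorem ES.up {q : ℕ} (hq : q ≠ 0) {g : ℂ → ℂ} (h : g ∈ ES 1) : g ∈ ES q := by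
  obtain ⟨⟨N, P, h⟩, hd⟩ := h
  exact ⟨⟨_, _, h.up hq⟩, hd⟩

theorem ES.comp_hpt {q : ℕ} (hq : q ≠ 0) {g : ℂ → ℂ} (h : g ∈ ES 1) (i : Option (Fin q)) :
    (fun τ => g (hpt q i τ)) ∈ ES q := by
  have hd : ∀ τ : ℂ, 0 < τ.im → DifferentiableAt ℂ (fun τ => g (hpt q i τ)) τ := fun τ hτ =>
    (h.2 _ (hpt_im_pos (Nat.pos_of_ne_zero hq) i hτ)).fun_comp' _ (differentiableAt_hpt q i τ)
  refine ⟨?_, hd⟩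
  obtain ⟨N, P, h⟩ := h.1
  rcases i with _ | b
  · exact ⟨_, _, ((h.comp_mul hq).up hq).congr fun τ _ => by rw [hpt_none]⟩
  · exact ⟨_, _, (h.frac hq b).congr fun τ _ => by rw [hpt_some]⟩

theorem ES.jpStar {p : ℕ} (hp : Good p) : jpStar p ∈ ES 1 := by
  obtain ⟨P, -, h⟩ := exists_expP_jpStar_Zb hp
  exact ⟨⟨_, _, h⟩, fun τ hτ => differentiableAt_jpStar hp hτ⟩

theorem ES.dd {p : ℕ} (hp : 0 < p) : dd p ∈ ES 1 := by
  obtain ⟨P, P', -, -, h, h'⟩ := exists_expP_dd hp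
  exact ⟨⟨_, _, h.toZb⟩, fun τ hτ => differentiableAt_dd hp hτ⟩

theorem ES.dd_inv {p : ℕ} (hp : 0 < p) : (fun τ => (_root_.dd p τ)⁻¹) ∈ ES 1 := by
  obtain ⟨P, P', -, -, h, h'⟩ := exists_expP_dd hp
  exact ⟨⟨_, _, h'.toZb⟩, fun τ hτ => (differentiableAt_dd hp hτ).inv (dd_ne_zero hp hτ)⟩

theorem ES.hph {p q : ℕ} (hp : 0 < p) (hq : 0 < q) (i : Option (Fin q)) : hph p q i ∈ ES q := by
  have h := mul_mem (ES.comp_hpt hq.ne' (ES.dd hp) i) (ES.up hq.ne' (ES.dd_inv hp))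
  rcases i with _ | b
  · convert mul_mem (natCast_mem (ES q) (q ^ 24)) h using 1
    ext τ
    simp only [Pi.mul_apply, Pi.natCast_apply, hph_none, hpt_none]
    push_cast
    ring
  · convert h using 1
    ext τ
    simp only [Pi.mul_apply, hph_some p hq, hpt_some]
    ring

theorem isIntegral_trans_Zb {x : ℂ} (h : IsIntegral Zb x) : IsIntegral ℤ x :=
  haveI : Algebra.IsIntegral ℤ Zb := inferInstance
  isIntegral_trans x h

theorem isIntegral_aeval_Zb {x : ℂ} (h : IsIntegral ℤ x) (R : Polynomial Zb) :
    IsIntegral ℤ (Polynomial.aeval x R) := by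
  rw [Polynomial.aeval_eq_sum_range]
  refine IsIntegral.sum _ fun i _ => ?_
  rw [Algebra.smul_def]
  exact (R.coeff i).2.mul (h.pow i)

/-- Values of modular functions are integral where the Hauptmodul is. -/
theorem InvF.isIntegral {p m : ℕ} (hp : Good p) (hm : m ≠ 0) {g : ℂ → ℂ} (hg : InvF p g)
    (hES : g ∈ ES m) {α : ℂ} (hα : 0 < α.im) (h : IsIntegral ℤ (jpStar p α)) :
    IsIntegral ℤ (g α) := by
  obtain ⟨⟨N, P, hP⟩, -⟩ := hES
  obtain ⟨K, P', hP'⟩ := hP.descend hm fun τ hτ => by simpa using hg.add_int hτ 1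
  obtain ⟨R, -, -, hR⟩ := hg.exists_polynomial hp hP'
  rw [hR α hα]
  exact isIntegral_aeval_Zb h R

theorem isIntegral_of_coeff {P : Polynomial ℂ} (hP : P.Monic)
    (h : ∀ k, IsIntegral ℤ (P.coeff k)) {x : ℂ} (hx : P.eval x = 0) : IsIntegral ℤ x := by
  apply isIntegral_trans_Zb
  have hl : P ∈ Polynomial.lifts (algebraMap Zb ℂ) := by
    rw [Polynomial.lifts_iff_coeff_lifts]
    exact fun n => ⟨⟨_, h n⟩, rfl⟩
  obtain ⟨Q, hQ, -, hQm⟩ := Polynomial.lifts_and_natDegree_eq_and_monic hl hP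
  refine ⟨Q, hQm, ?_⟩
  rw [← Polynomial.eval_map, hQ, hx]

/-- Functions permuted by `Γ₀(p)*` are integral where the Hauptmodul is. -/
theorem isIntegral_of_perm {p m : ℕ} (hp : Good p) (hm : m ≠ 0) {ι : Type*} [Fintype ι]
    (g : ι → ℂ → ℂ) (hES : ∀ i, g i ∈ ES m)
    (hmob : ∀ a b c d : ℤ, a * d - b * (p * c) = 1 → ∃ σ : Equiv.Perm ι, ∀ i (τ : ℂ), 0 < τ.im →
      g i (mob a b (p * c) d τ) = g (σ i) τ)
    (hW : ∃ σ : Equiv.Perm ι, ∀ i (τ : ℂ), 0 < τ.im → g i (-1 / (p * τ)) = g (σ i) τ)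
    {α : ℂ} (hα : 0 < α.im) (h : IsIntegral ℤ (jpStar p α)) (i : ι) : IsIntegral ℤ (g i α) := by
  let Q : Polynomial (ES m) := ∏ i, (Polynomial.X - Polynomial.C ⟨g i, hES i⟩)
  let P : ℂ → Polynomial ℂ := fun τ => ∏ i, (Polynomial.X - Polynomial.C (g i τ))
  have hQ : ∀ k τ, (Q.coeff k : ℂ → ℂ) τ = (P τ).coeff k := fun k τ => by
    have : Q.map ((Pi.evalRingHom (fun _ : ℂ => ℂ) τ).comp (ES m).subtype) = P τ := by
      simp [Q, P, Polynomial.map_prod]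
    rw [← this, Polynomial.coeff_map]
    rfl
  refine isIntegral_of_coeff (P := P α) (Polynomial.monic_prod_X_sub_C _ _) (fun k => ?_) ?_
  · rw [← hQ]
    refine InvF.isIntegral hp hm ⟨(Q.coeff k).2.2, ?_, ?_⟩ (Q.coeff k).2 hα h
    · intro a b c d hdet τ hτ
      rw [hQ, hQ]
      obtain ⟨σ, hσ⟩ := hmob a b c d hdet
      congr 1
      simp only [P]
      exact (Finset.prod_congr rfl fun i _ => by rw [hσ i τ hτ]).trans
        (Equiv.prod_comp σ fun i => Polynomial.X - Polynomial.C (g i τ))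
    · intro τ hτ
      rw [hQ, hQ]
      obtain ⟨σ, hσ⟩ := hW
      congr 1
      simp only [P]
      exact (Finset.prod_congr rfl fun i _ => by rw [hσ i τ hτ]).trans
        (Equiv.prod_comp σ fun i => Polynomial.X - Polynomial.C (g i τ))
  · rw [Polynomial.eval_prod]
    exact Finset.prod_eq_zero (Finset.mem_univ i) (by simp)

section

variable {p q : ℕ} (hp : Good p) (hq : q.Prime) (hpq : p.Coprime q) {α : ℂ} (hα : 0 < α.im)
include hp hq hpq hα

theorem isIntegral_jpStar_hpt (h : IsIntegral ℤ (jpStar p α)) (i : Option (Fin q)) :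
    IsIntegral ℤ (jpStar p (hpt q i α)) :=
  isIntegral_of_perm hp hq.ne_zero (fun i τ => jpStar p (hpt q i τ))
    (fun i => ES.comp_hpt hq.ne_zero (ES.jpStar hp) i)
    (fun _ _ _ _ hdet => (hecke_mob hp hq hpq hdet).imp fun _ h i τ hτ => (h i τ hτ).1)
    ((hecke_W hp hq hpq).imp fun _ h i τ hτ => (h i τ hτ).1) hα h i

theorem isIntegral_hph (h : IsIntegral ℤ (jpStar p α)) (i : Option (Fin q)) :
    IsIntegral ℤ (hph p q i α) :=
  isIntegral_of_perm hp hq.ne_zero (hph p q) (fun i => ES.hph hp.pos hq.pos i)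
    (fun _ _ _ _ hdet => (hecke_mob hp hq hpq hdet).imp fun _ h i τ hτ => (h i τ hτ).2)
    ((hecke_W hp hq hpq).imp fun _ h i τ hτ => (h i τ hτ).2) hα h i

/-- The Hauptmodul is integral at fixed points of matrices of prime determinant. -/
theorem isIntegral_jpStar_of_fixed {A B C D : ℤ} (hdet : A * D - B * (p * C) = q)
    (hfix : mob A B (p * C) D α = α) : IsIntegral ℤ (jpStar p α) := by
  have hq0 := hq.ne_zero
  let G : ℂ → ℂ := fun τ => ∏ i : Option (Fin q), (jpStar p τ - jpStar p (hpt q i τ))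
  have hG : InvF p G := by
    refine ⟨fun τ hτ => ?_, fun a b c d hdet τ hτ => ?_, fun τ hτ => ?_⟩
    · exact DifferentiableAt.fun_finsetProd fun i _ => ((ES.up hq0 (ES.jpStar hp)).2 τ hτ).sub
        ((ES.comp_hpt hq0 (ES.jpStar hp) i).2 τ hτ)
    · obtain ⟨σ, hσ⟩ := hecke_mob hp hq hpq hdet
      simp only [G]
      exact (Finset.prod_congr rfl fun i _ => by rw [(hσ i τ hτ).1, jpStar_mob hp hdet hτ]).trans
        (Equiv.prod_comp σ fun i => jpStar p τ - jpStar p (hpt q i τ))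
    · obtain ⟨σ, hσ⟩ := hecke_W hp hq hpq
      simp only [G]
      exact (Finset.prod_congr rfl fun i _ => by rw [(hσ i τ hτ).1, jpStar_W hp hτ]).trans
        (Equiv.prod_comp σ fun i => jpStar p τ - jpStar p (hpt q i τ))
  have hG0 : G α = 0 := by
    obtain ⟨i, a, b, c, d, h, e1, e2, e3, e4⟩ := exists_hecke_decomp hq hdet hpq
    refine Finset.prod_eq_zero (Finset.mem_univ i) (sub_eq_zero.2 ?_)
    have e3' : p * C = p * c * hA q i + d * 0 := by rw [e3]; ring
    have e1' : A = a * hA q i + b * 0 := by rw [e1]; ring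
    have hd : 0 < hA q i * hD q i - hB q i * 0 := by
      rw [mul_zero, sub_zero, hA_mul_hD]; exact_mod_cast hq.pos
    rw [e1', e2, e3', e4, ← mob_mob _ _ _ _ _ _ _ _ (den_ne_zero hα (ne_zero_or_of_det hd.ne')),
      ← hpt] at hfix
    rw [← jpStar_mob hp h (hpt_im_pos hq.pos i hα), hfix]
  obtain ⟨J, hJ1, hJ⟩ := exists_expP_jpStar_Zb hp
  have hup := hJ.up hq0
  rw [mul_one] at hup
  have hnone : ∃ P : PowerSeries Zb, P.constantCoeff = -1 ∧
      ExpP q (q * q) P (fun τ => jpStar p τ - jpStar p (hpt q none τ)) := by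
    have h1 := (hJ.comp_mul hq0).up hq0
    rw [mul_one] at h1
    have h2 := hup.shift (q * q - q)
    have h3 : q * q - q + q = q * q := Nat.sub_add_cancel (Nat.le_mul_self q)
    rw [h3] at h2
    refine ⟨_, ?_, (h2.sub h1).congr fun τ _ => by rw [hpt_none]⟩
    have : q * q - q ≠ 0 := by have := hq.one_lt; have : q < q * q := by nlinarith
                               omega
    simp [PowerSeries.constantCoeff_expand, hJ1, this]
  have hsome : ∀ b : Fin q, ∃ P : PowerSeries Zb, P.constantCoeff = 1 ∧
      ExpP q q P (fun τ => jpStar p τ - jpStar p (hpt q (some b) τ)) := fun b => by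
    have h1 := (hJ.frac hq0 b).shift (q - 1)
    rw [Nat.sub_add_cancel hq.one_le] at h1
    refine ⟨_, ?_, (hup.sub h1).congr fun τ _ => by rw [hpt_some]⟩
    have : q - 1 ≠ 0 := by have := hq.one_lt; omega
    simp [PowerSeries.constantCoeff_expand, hJ1, this]
  obtain ⟨P0, hP0, h0⟩ := hnone
  choose P1 hP1 h1 using hsome
  have h2 := h0.mul (ExpP.prod Finset.univ fun b _ => h1 b)
  have h3 : q * q + ∑ _b : Fin q, q = q * (2 * q) := by simp; ring
  rw [h3] at h2
  have h4 : ExpP q (q * (2 * q)) (P0 * ∏ b, P1 b) G := h2.congr fun τ _ => by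
    simp only [G, Fintype.prod_option]
  obtain ⟨P', hP', h5⟩ := h4.descend_mul hq0 fun τ hτ => by simpa using hG.add_int hτ 1
  obtain ⟨R, hR1, hR2, hR3⟩ := hG.exists_polynomial hp h5
  rw [hP', map_mul, map_prod, hP0] at hR2
  simp only [hP1, Finset.prod_const_one, mul_one] at hR2
  apply isIntegral_trans_Zb
  refine ⟨-R, Polynomial.monic_of_natDegree_le_of_coeff_eq_one (2 * q) (by simpa using hR1)
    (by simp [hR2]), ?_⟩
  have := hR3 α hα
  rw [hG0, Polynomial.aeval_def] at this
  rw [Polynomial.eval₂_neg, ← this, neg_zero]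

end

/-! ### The Kronecker congruence -/

theorem exists_expand_sub_pow {q : ℕ} (hq : q.Prime) (J : PowerSeries ℤ) :
    ∃ V : PowerSeries ℤ, J.expand q hq.ne_zero - J ^ q = PowerSeries.C (q : ℤ) * V := by
  have : Fact q.Prime := ⟨hq⟩
  have h : (J.expand q hq.ne_zero - J ^ q).map (Int.castRingHom (ZMod q)) = 0 := by
    rw [map_sub, map_pow, PowerSeries.map_expand, sub_eq_zero]
    have := MvPowerSeries.map_frobenius_expand (R := ZMod q) (p := q) hq.ne_zero
      (f := J.map (Int.castRingHom (ZMod q)))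
    rw [ZMod.frobenius_zmod, MvPowerSeries.map_id] at this
    exact this
  have h1 : ∀ n, (q : ℤ) ∣ (J.expand q hq.ne_zero - J ^ q).coeff n := fun n => by
    have := congrArg (PowerSeries.coeff n) h
    rw [PowerSeries.coeff_map] at this
    exact (ZMod.intCast_zmod_eq_zero_iff_dvd _ _).1 (by simpa using this)
  choose v hv using h1
  exact ⟨PowerSeries.mk v, by ext n; rw [hv, PowerSeries.coeff_C_mul, PowerSeries.coeff_mk]⟩

theorem ExpP.div_const {m N : ℕ} {q : ℕ} (hq : q ≠ 0) {V : PowerSeries ℤ} {g : ℂ → ℂ}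
    (h : ExpP m N (PowerSeries.C (q : ℤ) * V) g) : ExpP m N V (fun τ => g τ / q) := by
  have hq' : (q : ℂ) ≠ 0 := by exact_mod_cast hq
  obtain ⟨u, hu, h⟩ := h
  refine ⟨fun y => u y / q, fun y hy => ?_, fun τ hτ => ?_⟩
  · refine ((hu y hy).div_const (q : ℂ)).congr_fun' fun n => ?_
    rw [PowerSeries.coeff_C_mul, map_mul, map_natCast]
    field_simp
  · have := h τ hτ
    simp only [← this]
    ring

theorem ExpP.of_X_pow_mul {A : Type*} [CommRing A] [Algebra A ℂ] {m N : ℕ} {P : PowerSeries A}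
    {g : ℂ → ℂ} (hm : m ≠ 0) (h : ExpP m N (PowerSeries.X ^ N * P) g) : ExpP m 0 P g := by
  induction N with
  | zero => simpa using h
  | succ N ih =>
    rw [pow_succ', mul_assoc] at h
    exact ih (h.of_X_mul hm)

theorem hph_ne_zero {p q : ℕ} (hp : 0 < p) (hq : 0 < q) (i : Option (Fin q)) {τ : ℂ}
    (hτ : 0 < τ.im) : hph p q i τ ≠ 0 := by
  have h1 := dd_ne_zero hp hτ
  have h2 := dd_ne_zero hp (hpt_im_pos hq i hτ)
  have h3 : (q : ℂ) ≠ 0 := by exact_mod_cast hq.ne'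
  rcases i with _ | b
  · rw [hpt_none] at h2
    rw [hph_none]
    exact div_ne_zero (mul_ne_zero (pow_ne_zero _ h3) h2) h1
  · rw [hpt_some] at h2
    rw [hph_some p hq]
    exact div_ne_zero h2 h1

theorem inv_hph_none {p q : ℕ} (τ : ℂ) :
    (hph p q none τ)⁻¹ = (q ^ 24 : ℂ)⁻¹ * (dd p τ * (dd p (q * τ))⁻¹) := by
  rw [hph_none]
  by_cases h : dd p τ = 0
  · simp [h]
  by_cases h' : dd p (q * τ) = 0
  · simp [h']
  by_cases h'' : (q : ℂ) = 0
  · simp [h'']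
  field_simp

theorem ExpP.mul_cancel {A : Type*} [CommRing A] [Algebra A ℂ] {m M N K : ℕ}
    {P P' P'' : PowerSeries A} {g g' g'' : ℂ → ℂ} (hm : m ≠ 0)
    (h : ExpP m 0 (PowerSeries.X ^ M * P) g) (h' : ExpP m N P' g') (h'' : ExpP m K P'' g'')
    (hM : N + K = M) :
    ExpP m 0 (P * (P' * P'')) (fun τ => g τ * (g' τ * g'' τ)) := by
  have h1 := h.mul (h'.mul h'')
  rw [hM, zero_add, mul_assoc] at h1
  exact h1.of_X_pow_mul hm

theorem constantCoeff_toZb {P : PowerSeries ℤ} (h : P.constantCoeff = 1) :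
    (P.map (algebraMap ℤ Zb)).constantCoeff = 1 := by
  rw [← PowerSeries.coeff_zero_eq_constantCoeff_apply, PowerSeries.coeff_map,
    PowerSeries.coeff_zero_eq_constantCoeff_apply, h, map_one]

theorem ExpP.up_X_pow {q M : ℕ} (hq : q ≠ 0) {A : Type*} [CommRing A] [Algebra A ℂ]
    {P : PowerSeries A} {g : ℂ → ℂ} (h : ExpP 1 0 (PowerSeries.X ^ M * P) g) (k : ℕ) :
    ExpP q 0 (PowerSeries.X ^ (q * M * k) * P.expand q hq ^ k) (fun τ => g τ ^ k) := by
  have h1 := (h.up hq).pow k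
  rw [map_mul, map_pow, PowerSeries.expand_X, mul_pow, ← pow_mul, ← pow_mul] at h1
  simpa [mul_assoc] using h1

theorem zt_prod {q N : ℕ} (hq : q ≠ 0) (hq2 : Odd q) :
    ∏ b : Fin q, zt q ^ ((q - 1) * (b * N)) = 1 := by
  rw [Finset.prod_pow_eq_pow_sum]
  have h1 : ∑ b : Fin q, (q - 1) * ((b : ℕ) * N) = q * ((q - 1) * ((q - 1) / 2 * N)) := by
    rw [← Finset.mul_sum, ← Finset.sum_mul, Fin.sum_univ_eq_sum_range (fun i => i) q,
      Finset.sum_range_id]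
    obtain ⟨k, rfl⟩ := hq2
    simp only [Nat.add_sub_cancel, Nat.mul_div_cancel_left k two_pos]
    rw [show (2 * k + 1) * (2 * k) = 2 * ((2 * k + 1) * k) by ring,
      Nat.mul_div_cancel_left _ two_pos]
    ring
  rw [h1, pow_mul, zt_pow hq, one_pow]

/-- The expansion of the inverse of the product of all multipliers. -/
theorem exists_expP_prod {p q : ℕ} (hp : 0 < p) (hq : q ≠ 0) (hq2 : Odd q) :
    ∃ V : PowerSeries Zb, V.constantCoeff = 1 ∧ ExpP q 0 V (fun τ => dd p τ ^ (q + 1) *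
      ((dd p (q * τ))⁻¹ * ∏ b : Fin q, (dd p ((τ + (b : ℕ)) / q))⁻¹)) := by
  obtain ⟨P, P', hP, hP', h, h'⟩ := exists_expP_dd hp
  have k0 := constantCoeff_toZb hP
  have k0' := constantCoeff_toZb hP'
  replace h := h.toZb
  replace h' := h'.toZb
  rw [map_mul, map_pow, PowerSeries.map_X] at h
  generalize P.map (algebraMap ℤ Zb) = P at h k0
  generalize P'.map (algebraMap ℤ Zb) = P' at h' k0'
  have h1 := h.up_X_pow hq (q + 1)
  have h2 := (h'.comp_mul hq).up hq
  have h3 := ExpP.prod Finset.univ fun (b : Fin q) _ => h'.frac hq b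
  refine ⟨_, ?_, ExpP.mul_cancel hq h1 h2 h3 ?_⟩
  · simp only [map_mul, map_pow, map_prod, PowerSeries.constantCoeff_expand, k0, k0', one_pow,
      one_mul, PowerSeries.constantCoeff_C]
    rw [Finset.prod_mul_distrib, zt_prod hq hq2, one_mul]
    refine Finset.prod_eq_one fun b _ => ?_
    rw [← PowerSeries.coeff_zero_eq_constantCoeff_apply, PowerSeries.coeff_rescale,
      PowerSeries.coeff_zero_eq_constantCoeff_apply, k0', pow_zero, one_mul]
  · simp
    ring

theorem ES.congr {m : ℕ} {g g' : ℂ → ℂ} (h : g ∈ ES m) (hd : ∀ τ : ℂ, 0 < τ.im →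
    DifferentiableAt ℂ g' τ) (hg : ∀ τ : ℂ, 0 < τ.im → g' τ = g τ) : g' ∈ ES m := by
  obtain ⟨⟨N, P, h⟩, -⟩ := h
  exact ⟨⟨N, P, h.congr hg⟩, hd⟩

section

variable {p q : ℕ} (hp : Good p) (hq : q.Prime) (hq2 : q ≠ 2) (hpq : p.Coprime q)
include hp hq hpq

theorem invF_prod_hph : InvF p (fun τ => ∏ i, (hph p q i τ)⁻¹) where
  diff τ hτ := DifferentiableAt.fun_finsetProd fun i _ =>
    ((ES.hph hp.pos hq.pos i).2 τ hτ).inv (hph_ne_zero hp.pos hq.pos i hτ)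
  inv a b c d hdet τ hτ := by
    obtain ⟨σ, hσ⟩ := hecke_mob hp hq hpq hdet
    exact (Finset.prod_congr rfl fun i _ => by rw [(hσ i τ hτ).2]).trans
      (Equiv.prod_comp σ fun i => (hph p q i τ)⁻¹)
  W τ hτ := by
    obtain ⟨σ, hσ⟩ := hecke_W hp hq hpq
    exact (Finset.prod_congr rfl fun i _ => by rw [(hσ i τ hτ).2]).trans
      (Equiv.prod_comp σ fun i => (hph p q i τ)⁻¹)

include hq2 in
/-- The product of the multipliers. -/
theorem prod_hph {τ : ℂ} (hτ : 0 < τ.im) :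
    ∏ b : Fin q, hph p q (some b) τ = dd p τ / dd p (q * τ) := by
  have hq0 := hq.ne_zero
  have hqc : (q : ℂ) ≠ 0 := by exact_mod_cast hq0
  obtain ⟨V, hV, h⟩ := exists_expP_prod hp.pos hq0 (hq.odd_of_ne_two hq2)
  have e : ∀ τ : ℂ, 0 < τ.im → q ^ 24 * ∏ i, (hph p q i τ)⁻¹ = dd p τ ^ (q + 1) *
      ((dd p (q * τ))⁻¹ * ∏ b : Fin q, (dd p ((τ + (b : ℕ)) / q))⁻¹) := fun τ hτ => by
    rw [Fintype.prod_option, inv_hph_none]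
    have : ∀ b : Fin q, (hph p q (some b) τ)⁻¹ = dd p τ * (dd p ((τ + (b : ℕ)) / q))⁻¹ :=
      fun b => by rw [hph_some p hq.pos, inv_div, div_eq_mul_inv]
    rw [Finset.prod_congr rfl fun b _ => this b, Finset.prod_mul_distrib, Finset.prod_const,
      Finset.card_univ, Fintype.card_fin]
    have h24 : (q : ℂ) ^ 24 * (q ^ 24 : ℂ)⁻¹ = 1 := mul_inv_cancel₀ (pow_ne_zero _ hqc)
    linear_combination (dd p τ ^ (q + 1) *
      ((dd p (q * τ))⁻¹ * ∏ b : Fin q, (dd p ((τ + (b : ℕ)) / q))⁻¹)) * h24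
  have h1 : q ^ 24 * ∏ i, (hph p q i τ)⁻¹ = 1 := by
    have := ((InvF.const p (q ^ 24 : ℂ)).mul (invF_prod_hph hp hq hpq)).eq_constantCoeff
      hp.prime hq0 (h.congr e) hτ
    rwa [hV, map_one] at this
  rw [Fintype.prod_option, inv_hph_none, Finset.prod_inv_distrib] at h1
  have d1 := dd_ne_zero hp.pos hτ
  have d2 := dd_ne_zero hp.pos (im_natCast_mul_pos hq.pos hτ)
  have d3 : ∏ b : Fin q, hph p q (some b) τ ≠ 0 :=
    Finset.prod_ne_zero_iff.2 fun b _ => hph_ne_zero hp.pos hq.pos _ hτ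
  generalize ∏ b : Fin q, hph p q (some b) τ = W at *
  field_simp at h1
  rw [eq_div_iff d2, mul_comm, h1]

omit hpq in
theorem eS_frobenius_div : (fun τ => (jpStar p (q * τ) - jpStar p τ ^ q) / q) ∈ ES 1 := by
  obtain ⟨P, -, h⟩ := exists_expP_jpStar hp
  obtain ⟨V, hV⟩ := exists_expand_sub_pow hq P
  have h1 := (h.comp_mul hq.ne_zero).sub (h.pow q)
  rw [hV] at h1
  refine ⟨⟨_, _, (h1.div_const hq.ne_zero).toZb⟩, fun τ hτ => ?_⟩
  have d1 : DifferentiableAt ℂ (fun τ : ℂ => jpStar p (q * τ)) τ :=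
    (differentiableAt_jpStar hp (im_natCast_mul_pos hq.pos hτ)).fun_comp' _ (by fun_prop)
  exact (d1.sub ((differentiableAt_jpStar hp hτ).pow q)).div_const _

theorem invF_frobenius_sum : InvF p (fun τ => q ^ 23 * ∑ i : Option (Fin q),
    (jpStar p (hpt q i τ) - jpStar p τ ^ q) * (hph p q i τ)⁻¹) where
  diff τ hτ := (differentiableAt_const _).mul (DifferentiableAt.fun_sum fun i _ =>
    (((ES.comp_hpt hq.ne_zero (ES.jpStar hp) i).2 τ hτ).sub
      ((differentiableAt_jpStar hp hτ).pow q)).mul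
    (((ES.hph hp.pos hq.pos i).2 τ hτ).inv (hph_ne_zero hp.pos hq.pos i hτ)))
  inv a b c d hdet τ hτ := by
    obtain ⟨σ, hσ⟩ := hecke_mob hp hq hpq hdet
    exact congrArg _ ((Finset.sum_congr rfl fun i _ => by
      rw [(hσ i τ hτ).1, (hσ i τ hτ).2, jpStar_mob hp hdet hτ]).trans
      (Equiv.sum_comp σ fun i => (jpStar p (hpt q i τ) - jpStar p τ ^ q) * (hph p q i τ)⁻¹))
  W τ hτ := by
    obtain ⟨σ, hσ⟩ := hecke_W hp hq hpq
    exact congrArg _ ((Finset.sum_congr rfl fun i _ => by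
      rw [(hσ i τ hτ).1, (hσ i τ hτ).2, jpStar_W hp hτ]).trans
      (Equiv.sum_comp σ fun i => (jpStar p (hpt q i τ) - jpStar p τ ^ q) * (hph p q i τ)⁻¹))

theorem eS_frobenius_sum : (fun τ => q ^ 23 * ∑ i : Option (Fin q),
    (jpStar p (hpt q i τ) - jpStar p τ ^ q) * (hph p q i τ)⁻¹) ∈ ES q := by
  have hq0 := hq.ne_zero
  have hqc : (q : ℂ) ≠ 0 := by exact_mod_cast hq0
  have hF := ES.up hq0 (ES.dd hp.pos)
  have h1 := mul_mem (ES.up hq0 (eS_frobenius_div hp hq))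
    (mul_mem hF (ES.comp_hpt hq0 (ES.dd_inv hp.pos) none))
  have h2 := mul_mem (natCast_mem (ES q) (q ^ 23)) (sum_mem (t := Finset.univ)
    fun (b : Fin q) _ => mul_mem (sub_mem (ES.comp_hpt hq0 (ES.jpStar hp) (some b))
      (pow_mem (ES.up hq0 (ES.jpStar hp)) q))
      (mul_mem hF (ES.comp_hpt hq0 (ES.dd_inv hp.pos) (some b))))
  refine ES.congr (add_mem h1 h2) (invF_frobenius_sum hp hq hpq).diff fun τ hτ => ?_
  have h3 : ∀ b : Fin q, (hph p q (some b) τ)⁻¹ =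
      dd p τ * (dd p (hpt q (some b) τ))⁻¹ :=
    fun b => by rw [hph_some p hq.pos, inv_div, div_eq_mul_inv, hpt_some]
  rw [Fintype.sum_option, inv_hph_none]
  simp only [Pi.add_apply, Pi.mul_apply, Finset.sum_apply, Pi.sub_apply, Pi.pow_apply,
    Pi.natCast_apply, h3, hpt_none]
  push_cast
  field_simp

include hq2 in
/-- The Kronecker congruence `f(qα) ≡ f(α)^q` at a prime where the multiplier is a unit. -/
theorem hecke_frobenius {α : ℂ} (hα : 0 < α.im) (h : IsIntegral ℤ (jpStar p α))
    {I : Ideal Zb} [hI : I.IsPrime] (hqI : (q : Zb) ∈ I) {A F F' : Zb}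
    (hA : (A : ℂ) = dd p α / dd p (q * α)) (hAI : A ∉ I) (hF : (F : ℂ) = jpStar p α)
    (hF' : (F' : ℂ) = jpStar p (q * α)) : F' - F ^ q ∈ I := by
  classical
  have hqc : (q : ℂ) ≠ 0 := by exact_mod_cast hq.ne_zero
  have hw := (invF_frobenius_sum hp hq hpq).isIntegral hp hq.ne_zero
    (eS_frobenius_sum hp hq hpq) hα h
  have hne : ∀ i, hph p q i α ≠ 0 := fun i => hph_ne_zero hp.pos hq.pos i hα
  let w : Zb := ⟨_, hw⟩
  let f : Option (Fin q) → Zb := fun i => ⟨_, isIntegral_jpStar_hpt hp hq hpq hα h i⟩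
  let φ : Option (Fin q) → Zb := fun i => ⟨_, isIntegral_hph hp hq hpq hα h i⟩
  have hprod := prod_hph hp hq hq2 hpq hα
  have hnone : hph p q none α * (A : ℂ) = q ^ 24 := by
    rw [hA, hph_none]
    have d1 := dd_ne_zero hp.pos hα
    have d2 := dd_ne_zero hp.pos (im_natCast_mul_pos hq.pos hα)
    field_simp
  have hφ : φ none ∈ I := by
    have h1 : φ none * A = (q : Zb) ^ 24 := Subtype.ext (by simpa [φ] using hnone)
    have h2 : φ none * A ∈ I := by
      rw [h1]
      exact I.pow_mem_of_mem hqI 24 (by norm_num)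
    exact (hI.mem_or_mem h2).resolve_right hAI
  have key : (F' - F ^ q) * A = q * w - ∑ b : Fin q, (f (some b) - F ^ q) *
      (φ none * ∏ b' ∈ Finset.univ.erase b, φ (some b')) := by
    apply Subtype.ext
    have h1 : ∀ b : Fin q, hph p q none α * ∏ b' ∈ Finset.univ.erase b, hph p q (some b') α =
        q ^ 24 * (hph p q (some b) α)⁻¹ := fun b => by
      have h2 := Finset.mul_prod_erase Finset.univ (fun b => hph p q (some b) α)
        (Finset.mem_univ b)
      rw [hprod, ← hA] at h2
      rw [← hnone, ← h2]
      field_simp [hne (some b)]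
    have h3 : (w : ℂ) = q ^ 23 * ∑ i : Option (Fin q),
      (jpStar p (hpt q i α) - jpStar p α ^ q) * (hph p q i α)⁻¹ := rfl
    have h4 : (A : ℂ) = q ^ 24 * (hph p q none α)⁻¹ := by
      rw [← hnone]
      field_simp [hne none]
    push_cast
    simp only [f, φ, h1, h3, hF, hF', Fintype.sum_option, hpt_none, h4, Finset.mul_sum, mul_add]
    have h5 : ∀ b : Fin q, (jpStar p (hpt q (some b) α) - jpStar p α ^ q) *
        (q ^ 24 * (hph p q (some b) α)⁻¹) = q * (q ^ 23 *
        ((jpStar p (hpt q (some b) α) - jpStar p α ^ q) * (hph p q (some b) α)⁻¹)) :=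
      fun b => by ring
    rw [Finset.sum_congr rfl fun b _ => h5 b]
    ring
  have : (F' - F ^ q) * A ∈ I := by
    rw [key]
    exact I.sub_mem (I.mul_mem_right _ hqI) (I.sum_mem fun b _ =>
      I.mul_mem_left _ (I.mul_mem_right _ hφ))
  exact (hI.mem_or_mem this).resolve_right hAI

end

/-! ### Binary quadratic forms -/

/-- Substitution of the matrix `(x, y; z, w)` in a form. -/
def BQF.subst (Q : BQF) (x y z w : ℤ) : BQF :=
  ⟨Q.a * x ^ 2 + Q.b * x * z + Q.c * z ^ 2, 2 * Q.a * x * y + Q.b * (x * w + y * z) + 2 * Q.c * z * w,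
    Q.a * y ^ 2 + Q.b * y * w + Q.c * w ^ 2⟩

theorem BQF.ext' {Q Q' : BQF} (ha : Q.a = Q'.a) (hb : Q.b = Q'.b) (hc : Q.c = Q'.c) : Q = Q' := by
  cases Q; cases Q'; simp_all

theorem BQF.subst_subst (Q : BQF) (x y z w x' y' z' w' : ℤ) :
    (Q.subst x y z w).subst x' y' z' w' =
      Q.subst (x * x' + y * z') (x * y' + y * w') (z * x' + w * z') (z * y' + w * w') := by
  apply BQF.ext' <;> simp only [BQF.subst] <;> ring

theorem BQF.subst_one (Q : BQF) : Q.subst 1 0 0 1 = Q := by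
  apply BQF.ext' <;> simp [BQF.subst]

theorem BQF.disc_subst (Q : BQF) (x y z w : ℤ) :
    (Q.subst x y z w).disc = (x * w - y * z) ^ 2 * Q.disc := by
  simp only [BQF.subst, BQF.disc]; ring

theorem BQF.equiv_iff {p : ℕ} {Q Q' : BQF} : BQF.equiv (CongruenceSubgroup.Gamma0 p) Q Q' ↔
    ∃ x y z w : ℤ, x * w - y * (p * z) = 1 ∧ Q.subst x y (p * z) w = Q' := by
  constructor
  · rintro ⟨g, hg, rfl⟩
    rw [CongruenceSubgroup.Gamma0_mem, ZMod.intCast_zmod_eq_zero_iff_dvd] at hg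
    obtain ⟨z, hz⟩ := hg
    refine ⟨g.1 0 0, g.1 0 1, z, g.1 1 1, ?_, ?_⟩
    · have := g.det_coe
      rw [Matrix.det_fin_two] at this
      simpa only [hz] using this
    · rw [← hz]
      rfl
  · rintro ⟨x, y, z, w, hdet, rfl⟩
    refine ⟨⟨!![x, y; p * z, w], by rw [Matrix.det_fin_two_of]; exact hdet⟩, ?_, ?_⟩
    · refine CongruenceSubgroup.Gamma0_mem.2 ((ZMod.intCast_zmod_eq_zero_iff_dvd _ _).2 ?_)
      exact Dvd.intro z rfl
    · rfl

/-- `Γ₀(p)`-equivalence of forms. -/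
def BQF.Eqv (p : ℕ) (Q Q' : BQF) : Prop :=
  ∃ x y z w : ℤ, x * w - y * (p * z) = 1 ∧ Q.subst x y (p * z) w = Q'

theorem BQF.Eqv.refl (p : ℕ) (Q : BQF) : BQF.Eqv p Q Q :=
  ⟨1, 0, 0, 1, by ring, by simpa using Q.subst_one⟩

theorem BQF.Eqv.symm {p : ℕ} {Q Q' : BQF} (h : BQF.Eqv p Q Q') : BQF.Eqv p Q' Q := by
  obtain ⟨x, y, z, w, hdet, rfl⟩ := h
  refine ⟨w, -y, -z, x, by linear_combination hdet, ?_⟩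
  rw [BQF.subst_subst]
  convert Q.subst_one using 1
  congr 1
  · linear_combination hdet
  · ring
  · ring
  · linear_combination hdet

theorem BQF.Eqv.trans {p : ℕ} {Q Q' Q'' : BQF} (h : BQF.Eqv p Q Q') (h' : BQF.Eqv p Q' Q'') :
    BQF.Eqv p Q Q'' := by
  obtain ⟨x, y, z, w, hdet, rfl⟩ := h
  obtain ⟨x', y', z', w', hdet', rfl⟩ := h'
  refine ⟨x * x' + y * (p * z'), x * y' + y * w', z * x' + w * z', p * z * y' + w * w', ?_, ?_⟩
  · linear_combination (x' * w' - y' * (p * z')) * hdet + hdet'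
  · rw [BQF.subst_subst]
    congr 1
    ring

theorem BQF.IsPosDef.c_pos {Q : BQF} (h : Q.IsPosDef) : 0 < Q.c := by
  obtain ⟨ha, hd⟩ := h
  unfold BQF.disc at hd
  by_contra hc
  nlinarith [mul_nonneg ha.le (not_lt.1 hc |> neg_nonneg.2), sq_nonneg Q.b]

theorem BQF.four_mul (Q : BQF) (x y : ℤ) :
    4 * Q.a * (Q.a * x ^ 2 + Q.b * x * y + Q.c * y ^ 2) =
      (2 * Q.a * x + Q.b * y) ^ 2 - Q.disc * y ^ 2 := by
  unfold BQF.disc; ring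

theorem BQF.IsPosDef.eval_pos {Q : BQF} (h : Q.IsPosDef) {x y : ℤ} (hxy : x ≠ 0 ∨ y ≠ 0) :
    0 < Q.a * x ^ 2 + Q.b * x * y + Q.c * y ^ 2 := by
  obtain ⟨ha, hd⟩ := h
  have h1 := Q.four_mul x y
  have h2 : 0 < (2 * Q.a * x + Q.b * y) ^ 2 - Q.disc * y ^ 2 := by
    rcases eq_or_ne y 0 with rfl | hy
    · have hx : x ≠ 0 := by simpa using hxy
      have := sq_pos_of_ne_zero (mul_ne_zero (mul_ne_zero two_ne_zero ha.ne') hx)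
      simpa using this
    · have := sq_pos_of_ne_zero hy
      nlinarith [sq_nonneg (2 * Q.a * x + Q.b * y)]
  rw [← h1] at h2
  exact pos_of_mul_pos_right h2 (by linarith)

theorem BQF.IsPosDef.subst {Q : BQF} (h : Q.IsPosDef) {x y z w : ℤ} (hdet : x * w - y * z = 1) :
    (Q.subst x y z w).IsPosDef := by
  refine ⟨h.eval_pos ?_, ?_⟩
  · by_contra! h0
    simp [h0.1, h0.2] at hdet
  · rw [BQF.disc_subst, hdet]
    simpa using h.2

theorem BQF.root_re_im {Q : BQF} :
    Q.root = ((-Q.b / (2 * Q.a) : ℝ) : ℂ) + ((Real.sqrt (-(Q.disc : ℝ)) / (2 * Q.a) : ℝ) : ℂ) * I := by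
  unfold BQF.root
  push_cast
  ring

theorem BQF.IsPosDef.root_im_pos {Q : BQF} (h : Q.IsPosDef) : 0 < Q.root.im := by
  rw [BQF.root_re_im]
  have h1 : (0 : ℝ) < Q.a := by exact_mod_cast h.1
  have h2 : (0 : ℝ) < -(Q.disc : ℝ) := by
    have : ((Q.disc : ℤ) : ℝ) < 0 := by exact_mod_cast h.2
    linarith
  have := div_pos (Real.sqrt_pos.2 h2) (by linarith : (0 : ℝ) < 2 * Q.a)
  simpa only [add_im, ofReal_im, zero_add, im_ofReal_mul, I_im, mul_one] using this

/-- The square root of a negative discriminant in the upper half plane. -/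
noncomputable def sqD (Δ : ℤ) : ℂ := I * Real.sqrt (-(Δ : ℝ))

theorem sqD_sq {Δ : ℤ} (h : Δ < 0) : sqD Δ ^ 2 = Δ := by
  have h2 : (0 : ℝ) ≤ -(Δ : ℝ) := by
    have : ((Δ : ℤ) : ℝ) < 0 := by exact_mod_cast h
    linarith
  unfold sqD
  rw [mul_pow, I_sq, ← ofReal_pow, Real.sq_sqrt h2]
  simp

theorem BQF.IsPosDef.two_mul_root {Q : BQF} (h : Q.IsPosDef) :
    2 * Q.a * Q.root + Q.b = sqD Q.disc := by
  have h1 : (Q.a : ℂ) ≠ 0 := by exact_mod_cast h.1.ne'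
  unfold BQF.root sqD
  field_simp
  ring

theorem BQF.IsPosDef.root_eq {Q : BQF} (h : Q.IsPosDef) :
    Q.a * Q.root ^ 2 + Q.b * Q.root + Q.c = 0 := by
  have h1 : (Q.a : ℂ) ≠ 0 := by exact_mod_cast h.1.ne'
  have h2 := h.two_mul_root
  have h3 := sqD_sq h.2
  have h4 : (Q.disc : ℂ) = Q.b ^ 2 - 4 * Q.a * Q.c := by simp [BQF.disc]
  rw [← h2, h4] at h3
  apply mul_left_cancel₀ (mul_ne_zero (by norm_num : (4 : ℂ) ≠ 0) h1)
  linear_combination h3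

theorem BQF.IsPosDef.eq_root {Q : BQF} (h : Q.IsPosDef) {z : ℂ} (hz : 0 < z.im)
    (h0 : Q.a * z ^ 2 + Q.b * z + Q.c = 0) : z = Q.root := by
  have h1 := h.root_eq
  have ha : (Q.a : ℂ) ≠ 0 := by exact_mod_cast h.1.ne'
  have h2 : (z - Q.root) * (Q.a * (z + Q.root) + Q.b) = 0 := by linear_combination h0 - h1
  rcases mul_eq_zero.1 h2 with h3 | h3
  · exact sub_eq_zero.1 h3
  · exfalso
    have h4 := congrArg Complex.im h3
    have h5 : (0 : ℝ) < Q.a := by exact_mod_cast h.1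
    have h6 := h.root_im_pos
    have h7 := mul_pos h5 (add_pos hz h6)
    simp [h.1.ne'] at h4
    linarith

theorem BQF.IsPosDef.mob_root {Q : BQF} (h : Q.IsPosDef) {x y z w : ℤ}
    (hdet : x * w - y * z = 1) : mob x y z w (Q.subst x y z w).root = Q.root := by
  have h' := h.subst hdet
  have him := h'.root_im_pos
  have hden := den_ne_zero (c := z) (d := w) him (ne_zero_or_of_det (a := x) (b := y) (by omega))
  refine h.eq_root (mob_im_pos him (by omega)) ?_
  have h1 := h'.root_eq
  unfold mob
  generalize (Q.subst x y z w).root = r at *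
  simp only [BQF.subst] at h1
  push_cast at h1
  obtain ⟨W, hW⟩ : ∃ W, W = z * r + (w : ℂ) := ⟨_, rfl⟩
  rw [← hW] at hden ⊢
  field_simp
  rw [hW]
  linear_combination h1

/-! ### The action of a split prime on classes of forms -/

theorem BQF.memN.posDef {N β : ℤ} {p : ℕ} {Q : BQF} (h : Q.memN N p β) : Q.IsPosDef := h.1.1

theorem BQF.memN.disc {N β : ℤ} {p : ℕ} {Q : BQF} (h : Q.memN N p β) : Q.disc = -N := h.1.2

theorem BQF.memN.of_eqv {N β : ℤ} {p : ℕ} {Q Q' : BQF} (h : Q.memN N p β) (h' : BQF.Eqv p Q Q') :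
    Q'.memN N p β := by
  obtain ⟨x, y, z, w, hdet, rfl⟩ := h'
  obtain ⟨⟨hpos, hdisc⟩, ⟨a, ha⟩, hb⟩ := h
  refine ⟨⟨hpos.subst hdet, by rw [BQF.disc_subst, hdet, hdisc]; ring⟩, ?_, ?_⟩
  · simp only [BQF.subst, ha]
    exact ⟨a * x ^ 2 + Q.b * x * z + Q.c * p * z ^ 2, by ring⟩
  · refine Int.ModEq.trans ?_ hb
    rw [Int.modEq_iff_dvd]
    simp only [BQF.subst, ha]
    exact ⟨-(a * x * y + Q.b * y * z + Q.c * z * w), by linear_combination (-Q.b) * hdet⟩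

theorem BQF.Eqv.jpStar_root {p : ℕ} (hp : Good p) {Q Q' : BQF} (hQ : Q.IsPosDef)
    (h : BQF.Eqv p Q Q') : jpStar p Q'.root = jpStar p Q.root := by
  obtain ⟨x, y, z, w, hdet, rfl⟩ := h
  rw [← hQ.mob_root hdet, jpStar_mob hp hdet (hQ.subst hdet).root_im_pos]

/-- The form `[aq, b, c/q]`. -/
def BQF.shift (Q : BQF) (q : ℤ) : BQF := ⟨Q.a * q, Q.b, Q.c / q⟩

theorem BQF.disc_shift {Q : BQF} {q : ℤ} (h : q ∣ Q.c) : (Q.shift q).disc = Q.disc := by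
  simp only [BQF.shift, BQF.disc]
  linear_combination (-4 * Q.a) * Int.mul_ediv_cancel' h

theorem BQF.memN.shift {N β : ℤ} {p : ℕ} {Q : BQF} (h : Q.memN N p β) {q : ℤ} (hq : 0 < q)
    (hc : q ∣ Q.c) : (Q.shift q).memN N p β := by
  refine ⟨⟨⟨mul_pos h.1.1.1 hq, ?_⟩, ?_⟩, h.2.1.mul_right q, h.2.2⟩
  · rw [BQF.disc_shift hc]; exact h.1.1.2
  · rw [BQF.disc_shift hc]; exact h.1.2

theorem BQF.root_shift {Q : BQF} {q : ℤ} (h : q ∣ Q.c) : (Q.shift q).root = Q.root / q := by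
  unfold BQF.root
  rw [BQF.disc_shift h, div_div]
  congr 1
  simp only [BQF.shift]
  push_cast
  ring

theorem not_dvd_b_of_disc {Q : BQF} {q : ℤ} (hc : q ∣ Q.c) (hΔ : ¬ q ∣ Q.disc) : ¬ q ∣ Q.b :=
  fun h => hΔ (by
    unfold BQF.disc
    exact dvd_sub ((dvd_pow h two_ne_zero)) (hc.mul_left _))

section

variable {p : ℕ} {q : ℤ} (hq : Prime q) (hq2 : ¬ q ∣ 2) (hqp : ¬ q ∣ p)
  {Q Q' : BQF} (hΔ : ¬ q ∣ Q.disc) (ha : ¬ q ∣ Q.a)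
  (hc : q ∣ Q.c) (hc' : q ∣ Q'.c) (hb : q ∣ Q'.b - Q.b)

include hq hq2 ha hc hc' hb in
theorem BQF.Eqv.shift (h : BQF.Eqv p Q Q') : BQF.Eqv p (Q.shift q) (Q'.shift q) := by
  obtain ⟨x, y, z, w, hdet, rfl⟩ := h
  have hq0 := hq.ne_zero
  have hy : q ∣ y := by
    by_contra hy
    obtain ⟨c, hc⟩ := hc
    simp only [BQF.subst, hc] at hc' hb
    have h1 : q ∣ y * (Q.a * y + Q.b * w) := by
      refine (dvd_sub hc' (dvd_mul_right q (c * w ^ 2))).trans (dvd_of_eq ?_)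
      ring
    have h2 : q ∣ 2 * (y * (Q.a * x + Q.b * (p * z))) := by
      refine (dvd_sub hb (dvd_mul_right q (2 * c * (p * z) * w))).trans (dvd_of_eq ?_)
      linear_combination (Q.b) * hdet
    have h3 := (hq.dvd_or_dvd h1).resolve_left hy
    have h4 := (hq.dvd_or_dvd ((hq.dvd_or_dvd h2).resolve_left hq2)).resolve_left hy
    apply ha
    refine (dvd_sub (h4.mul_right w) (h3.mul_right (p * z))).trans (dvd_of_eq ?_)
    linear_combination Q.a * hdet
  obtain ⟨y, rfl⟩ := hy
  refine ⟨x, y, z * q, w, by linear_combination hdet, ?_⟩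
  have e1 := Int.mul_ediv_cancel' hc
  have e2 := Int.mul_ediv_cancel' hc'
  apply BQF.ext'
  · simp only [BQF.shift, BQF.subst]
    linear_combination (p * z) ^ 2 * q * e1
  · simp only [BQF.shift, BQF.subst]
    linear_combination (2 * (p * z) * w) * e1
  · apply mul_left_cancel₀ hq0
    simp only [BQF.shift, BQF.subst] at e2 ⊢
    rw [e2]
    linear_combination w ^ 2 * e1

include hq hq2 hqp hΔ hc hc' hb in
theorem BQF.Eqv.of_shift (h : BQF.Eqv p (Q.shift q) (Q'.shift q)) : BQF.Eqv p Q Q' := by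
  obtain ⟨x, y, z, w, hdet, h⟩ := h
  have hq0 := hq.ne_zero
  have hbq := not_dvd_b_of_disc hc hΔ
  have e1 := Int.mul_ediv_cancel' hc
  have e2 := Int.mul_ediv_cancel' hc'
  have ha' := congrArg BQF.a h
  have hb' := congrArg BQF.b h
  have hc'' := congrArg BQF.c h
  simp only [BQF.shift, BQF.subst] at ha' hb' hc''
  have hz : q ∣ p * z := by
    by_contra hz
    have h1 : q ∣ (p * z) * (Q.b * x + (Q.c / q) * (p * z)) :=
      ⟨Q'.a - Q.a * x ^ 2, by linear_combination ha'⟩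
    have h2 : q ∣ 2 * ((p * z) * (Q.b * y + (Q.c / q) * w)) := by
      refine (dvd_sub hb (dvd_mul_right q (2 * Q.a * x * y))).trans (dvd_of_eq ?_)
      linear_combination (-1 : ℤ) * hb' + (Q.b) * hdet
    have h3 := (hq.dvd_or_dvd h1).resolve_left hz
    have h4 := (hq.dvd_or_dvd ((hq.dvd_or_dvd h2).resolve_left hq2)).resolve_left hz
    apply hbq
    refine (dvd_sub (h3.mul_right w) (h4.mul_right (p * z))).trans (dvd_of_eq ?_)
    linear_combination Q.b * hdet
  obtain ⟨z, rfl⟩ := (hq.dvd_or_dvd hz).resolve_left hqp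
  refine ⟨x, y * q, z, w, by linear_combination hdet, ?_⟩
  apply BQF.ext'
  · apply mul_left_cancel₀ hq0
    simp only [BQF.subst]
    linear_combination ha' - (p * z) ^ 2 * q * e1
  · simp only [BQF.subst]
    linear_combination hb' - (2 * (p * z) * w) * e1
  · simp only [BQF.subst]
    linear_combination q * hc'' - w ^ 2 * e1 + e2

end

theorem exists_eqv_not_dvd {p : ℕ} {q : ℤ} (hq : Prime q) (hq2 : ¬ q ∣ 2) (hqp : ¬ q ∣ p)
    {Q : BQF} (hΔ : ¬ q ∣ Q.disc) : ∃ Q', BQF.Eqv p Q Q' ∧ ¬ q ∣ Q'.a := by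
  by_cases h0 : q ∣ Q.a
  · by_contra! h
    have h1 := h _ ⟨1, 0, 1, 1, by ring, rfl⟩
    have h2 := h _ ⟨1, 0, -1, 1, by ring, rfl⟩
    simp only [BQF.subst] at h1 h2
    have h3 : q ∣ 2 * (Q.b * p) := (dvd_sub h1 h2).trans (dvd_of_eq (by ring))
    have h4 := (hq.dvd_or_dvd ((hq.dvd_or_dvd h3).resolve_left hq2)).resolve_right hqp
    apply hΔ
    unfold BQF.disc
    exact dvd_sub (dvd_pow h4 two_ne_zero) ((h0.mul_left 4).mul_right _)
  · exact ⟨Q, .refl p Q, h0⟩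

/-- Each class contains a form with `a` prime to `q` and prescribed `b` modulo `qʰ`. -/
theorem exists_eqv_modEq {p : ℕ} {q : ℤ} (hq : Prime q) (hq2 : ¬ q ∣ 2) (hqp : ¬ q ∣ p)
    {Q : BQF} (hΔ : ¬ q ∣ Q.disc) (h : ℕ) {b₀ : ℤ} (hb₀ : q ^ h ∣ b₀ ^ 2 - Q.disc) :
    ∃ Q', BQF.Eqv p Q Q' ∧ ¬ q ∣ Q'.a ∧ q ^ h ∣ Q'.c ∧ q ^ h ∣ Q'.b - b₀ := by
  obtain ⟨Q₁, h1, ha⟩ := exists_eqv_not_dvd hq hq2 hqp hΔ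
  have hcop : IsCoprime (q ^ h) (2 * Q₁.a) :=
    IsCoprime.pow_left ((hq.coprime_iff_not_dvd).2 fun h => (hq.dvd_or_dvd h).elim hq2 ha)
  obtain ⟨r, s, hrs⟩ := hcop
  have hdisc : Q₁.disc = Q.disc := by
    obtain ⟨x, y, z, w, hdet, rfl⟩ := h1
    rw [BQF.disc_subst, hdet]
    ring
  let Q₂ := Q₁.subst 1 (s * (b₀ - Q₁.b)) (p * 0) 1
  have e : Q₁.Eqv p Q₂ := ⟨1, s * (b₀ - Q₁.b), 0, 1, by ring, rfl⟩
  have hb : q ^ h ∣ Q₂.b - b₀ := by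
    simp only [Q₂, BQF.subst]
    exact ⟨-r * (b₀ - Q₁.b), by linear_combination (b₀ - Q₁.b) * hrs⟩
  have ha2 : Q₂.a = Q₁.a := by simp [Q₂, BQF.subst]
  have hdisc2 : Q₂.disc = Q.disc := by
    rw [← hdisc]
    simp only [Q₂]
    rw [BQF.disc_subst]
    ring
  refine ⟨Q₂, h1.trans e, by rwa [ha2], ?_, hb⟩
  have h3 : q ^ h ∣ 4 * Q₂.a * Q₂.c := by
    have h4 : q ^ h ∣ Q₂.b ^ 2 - b₀ ^ 2 := hb.trans ⟨Q₂.b + b₀, by ring⟩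
    refine (dvd_add h4 hb₀).trans (dvd_of_eq ?_)
    rw [← hdisc2]
    unfold BQF.disc
    ring
  refine IsCoprime.dvd_of_dvd_mul_left (y := 4 * Q₂.a) ?_ h3
  refine IsCoprime.pow_left ((hq.coprime_iff_not_dvd).2 fun h => ?_)
  rw [show 4 * Q₂.a = 2 * (2 * Q₂.a) by ring, ha2] at h
  exact (hq.dvd_or_dvd h).elim hq2 fun h => (hq.dvd_or_dvd h).elim hq2 ha

/-- Forms of discriminant `Δ` are primitive. -/
def Prim (Δ : ℤ) : Prop := ∀ Q : BQF, Q.disc = Δ → ∀ g : ℤ, g ∣ Q.a → g ∣ Q.b → g ∣ Q.c → IsUnit g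

theorem Prim.exists_combination {Δ : ℤ} (h : Prim Δ) {Q : BQF} (hQ : Q.disc = Δ) :
    ∃ r s m : ℤ, Q.a * r + Q.b * s + Q.c * m = 1 := by
  have h1 := h Q hQ (gcd Q.a (gcd Q.b Q.c)) (gcd_dvd_left _ _)
    ((gcd_dvd_right _ _).trans (gcd_dvd_left _ _)) ((gcd_dvd_right _ _).trans (gcd_dvd_right _ _))
  obtain ⟨x, y, h2⟩ := exists_gcd_eq_mul_add_mul Q.a (gcd Q.b Q.c)
  obtain ⟨z, w, h3⟩ := exists_gcd_eq_mul_add_mul Q.b Q.c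
  obtain ⟨v, hv⟩ := h1.exists_right_inv
  rw [h2, h3] at hv
  exact ⟨x * v, y * z * v, y * w * v, by linear_combination hv⟩

/-- If `[A, B, Cq]` and `[Aq, B, C]` (`q` a prime power) are equivalent then `4q` is a norm. -/
theorem exists_norm_of_eqv {p : ℕ} {Δ : ℤ} (hprim : Prim Δ) {q : ℤ} (hq : Prime q)
    (hqΔ : ¬ q ∣ Δ) {h : ℕ} (hh : h ≠ 0) {A B C : ℤ} (hA : A ≠ 0)
    (hdisc : B ^ 2 - 4 * A * (C * q ^ h) = Δ)
    (he : BQF.Eqv p ⟨A, B, C * q ^ h⟩ ⟨A * q ^ h, B, C⟩) :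
    ∃ t u : ℤ, t ^ 2 - Δ * u ^ 2 = 4 * q ^ h ∧ ¬ q ∣ t ∧ ¬ q ∣ u := by
  obtain ⟨x, y, z, w, hdet, he⟩ := he
  have ha := congrArg BQF.a he
  have hb := congrArg BQF.b he
  have hc := congrArg BQF.c he
  simp only [BQF.subst] at ha hb hc
  obtain ⟨r, s, m, hrs⟩ := hprim.exists_combination (Q := ⟨A, B, C * q ^ h⟩) hdisc
  simp only at hrs
  generalize (p : ℤ) * z = Z at *
  have i1 : A * (w * q ^ h - x) = B * Z := by
    have : 2 * (A * (w * q ^ h - x)) = 2 * (B * Z) := by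
      linear_combination (-2 * w) * ha + Z * hb + (2 * A * x + B * Z) * hdet
    omega
  have i2 : A * y = -C * Z := by
    have : 2 * (A * y) = 2 * (-C * Z) := by
      linear_combination w * hb - 2 * Z * hc - (2 * A * y + B * w) * hdet
    omega
  obtain ⟨u, rfl⟩ : A ∣ Z := ⟨Z * r + (w * q ^ h - x) * s - y * q ^ h * m, by
    linear_combination (-Z) * hrs - s * i1 + q ^ h * m * i2⟩
  have i3 : w * q ^ h - x = B * u := mul_left_cancel₀ hA (by linear_combination i1)
  have i4 : y = -C * u := mul_left_cancel₀ hA (by linear_combination i2)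
  have key : (x + w * q ^ h) ^ 2 - Δ * u ^ 2 = 4 * q ^ h := by
    subst hdisc i4
    linear_combination 4 * q ^ h * hdet + (w * q ^ h - x + B * u) * i3
  have hqq : q ∣ q ^ h := dvd_pow_self q hh
  have h4 : q ∣ (x + w * q ^ h) ^ 2 - Δ * u ^ 2 := by
    rw [key]
    exact hqq.mul_left 4
  have ht : ¬ q ∣ x + w * q ^ h := fun ht => by
    have h1 : q ∣ Δ * u ^ 2 := by
      refine (dvd_sub (dvd_pow ht two_ne_zero) h4).trans (dvd_of_eq (by ring))
    have h2 : q ∣ u := hq.dvd_of_dvd_pow ((hq.dvd_or_dvd h1).resolve_left hqΔ)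
    have h3 : q ∣ x := (dvd_sub ht (hqq.mul_left w)).trans (dvd_of_eq (by ring))
    apply hq.not_isUnit
    rw [isUnit_iff_dvd_one, ← hdet]
    exact dvd_sub (h3.mul_right w) ((h2.mul_left A).mul_left y)
  refine ⟨x + w * q ^ h, u, key, ht, fun hu => ht (hq.dvd_of_dvd_pow (n := 2) ?_)⟩
  refine (dvd_add h4 ((dvd_pow hu two_ne_zero).mul_left Δ)).trans (dvd_of_eq (by ring))

/-- Hensel lifting of a square root. -/
theorem exists_sq_modEq_pow {q Δ : ℤ} (hq : Prime q) (hq2 : ¬ q ∣ 2) (hqΔ : ¬ q ∣ Δ) {b : ℤ}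
    (hb : q ∣ b ^ 2 - Δ) (k : ℕ) : ∃ b' : ℤ, q ^ (k + 1) ∣ b' ^ 2 - Δ := by
  induction k with
  | zero => exact ⟨b, by simpa using hb⟩
  | succ k ih =>
    obtain ⟨b', e, he⟩ := ih
    have hqb : ¬ q ∣ 2 * b' := fun h => by
      have h1 := (hq.dvd_or_dvd h).resolve_left hq2
      apply hqΔ
      have h2 : q ∣ b' ^ 2 - Δ := by
        rw [he, pow_succ']
        exact (dvd_mul_right q _).mul_right _
      exact (dvd_sub (dvd_pow h1 two_ne_zero) h2).trans (dvd_of_eq (by ring))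
    obtain ⟨r, s, hrs⟩ := (hq.coprime_iff_not_dvd).2 hqb
    refine ⟨b' - s * e * q ^ (k + 1), r * e + q ^ k * (s * e) ^ 2, ?_⟩
    linear_combination he - e * q ^ (k + 1) * hrs

/-- For a split prime `q`, some `4qʰ` is a norm. -/
theorem exists_norm {p : ℕ} {N β : ℤ} (hprim : Prim (-N)) {R : Finset BQF}
    (hRcover : ∀ Q : BQF, Q.memN N p β → ∃ Q' ∈ R, BQF.Eqv p Q Q') {q : ℤ} (hq0 : 0 < q)
    (hq : Prime q) (hq2 : ¬ q ∣ 2) (hqp : ¬ q ∣ p) (hqΔ : ¬ q ∣ -N) {b : ℤ}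
    (hb : q ∣ b ^ 2 - (-N)) {Q : BQF} (hQ : Q.memN N p β) :
    ∃ h : ℕ, h ≠ 0 ∧ ∃ t u : ℤ, t ^ 2 - -N * u ^ 2 = 4 * q ^ h ∧ ¬ q ∣ t ∧ ¬ q ∣ u := by
  obtain ⟨b', hb'⟩ := exists_sq_modEq_pow hq hq2 hqΔ hb R.card
  rw [← hQ.disc] at hqΔ hb'
  obtain ⟨Q', he, ha, ⟨c, hc⟩, -⟩ := exists_eqv_modEq hq hq2 hqp hqΔ (R.card + 1) hb'
  have hQ' := hQ.of_eqv he
  let S : ℕ → BQF := fun i => ⟨Q'.a * q ^ i, Q'.b, q ^ (R.card + 1 - i) * c⟩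
  have hS : ∀ i ≤ R.card, (S i).memN N p β := fun i hi => by
    have hd : (S i).disc = Q'.disc := by
      have : q ^ (R.card + 1) = q ^ i * q ^ (R.card + 1 - i) := by
        rw [← pow_add]; congr 1; omega
      simp only [S, BQF.disc, hc, this]
      ring
    exact ⟨⟨⟨mul_pos hQ'.1.1.1 (pow_pos hq0 i), by rw [hd]; exact hQ'.1.1.2⟩,
      by rw [hd]; exact hQ'.1.2⟩, hQ'.2.1.mul_right _, hQ'.2.2⟩
  have : ∀ i : Fin (R.card + 1), ∃ Q'' ∈ R, BQF.Eqv p (S i) Q'' := fun i =>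
    hRcover _ (hS i (Nat.lt_succ_iff.1 i.2))
  choose f hf hfe using this
  obtain ⟨i, -, j, -, hij, hfij⟩ := Finset.exists_ne_map_eq_of_card_lt_of_maps_to
    (s := (Finset.univ : Finset (Fin (R.card + 1)))) (t := R) (by simp) (fun i _ => hf i)
  wlog hlt : i < j generalizing i j
  · exact this j i hij.symm hfij.symm (lt_of_le_of_ne (not_lt.1 hlt) hij.symm)
  have h1 : BQF.Eqv p (S i) (S j) := (hfe i).trans (hfij ▸ (hfe j).symm)
  have hj := j.2
  have hl : (i : ℕ) < j := hlt
  have e1 : S i = ⟨Q'.a * q ^ (i : ℕ), Q'.b, (q ^ (R.card + 1 - j) * c) * q ^ ((j : ℕ) - i)⟩ := by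
    simp only [S]
    congr 1
    rw [mul_right_comm, ← pow_add]
    congr 2
    omega
  have e2 : S j = ⟨Q'.a * q ^ (i : ℕ) * q ^ ((j : ℕ) - i), Q'.b, q ^ (R.card + 1 - j) * c⟩ := by
    simp only [S]
    congr 1
    rw [mul_assoc, ← pow_add]
    congr 2
    omega
  have hd := (hS i (by omega)).disc
  rw [e1] at h1 hd
  rw [e2] at h1
  have hh : (j : ℕ) - i ≠ 0 := by omega
  rw [hQ.disc] at hqΔ
  exact ⟨_, hh, exists_norm_of_eqv hprim hq hqΔ hh
    (mul_ne_zero hQ'.1.1.1.ne' (pow_ne_zero _ hq.ne_zero)) hd h1⟩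

theorem BQF.memN.of_shift_pow {N β : ℤ} {p : ℕ} {Q : BQF} (h : Q.memN N p β) {q : ℤ} (hq : 0 < q)
    {n : ℕ} (hc : q ^ n ∣ Q.c) {i : ℕ} (hi : i ≤ n) :
    (Q.shift (q ^ i)).memN N p β ∧ (Q.shift (q ^ i)).root = Q.root / q ^ i := by
  have h1 := (pow_dvd_pow q hi).trans hc
  refine ⟨h.shift (pow_pos hq i) h1, ?_⟩
  rw [BQF.root_shift h1]
  push_cast
  rfl

/-- `(t - u√Δ)/2` as an algebraic integer. -/
theorem isIntegral_lam {Δ t u n : ℤ} (hΔ : Δ < 0) (h : t ^ 2 - Δ * u ^ 2 = 4 * n) :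
    IsIntegral ℤ ((t - u * sqD Δ) / 2 : ℂ) := by
  refine ⟨Polynomial.X ^ 2 - Polynomial.C t * Polynomial.X + Polynomial.C n, by monicity!, ?_⟩
  have h1 := sqD_sq hΔ
  have h2 : (t : ℂ) ^ 2 - Δ * u ^ 2 = 4 * n := by exact_mod_cast h
  simp only [Polynomial.eval₂_add, Polynomial.eval₂_sub, Polynomial.eval₂_mul, Polynomial.eval₂_C,
    Polynomial.eval₂_X_pow, Polynomial.eval₂_X, algebraMap_int_eq]
  simp only [eq_intCast]
  linear_combination (u ^ 2 / 4) * h1 - (1 / 4) * h2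

theorem prod_range_div_of_ne_zero {g : ℕ → ℂ} {n : ℕ} (hg : ∀ i ≤ n, g i ≠ 0) :
    ∏ i ∈ Finset.range n, (g (i + 1) / g i) = g n / g 0 := by
  induction n with
  | zero => simp [hg 0 le_rfl]
  | succ n ih =>
    rw [Finset.prod_range_succ, ih fun i hi => hg i (hi.trans n.le_succ)]
    have := hg n n.le_succ
    field_simp

section

variable {p q : ℕ} (hp : Good p) {N β : ℤ} (hN : 0 < N) (hq : q.Prime) (hq2 : q ≠ 2)
  (hpq : p.Coprime q) {h : ℕ} (hh : h ≠ 0) {t u : ℤ} (hrel : t ^ 2 - -N * u ^ 2 = 4 * q ^ h)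
  (hint : ∀ Q : BQF, Q.memN N p β → IsIntegral ℤ (jpStar p Q.root))
  {I : Ideal Zb} [hI : I.IsPrime] (hqI : (q : Zb) ∈ I)

include hrel in
theorem dd_root_div {Q : BQF} (hQ : Q.memN N p β) (hp : 0 < p) (hq : 0 < q) (hc : (q : ℤ) ^ h ∣ Q.c)
    (htb : 2 * (q : ℤ) ^ h ∣ t + Q.b * u) :
    dd p (Q.root / q ^ h) = ((t - u * sqD (-N)) / 2) ^ 24 * dd p Q.root := by
  obtain ⟨c, hc⟩ := hc
  obtain ⟨v, hv⟩ := htb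
  obtain ⟨a, ha⟩ := hQ.2.1
  obtain ⟨w, hw⟩ : (2 : ℤ) ∣ t - Q.b * u := by
    have h2 : (2 : ℤ) ∣ t + Q.b * u := ⟨q ^ h * v, by rw [hv]; ring⟩
    exact (dvd_sub h2 (dvd_mul_right 2 (Q.b * u))).trans (dvd_of_eq (by ring))
  have hq0 : (q : ℤ) ^ h ≠ 0 := pow_ne_zero _ (by exact_mod_cast hq.ne')
  have hdisc : Q.b ^ 2 - 4 * Q.a * Q.c = -N := hQ.disc
  have hdet : v * w - (c * u) * (p * (-a * u)) = 1 := by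
    apply mul_left_cancel₀ (mul_ne_zero (four_ne_zero (α := ℤ)) hq0)
    rw [← hdisc, hc, ha] at hrel
    linear_combination hrel - (t - Q.b * u) * hv - 2 * q ^ h * v * hw
  have h2 := hQ.posDef.two_mul_root
  rw [hQ.disc] at h2
  have him := hQ.posDef.root_im_pos
  have hqc : (q : ℂ) ^ h ≠ 0 := by exact_mod_cast hq0
  have hvc : (t : ℂ) + Q.b * u = 2 * q ^ h * v := by exact_mod_cast hv
  have hwc : (t : ℂ) - Q.b * u = 2 * w := by exact_mod_cast hw
  have hac : (Q.a : ℂ) = p * a := by exact_mod_cast ha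
  have hcc : (Q.c : ℂ) = q ^ h * c := by exact_mod_cast hc
  have hden : (((p : ℤ) * (-a * u) : ℤ) : ℂ) * Q.root + w = (t - u * sqD (-N)) / 2 := by
    rw [← h2, hac]
    push_cast
    linear_combination (-1 / 2 : ℂ) * hwc
  have hmob : mob v (c * u) (p * (-a * u)) w Q.root = Q.root / q ^ h := by
    have hd := den_ne_zero (c := p * (-a * u)) (d := w) him
      (ne_zero_or_of_det (a := v) (b := c * u) (by omega))
    unfold mob
    rw [div_eq_div_iff hd hqc]
    have h3 := hQ.posDef.root_eq
    rw [hac, hcc] at h3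
    push_cast
    linear_combination u * h3 - (1 / 2 : ℂ) * Q.root * hvc + (1 / 2 : ℂ) * Q.root * hwc
  rw [← hmob, dd_mob hp him hdet, hden]

include hp hq hq2 hpq hh hrel hint hqI in
theorem frob_core {L : Zb} (hL : (L : ℂ) = (t - u * sqD (-N)) / 2) (hLI : L ∉ I) {Q : BQF}
    (hQ : Q.memN N p β) (hc : (q : ℤ) ^ h ∣ Q.c) (htb : 2 * (q : ℤ) ^ h ∣ t + Q.b * u)
    {F F' : Zb} (hF : (F : ℂ) = jpStar p Q.root) (hF' : (F' : ℂ) = jpStar p (Q.root / q)) :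
    F - F' ^ q ∈ I := by
  have him := hQ.posDef.root_im_pos
  have hqpos : (0 : ℤ) < q := by exact_mod_cast hq.pos
  have hS := fun i (hi : i ≤ h) => hQ.of_shift_pow hqpos hc hi
  have him' : ∀ i ≤ h, 0 < (Q.root / (q : ℂ) ^ i).im := fun i hi => by
    have := (hS i hi).1.posDef.root_im_pos
    rw [(hS i hi).2] at this
    exact_mod_cast this
  have hint' : ∀ i ≤ h, IsIntegral ℤ (jpStar p (Q.root / (q : ℂ) ^ i)) := fun i hi => by
    have := hint _ (hS i hi).1
    rw [(hS i hi).2] at this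
    exact_mod_cast this
  have hqc : (q : ℂ) ≠ 0 := by exact_mod_cast hq.ne_zero
  have hφ : ∀ i ∈ Finset.range h, IsIntegral ℤ
      (dd p (Q.root / (q : ℂ) ^ (i + 1)) / dd p (Q.root / (q : ℂ) ^ i)) := fun i hi => by
    have hi' := (Finset.mem_range.1 hi).le
    have := isIntegral_hph hp hq hpq (him' i hi') (hint' i hi') (some ⟨0, hq.pos⟩)
    rw [hph_some p hq.pos] at this
    simpa [pow_succ, div_div] using this
  obtain ⟨k, rfl⟩ := Nat.exists_eq_succ_of_ne_zero hh
  have hprod : ∏ i ∈ Finset.range (k + 1),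
      (dd p (Q.root / (q : ℂ) ^ (i + 1)) / dd p (Q.root / (q : ℂ) ^ i)) = (L : ℂ) ^ 24 := by
    rw [prod_range_div_of_ne_zero (g := fun i => dd p (Q.root / (q : ℂ) ^ i))
        (fun i hi => dd_ne_zero hp.pos (him' i hi)),
      dd_root_div hrel hQ hp.pos hq.pos hc htb, ← hL]
    simp [dd_ne_zero hp.pos him]
  rw [Finset.prod_range_succ'] at hprod
  have hrest : IsIntegral ℤ (∏ i ∈ Finset.range k, (dd p (Q.root / (q : ℂ) ^ (i + 1 + 1)) /
      dd p (Q.root / (q : ℂ) ^ (i + 1)))) :=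
    IsIntegral.prod _ fun i hi => hφ (i + 1) (by simpa using hi)
  have hA := hφ 0 (by simp)
  let A : Zb := ⟨_, hA⟩
  have hAI : A ∉ I := fun h0 => by
    have h1 : (⟨_, hrest⟩ : Zb) * A = L ^ 24 := Subtype.ext (by simpa [A] using hprod)
    have h2 : L ^ 24 ∈ I := h1 ▸ I.mul_mem_left _ h0
    exact hLI (hI.mem_of_pow_mem _ h2)
  have i1 := him' 1 (by omega)
  have j1 := hint' 1 (by omega)
  rw [pow_one] at i1 j1
  have e : (q : ℂ) * (Q.root / q) = Q.root := mul_div_cancel₀ _ hqc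
  exact hecke_frobenius hp hq hq2 hpq i1 j1 hqI (A := A) (by simp [A, e]) hAI hF' (by rw [e, hF])
end

section

variable {p q : ℕ} (hp : Good p) {N β : ℤ} (hN : 0 < N) (hq : q.Prime) (hq2 : q ≠ 2)
  (hpq : p.Coprime q) (hqN : ¬ (q : ℤ) ∣ -N) {h : ℕ} (hh : h ≠ 0) {t u : ℤ}
  (hrel : t ^ 2 - -N * u ^ 2 = 4 * q ^ h)
  (hint : ∀ Q : BQF, Q.memN N p β → IsIntegral ℤ (jpStar p Q.root))
  {I : Ideal Zb} [hI : I.IsPrime] (hqI : (q : Zb) ∈ I)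

include hp hq hq2 hpq hqN hh hrel hint hqI in
theorem frob_shift_of_notMem (hu : ¬ (q : ℤ) ∣ u) {L : Zb}
    (hL : (L : ℂ) = (t - u * sqD (-N)) / 2) (hLI : L ∉ I) :
    ∃ b₀ : ℤ, (q : ℤ) ∣ b₀ ^ 2 - -N ∧ ∀ Q : BQF, Q.memN N p β → ¬ (q : ℤ) ∣ Q.a → (q : ℤ) ∣ Q.c →
      (q : ℤ) ∣ Q.b - b₀ → ∀ F F' : Zb, (F : ℂ) = jpStar p Q.root →
        (F' : ℂ) = jpStar p (Q.shift q).root → F - F' ^ q ∈ I := by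
  have hq' : Prime (q : ℤ) := Nat.prime_iff_prime_int.1 hq
  have hq2' : ¬ (q : ℤ) ∣ 2 := fun h2 =>
    hq2 ((Nat.prime_dvd_prime_iff_eq hq Nat.prime_two).1 (by exact_mod_cast h2))
  have hqp : ¬ (q : ℤ) ∣ p := fun h2 => by
    have h3 : q ∣ p := by exact_mod_cast h2
    exact hq.one_lt.ne' (Nat.dvd_one.1 (hpq ▸ Nat.dvd_gcd h3 dvd_rfl))
  have hcop : IsCoprime ((q : ℤ) ^ h) u := IsCoprime.pow_left ((hq'.coprime_iff_not_dvd).2 hu)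
  obtain ⟨r, s, hrs⟩ := hcop
  have hb1 : (q : ℤ) ^ h ∣ t + (-t * s) * u := ⟨t * r, by linear_combination (-t) * hrs⟩
  generalize -t * s = b₀ at hb1
  obtain ⟨v, hv⟩ := hb1
  have hb0 : (q : ℤ) ^ h ∣ b₀ ^ 2 - -N := by
    refine (IsCoprime.pow_right ⟨r, s, hrs⟩ : IsCoprime ((q : ℤ) ^ h) (u ^ 2)).dvd_of_dvd_mul_left
      ⟨v * (b₀ * u - t) + 4, ?_⟩
    linear_combination (b₀ * u - t) * hv + hrel
  have hqh : (q : ℤ) ∣ q ^ h := dvd_pow_self _ hh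
  refine ⟨b₀, hqh.trans hb0, fun Q hQ ha hc hb F F' hF hF' => ?_⟩
  rw [← hQ.disc] at hb0 hqN
  obtain ⟨Q', he, ha', hc', hb'⟩ := exists_eqv_modEq hq' hq2' hqp hqN h hb0
  have hQ' := hQ.of_eqv he
  have hsh : BQF.Eqv p (Q.shift q) (Q'.shift q) :=
    BQF.Eqv.shift hq' hq2' ha hc (hqh.trans hc')
      ((dvd_sub (hqh.trans hb') hb).trans (dvd_of_eq (by ring))) he
  have hqpos : (0 : ℤ) < q := by exact_mod_cast hq.pos
  refine frob_core hp hq hq2 hpq hh hrel hint hqI hL hLI hQ' hc' ?_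
    (by rw [hF, he.jpStar_root hp hQ.posDef]) ?_
  · refine IsCoprime.mul_dvd (IsCoprime.pow_right ?_) ?_ ?_
    · exact ((hq'.coprime_iff_not_dvd).2 hq2').symm
    · have hdisc := hQ'.disc
      unfold BQF.disc at hdisc
      have h2 : (2 : ℤ) ∣ (t + Q'.b * u) * (t + Q'.b * u) :=
        ⟨2 * q ^ h - 2 * Q'.a * Q'.c * u ^ 2 + Q'.b * u * (t + Q'.b * u), by
          linear_combination hrel - u ^ 2 * hdisc⟩
      exact (Int.prime_two.dvd_or_dvd h2).elim id id
    · obtain ⟨m, hm⟩ := hb'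
      exact ⟨v + m * u, by linear_combination hv + u * hm⟩
  · rw [hF', ← hsh.jpStar_root hp (hQ.shift hqpos hc).posDef, BQF.root_shift (hqh.trans hc')]
    push_cast
    rfl

include hp hN hq hq2 hpq hqN hh hrel hint hqI in
theorem frob_shift (ht : ¬ (q : ℤ) ∣ t) (hu : ¬ (q : ℤ) ∣ u) :
    ∃ b₀ : ℤ, (q : ℤ) ∣ b₀ ^ 2 - -N ∧ ∀ Q : BQF, Q.memN N p β → ¬ (q : ℤ) ∣ Q.a → (q : ℤ) ∣ Q.c →
      (q : ℤ) ∣ Q.b - b₀ → ∀ F F' : Zb, (F : ℂ) = jpStar p Q.root →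
        (F' : ℂ) = jpStar p (Q.shift q).root → F - F' ^ q ∈ I := by
  have hΔ : -N < 0 := by omega
  have hrel' : t ^ 2 - -N * (-u) ^ 2 = 4 * q ^ h := by rw [neg_sq, hrel]
  let L : Zb := ⟨_, isIntegral_lam hΔ hrel⟩
  let L' : Zb := ⟨_, isIntegral_lam hΔ hrel'⟩
  by_cases hLI : L ∈ I
  · have hLI' : L' ∉ I := fun hLI' => by
      have h1 : (t : Zb) ∈ I := by
        have : L + L' = (t : Zb) := Subtype.ext (by
          have e : ((t : Zb) : ℂ) = t := map_intCast (algebraMap Zb ℂ) t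
          rw [e]
          simp only [L, L', Subalgebra.coe_add]
          push_cast
          ring)
        exact this ▸ I.add_mem hLI hLI'
      obtain ⟨x, y, hxy⟩ := ((Nat.prime_iff_prime_int.1 hq).coprime_iff_not_dvd).2 ht
      have h2 : ((x : Zb) * q + y * t) = 1 := by exact_mod_cast congrArg (Int.cast (R := Zb)) hxy
      exact hI.ne_top ((Ideal.eq_top_iff_one I).2
        (h2 ▸ I.add_mem (I.mul_mem_left _ hqI) (I.mul_mem_left _ h1)))
    exact frob_shift_of_notMem hp hq hq2 hpq hqN hh hrel' hint hqI (by simpa using hu) (L := L')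
      (by simp [L']) hLI'
  · exact frob_shift_of_notMem hp hq hq2 hpq hqN hh hrel hint hqI hu (L := L) rfl hLI

end

/-- The shift by `q`, composed with suitable equivalences, permutes a set of representatives. -/
theorem exists_shift_perm {p : ℕ} {q : ℤ} (hq0 : 0 < q) (hq : Prime q) (hq2 : ¬ q ∣ 2)
    (hqp : ¬ q ∣ p) {N β : ℤ} (hqN : ¬ q ∣ -N) {b₀ : ℤ} (hb₀ : q ∣ b₀ ^ 2 - -N) {R : Finset BQF}
    (hRmem : ∀ Q ∈ R, Q.memN N p β)
    (hRineq : ∀ Q ∈ R, ∀ Q' ∈ R, Q ≠ Q' → ¬ BQF.Eqv p Q Q')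
    (hRcover : ∀ Q : BQF, Q.memN N p β → ∃ Q' ∈ R, BQF.Eqv p Q Q') :
    ∃ T : BQF → BQF, Set.BijOn T R R ∧ ∀ Q ∈ R, ∃ Q₁, BQF.Eqv p Q Q₁ ∧ ¬ q ∣ Q₁.a ∧
      q ∣ Q₁.c ∧ q ∣ Q₁.b - b₀ ∧ BQF.Eqv p (Q₁.shift q) (T Q) := by
  have key : ∀ Q : BQF, ∃ T : BQF, Q ∈ R → T ∈ R ∧ ∃ Q₁, BQF.Eqv p Q Q₁ ∧ ¬ q ∣ Q₁.a ∧
      q ∣ Q₁.c ∧ q ∣ Q₁.b - b₀ ∧ BQF.Eqv p (Q₁.shift q) T := fun Q => by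
    by_cases hQ : Q ∈ R
    · have hQ' := hRmem Q hQ
      have hd := hqN
      have hb := hb₀
      rw [← hQ'.disc] at hd hb
      obtain ⟨Q₁, he, h1, h2, h3⟩ := exists_eqv_modEq hq hq2 hqp hd 1 (by simpa using hb)
      rw [pow_one] at h2 h3
      obtain ⟨T, hT, hT'⟩ := hRcover _ ((hQ'.of_eqv he).shift hq0 h2)
      exact ⟨T, fun _ => ⟨hT, Q₁, he, h1, h2, h3, hT'⟩⟩
    · exact ⟨Q, fun h => absurd h hQ⟩
  choose T hT using key
  refine ⟨T, ?_, fun Q hQ => (hT Q hQ).2⟩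
  have hmaps : Set.MapsTo T R R := fun Q hQ => (hT Q hQ).1
  have hinj : Set.InjOn T R := fun Q hQ Q' hQ' he => by
    by_contra hne
    obtain ⟨Q₁, h1, h2, h3, h4, h5⟩ := (hT Q hQ).2
    obtain ⟨Q₁', h1', h2', h3', h4', h5'⟩ := (hT Q' hQ').2
    rw [← he] at h5'
    have hd : ¬ q ∣ Q₁.disc := by rwa [((hRmem Q hQ).of_eqv h1).disc]
    have h6 := BQF.Eqv.of_shift hq hq2 hqp hd h3 h3'
      ((dvd_sub h4' h4).trans (dvd_of_eq (by ring))) (h5.trans h5'.symm)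
    exact hRineq Q hQ Q' hQ' hne (h1.trans (h6.trans h1'.symm))
  exact ⟨hmaps, hinj, Finset.surjOn_of_injOn_of_card_le T hmaps hinj le_rfl⟩

theorem neg_one_pow_of_odd {A : Type*} [CommRing A] {n : ℕ} (h : Odd n) : (-1 : A) ^ n = -1 :=
  h.neg_one_pow

theorem frob_sum {p q : ℕ} (hp : Good p) {N β : ℤ} (hN : 0 < N) (hprim : Prim (-N))
    (hq : q.Prime) (hq2 : q ≠ 2) (hpq : p.Coprime q) (hqN : ¬ (q : ℤ) ∣ -N)
    {b : ℤ} (hb : (q : ℤ) ∣ b ^ 2 - -N)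
    (hint : ∀ Q : BQF, Q.memN N p β → IsIntegral ℤ (jpStar p Q.root))
    {R : Finset BQF} (hRmem : ∀ Q ∈ R, Q.memN N p β)
    (hRineq : ∀ Q ∈ R, ∀ Q' ∈ R, Q ≠ Q' → ¬ BQF.Eqv p Q Q')
    (hRcover : ∀ Q : BQF, Q.memN N p β → ∃ Q' ∈ R, BQF.Eqv p Q Q')
    {w : BQF → ℤ} (hw : ∀ Q : BQF, Q.memN N p β → w Q = 1 ∨ w Q = -1)
    (hwe : ∀ Q Q' : BQF, Q.memN N p β → BQF.Eqv p Q Q' → w Q' = w Q) {ε : ℤ}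
    (hws : ∀ Q : BQF, Q.memN N p β → (q : ℤ) ∣ Q.c → w (Q.shift q) = ε * w Q)
    (hε : ε = 1 ∨ ε = -1)
    {I : Ideal Zb} [hI : I.IsPrime] (hqI : (q : Zb) ∈ I) {S : Zb}
    (hS : (S : ℂ) = ∑ Q ∈ R, (w Q : ℂ) * jpStar p Q.root) : S - ε * S ^ q ∈ I := by
  classical
  have hq' : Prime (q : ℤ) := Nat.prime_iff_prime_int.1 hq
  have hq2' : ¬ (q : ℤ) ∣ 2 := fun h2 =>
    hq2 ((Nat.prime_dvd_prime_iff_eq hq Nat.prime_two).1 (by exact_mod_cast h2))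
  have hqp : ¬ (q : ℤ) ∣ p := fun h2 => by
    have h3 : q ∣ p := by exact_mod_cast h2
    exact hq.one_lt.ne' (Nat.dvd_one.1 (hpq ▸ Nat.dvd_gcd h3 dvd_rfl))
  have hqpos : (0 : ℤ) < q := by exact_mod_cast hq.pos
  rcases R.eq_empty_or_nonempty with rfl | ⟨Q₀, hQ₀⟩
  · have : S = 0 := Subtype.ext (by simpa using hS)
    simp [this, hq.ne_zero]
  obtain ⟨h, hh, t, u, hrel, ht, hu⟩ :=
    exists_norm hprim hRcover hqpos hq' hq2' hqp hqN hb (hRmem Q₀ hQ₀)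
  obtain ⟨b₀, hb₀, hfrob⟩ := frob_shift hp hN hq hq2 hpq hqN hh hrel hint hqI ht hu
  obtain ⟨T, hT, hT'⟩ := exists_shift_perm hqpos hq' hq2' hqp hqN hb₀ hRmem hRineq hRcover
  let F : BQF → Zb := fun Q =>
    if hQ : Q.memN N p β then ⟨jpStar p Q.root, hint Q hQ⟩ else 0
  have hF : ∀ Q, Q.memN N p β → (F Q : ℂ) = jpStar p Q.root := fun Q hQ => by simp [F, hQ]
  have hSF : S = ∑ Q ∈ R, (w Q : Zb) * F Q := Subtype.ext (by
    rw [hS, AddSubmonoidClass.coe_finsetSum]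
    refine Finset.sum_congr rfl fun Q hQ => ?_
    rw [Subalgebra.coe_mul, hF Q (hRmem Q hQ)]
    congr 1)
  have hFT : ∀ Q ∈ R, Ideal.Quotient.mk I (F Q) = Ideal.Quotient.mk I (F (T Q)) ^ q ∧
      w Q = ε * w (T Q) := fun Q hQ => by
    obtain ⟨Q₁, h1, h2, h3, h4, h5⟩ := hT' Q hQ
    have hQ1 := (hRmem Q hQ).of_eqv h1
    have hQ2 := hQ1.shift hqpos h3
    constructor
    · rw [← map_pow, Ideal.Quotient.eq]
      refine hfrob Q₁ hQ1 h2 h3 h4 _ _ ?_ ?_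
      · rw [hF Q (hRmem Q hQ), h1.jpStar_root hp (hRmem Q hQ).posDef]
      · rw [hF (T Q) (hRmem _ (hT.1 hQ)), h5.jpStar_root hp hQ2.posDef]
    · rw [hwe _ _ hQ2 h5, hws _ hQ1 h3, hwe _ _ (hRmem Q hQ) h1]
      rcases hε with rfl | rfl <;> ring
  have hqq : ((q : ℕ) : Zb ⧸ I) = 0 := by
    have := Ideal.Quotient.eq_zero_iff_mem.2 hqI
    simpa using this
  have : Fact q.Prime := ⟨hq⟩
  have : CharP (Zb ⧸ I) q := (CharP.charP_iff_prime_eq_zero hq).2 hqq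
  have hodd : Odd q := hq.odd_of_ne_two hq2
  rw [← Ideal.Quotient.eq_zero_iff_mem, map_sub, sub_eq_zero, map_mul, map_pow, map_intCast]
  have h1 : Ideal.Quotient.mk I S =
      ∑ Q ∈ R, (ε : Zb ⧸ I) * ((w (T Q) : Zb ⧸ I) * Ideal.Quotient.mk I (F (T Q))) ^ q := by
    rw [hSF, map_sum]
    refine Finset.sum_congr rfl fun Q hQ => ?_
    rw [map_mul, map_intCast, (hFT Q hQ).1, (hFT Q hQ).2, mul_pow]
    rcases hw _ (hRmem _ (hT.1 hQ)) with h2 | h2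
    · simp [h2]
    · have e : (-1 : Zb ⧸ I) ^ q = -1 := neg_one_pow_of_odd hodd
      rw [h2]
      push_cast
      rw [e]
      ring
  have h2 : Ideal.Quotient.mk I S =
      ∑ Q ∈ R, (w (T Q) : Zb ⧸ I) * Ideal.Quotient.mk I (F (T Q)) := by
    rw [hSF, map_sum]
    simp only [map_mul, map_intCast]
    exact (Finset.sum_nbij T hT.1 hT.2.1 hT.2.2 fun _ _ => rfl).symm
  conv_lhs => rw [h1, ← Finset.mul_sum, ← sum_pow_char]
  rw [h2]

open Complex ComplexConjugate

theorem conj_tprod (f : ℕ → ℂ) : conj (∏' n, f n) = ∏' n, conj (f n) := by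
  by_cases h : Multipliable f
  · exact h.map_tprod (starRingEnd ℂ) continuous_conj
  · have h' : ¬ Multipliable fun n => conj (f n) := fun h' => h <| by
      simpa [Function.comp_def] using h'.map (starRingEnd ℂ) continuous_conj
    rw [tprod_eq_one_of_not_multipliable h, tprod_eq_one_of_not_multipliable h', map_one]

theorem dedekindEta_neg_conj (τ : ℂ) : dedekindEta (-conj τ) = conj (dedekindEta τ) := by
  unfold dedekindEta
  rw [map_mul, conj_tprod, ← exp_conj]
  have h2 : conj (2 : ℂ) = 2 := conj_ofNat 2
  have h24 : conj (24 : ℂ) = 24 := conj_ofNat 24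
  congr 2
  · simp [h2, h24]
  · ext n
    rw [map_sub, map_one, ← exp_conj]
    congr 2
    simp [h2]

theorem jpStar_neg_conj (p : ℕ) (τ : ℂ) : jpStar p (-conj τ) = conj (jpStar p τ) := by
  unfold jpStar
  have h : (p : ℂ) * -conj τ = -conj (p * τ) := by simp
  rw [h, dedekindEta_neg_conj, dedekindEta_neg_conj]
  simp

/-- The form `[pc, b, a/p]`. -/
def BQF.dual (Q : BQF) (p : ℕ) : BQF := ⟨p * Q.c, Q.b, Q.a / p⟩

theorem BQF.memN.dual {N β : ℤ} {p : ℕ} (hp : 0 < p) {Q : BQF} (h : Q.memN N p β) :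
    (Q.dual p).memN N p β := by
  have hd : (Q.dual p).disc = Q.disc := by
    simp only [BQF.dual, BQF.disc]
    linear_combination (-4 * Q.c) * Int.mul_ediv_cancel' h.2.1
  have hp' : (0 : ℤ) < p := by exact_mod_cast hp
  exact ⟨⟨⟨mul_pos hp' h.posDef.c_pos, by rw [hd]; exact h.1.1.2⟩, by rw [hd]; exact h.1.2⟩,
    dvd_mul_right _ _, h.2.2⟩

theorem BQF.dual_dual {Q : BQF} {p : ℕ} (hp : 0 < p) (h : (p : ℤ) ∣ Q.a) :
    (Q.dual p).dual p = Q := by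
  have hp' : (p : ℤ) ≠ 0 := by exact_mod_cast hp.ne'
  exact BQF.ext' (Int.mul_ediv_cancel' h) rfl (Int.mul_ediv_cancel_left _ hp')

theorem BQF.Eqv.dual {Q Q' : BQF} {p : ℕ} (hp : 0 < p) (hQ : (p : ℤ) ∣ Q.a)
    (h : BQF.Eqv p Q Q') : BQF.Eqv p (Q.dual p) (Q'.dual p) := by
  have hp' : (p : ℤ) ≠ 0 := by exact_mod_cast hp.ne'
  obtain ⟨x, y, z, w, hdet, rfl⟩ := h
  obtain ⟨a, ha⟩ := hQ
  refine ⟨w, z, y, x, by linear_combination hdet, BQF.ext' ?_ ?_ ?_⟩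
  · simp only [BQF.dual, BQF.subst, ha, Int.mul_ediv_cancel_left _ hp']
    ring
  · simp only [BQF.dual, BQF.subst, ha, Int.mul_ediv_cancel_left _ hp']
    ring
  · simp only [BQF.dual, BQF.subst, ha, Int.mul_ediv_cancel_left _ hp']
    symm
    apply Int.ediv_eq_of_eq_mul_right hp'
    ring

theorem jpStar_dual_root {p : ℕ} (hp : Good p) {N β : ℤ} {Q : BQF} (h : Q.memN N p β) :
    jpStar p (Q.dual p).root = conj (jpStar p Q.root) := by
  have him := h.posDef.root_im_pos
  have h0 : Q.root ≠ 0 := fun h0 => by simp [h0] at him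
  have hp0 : (p : ℂ) ≠ 0 := by exact_mod_cast hp.pos.ne'
  rw [← jpStar_W hp him, ← jpStar_neg_conj]
  congr 1
  have hpos : 0 < (-1 / (p * Q.root)).im := by
    have h1 : 0 < (p * Q.root).im := im_natCast_mul_pos hp.pos him
    rw [neg_div, one_div, neg_im, inv_im, neg_div, neg_neg]
    exact div_pos h1 (normSq_pos.2 (mul_ne_zero hp0 h0))
  symm
  refine (h.dual hp.pos).posDef.eq_root (by rwa [neg_im, conj_im, neg_neg]) ?_
  have h2 := congrArg conj h.posDef.root_eq
  have h3 : conj Q.root ≠ 0 := (map_ne_zero _).2 h0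
  have ha : (Q.a : ℂ) = p * ((Q.a / p : ℤ) : ℂ) := by exact_mod_cast (Int.mul_ediv_cancel' h.2.1).symm
  simp only [map_add, map_mul, map_pow, map_intCast, map_natCast, map_zero, ha] at h2
  simp only [BQF.dual, map_div₀, map_mul, map_neg, map_one, map_natCast]
  push_cast
  field_simp
  linear_combination h2

theorem conj_sum_eq {p : ℕ} (hp : Good p) {N β : ℤ} {R : Finset BQF}
    (hRmem : ∀ Q ∈ R, Q.memN N p β)
    (hRineq : ∀ Q ∈ R, ∀ Q' ∈ R, Q ≠ Q' → ¬ BQF.Eqv p Q Q')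
    (hRcover : ∀ Q : BQF, Q.memN N p β → ∃ Q' ∈ R, BQF.Eqv p Q Q') {w : BQF → ℤ}
    (hwe : ∀ Q Q' : BQF, Q.memN N p β → BQF.Eqv p Q Q' → w Q' = w Q)
    (hwd : ∀ Q : BQF, Q.memN N p β → w (Q.dual p) = w Q) :
    conj (∑ Q ∈ R, (w Q : ℂ) * jpStar p Q.root) = ∑ Q ∈ R, (w Q : ℂ) * jpStar p Q.root := by
  have key : ∀ Q : BQF, ∃ T : BQF, Q ∈ R → T ∈ R ∧ BQF.Eqv p (Q.dual p) T := fun Q => by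
    by_cases hQ : Q ∈ R
    · obtain ⟨T, hT, hT'⟩ := hRcover _ ((hRmem Q hQ).dual hp.pos)
      exact ⟨T, fun _ => ⟨hT, hT'⟩⟩
    · exact ⟨Q, fun h => absurd h hQ⟩
  choose T hT using key
  have hmaps : Set.MapsTo T R R := fun Q hQ => (hT Q hQ).1
  have hinj : Set.InjOn T R := fun Q hQ Q' hQ' he => by
    by_contra hne
    have h1 := (hT Q hQ).2
    have h2 := (hT Q' hQ').2
    rw [← he] at h2
    have h3 := (h1.trans h2.symm).dual hp.pos ((hRmem Q hQ).dual hp.pos).2.1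
    rw [BQF.dual_dual hp.pos (hRmem Q hQ).2.1, BQF.dual_dual hp.pos (hRmem Q' hQ').2.1] at h3
    exact hRineq Q hQ Q' hQ' hne h3
  rw [map_sum]
  refine Finset.sum_nbij T hmaps hinj (Finset.surjOn_of_injOn_of_card_le T hmaps hinj le_rfl)
    fun Q hQ => ?_
  have h := hRmem Q hQ
  rw [hwe _ _ (h.dual hp.pos) (hT Q hQ).2, hwd Q h,
    (hT Q hQ).2.jpStar_root hp (h.dual hp.pos).posDef, jpStar_dual_root hp h]
  simp

theorem kronecker_prime (D : ℤ) {q : ℕ} (hq : q.Prime) (hq2 : q ≠ 2) :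
    kronecker D q = jacobiSym D q := by
  simp [kronecker, hq.ne_zero, hq.factorization, hq2]

theorem jacobiSym_natAbs {E : ℤ} (hE : E % 4 = 1) {n : ℕ} (hn : Odd n) :
    jacobiSym E n = jacobiSym n E.natAbs := by
  rcases Int.natAbs_eq E with h | h
  · have h4 : E.natAbs % 4 = 1 := by omega
    conv_lhs => rw [h]
    exact jacobiSym.quadratic_reciprocity_one_mod_four h4 hn
  · have h4 : E.natAbs % 4 = 3 := by omega
    conv_lhs => rw [h, neg_eq_neg_one_mul, jacobiSym.mul_left, jacobiSym.at_neg_one hn]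
    rcases Nat.odd_mod_four_iff.1 (Nat.odd_iff.1 hn) with h1 | h3
    · rw [ZMod.χ₄_nat_one_mod_four h1, one_mul]
      exact (jacobiSym.quadratic_reciprocity_one_mod_four h1
        (Nat.odd_iff.2 (Nat.odd_of_mod_four_eq_three h4))).symm
    · rw [ZMod.χ₄_nat_three_mod_four h3, jacobiSym.quadratic_reciprocity_three_mod_four h4 h3]
      ring

theorem jacobiSym_eq_one_of_sq {a X : ℤ} {m : ℕ} (hm : Odd m) (ha : IsCoprime a m)
    (h : (m : ℤ) ∣ X ^ 2 - 4 * a) : jacobiSym a m = 1 := by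
  have h4 : IsCoprime (4 : ℤ) m := by
    have : Nat.Coprime 4 m := by
      rw [show 4 = 2 ^ 2 by norm_num]
      exact Nat.Coprime.pow_left 2 (Nat.coprime_two_left.2 hm)
    exact_mod_cast Nat.isCoprime_iff_coprime.2 this
  have hX : IsCoprime X m := by
    have h1 : IsCoprime (X ^ 2) (m : ℤ) := by
      obtain ⟨k, hk⟩ := h
      have h2 : IsCoprime (4 * a) (m : ℤ) := h4.mul_left ha
      rw [show X ^ 2 = 4 * a + m * k by linear_combination hk]
      exact IsCoprime.add_mul_left_left h2 k
    exact (IsCoprime.pow_left_iff two_pos).1 h1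
  have h1 : jacobiSym (4 * a) m = 1 := by
    rw [← jacobiSym.sq_one' (a := X) (b := m) (Int.isCoprime_iff_gcd_eq_one.1 hX)]
    exact jacobiSym.mod_left' (Int.ModEq.eq (Int.modEq_iff_dvd.2 h))
  rwa [jacobiSym.mul_left, jacobiSym.at_four hm, one_mul] at h1

theorem jacobiSym_eq_one_of_sq' {a X : ℤ} {m : ℕ} (ha : IsCoprime a m)
    (h : (m : ℤ) ∣ X ^ 2 - a) : jacobiSym a m = 1 := by
  have hX : IsCoprime X m := by
    have h1 : IsCoprime (X ^ 2) (m : ℤ) := by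
      obtain ⟨k, hk⟩ := h
      rw [show X ^ 2 = a + m * k by linear_combination hk]
      exact IsCoprime.add_mul_left_left ha k
    exact (IsCoprime.pow_left_iff two_pos).1 h1
  rw [← jacobiSym.sq_one' (a := X) (b := m) (Int.isCoprime_iff_gcd_eq_one.1 hX)]
  exact jacobiSym.mod_left' (Int.ModEq.eq (Int.modEq_iff_dvd.2 h))

theorem jacobiSym_eq_one_of_norm {E : ℤ} (hE : E % 4 = 1) {n : ℕ} (hn : Odd n)
    (hnE : IsCoprime (n : ℤ) E) {X : ℤ} (h : E ∣ X ^ 2 - 4 * n) : jacobiSym E n = 1 := by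
  rw [jacobiSym_natAbs hE hn]
  have hodd : Odd E.natAbs := Int.natAbs_odd.2 (Int.odd_iff.2 (by omega))
  refine jacobiSym_eq_one_of_sq hodd ?_ (Int.natAbs_dvd.2 h)
  rcases Int.natAbs_eq E with h1 | h1
  · rwa [← h1]
  · rw [h1] at hnE
    exact (IsCoprime.neg_right_iff _ _).1 hnE

/-- Product of two values of a form, as a norm form. -/
theorem BQF.four_mul_mul (Q : BQF) (x y x' y' : ℤ) :
    4 * (Q.a * x ^ 2 + Q.b * x * y + Q.c * y ^ 2) * (Q.a * x' ^ 2 + Q.b * x' * y' + Q.c * y' ^ 2) =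
      (2 * Q.a * x * x' + Q.b * (x * y' + x' * y) + 2 * Q.c * y * y') ^ 2 -
        Q.disc * (x * y' - x' * y) ^ 2 := by
  unfold BQF.disc
  ring

theorem BQF.Represents.jacobiSym_disc {Q : BQF} {l : ℕ} (hl : l.Prime)
    (h : Q.Represents l) (hld : ¬ (l : ℤ) ∣ Q.disc) : jacobiSym Q.disc l = 1 := by
  have hl' : Prime (l : ℤ) := Nat.prime_iff_prime_int.1 hl
  have : Fact l.Prime := ⟨hl⟩
  obtain ⟨x, y, h⟩ := h
  by_contra hne
  have h1 : jacobiSym Q.disc l = -1 := by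
    refine (jacobiSym.eq_one_or_neg_one ?_).resolve_left hne
    exact Int.isCoprime_iff_gcd_eq_one.1 ((hl'.coprime_iff_not_dvd).2 hld).symm
  have h2 := jacobiSym.prime_dvd_of_eq_neg_one h1 (x := 2 * Q.a * x + Q.b * y) (y := y)
    ⟨4 * Q.a, by unfold BQF.disc; linear_combination (4 * Q.a) * h⟩
  have h3 := jacobiSym.prime_dvd_of_eq_neg_one h1 (x := 2 * Q.c * y + Q.b * x) (y := x)
    ⟨4 * Q.c, by unfold BQF.disc; linear_combination (4 * Q.c) * h⟩
  obtain ⟨x', hx⟩ := h3.2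
  obtain ⟨y', hy⟩ := h2.2
  have h4 : (l : ℤ) * l ∣ l * 1 := ⟨Q.a * x' ^ 2 + Q.b * x' * y' + Q.c * y' ^ 2, by
    rw [hx, hy] at h
    linear_combination -h⟩
  have h5 : (l : ℤ) ∣ 1 := Int.dvd_of_mul_dvd_mul_left hl'.ne_zero h4
  exact hl'.not_isUnit (isUnit_of_dvd_one h5)

theorem sq_eq_one_of_jacobi {a : ℤ} {n : ℕ} (h : IsCoprime a n) :
    jacobiSym a n * jacobiSym a n = 1 := by
  rw [← sq]
  exact jacobiSym.sq_one (Int.isCoprime_iff_gcd_eq_one.1 h)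

theorem jacobi_eq_of_mul_eq_one {x y : ℤ} (hy : y * y = 1) (h : x * y = 1) : x = y := by
  linear_combination y * h - x * hy

theorem genus_dual_of_dvd {p : ℕ} (hp : p.Prime) (hp2 : p ≠ 2) {E E' : ℤ} (hE : E % 4 = 1)
    (hsq : Squarefree E) (hcop : IsCoprime E E') (hE' : ∃ s : ℤ, s ^ 2 ≡ E' [ZMOD (4 * p)])
    (hpE : (p : ℤ) ∣ E) {n : ℕ} (hn : Odd n) (hnE : IsCoprime (n : ℤ) E)
    {X Y : ℤ} (h : X ^ 2 - E * E' * Y ^ 2 = 4 * (p * n)) : jacobiSym E n = 1 := by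
  have hp' : Prime (p : ℤ) := Nat.prime_iff_prime_int.1 hp
  have hpodd : Odd p := hp.odd_of_ne_two hp2
  have hpe : jacobiSym E' p = 1 := by
    obtain ⟨s, hs⟩ := hE'
    refine jacobiSym_eq_one_of_sq' (X := s) (hcop.of_isCoprime_of_dvd_left hpE).symm ?_
    exact (dvd_mul_left (p : ℤ) 4).trans (Int.modEq_iff_dvd.1 hs.symm)
  obtain ⟨F, rfl⟩ := hpE
  have hpF : IsCoprime F (p : ℤ) := by
    refine ((hp'.coprime_iff_not_dvd).2 fun ⟨G, hG⟩ => ?_).symm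
    exact hp'.not_isUnit (hsq p ⟨G, by rw [hG]; ring⟩)
  have hnp : IsCoprime (n : ℤ) p := hnE.of_mul_right_left
  have hnF : IsCoprime (n : ℤ) F := hnE.of_mul_right_right
  obtain ⟨σ, hσ1, hσ4, hσ⟩ : ∃ σ : ℤ, (σ = 1 ∨ σ = -1) ∧ (σ * p) % 4 = 1 ∧
      jacobiSym (-σ) p = 1 := by
    rcases Nat.odd_mod_four_iff.1 (Nat.odd_iff.1 hpodd) with h1 | h3
    · exact ⟨1, Or.inl rfl, by omega, by
        rw [jacobiSym.at_neg_one hpodd, ZMod.χ₄_nat_one_mod_four h1]⟩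
    · exact ⟨-1, Or.inr rfl, by omega, by rw [neg_neg, jacobiSym.one_left]⟩
  have hσσ : σ * σ = 1 := by rcases hσ1 with rfl | rfl <;> rfl
  have hF4 : (σ * F) % 4 = 1 := by
    rw [show p * F = (σ * p) * (σ * F) by linear_combination (-p * F) * hσσ, Int.mul_emod,
      hσ4] at hE
    omega
  have hσu : IsUnit σ := IsUnit.of_mul_eq_one _ hσσ
  have e1 : jacobiSym (σ * p) n = jacobiSym n p := by
    rw [jacobiSym_natAbs hσ4 hn]
    congr 1
    rcases hσ1 with rfl | rfl <;> simp
  have hFodd : Odd (σ * F).natAbs := Int.natAbs_odd.2 (Int.odd_iff.2 (by omega))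
  have hcopF : ∀ a : ℤ, IsCoprime a F → IsCoprime a ((σ * F).natAbs : ℤ) := fun a ha => by
    rw [Int.natAbs_mul, Int.isUnit_iff_natAbs_eq.1 hσu, one_mul]
    rcases Int.natAbs_eq F with h1 | h1
    · rwa [← h1]
    · rw [h1] at ha
      exact (IsCoprime.neg_right_iff _ _).1 ha
  have e2 : jacobiSym (σ * F) n = jacobiSym (σ * F) p := by
    rw [jacobiSym_natAbs hF4 hn, jacobiSym_natAbs hF4 hpodd]
    have h1 : jacobiSym (n * p) (σ * F).natAbs = 1 := by
      refine jacobiSym_eq_one_of_sq (X := X) hFodd (hcopF _ (hnF.mul_left hpF.symm)) ?_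
      rw [Int.natAbs_dvd]
      exact ⟨σ * p * E' * Y ^ 2, by linear_combination h - p * F * E' * Y ^ 2 * hσσ⟩
    rw [jacobiSym.mul_left] at h1
    exact jacobi_eq_of_mul_eq_one (sq_eq_one_of_jacobi (hcopF _ hpF.symm)) h1
  have e3 : jacobiSym n p = jacobiSym (σ * F) p := by
    obtain ⟨X₁, rfl⟩ : (p : ℤ) ∣ X :=
      hp'.dvd_of_dvd_pow (n := 2) ⟨F * E' * Y ^ 2 + 4 * n, by linear_combination h⟩
    have h1 : 4 * n + F * E' * Y ^ 2 = p * X₁ ^ 2 :=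
      mul_left_cancel₀ hp'.ne_zero (by linear_combination -h)
    have h4p : IsCoprime (4 : ℤ) p := by
      have : Nat.Coprime 4 p := by
        rw [show 4 = 2 ^ 2 by norm_num]
        exact Nat.Coprime.pow_left 2 (Nat.coprime_two_left.2 hpodd)
      exact_mod_cast Nat.isCoprime_iff_coprime.2 this
    have hY : IsCoprime Y p := by
      refine ((hp'.coprime_iff_not_dvd).2 fun ⟨G, hG⟩ => ?_).symm
      have h2 : (p : ℤ) ∣ 4 * n := ⟨X₁ ^ 2 - F * E' * Y * G, by
        linear_combination h1 - F * E' * Y * hG⟩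
      exact hp'.not_isUnit ((h4p.mul_left hnp).isUnit_of_dvd' h2 dvd_rfl)
    have h2 : jacobiSym (4 * n) p = jacobiSym (-σ * (σ * F) * E' * Y ^ 2) p := by
      refine jacobiSym.mod_left' (Int.ModEq.eq (Int.modEq_iff_dvd.2 ⟨-X₁ ^ 2, ?_⟩))
      linear_combination -h1 - F * E' * Y ^ 2 * hσσ
    rw [jacobiSym.mul_left, jacobiSym.at_four hpodd, one_mul, jacobiSym.mul_left,
      jacobiSym.mul_left, jacobiSym.mul_left, hσ, hpe,
      jacobiSym.sq_one' (Int.isCoprime_iff_gcd_eq_one.1 hY)] at h2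
    linear_combination h2
  rw [show p * F = (σ * p) * (σ * F) by linear_combination (-p * F) * hσσ, jacobiSym.mul_left, e1,
    e2, e3]
  refine sq_eq_one_of_jacobi ?_
  rcases hσ1 with rfl | rfl
  · simpa using hpF
  · simpa using hpF.neg_left

theorem genus_dual_one {p : ℕ} (hp : p.Prime) {E E' : ℤ} (hE : E % 4 = 1)
    (hsq : Squarefree E) (hcop : IsCoprime E E') (hEs : ∃ s : ℤ, s ^ 2 ≡ E [ZMOD (4 * p)])
    (hE' : ∃ s : ℤ, s ^ 2 ≡ E' [ZMOD (4 * p)]) {n : ℕ} (hn : Odd n) (hnE : IsCoprime (n : ℤ) E)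
    {X Y : ℤ} (h : X ^ 2 - E * E' * Y ^ 2 = 4 * (p * n)) : jacobiSym E n = 1 := by
  have hp' : Prime (p : ℤ) := Nat.prime_iff_prime_int.1 hp
  have hdvd : E ∣ X ^ 2 - 4 * (n * p) := ⟨E' * Y ^ 2, by linear_combination h⟩
  by_cases hpE : (p : ℤ) ∣ E
  · rcases eq_or_ne p 2 with rfl | hp2
    · omega
    · exact genus_dual_of_dvd hp hp2 hE hsq hcop hE' hpE hn hnE h
  have hpE' : IsCoprime (p : ℤ) E := (hp'.coprime_iff_not_dvd).2 hpE
  obtain ⟨s, hs⟩ := hEs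
  rcases eq_or_ne p 2 with rfl | hp2
  · have hE8 : E % 8 = 1 := by
      have h8 : s ^ 2 % 8 = E % 8 := hs
      rw [pow_two, Int.mul_emod] at h8
      have : s % 8 = 0 ∨ s % 8 = 1 ∨ s % 8 = 2 ∨ s % 8 = 3 ∨ s % 8 = 4 ∨ s % 8 = 5 ∨ s % 8 = 6 ∨
        s % 8 = 7 := by omega
      rcases this with h | h | h | h | h | h | h | h <;> rw [h] at h8 <;> norm_num at h8 <;> omega
    have hodd : Odd E.natAbs := Int.natAbs_odd.2 (Int.odd_iff.2 (by omega))
    have hc : ∀ a : ℤ, IsCoprime a E → IsCoprime a (E.natAbs : ℤ) := fun a ha => by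
      rcases Int.natAbs_eq E with h1 | h1
      · rwa [← h1]
      · rw [h1] at ha
        exact (IsCoprime.neg_right_iff _ _).1 ha
    have h1 := jacobiSym_eq_one_of_sq (X := X) hodd (hc _ (hnE.mul_left hpE'))
      (Int.natAbs_dvd.2 hdvd)
    have h2 : jacobiSym ((2 : ℕ) : ℤ) E.natAbs = 1 := by
      rw [Nat.cast_ofNat, jacobiSym.at_two hodd, ZMod.χ₈_nat_eq_if_mod_eight]
      have : E.natAbs % 8 = 1 ∨ E.natAbs % 8 = 7 := by omega
      rw [if_neg (by omega), if_pos this]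
    rw [jacobiSym_natAbs hE hn]
    rwa [jacobiSym.mul_left, h2, mul_one] at h1
  · have h1 : jacobiSym E (n * p) = 1 := by
      refine jacobiSym_eq_one_of_norm (X := X) hE (hn.mul (hp.odd_of_ne_two hp2)) ?_ ?_
      · push_cast; exact hnE.mul_left hpE'
      · push_cast; exact hdvd
    have h2 : jacobiSym E p = 1 :=
      jacobiSym_eq_one_of_sq' (X := s) hpE'.symm
        ((dvd_mul_left (p : ℤ) 4).trans (Int.modEq_iff_dvd.1 hs.symm))
    rwa [jacobiSym.mul_right' E (by rintro rfl; simp at hn) hp.ne_zero, h2, mul_one] at h1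

theorem prim_of_isFundamentalDiscriminant {D d : ℤ} (hD : IsFundamentalDiscriminant D)
    (hd : IsFundamentalDiscriminant (-d)) (hcop : IsCoprime D d) : Prim (-(d * D)) := by
  intro Q hQ g ha hb hc
  by_contra hg
  have hΔ : -(d * D) ≠ 0 := by
    rcases hD with h | h <;> rcases hd with h' | h' <;>
      refine neg_ne_zero.2 (mul_ne_zero ?_ ?_) <;> rintro rfl <;> simp at h h'
  have hg0 : g ≠ 0 := by
    rintro rfl
    rw [zero_dvd_iff] at ha hb
    apply hΔ
    rw [← hQ, BQF.disc, ha, hb]; ring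
  obtain ⟨r, hr, hrg⟩ := WfDvdMonoid.exists_irreducible_factor hg hg0
  have hr' : Prime r := hr.prime
  obtain ⟨a, ha⟩ := hrg.trans ha
  obtain ⟨b, hb⟩ := hrg.trans hb
  obtain ⟨c, hc⟩ := hrg.trans hc
  have h1 : -(d * D) = r ^ 2 * (b ^ 2 - 4 * a * c) := by
    rw [← hQ, BQF.disc, ha, hb, hc]; ring
  have key : ∀ F F' : ℤ, IsFundamentalDiscriminant F → IsCoprime F F' →
      F * F' = r ^ 2 * (b ^ 2 - 4 * a * c) → (F' % 2 = 0 ∨ F' % 4 = 1) → r ∣ F → False := by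
    intro F F' hF hFF h h2 hrF
    have hrF' : IsCoprime (r ^ 2) F' := (hFF.of_isCoprime_of_dvd_left hrF).pow_left
    have h3 : r ^ 2 ∣ F := hrF'.dvd_of_dvd_mul_right ⟨_, h⟩
    rcases hF with ⟨_, hF⟩ | ⟨h0, hF, h4⟩
    · exact hr.not_isUnit (hF r (by rwa [← sq]))
    · obtain ⟨G, hG⟩ : (4 : ℤ) ∣ F := Int.dvd_of_emod_eq_zero h0
      have hG' : F / 4 = G := by omega
      rw [hG'] at hF h4
      have hF'2 : F' % 4 = 1 := by
        refine h2.resolve_left fun h2 => ?_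
        have := hFF.isUnit_of_dvd' (x := 2) (by omega) (by omega)
        exact absurd this (by decide)
      by_cases hr2 : r ∣ 2
      · have hr4 : r ^ 2 = 4 := by
          have h := Int.associated_iff_natAbs.1 (hr'.associated_of_dvd Int.prime_two hr2)
          rcases Int.natAbs_eq r with h' | h' <;> rw [h', h] <;> rfl
        rw [hr4, hG] at h
        have h5 : G * F' = b ^ 2 - 4 * (a * c) := by linarith
        have h6 : G * F' % 4 = G % 4 := by rw [Int.mul_emod, hF'2]; omega
        have h7 : b ^ 2 % 4 = 0 ∨ b ^ 2 % 4 = 1 := by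
          rcases Int.even_or_odd' b with ⟨k, rfl | rfl⟩
          · left; ring_nf; omega
          · right; ring_nf; omega
        omega
      · have hr4 : IsCoprime (r ^ 2) (4 : ℤ) := by
          rw [show (4 : ℤ) = 2 ^ 2 by norm_num]
          exact ((hr'.coprime_iff_not_dvd).2 hr2).pow
        rw [hG] at h3
        exact hr.not_isUnit (hF r (by rw [← sq]; exact hr4.dvd_of_dvd_mul_left h3))
  have hpar : ∀ F : ℤ, IsFundamentalDiscriminant F → F % 2 = 0 ∨ F % 4 = 1 := by
    rintro F (h | h) <;> omega
  have hrd : r ∣ -(d * D) := h1 ▸ (dvd_pow_self r two_ne_zero).mul_right _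
  rcases hr'.dvd_or_dvd ((dvd_neg).1 hrd) with h | h
  · exact key (-d) D hd hcop.symm.neg_left (by linear_combination h1) (hpar D hD) ((dvd_neg).2 h)
  · exact key D (-d) hD hcop.neg_right (by linear_combination h1) (hpar _ hd) h

theorem exists_odd_part {D d : ℤ} (hD : IsFundamentalDiscriminant D)
    (hd : IsFundamentalDiscriminant (-d)) (hcop : IsCoprime D d) {m : ℤ}
    (hDsq : ∃ s : ℤ, s ^ 2 ≡ D [ZMOD m]) (hdsq : ∃ s : ℤ, s ^ 2 ≡ -d [ZMOD m]) :
    ∃ E E' : ℤ, E * E' = -(d * D) ∧ E % 4 = 1 ∧ Squarefree E ∧ IsCoprime E E' ∧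
      (∃ s : ℤ, s ^ 2 ≡ E [ZMOD m]) ∧ (∃ s : ℤ, s ^ 2 ≡ E' [ZMOD m]) ∧
      ∀ n : ℕ, jacobiSym (-(d * D)) n = 1 → jacobiSym D n = jacobiSym E n := by
  by_cases h2 : D % 4 = 1
  · refine ⟨D, -d, by ring, h2, ?_, hcop.neg_right, hDsq, hdsq, fun n _ => rfl⟩
    rcases hD with h | h
    · exact h.2
    · omega
  · have hd2 : (-d) % 4 = 1 := by
      rcases hd with h | h
      · exact h.1
      · rcases hD with h' | h'
        · omega
        · exact absurd (hcop.isUnit_of_dvd' (x := 2) (by omega) (by omega)) (by decide)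
    refine ⟨-d, D, by ring, hd2, ?_, hcop.symm.neg_left, hdsq, hDsq, fun n hn => ?_⟩
    · rcases hd with h | h
      · exact h.2
      · omega
    · rw [show -(d * D) = D * -d by ring, jacobiSym.mul_left] at hn
      rcases jacobiSym.trichotomy (-d) n with h | h | h <;> rw [h] at hn ⊢ <;> linarith

section Genus

variable {E E' N : ℤ} {χ : BQF → ℤ}

theorem genus_of_eqv {p : ℕ} (hrep : ∀ Q : BQF, Q.mem N → ∀ B : ℕ, ∃ l > B, l.Prime ∧ Q.Represents l)
    (hN : 0 < N)
    (hχ : ∀ Q : BQF, Q.mem N → ∀ l : ℕ, l.Prime → l ≠ 2 → Q.Represents l → ¬ (l : ℤ) ∣ N →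
      χ Q = jacobiSym E l) {Q Q' : BQF} (hQ : Q.mem N) (hQ' : Q'.mem N) (h : BQF.Eqv p Q Q') :
    χ Q' = χ Q := by
  obtain ⟨l, hlB, hl, hrep⟩ := hrep Q' hQ' (2 + N.natAbs)
  have hlN : ¬ (l : ℤ) ∣ N := fun h => by
    have := Int.le_of_dvd hN h
    omega
  rw [hχ Q' hQ' l hl (by omega) hrep hlN, hχ Q hQ l hl (by omega) ?_ hlN]
  obtain ⟨x, y, z, w, hdet, rfl⟩ := h
  obtain ⟨u, v, huv⟩ := hrep
  exact ⟨x * u + y * v, p * z * u + w * v, by rw [← huv]; simp only [BQF.subst]; ring⟩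

theorem genus_shift (hrep : ∀ Q : BQF, Q.mem N → ∀ B : ℕ, ∃ l > B, l.Prime ∧ Q.Represents l)
    (hN : 0 < N) (hE : E % 4 = 1) (hEE' : E * E' = -N)
    (hχ : ∀ Q : BQF, Q.mem N → ∀ l : ℕ, l.Prime → l ≠ 2 → Q.Represents l → ¬ (l : ℤ) ∣ N →
      χ Q = jacobiSym E l) {q : ℕ} (hq : q.Prime) (hq2 : q ≠ 2) (hqN : ¬ (q : ℤ) ∣ -N)
    {Q : BQF} (hQ : Q.mem N) (hqc : (q : ℤ) ∣ Q.c) (hQ' : (Q.shift q).mem N) :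
    χ (Q.shift q) = jacobiSym E q * χ Q := by
  obtain ⟨l, hlB, hl, x, y, hxy⟩ := hrep Q hQ (2 + N.natAbs)
  obtain ⟨l', hlB', hl', x', y', hxy'⟩ := hrep _ hQ' (2 + N.natAbs)
  have hN' : ∀ l : ℕ, l > 2 + N.natAbs → ¬ (l : ℤ) ∣ N := fun l hl h => by
    have := Int.le_of_dvd hN h
    omega
  rw [hχ Q hQ l hl (by omega) ⟨x, y, hxy⟩ (hN' l hlB),
    hχ _ hQ' l' hl' (by omega) ⟨x', y', hxy'⟩ (hN' l' hlB')]
  have hc : ∀ l : ℕ, l.Prime → ¬ (l : ℤ) ∣ N → IsCoprime (l : ℤ) E := fun l hl h =>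
    ((Nat.prime_iff_prime_int.1 hl).coprime_iff_not_dvd).2 fun h' => h <| by
      rw [← dvd_neg, ← hEE']; exact h'.mul_right _
  have h1 := hc l hl (hN' l hlB)
  have h2 := hc l' hl' (hN' l' hlB')
  have h3 := hc q hq (by rwa [dvd_neg] at hqN)
  have h4 : jacobiSym E (l * l' * q) = 1 := by
    refine jacobiSym_eq_one_of_norm (X := 2 * Q.a * x * (q * x') + Q.b * (x * y' + (q * x') * y)
      + 2 * Q.c * y * y') hE ((hl.odd_of_ne_two (by omega)).mul
      (hl'.odd_of_ne_two (by omega)) |>.mul (hq.odd_of_ne_two hq2)) ?_ ?_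
    · push_cast; exact (h1.mul_left h2).mul_left h3
    · have h5 := Q.four_mul_mul x y (q * x') y'
      rw [hQ.2] at h5
      have h6 : Q.a * (q * x') ^ 2 + Q.b * (q * x') * y' + Q.c * y' ^ 2 = q * l' := by
        rw [← hxy']
        simp only [BQF.shift]
        linear_combination (-y' ^ 2) * Int.mul_ediv_cancel' hqc
      rw [hxy, h6] at h5
      refine ⟨E' * (x * y' - q * x' * y) ^ 2, ?_⟩
      push_cast
      linear_combination -h5 - (x * y' - q * x' * y) ^ 2 * hEE'
  have hz : ∀ l : ℕ, l.Prime → NeZero l := fun l hl => ⟨hl.ne_zero⟩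
  have := hz l hl; have := hz l' hl'; have := hz q hq
  rw [jacobiSym.mul_right, jacobiSym.mul_right] at h4
  have s1 := sq_eq_one_of_jacobi h1.symm
  have s2 := sq_eq_one_of_jacobi h2.symm
  have s3 := sq_eq_one_of_jacobi h3.symm
  refine jacobi_eq_of_mul_eq_one (y := jacobiSym E q * jacobiSym E l) ?_ ?_
  · linear_combination jacobiSym E l * jacobiSym E l * s3 + s1
  · linear_combination h4

theorem genus_dual {p : ℕ} (hp : p.Prime)
    (hrep : ∀ Q : BQF, Q.mem N → ∀ B : ℕ, ∃ l > B, l.Prime ∧ Q.Represents l)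
    (hN : 0 < N) (hE : E % 4 = 1) (hsq : Squarefree E) (hcop : IsCoprime E E')
    (hEs : ∃ s : ℤ, s ^ 2 ≡ E [ZMOD (4 * p)]) (hE' : ∃ s : ℤ, s ^ 2 ≡ E' [ZMOD (4 * p)])
    (hEE' : E * E' = -N)
    (hχ : ∀ Q : BQF, Q.mem N → ∀ l : ℕ, l.Prime → l ≠ 2 → Q.Represents l → ¬ (l : ℤ) ∣ N →
      χ Q = jacobiSym E l)
    {Q : BQF} (hQ : Q.mem N) (hpa : (p : ℤ) ∣ Q.a) (hQ' : (Q.dual p).mem N) :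
    χ (Q.dual p) = χ Q := by
  obtain ⟨l, hlB, hl, x, y, hxy⟩ := hrep Q hQ (2 + N.natAbs)
  obtain ⟨l', hlB', hl', x', y', hxy'⟩ := hrep _ hQ' (2 + N.natAbs)
  have hN' : ∀ l : ℕ, l > 2 + N.natAbs → ¬ (l : ℤ) ∣ N := fun l hl h => by
    have := Int.le_of_dvd hN h
    omega
  rw [hχ Q hQ l hl (by omega) ⟨x, y, hxy⟩ (hN' l hlB),
    hχ _ hQ' l' hl' (by omega) ⟨x', y', hxy'⟩ (hN' l' hlB')]
  have hc : ∀ l : ℕ, l.Prime → ¬ (l : ℤ) ∣ N → IsCoprime (l : ℤ) E := fun l hl h =>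
    ((Nat.prime_iff_prime_int.1 hl).coprime_iff_not_dvd).2 fun h' => h <| by
      rw [← dvd_neg, ← hEE']; exact h'.mul_right _
  have h1 := hc l hl (hN' l hlB)
  have h2 := hc l' hl' (hN' l' hlB')
  have h4 : jacobiSym E (l * l') = 1 := by
    have h5 := Q.four_mul_mul x y y' (p * x')
    rw [hQ.2] at h5
    have h6 : Q.a * y' ^ 2 + Q.b * y' * (p * x') + Q.c * (p * x') ^ 2 = p * l' := by
      rw [← hxy']
      simp only [BQF.dual]
      linear_combination (-y' ^ 2) * Int.mul_ediv_cancel' hpa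
    rw [hxy, h6] at h5
    refine genus_dual_one hp hE hsq hcop hEs hE' (X := 2 * Q.a * x * y' +
      Q.b * (x * (p * x') + y' * y) + 2 * Q.c * y * (p * x')) (Y := x * (p * x') - y' * y)
      ((hl.odd_of_ne_two (by omega)).mul (hl'.odd_of_ne_two (by omega))) ?_ ?_
    · push_cast; exact h1.mul_left h2
    · push_cast
      linear_combination -h5 - (x * (p * x') - y' * y) ^ 2 * hEE'
  have hz : ∀ l : ℕ, l.Prime → NeZero l := fun l hl => ⟨hl.ne_zero⟩
  have := hz l hl; have := hz l' hl'
  rw [jacobiSym.mul_right] at h4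
  refine jacobi_eq_of_mul_eq_one (sq_eq_one_of_jacobi h1.symm) ?_
  linear_combination h4

end Genus

theorem hasSum_of_eq {ι : Type*} {f g : ι → ℂ} {a : ℂ} (h : ∀ i, f i = g i) (hf : HasSum f a) :
    HasSum g a := (funext h : f = g) ▸ hf

section Epstein

variable {A B C : ℝ}

/-- A real binary quadratic form, as a function on `ℤ × ℤ`. -/
def rForm (A B C : ℝ) (v : ℤ × ℤ) : ℝ := A * v.1 ^ 2 + B * v.1 * v.2 + C * v.2 ^ 2

theorem rForm_lower (hA : 0 < A) (h : 4 * A * C - B ^ 2 = 4) :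
    0 < A + C ∧ ∀ v, (1 / (A + C)) * ((v.1 : ℝ) ^ 2 + (v.2 : ℝ) ^ 2) ≤ rForm A B C v := by
  have hC : 0 < C := by nlinarith [sq_nonneg B]
  refine ⟨by positivity, fun v => ?_⟩
  rw [one_div, inv_mul_le_iff₀ (by positivity), rForm]
  nlinarith [sq_nonneg (A * v.1 + B / 2 * v.2), sq_nonneg (B / 2 * v.1 + C * v.2)]

theorem summable_exp_sq {c : ℝ} (hc : 0 < c) : Summable fun n : ℤ => Real.exp (-c * (n : ℝ) ^ 2) := by
  have h := (summable_jacobiTheta₂_term_iff 0 (I * (c / Real.pi : ℝ))).2 (by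
    simp only [mul_im, I_re, ofReal_im, mul_zero, I_im, ofReal_re, one_mul, zero_add]
    positivity)
  refine h.norm.congr fun n => ?_
  rw [norm_jacobiTheta₂_term]
  congr 1
  simp only [mul_im, I_re, ofReal_im, mul_zero, I_im, ofReal_re, one_mul, zero_add, zero_im,
    sub_zero]
  field_simp
  try ring

theorem summable_exp_sq_prod {c c' : ℝ} (hc : 0 < c) (hc' : 0 < c') :
    Summable fun v : ℤ × ℤ => Real.exp (-c * (v.1 : ℝ) ^ 2) * Real.exp (-c' * (v.2 : ℝ) ^ 2) :=
  (summable_exp_sq hc).mul_of_nonneg (summable_exp_sq hc') (fun _ => (Real.exp_pos _).le)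
    fun _ => (Real.exp_pos _).le

theorem summable_exp_rForm (hA : 0 < A) (h : 4 * A * C - B ^ 2 = 4) {t : ℝ} (ht : 0 < t) :
    Summable fun v : ℤ × ℤ => Real.exp (-Real.pi * rForm A B C v * t) := by
  obtain ⟨hAC, hQ⟩ := rForm_lower hA h
  have hc : 0 < Real.pi * t * (1 / (A + C)) := by positivity
  refine (summable_exp_sq_prod hc hc).of_nonneg_of_le (fun _ => (Real.exp_pos _).le) fun v => ?_
  rw [← Real.exp_add]
  gcongr
  have := mul_le_mul_of_nonneg_left (hQ v) (by positivity : 0 ≤ Real.pi * t)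
  linarith

/-- The theta function of a binary form. -/
noncomputable def rTheta (A B C : ℝ) (t : ℝ) : ℂ :=
  ∑' v : ℤ × ℤ, (Real.exp (-Real.pi * rForm A B C v * t) : ℂ)

theorem hasSum_rTheta (hA : 0 < A) (h : 4 * A * C - B ^ 2 = 4) {t : ℝ} (ht : 0 < t) :
    HasSum (fun v : ℤ × ℤ => (Real.exp (-Real.pi * rForm A B C v * t) : ℂ)) (rTheta A B C t) :=
  (summable_ofReal.2 (summable_exp_rForm hA h ht)).hasSum

theorem neg_I_mul_I_mul_cpow {x : ℝ} (hx : 0 < x) :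
    (-I * (I * x)) ^ (1 / 2 : ℂ) = (Real.sqrt x : ℂ) := by
  rw [show -I * (I * x) = (x : ℂ) by linear_combination (-x : ℂ) * I_mul_I, Real.sqrt_eq_rpow,
    ofReal_cpow hx.le]
  norm_num

/-- The mixed terms occurring after Poisson summation in one variable. -/
noncomputable def rMixed (A B t : ℝ) (y n : ℤ) : ℂ :=
  cexp (-Real.pi * (t / A) * y ^ 2) * cexp (2 * Real.pi * I * n * (B * y / (2 * A))) *
    cexp (-Real.pi * n ^ 2 / (t * A))

theorem tsum_fst (hA : 0 < A) (h : 4 * A * C - B ^ 2 = 4) {t : ℝ} (ht : 0 < t) (y : ℤ) :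
    ∑' x : ℤ, (Real.exp (-Real.pi * rForm A B C (x, y) * t) : ℂ) =
      (1 / Real.sqrt (t * A) : ℂ) * ∑' n : ℤ, rMixed A B t y n := by
  have hAc : (A : ℂ) ≠ 0 := by exact_mod_cast hA.ne'
  have htc : (t : ℂ) ≠ 0 := by exact_mod_cast ht.ne'
  have h4 : 4 * (A : ℂ) * C - B ^ 2 = 4 := by exact_mod_cast h
  have h1 : ∑' x : ℤ, (Real.exp (-Real.pi * rForm A B C (x, y) * t) : ℂ) =
      cexp (-Real.pi * C * y ^ 2 * t) * jacobiTheta₂ (I * (t * B * y / 2)) (I * (t * A : ℝ)) := by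
    rw [jacobiTheta₂, ← tsum_mul_left]
    refine tsum_congr fun x => ?_
    rw [jacobiTheta₂_term, ← Complex.exp_add, ofReal_exp, rForm]
    congr 1
    push_cast
    linear_combination (-Real.pi * x * t * B * y - Real.pi * x ^ 2 * t * A) * I_mul_I
  rw [h1, jacobiTheta₂_functional_equation, neg_I_mul_I_mul_cpow (by positivity : 0 < t * A),
    jacobiTheta₂, ← tsum_mul_left, ← tsum_mul_left, ← tsum_mul_left]
  refine tsum_congr fun n => ?_
  rw [rMixed, jacobiTheta₂_term, mul_left_comm, mul_assoc, mul_assoc, ← Complex.exp_add,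
    ← Complex.exp_add, ← Complex.exp_add, ← Complex.exp_add]
  congr 2
  push_cast
  field_simp
  linear_combination (-((t : ℂ) ^ 2 * y ^ 2)) * h4 - (t : ℂ) ^ 2 * B ^ 2 * y ^ 2 * I_sq

theorem tsum_snd (hA : 0 < A) (h : 4 * A * C - B ^ 2 = 4) {t : ℝ} (ht : 0 < t) (n : ℤ) :
    ∑' y : ℤ, rMixed A B t y n = (1 / Real.sqrt (t / A) : ℂ) *
      ∑' m : ℤ, (Real.exp (-Real.pi * rForm A B C (m, -n) * (1 / t)) : ℂ) := by
  have hAc : (A : ℂ) ≠ 0 := by exact_mod_cast hA.ne'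
  have htc : (t : ℂ) ≠ 0 := by exact_mod_cast ht.ne'
  have h4 : 4 * (A : ℂ) * C - B ^ 2 = 4 := by exact_mod_cast h
  have h1 : ∑' y : ℤ, rMixed A B t y n =
      cexp (-Real.pi * n ^ 2 / (t * A)) * jacobiTheta₂ (n * B / (2 * A)) (I * (t / A : ℝ)) := by
    rw [jacobiTheta₂, ← tsum_mul_left]
    refine tsum_congr fun x => ?_
    rw [jacobiTheta₂_term, ← Complex.exp_add, rMixed, ← Complex.exp_add, ← Complex.exp_add]
    congr 1
    push_cast
    linear_combination (-Real.pi * x ^ 2 * t / A) * I_mul_I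
  rw [h1, jacobiTheta₂_functional_equation, neg_I_mul_I_mul_cpow (by positivity : 0 < t / A),
    jacobiTheta₂, ← tsum_mul_left, ← tsum_mul_left, ← tsum_mul_left]
  refine tsum_congr fun m => ?_
  rw [jacobiTheta₂_term, mul_left_comm, mul_assoc, ← Complex.exp_add, ← Complex.exp_add,
    ofReal_exp, rForm]
  congr 2
  push_cast
  field_simp
  linear_combination (n : ℂ) ^ 2 * h4

theorem summable_rMixed (hA : 0 < A) {t : ℝ} (ht : 0 < t) :
    Summable fun v : ℤ × ℤ => rMixed A B t v.1 v.2 := by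
  refine Summable.of_norm ((summable_exp_sq_prod (c := Real.pi * (t / A))
    (c' := Real.pi / (t * A)) (by positivity) (by positivity)).congr fun v => ?_)
  rw [rMixed, norm_mul, norm_mul, Complex.norm_exp, Complex.norm_exp, Complex.norm_exp]
  have e1 : (-Real.pi * (t / A) * v.1 ^ 2 : ℂ) = ((-(Real.pi * (t / A)) * v.1 ^ 2 : ℝ) : ℂ) := by
    push_cast; ring
  have e2 : (2 * Real.pi * I * v.2 * (B * v.1 / (2 * A)) : ℂ) =
      ((2 * Real.pi * v.2 * (B * v.1 / (2 * A)) : ℝ) : ℂ) * I := by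
    push_cast; ring
  have e3 : (-Real.pi * v.2 ^ 2 / (t * A) : ℂ) = ((-(Real.pi / (t * A)) * v.2 ^ 2 : ℝ) : ℂ) := by
    push_cast; ring
  rw [e1, e2, e3, ofReal_re, ofReal_re, re_ofReal_mul, I_re, mul_zero, Real.exp_zero, mul_one]

theorem tsum_prod_swap {f : ℤ × ℤ → ℂ} (hf : Summable f) :
    ∑' v, f v = ∑' y : ℤ, ∑' x : ℤ, f (x, y) := by
  rw [← (Equiv.prodComm ℤ ℤ).tsum_eq f]
  exact ((Equiv.prodComm ℤ ℤ).summable_iff.2 hf).tsum_prod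

theorem tsum_neg_snd (f : ℤ → ℂ) : ∑' n, f (-n) = ∑' n, f n := (Equiv.neg ℤ).tsum_eq f

theorem rTheta_one_div (hA : 0 < A) (h : 4 * A * C - B ^ 2 = 4) {t : ℝ} (ht : 0 < t) :
    rTheta A B C (1 / t) = t * rTheta A B C t := by
  have hA' : 0 ≤ A := hA.le
  have hsum := (hasSum_rTheta hA h (one_div_pos.2 ht)).summable
  have hsq : (1 / Real.sqrt (t * A) : ℂ) * (1 / Real.sqrt (t / A) : ℂ) = 1 / t := by
    rw [div_mul_div_comm, one_mul, ← ofReal_mul, ← Real.sqrt_mul (by positivity),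
      show t * A * (t / A) = t * t by field_simp, Real.sqrt_mul_self ht.le]
  have h1 : rTheta A B C t = ∑' y : ℤ, ∑' x : ℤ,
      (Real.exp (-Real.pi * rForm A B C (x, y) * t) : ℂ) := by
    have hs := (hasSum_rTheta hA h ht).summable
    rw [rTheta, tsum_prod_swap hs]
  have h2 : rTheta A B C (1 / t) = ∑' n : ℤ, ∑' m : ℤ,
      (Real.exp (-Real.pi * rForm A B C (m, -n) * (1 / t)) : ℂ) := by
    rw [rTheta, tsum_prod_swap hsum, ← tsum_neg_snd]
  have key : rTheta A B C t = (1 / t : ℂ) * rTheta A B C (1 / t) := by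
    rw [h1, h2]
    simp only [tsum_fst hA h ht]
    rw [tsum_mul_left, ← Summable.tsum_comm (f := fun y n => rMixed A B t y n) (summable_rMixed hA ht)]
    simp only [tsum_snd hA h ht]
    rw [tsum_mul_left, ← mul_assoc, hsq]
  have htc : (t : ℂ) ≠ 0 := by exact_mod_cast ht.ne'
  rw [key]
  field_simp

theorem continuousOn_rTheta (hA : 0 < A) (h : 4 * A * C - B ^ 2 = 4) :
    ContinuousOn (rTheta A B C) (Set.Ioi 0) := by
  obtain ⟨hAC, hQ⟩ := rForm_lower hA h
  intro t ht
  rw [Set.mem_Ioi] at ht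
  have h2 : 0 < t / 2 := by linarith
  have h1 : ContinuousOn (rTheta A B C) (Set.Ioi (t / 2)) := by
    refine continuousOn_tsum (fun v => ?_) (summable_exp_rForm hA h h2) fun v x hx => ?_
    · fun_prop
    · rw [norm_real, Real.norm_eq_abs, Real.abs_exp, Real.exp_le_exp]
      have h3 : 0 ≤ rForm A B C v := le_trans (by positivity) (hQ v)
      have := mul_le_mul_of_nonneg_left (Set.mem_Ioi.1 hx).le (mul_nonneg Real.pi_pos.le h3)
      linarith
  exact (h1.continuousAt (Ioi_mem_nhds (by linarith))).continuousWithinAt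

theorem rTheta_sub_one (hA : 0 < A) (h : 4 * A * C - B ^ 2 = 4) {t : ℝ} (ht : 0 < t) :
    HasSum (fun v : ℤ × ℤ => (if v = 0 then 0 else 1) *
      (Real.exp (-Real.pi * rForm A B C v * t) : ℂ)) (rTheta A B C t - 1) := by
  have h1 := hasSum_ite_sub_hasSum (hasSum_rTheta hA h ht) 0
  have h0 : (Real.exp (-Real.pi * rForm A B C 0 * t) : ℂ) = 1 := by simp [rForm]
  rw [h0] at h1
  exact hasSum_of_eq (fun v => by split_ifs <;> simp) h1

theorem rForm_pos (hA : 0 < A) (h : 4 * A * C - B ^ 2 = 4) {v : ℤ × ℤ} (hv : v ≠ 0) :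
    1 / (A + C) ≤ rForm A B C v := by
  obtain ⟨hAC, hQ⟩ := rForm_lower hA h
  refine le_trans ?_ (hQ v)
  refine le_mul_of_one_le_right (by positivity) ?_
  have : 1 ≤ v.1 ^ 2 + v.2 ^ 2 := by
    by_contra hlt
    have h1 : v.1 ^ 2 = 0 := by nlinarith [sq_nonneg v.1, sq_nonneg v.2]
    have h2 : v.2 ^ 2 = 0 := by nlinarith [sq_nonneg v.1, sq_nonneg v.2]
    exact hv (Prod.ext (pow_eq_zero_iff two_ne_zero |>.1 h1) (pow_eq_zero_iff two_ne_zero |>.1 h2))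
  exact_mod_cast this

theorem isBigO_rTheta (hA : 0 < A) (h : 4 * A * C - B ^ 2 = 4) (r : ℝ) :
    (fun t => rTheta A B C t - 1) =O[Filter.atTop] fun t : ℝ => t ^ r := by
  obtain ⟨hAC, hQ⟩ := rForm_lower hA h
  set c := Real.pi * (1 / (A + C)) with hc
  have hc0 : 0 < c := by positivity
  have h1 : (fun t => rTheta A B C t - 1) =O[Filter.atTop] fun t : ℝ => Real.exp (-c * t) := by
    refine Asymptotics.IsBigO.of_bound
      (∑' v : ℤ × ℤ, Real.exp (-Real.pi * rForm A B C v * 1) * Real.exp c) ?_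
    filter_upwards [Filter.eventually_ge_atTop 1] with t ht
    rw [← (rTheta_sub_one hA h (by linarith)).tsum_eq, ← tsum_mul_right]
    refine tsum_of_norm_bounded (((summable_exp_rForm hA h one_pos).mul_right _).mul_right
      _).hasSum fun v => ?_
    rw [Real.norm_eq_abs, Real.abs_exp, ← Real.exp_add, ← Real.exp_add]
    split_ifs with hv
    · rw [zero_mul, norm_zero]; positivity
    · rw [one_mul, norm_real, Real.norm_eq_abs, Real.abs_exp, Real.exp_le_exp]
      have h2 := rForm_pos hA h hv
      have h3 : c ≤ Real.pi * rForm A B C v := mul_le_mul_of_nonneg_left h2 Real.pi_pos.le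
      nlinarith
  exact h1.trans (isLittleO_exp_neg_mul_rpow_atTop hc0 r).isBigO

/-- The functional equation of the theta function of a binary form. -/
noncomputable def rPair (hA : 0 < A) (h : 4 * A * C - B ^ 2 = 4) : WeakFEPair ℂ where
  f := rTheta A B C
  g := rTheta A B C
  k := 1
  ε := 1
  f₀ := 1
  g₀ := 1
  hf_int := (continuousOn_rTheta hA h).locallyIntegrableOn measurableSet_Ioi
  hg_int := (continuousOn_rTheta hA h).locallyIntegrableOn measurableSet_Ioi
  hk := one_pos
  hε := one_ne_zero
  h_feq := fun t ht => by
    rw [rTheta_one_div hA h ht, Real.rpow_one, one_mul, smul_eq_mul]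
  hf_top := isBigO_rTheta hA h
  hg_top := isBigO_rTheta hA h

theorem summable_rForm (hA : 0 < A) (h : 4 * A * C - B ^ 2 = 4) {σ : ℝ} (hσ : 1 < σ) :
    Summable fun v : ℤ × ℤ => (if v = 0 then (0 : ℝ) else 1) / rForm A B C v ^ σ := by
  obtain ⟨hAC, hQ⟩ := rForm_lower hA h
  have h1 := (finTwoArrowEquiv ℤ).symm.summable_iff.2
    (EisensteinSeries.summable_one_div_norm_rpow (k := 2 * σ) (by linarith))
  refine (h1.mul_left ((A + C) ^ σ)).of_nonneg_of_le (fun v => ?_) fun v => ?_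
  · split_ifs with hv
    · simp
    · have := (rForm_pos hA h hv).trans' (by positivity : 0 ≤ 1 / (A + C))
      positivity
  · split_ifs with hv
    · rw [zero_div]
      exact mul_nonneg (Real.rpow_nonneg hAC.le _) (Real.rpow_nonneg (norm_nonneg _) _)
    · set w := (finTwoArrowEquiv ℤ).symm v with hw
      have hw0 : w ≠ 0 := fun h0 => hv (by
        rw [← (finTwoArrowEquiv ℤ).apply_symm_apply v, ← hw, h0]; rfl)
      have hn : 0 < ‖w‖ := norm_pos_iff.2 hw0
      have h2 : ‖w‖ ^ 2 ≤ (v.1 : ℝ) ^ 2 + (v.2 : ℝ) ^ 2 := by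
        have : ‖w‖ ≤ Real.sqrt ((v.1 : ℝ) ^ 2 + (v.2 : ℝ) ^ 2) := by
          refine (pi_norm_le_iff_of_nonneg (Real.sqrt_nonneg _)).2 fun i => ?_
          rw [Int.norm_eq_abs]
          fin_cases i
          · exact Real.abs_le_sqrt (le_add_of_nonneg_right (sq_nonneg _))
          · exact Real.abs_le_sqrt (le_add_of_nonneg_left (sq_nonneg _))
        calc ‖w‖ ^ 2 ≤ Real.sqrt ((v.1 : ℝ) ^ 2 + (v.2 : ℝ) ^ 2) ^ 2 := by gcongr
          _ = _ := Real.sq_sqrt (by positivity)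
      have h3 : ‖w‖ ^ 2 / (A + C) ≤ rForm A B C v := by
        refine le_trans ?_ (hQ v)
        rw [one_div, inv_mul_eq_div]
        gcongr
      have h4 : ((A + C) ^ σ) * ‖w‖ ^ (-(2 * σ)) = 1 / (‖w‖ ^ 2 / (A + C)) ^ σ := by
        rw [Real.div_rpow (by positivity) hAC.le, ← Real.rpow_natCast, ← Real.rpow_mul hn.le,
          Real.rpow_neg hn.le]
        have : ‖w‖ ^ (2 * σ) ≠ 0 := (Real.rpow_pos_of_pos hn _).ne'
        push_cast
        field_simp
      simp only [Function.comp_apply, ← hw]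
      rw [h4]
      gcongr

theorem exists_epstein (hA : 0 < A) (h : 4 * A * C - B ^ 2 = 4) :
    ∃ G : ℂ → ℂ, Differentiable ℂ G ∧ G (-1) = 0 ∧ ∀ s : ℂ, 1 < s.re →
      HasSum (fun v : ℤ × ℤ => (if v = 0 then (0 : ℂ) else 1) / (rForm A B C v : ℂ) ^ s)
        (G s / (s - 1)) := by
  have hpi : (Real.pi : ℂ) ≠ 0 := by exact_mod_cast Real.pi_ne_zero
  refine ⟨fun s => Real.pi ^ s * ((s - 1) * (rPair hA h).Λ₀ s * (Gamma s)⁻¹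
    - (s - 1) * (Gamma (s + 1))⁻¹ + (Gamma s)⁻¹), ?_, ?_, fun s hs => ?_⟩
  · have h1 : Differentiable ℂ fun s : ℂ => (Gamma (s + 1))⁻¹ :=
      differentiable_one_div_Gamma.comp (differentiable_id.add_const 1)
    have h2 := differentiable_one_div_Gamma
    have h3 := (rPair hA h).differentiable_Λ₀
    have h4 : Differentiable ℂ fun s : ℂ => (Real.pi : ℂ) ^ s :=
      differentiable_id.const_cpow (Or.inl hpi)
    fun_prop
  · have h1 : Gamma (-1) = 0 := by simpa using Gamma_neg_nat_eq_zero 1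
    have h0 : Gamma (-1 + 1) = 0 := by simp
    simp only [h1, h0]
    simp
  · have hs0 : 0 < s.re := by linarith
    have hs1 : s - 1 ≠ 0 := fun h => by
      rw [sub_eq_zero] at h
      rw [h, one_re] at hs
      exact lt_irrefl _ hs
    have hs00 : s ≠ 0 := fun h => by rw [h, zero_re] at hs0; exact lt_irrefl _ hs0
    have hG : Gamma s ≠ 0 := Gamma_ne_zero_of_re_pos hs0
    have h1 := hasSum_mellin_pi_mul (a := fun v : ℤ × ℤ => if v = 0 then (0 : ℂ) else 1)
      (q := rForm A B C) (F := fun t => rTheta A B C t - 1) (s := s) (fun v => ?_) hs0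
      (fun t ht => ?_) ?_
    · have h2 := ((rPair hA h).hasMellin (s := s) hs).2
      change mellin (fun t => rTheta A B C t - 1) s = _ at h2
      rw [h2, WeakFEPair.Λ] at h1
      have h3 := h1.mul_left (Real.pi ^ s * (Gamma s)⁻¹)
      have h4 : (Real.pi : ℂ) ^ s * Real.pi ^ (-s) = 1 := by
        rw [← cpow_add _ _ hpi, add_neg_cancel, cpow_zero]
      have h5 : (fun s => Real.pi ^ s * ((s - 1) * (rPair hA h).Λ₀ s * (Gamma s)⁻¹
          - (s - 1) * (Gamma (s + 1))⁻¹ + (Gamma s)⁻¹)) s / (s - 1) =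
          Real.pi ^ s * (Gamma s)⁻¹ * ((rPair hA h).Λ₀ s - (1 / s) • (rPair hA h).f₀
            - ((rPair hA h).ε / ((rPair hA h).k - s)) • (rPair hA h).g₀) := by
        simp only [Gamma_add_one s hs00]
        simp only [rPair, smul_eq_mul, ofReal_one]
        have : (1 : ℂ) - s ≠ 0 := fun h => hs1 (by linear_combination -h)
        field_simp
        ring
      rw [h5]
      refine hasSum_of_eq (fun v => ?_) h3
      split_ifs
      · simp
      · rw [show (Real.pi : ℂ) ^ s * (Gamma s)⁻¹ *
          (Real.pi ^ (-s) * Gamma s * 1 / (rForm A B C v : ℂ) ^ s) =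
          (Real.pi ^ s * Real.pi ^ (-s)) * ((Gamma s)⁻¹ * Gamma s) * (1 / (rForm A B C v : ℂ) ^ s)
          by ring, h4, inv_mul_cancel₀ hG, one_mul, one_mul]
    · by_cases hv : v = 0
      · left; simp [hv]
      · right
        obtain ⟨hAC, _⟩ := rForm_lower hA h
        exact (rForm_pos hA h hv).trans_lt' (by positivity)
    · simpa using rTheta_sub_one hA h ht
    · refine (summable_rForm hA h hs).congr fun v => ?_
      split_ifs <;> simp

theorem exists_epstein_of_pos (hA : 0 < A) (h : 0 < 4 * A * C - B ^ 2) :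
    ∃ G : ℂ → ℂ, Differentiable ℂ G ∧ G (-1) = 0 ∧ ∀ s : ℂ, 1 < s.re →
      HasSum (fun v : ℤ × ℤ => (if v = 0 then (0 : ℂ) else 1) / (rForm A B C v : ℂ) ^ s)
        (G s / (s - 1)) := by
  set c : ℝ := 2 / Real.sqrt (4 * A * C - B ^ 2) with hc
  have hc0 : 0 < c := by positivity
  have hcc : (c : ℂ) ≠ 0 := by exact_mod_cast hc0.ne'
  obtain ⟨G, hG, hG1, hG2⟩ := exists_epstein (A := c * A) (B := c * B) (C := c * C)
    (by positivity) (by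
      have h1 : c ^ 2 * (4 * A * C - B ^ 2) = 4 := by
        rw [hc, div_pow, Real.sq_sqrt h.le]
        field_simp
        norm_num
      linear_combination h1)
  refine ⟨fun s => c ^ s * G s, (differentiable_id.const_cpow (Or.inl hcc)).mul hG, by simp [hG1],
    fun s hs => ?_⟩
  rw [mul_div_assoc]
  refine hasSum_of_eq (fun v => ?_) ((hG2 s hs).mul_left (c ^ s : ℂ))
  have h1 : rForm (c * A) (c * B) (c * C) v = c * rForm A B C v := by simp only [rForm]; ring
  split_ifs with hv
  · simp
  · have h3 : 0 ≤ rForm A B C v := by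
      have h2 : 0 ≤ 4 * A * rForm A B C v := by
        have e : 4 * A * rForm A B C v = (2 * A * v.1 + B * v.2) ^ 2 +
            (4 * A * C - B ^ 2) * (v.2 : ℝ) ^ 2 := by simp only [rForm]; ring
        rw [e]
        positivity
      exact nonneg_of_mul_nonneg_right h2 (by positivity)
    rw [h1, ofReal_mul, mul_cpow_ofReal_nonneg hc0.le h3]
    have : (c : ℂ) ^ s ≠ 0 := by simp [cpow_eq_zero_iff, hcc]
    field_simp

end Epstein

section IdealVonMangoldt

variable {K : Type*} [Field K] [NumberField K]

open NumberField

open Classical in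
/-- The von Mangoldt function on ideals. -/
noncomputable def idealLam (I : Ideal (𝓞 K)) : ℝ :=
  if h : IsPrimePow I then Real.log (Ideal.absNorm h.choose) else 0

theorem prime_eq_of_pow_eq {P Q : Ideal (𝓞 K)} (hP : Prime P) (hQ : Prime Q) {k l : ℕ}
    (hk : 0 < k) (h : P ^ k = Q ^ l) : P = Q :=
  associated_iff_eq.1 (hP.associated_of_dvd hQ
    (hP.dvd_of_dvd_pow ((dvd_pow_self P hk.ne').trans h.dvd)))

theorem idealLam_pow {P : Ideal (𝓞 K)} (hP : Prime P) {k : ℕ} (hk : 0 < k) :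
    idealLam (P ^ k) = Real.log (Ideal.absNorm P) := by
  have h : IsPrimePow (P ^ k) := ⟨P, k, hP, hk, rfl⟩
  rw [idealLam, dif_pos h]
  obtain ⟨l, hl, hl0, h1⟩ := h.choose_spec
  have h2 := prime_eq_of_pow_eq hP hl hk h1.symm
  exact congrArg (fun J : Ideal (𝓞 K) => Real.log (Ideal.absNorm J)) h2.symm

theorem idealLam_eq_zero {I : Ideal (𝓞 K)} (h : ¬ IsPrimePow I) : idealLam I = 0 := by
  rw [idealLam, dif_neg h]

theorem idealLam_nonneg (I : Ideal (𝓞 K)) : 0 ≤ idealLam I := by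
  unfold idealLam
  split_ifs
  · exact Real.log_natCast_nonneg _
  · exact le_rfl

theorem finite_ideal_dvd {I : Ideal (𝓞 K)} (hI : I ≠ 0) : {J | J ∣ I}.Finite := by
  have h := UniqueFactorizationMonoid.fintypeSubtypeDvd I hI
  have : Finite {J // J ∣ I} := Finite.of_fintype _
  exact Set.finite_coe_iff.1 this

theorem isCoprime_of_isRelPrime {I J : Ideal (𝓞 K)} (h : IsRelPrime I J) : IsCoprime I J := by
  rw [Ideal.isCoprime_iff_sup_eq]
  exact Ideal.isUnit_iff.1 (h (Ideal.dvd_iff_le.2 le_sup_left) (Ideal.dvd_iff_le.2 le_sup_right))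

theorem absNorm_ne_zero {I : Ideal (𝓞 K)} (h : I ≠ 0) : Ideal.absNorm I ≠ 0 := fun h1 =>
  h (Ideal.absNorm_eq_zero_iff.1 h1)

open Classical in
/-- The divisors of a nonzero ideal. -/
noncomputable def idealDivisors (I : Ideal (𝓞 K)) : Finset (Ideal (𝓞 K)) :=
  if h : I = 0 then ∅ else (finite_ideal_dvd h).toFinset

theorem mem_idealDivisors {I J : Ideal (𝓞 K)} (hI : I ≠ 0) : J ∈ idealDivisors I ↔ J ∣ I := by
  rw [idealDivisors, dif_neg hI, Set.Finite.mem_toFinset, Set.mem_ofPred_eq]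

open Classical in
theorem sum_idealLam {I : Ideal (𝓞 K)} (hI : I ≠ 0) :
    ∑ J ∈ idealDivisors I, idealLam J = Real.log (Ideal.absNorm I) := by
  induction I using UniqueFactorizationMonoid.induction_on_coprime with
  | h0 => exact absurd rfl hI
  | h1 hx =>
    rename_i x
    have h1 : x = 1 := isUnit_iff_eq_one.1 hx
    subst h1
    rw [map_one, Nat.cast_one, Real.log_one]
    refine Finset.sum_eq_zero fun J hJ => idealLam_eq_zero ?_
    rw [mem_idealDivisors one_ne_zero] at hJ
    rw [isUnit_iff_eq_one.1 (isUnit_of_dvd_one hJ)]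
    exact not_isPrimePow_one
  | hpr i hp =>
    rename_i P
    have h1 : idealDivisors (P ^ i) = (Finset.range (i + 1)).image fun k => P ^ k := by
      ext J
      rw [mem_idealDivisors (pow_ne_zero _ hp.ne_zero), dvd_prime_pow hp]
      simp only [associated_iff_eq, Finset.mem_image, Finset.mem_range, Nat.lt_succ_iff]
      constructor
      · rintro ⟨k, hk, rfl⟩; exact ⟨k, hk, rfl⟩
      · rintro ⟨k, hk, rfl⟩; exact ⟨k, hk, rfl⟩
    rw [h1, Finset.sum_image fun a _ b _ hab => pow_injective_of_not_isUnit hp.not_isUnit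
      hp.ne_zero hab, Finset.sum_range_succ', pow_zero, idealLam_eq_zero not_isPrimePow_one,
      add_zero, Finset.sum_congr rfl fun k _ => idealLam_pow hp k.succ_pos, Finset.sum_const,
      Finset.card_range, map_pow, Nat.cast_pow, Real.log_pow, nsmul_eq_mul]
  | hcp hxy hx hy =>
    rename_i x y
    have hx0 : x ≠ 0 := left_ne_zero_of_mul hI
    have hy0 : y ≠ 0 := right_ne_zero_of_mul hI
    have hcop : IsCoprime x y := isCoprime_of_isRelPrime hxy
    rw [map_mul, Nat.cast_mul, Real.log_mul (Nat.cast_ne_zero.2 (absNorm_ne_zero hx0))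
      (Nat.cast_ne_zero.2 (absNorm_ne_zero hy0)), ← hx hx0,
      ← hy hy0]
    have hdis : Disjoint ((idealDivisors x).filter IsPrimePow)
        ((idealDivisors y).filter IsPrimePow) := by
      rw [Finset.disjoint_left]
      intro J hJ hJ'
      rw [Finset.mem_filter, mem_idealDivisors hx0] at hJ
      rw [Finset.mem_filter, mem_idealDivisors hy0] at hJ'
      exact hJ.2.not_isUnit (hxy hJ.1 hJ'.1)
    have hf : ∀ I : Ideal (𝓞 K), ∑ J ∈ idealDivisors I, idealLam J =
        ∑ J ∈ (idealDivisors I).filter IsPrimePow, idealLam J := fun I => by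
      rw [Finset.sum_filter_of_ne]
      intro J _ h
      by_contra h1
      exact h (idealLam_eq_zero h1)
    rw [hf, hf x, hf y, ← Finset.sum_union hdis]
    refine Finset.sum_congr ?_ fun _ _ => rfl
    ext J
    simp only [Finset.mem_filter, Finset.mem_union, mem_idealDivisors hI, mem_idealDivisors hx0,
      mem_idealDivisors hy0]
    constructor
    · rintro ⟨h, P, k, hP, hk, rfl⟩
      have h1 : IsPrimePow (P ^ k) := ⟨P, k, hP, hk, rfl⟩
      by_cases hPx : P ∣ x
      · left
        refine ⟨?_, h1⟩
        have : IsCoprime (P ^ k) y := by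
          refine IsCoprime.pow_left (IsCoprime.of_isCoprime_of_dvd_left hcop hPx)
        exact this.dvd_of_dvd_mul_right h
      · right
        refine ⟨?_, h1⟩
        have : IsCoprime (P ^ k) x := by
          refine IsCoprime.pow_left (isCoprime_of_isRelPrime ?_)
          exact (hP.irreducible.isRelPrime_iff_not_dvd).2 hPx
        exact this.dvd_of_dvd_mul_left h
    · rintro (⟨h, h1⟩ | ⟨h, h1⟩)
      · exact ⟨h.mul_right y, h1⟩
      · exact ⟨h.mul_left x, h1⟩

end IdealVonMangoldt

section NormSum

variable {K : Type*} [Field K] [NumberField K]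

open NumberField

/-- The ideals of a given norm. -/
noncomputable def idealsOfNorm (K : Type*) [Field K] [NumberField K] (n : ℕ) :
    Finset (Ideal (𝓞 K)) :=
  (Ideal.finite_setOfPred_absNorm_eq (S := 𝓞 K) n).toFinset

theorem mem_idealsOfNorm {n : ℕ} {I : Ideal (𝓞 K)} :
    I ∈ idealsOfNorm K n ↔ Ideal.absNorm I = n := by
  rw [idealsOfNorm, Set.Finite.mem_toFinset, Set.mem_ofPred_eq]

/-- The arithmetic function summing a function over the ideals of norm `n`. -/
noncomputable def normSum (v : Ideal (𝓞 K) → ℂ) : ArithmeticFunction ℂ :=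
  ⟨fun n => if n = 0 then 0 else ∑ I ∈ idealsOfNorm K n, v I, if_pos rfl⟩

theorem normSum_apply (v : Ideal (𝓞 K) → ℂ) {n : ℕ} (hn : n ≠ 0) :
    normSum v n = ∑ I ∈ idealsOfNorm K n, v I := if_neg hn

theorem ne_zero_of_mem_idealsOfNorm {n : ℕ} (hn : n ≠ 0) {I : Ideal (𝓞 K)}
    (h : I ∈ idealsOfNorm K n) : I ≠ 0 := by
  rintro rfl
  rw [mem_idealsOfNorm, map_zero] at h
  exact hn h.symm

theorem normSum_one {v : Ideal (𝓞 K) → ℂ} (h1 : v 1 = 1) : normSum v 1 = 1 := by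
  have : idealsOfNorm K 1 = {1} := by
    ext I
    rw [mem_idealsOfNorm, Finset.mem_singleton, Ideal.absNorm_eq_one_iff, Ideal.one_eq_top]
  rw [normSum_apply v one_ne_zero, this, Finset.sum_singleton, h1]

theorem normSum_lam_mul {v : Ideal (𝓞 K) → ℂ}
    (hv : ∀ I J, I ≠ 0 → J ≠ 0 → v (I * J) = v I * v J) (n : ℕ) :
    (normSum (fun I => idealLam I * v I) * normSum v) n = Real.log n * normSum v n := by
  rcases eq_or_ne n 0 with rfl | hn
  · simp
  have h1 : Real.log n * normSum v n = ∑ s ∈ (idealsOfNorm K n).sigma idealDivisors,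
      (idealLam s.2 : ℂ) * v s.1 := by
    rw [normSum_apply v hn, Finset.mul_sum, Finset.sum_sigma]
    refine Finset.sum_congr rfl fun I hI => ?_
    show _ = ∑ J ∈ idealDivisors I, (idealLam J : ℂ) * v I
    rw [show ∑ J ∈ idealDivisors I, (idealLam J : ℂ) * v I = _ from (Finset.sum_mul ..).symm,
      ← Complex.ofReal_sum, sum_idealLam (ne_zero_of_mem_idealsOfNorm hn hI),
      mem_idealsOfNorm.1 hI]
  have h2 : (normSum (fun I => idealLam I * v I) * normSum v) n =
      ∑ s ∈ n.divisorsAntidiagonal.sigma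
        (fun x => idealsOfNorm K x.1 ×ˢ idealsOfNorm K x.2),
        (idealLam s.2.1 : ℂ) * v (s.2.1 * s.2.2) := by
    rw [ArithmeticFunction.mul_apply, Finset.sum_sigma]
    refine Finset.sum_congr rfl fun x hx => ?_
    obtain ⟨hx1, _⟩ := Nat.mem_divisorsAntidiagonal.1 hx
    have hx2 : x.1 ≠ 0 := fun h => hn (by rw [← hx1, h, zero_mul])
    have hx3 : x.2 ≠ 0 := fun h => hn (by rw [← hx1, h, mul_zero])
    rw [normSum_apply _ hx2, normSum_apply _ hx3, Finset.sum_mul_sum, Finset.sum_product]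
    refine Finset.sum_congr rfl fun I hI => Finset.sum_congr rfl fun J hJ => ?_
    rw [hv I J (ne_zero_of_mem_idealsOfNorm hx2 hI) (ne_zero_of_mem_idealsOfNorm hx3 hJ),
      mul_assoc]
  rw [h1, h2]
  refine Finset.sum_bij
    (fun s _ => (⟨s.2.1 * s.2.2, s.2.1⟩ : Σ _ : Ideal (𝓞 K), Ideal (𝓞 K))) ?_ ?_ ?_ ?_
  · rintro ⟨x, J, J'⟩ hs
    simp only [Finset.mem_sigma, Finset.mem_product, mem_idealsOfNorm,
      Nat.mem_divisorsAntidiagonal] at hs ⊢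
    have hN : Ideal.absNorm (J * J') = n := by rw [map_mul, hs.2.1, hs.2.2, hs.1.1]
    refine ⟨hN, (mem_idealDivisors ?_).2 (dvd_mul_right J J')⟩
    exact ne_zero_of_mem_idealsOfNorm hn (mem_idealsOfNorm.2 hN)
  · rintro ⟨x, J, J'⟩ hs ⟨y, L, L'⟩ ht h
    simp only [Finset.mem_sigma, Finset.mem_product, mem_idealsOfNorm,
      Nat.mem_divisorsAntidiagonal] at hs ht
    simp only [Sigma.mk.injEq, heq_eq_eq] at h
    obtain ⟨h, rfl⟩ := h
    have hJ : J ≠ 0 := by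
      rintro rfl
      rw [map_zero] at hs
      apply hn
      rw [← hs.1.1, ← hs.2.1, zero_mul]
    have h3 : J' = L' := mul_left_cancel₀ hJ h
    subst h3
    have : x = y := Prod.ext (hs.2.1.symm.trans ht.2.1) (hs.2.2.symm.trans ht.2.2)
    subst this
    rfl
  · rintro ⟨I, J⟩ hs
    simp only [Finset.mem_sigma] at hs
    have hI := ne_zero_of_mem_idealsOfNorm hn hs.1
    obtain ⟨J', hJ'⟩ := (mem_idealDivisors hI).1 hs.2
    refine ⟨⟨(Ideal.absNorm J, Ideal.absNorm J'), J, J'⟩, ?_, ?_⟩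
    · simp only [Finset.mem_sigma, Finset.mem_product, mem_idealsOfNorm,
        Nat.mem_divisorsAntidiagonal, and_true]
      refine ⟨?_, hn⟩
      rw [← map_mul, ← hJ', mem_idealsOfNorm.1 hs.1]
    · simp only [Sigma.mk.injEq, heq_eq_eq, and_true]
      exact hJ'.symm
  · rintro ⟨x, J, J'⟩ _
    rfl

theorem norm_normSum_le {v : Ideal (𝓞 K) → ℂ} {u : Ideal (𝓞 K) → ℝ} (h : ∀ I, ‖v I‖ ≤ u I)
    (n : ℕ) : ‖normSum v n‖ ≤ ‖normSum (fun I => (u I : ℂ)) n‖ := by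
  rcases eq_or_ne n 0 with rfl | hn
  · simp
  rw [normSum_apply _ hn, normSum_apply _ hn, ← Complex.ofReal_sum, Complex.norm_real,
    Real.norm_eq_abs]
  exact (norm_sum_le _ _).trans ((Finset.sum_le_sum fun I _ => h I).trans (le_abs_self _))

theorem idealLam_le {I : Ideal (𝓞 K)} (hI : I ≠ 0) :
    idealLam I ≤ Real.log (Ideal.absNorm I) := by
  rw [← sum_idealLam hI]
  exact Finset.single_le_sum (fun J _ => idealLam_nonneg J)
    ((mem_idealDivisors hI).2 dvd_rfl)

theorem absNorm_natCast (q : ℕ) :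
    Ideal.absNorm (Ideal.span {(q : 𝓞 K)}) = q ^ Module.finrank ℚ K := by
  rw [Ideal.absNorm_span_singleton]
  have h := Algebra.norm_algebraMap_of_basis (RingOfIntegers.basis K) (q : ℤ)
  rw [← Module.finrank_eq_card_chooseBasisIndex, RingOfIntegers.rank] at h
  rw [show (q : 𝓞 K) = algebraMap ℤ (𝓞 K) q by simp, h]
  simp [Int.natAbs_pow]

/-- The ideals of `q`-power norm have total von Mangoldt weight at most that of the divisors of
`q`. -/
theorem sum_idealLam_of_norm_prime_pow_le {q : ℕ} (hq : q.Prime) {j : ℕ} (hj : j ≠ 0) :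
    ∑ I ∈ idealsOfNorm K (q ^ j), idealLam I ≤ Module.finrank ℚ K * Real.log q := by
  classical
  have hq0 : Ideal.span {(q : 𝓞 K)} ≠ 0 := by
    intro h
    have := absNorm_natCast (K := K) q
    rw [h, map_zero] at this
    exact pow_ne_zero _ hq.ne_zero this.symm
  have h1 : ∑ J ∈ idealDivisors (Ideal.span {(q : 𝓞 K)}), idealLam J =
      Module.finrank ℚ K * Real.log q := by
    rw [sum_idealLam hq0, absNorm_natCast, Nat.cast_pow, Real.log_pow]
  rw [← h1, ← Finset.sum_filter_of_ne (p := IsPrimePow)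
    fun I _ h => by_contra fun h2 => h (idealLam_eq_zero h2)]
  have key : ∀ I ∈ (idealsOfNorm K (q ^ j)).filter IsPrimePow, ∃ P, Prime P ∧
      P ∣ Ideal.span {(q : 𝓞 K)} ∧ idealLam P = idealLam I ∧ (∃ k, 0 < k ∧ P ^ k = I) := by
    intro I hI
    rw [Finset.mem_filter, mem_idealsOfNorm] at hI
    obtain ⟨hN, P, k, hP, hk, rfl⟩ := hI
    refine ⟨P, hP, ?_, ?_, k, hk, rfl⟩
    · have h3 : P ^ k ∣ Ideal.span {(q : 𝓞 K)} ^ j := by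
        rw [Ideal.span_singleton_pow, Ideal.dvd_span_singleton]
        have := Ideal.absNorm_mem (P ^ k)
        rwa [hN, Nat.cast_pow] at this
      exact hP.dvd_of_dvd_pow ((dvd_pow_self P hk.ne').trans h3)
    · rw [idealLam_pow hP hk]
      simpa using idealLam_pow hP one_pos
  choose! f hf using key
  rw [← Finset.sum_congr rfl fun I hI => (hf I hI).2.2.1]
  rw [← Finset.sum_image (f := idealLam) (g := f)]
  · refine Finset.sum_le_sum_of_subset_of_nonneg ?_ fun J _ _ => idealLam_nonneg J
    intro J hJ
    obtain ⟨I, hI, rfl⟩ := Finset.mem_image.1 hJ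
    exact (mem_idealDivisors hq0).2 (hf I hI).2.1
  · intro I hI I' hI' h
    obtain ⟨hP, -, -, k, hk, hk1⟩ := hf I hI
    obtain ⟨hP', -, -, k', hk', hk1'⟩ := hf I' hI'
    have e1 := mem_idealsOfNorm.1 (Finset.mem_filter.1 hI).1
    have e2 := mem_idealsOfNorm.1 (Finset.mem_filter.1 hI').1
    rw [← hk1, map_pow] at e1
    rw [← hk1', map_pow, ← h] at e2
    rw [← hk1, ← hk1', ← h]
    congr 1
    refine Nat.pow_right_injective ?_ (e1.trans e2.symm)
    by_contra hlt
    push Not at hlt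
    interval_cases Ideal.absNorm (f I)
    · rw [zero_pow hk.ne'] at e1
      exact pow_ne_zero _ hq.ne_zero e1.symm
    · rw [one_pow] at e1
      exact hq.one_lt.ne' ((Nat.pow_eq_one.1 e1.symm).resolve_right hj)

end NormSum

section IdealCount

variable {K : Type*} [Field K] [NumberField K]

open NumberField Filter Topology

open Classical in
/-- The class of a nonzero ideal. -/
noncomputable def idealClass (I : Ideal (𝓞 K)) : ClassGroup (𝓞 K) :=
  if h : I ∈ nonZeroDivisors (Ideal (𝓞 K)) then ClassGroup.mk0 ⟨I, h⟩ else 1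

theorem idealClass_eq {I : Ideal (𝓞 K)} (h : I ∈ nonZeroDivisors (Ideal (𝓞 K))) :
    idealClass I = ClassGroup.mk0 ⟨I, h⟩ := dif_pos h

theorem idealClass_mul {I J : Ideal (𝓞 K)} (hI : I ≠ 0) (hJ : J ≠ 0) :
    idealClass (I * J) = idealClass I * idealClass J := by
  have h1 := mem_nonZeroDivisors_of_ne_zero hI
  have h2 := mem_nonZeroDivisors_of_ne_zero hJ
  rw [idealClass_eq h1, idealClass_eq h2, idealClass_eq (mul_mem h1 h2), ← map_mul]
  rfl

theorem idealClass_one : idealClass (1 : Ideal (𝓞 K)) = 1 := by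
  have h : (1 : Ideal (𝓞 K)) ∈ nonZeroDivisors (Ideal (𝓞 K)) := one_mem _
  rw [idealClass_eq h, ← map_one ClassGroup.mk0]
  rfl

open Classical in
/-- The number of ideals of norm `n` in a given class. -/
noncomputable def classCount (C : ClassGroup (𝓞 K)) (n : ℕ) : ℝ :=
  ((idealsOfNorm K n).filter fun I => idealClass I = C).card

open InfinitePlace Units in
/-- The common residue of the partial zeta functions. -/
noncomputable def classResidue (K : Type*) [Field K] [NumberField K] : ℝ :=
  (2 ^ nrRealPlaces K * (2 * Real.pi) ^ nrComplexPlaces K * regulator K) /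
    (torsionOrder K * Real.sqrt |discr K|)

theorem classResidue_pos : 0 < classResidue K := by
  refine div_pos ?_ ?_
  · exact mul_pos (by positivity) (Units.regulator_pos K)
  · exact mul_pos (Nat.cast_pos.mpr (Units.torsionOrder_pos K)) <|
      Real.sqrt_pos_of_pos <| abs_pos.mpr (Int.cast_ne_zero.mpr (discr_ne_zero K))

theorem tendsto_sum_classCount (C : ClassGroup (𝓞 K)) :
    Tendsto (fun n : ℕ => (∑ k ∈ Finset.Icc 1 n, classCount C k) / (n : ℝ)) atTop
      (𝓝 (classResidue K)) := by
  classical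
  refine ((NumberField.Ideal.tendsto_norm_le_and_mk_eq_div_atTop K C).comp
    tendsto_natCast_atTop_atTop).congr fun n => ?_
  simp only [Function.comp_apply, Nat.cast_le]
  congr 1
  have h1 : ∑ k ∈ Finset.Icc 1 n, classCount C k =
      (((Finset.Icc 1 n).biUnion fun k =>
        (idealsOfNorm K k).filter fun I => idealClass I = C).card : ℝ) := by
    rw [Finset.card_biUnion, Nat.cast_sum]
    · rfl
    · intro a _ b _ hab
      rw [Function.onFun, Finset.disjoint_left]
      intro I hI hI'
      rw [Finset.mem_filter, mem_idealsOfNorm] at hI hI'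
      exact hab (hI.1.symm.trans hI'.1)
  have h2 : ∀ I : Ideal (𝓞 K), I ∈ ((Finset.Icc 1 n).biUnion fun k =>
        (idealsOfNorm K k).filter fun I => idealClass I = C) ↔
      I ≠ 0 ∧ Ideal.absNorm I ≤ n ∧ idealClass I = C := fun I => by
    simp only [Finset.mem_biUnion, Finset.mem_Icc, Finset.mem_filter, mem_idealsOfNorm]
    constructor
    · rintro ⟨k, ⟨hk, hk'⟩, h, hC⟩
      exact ⟨ne_zero_of_mem_idealsOfNorm (by lia) (mem_idealsOfNorm.2 h), h.le.trans hk', hC⟩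
    · rintro ⟨h, h', hC⟩
      exact ⟨_, ⟨Nat.pos_of_ne_zero (absNorm_ne_zero h), h'⟩, rfl, hC⟩
  rw [h1, ← Nat.card_eq_finsetCard]
  congr 1
  refine Nat.card_congr ⟨fun I => ⟨I.1.1, (h2 _).2 ⟨nonZeroDivisors.ne_zero I.1.2, I.2.1, ?_⟩⟩,
    fun I => ⟨⟨I.1, mem_nonZeroDivisors_of_ne_zero ((h2 _).1 I.2).1⟩, ((h2 _).1 I.2).2.1, ?_⟩,
    fun I => rfl, fun I => rfl⟩
  · rw [idealClass_eq I.1.2]; exact I.2.2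
  · rw [← idealClass_eq]; exact ((h2 _).1 I.2).2.2

theorem summable_classCount (C : ClassGroup (𝓞 K)) {s : ℂ} (hs : 1 < s.re) :
    LSeriesSummable (fun n => (classCount C n : ℂ)) s := by
  refine LSeriesSummable_of_sum_norm_bigO_and_nonneg (r := 1) ?_ (fun n => Nat.cast_nonneg _)
    zero_le_one hs
  have h := (tendsto_sum_classCount C).isBigO_one ℝ
  have h2 := h.mul (Asymptotics.isBigO_refl (fun n : ℕ => (n : ℝ)) atTop)
  refine (h2.congr' ?_ ?_)
  · filter_upwards [eventually_ne_atTop 0] with n hn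
    exact div_mul_cancel₀ _ (Nat.cast_ne_zero.2 hn)
  · exact Eventually.of_forall fun n => by simp

theorem tendsto_classCount (C : ClassGroup (𝓞 K)) :
    Tendsto (fun s : ℝ => (s - 1) * LSeries (fun n => (classCount C n : ℂ)) s) (𝓝[>] 1)
      (𝓝 (classResidue K)) :=
  LSeries_tendsto_sub_mul_nhds_one_of_tendsto_sum_div_and_nonneg _ (tendsto_sum_classCount C)
    fun _ => Nat.cast_nonneg _

/-- Summing a function of the ideal class over ideals of given norm. -/
theorem normSum_class (f : ClassGroup (𝓞 K) → ℂ) {n : ℕ} (hn : n ≠ 0) :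
    normSum (fun I => f (idealClass I)) n = ∑ C, f C * classCount C n := by
  classical
  rw [normSum_apply _ hn, ← Finset.sum_fiberwise (idealsOfNorm K n) idealClass]
  refine Finset.sum_congr rfl fun C _ => ?_
  rw [Finset.sum_congr rfl fun I hI => by rw [(Finset.mem_filter.1 hI).2], Finset.sum_const,
    nsmul_eq_mul, mul_comm, classCount]
  norm_cast

theorem hasSum_normSum_class (f : ClassGroup (𝓞 K) → ℂ) {s : ℂ} (hs : 1 < s.re) :
    LSeriesHasSum (normSum fun I => f (idealClass I)) s
      (∑ C, f C * LSeries (fun n => (classCount C n : ℂ)) s) := by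
  rw [LSeriesHasSum_congr s _ fun hn => normSum_class f hn]
  have := fun C => ((summable_classCount C hs).LSeriesHasSum).smul (f C)
  have h2 := LSeriesHasSum.sum (S := Finset.univ) (fun C _ => this C)
  refine (LSeriesHasSum_congr s _ fun {n} _ => ?_).1 h2
  simp [Finset.sum_apply]

theorem summable_normSum {v : Ideal (𝓞 K) → ℂ} (hv : ∀ I, ‖v I‖ ≤ 1) {s : ℂ} (hs : 1 < s.re) :
    LSeriesSummable (normSum v) s := by
  have h := (hasSum_normSum_class (K := K) (fun _ => 1) hs).LSeriesSummable
  refine Summable.of_norm_bounded h.norm fun n => LSeries.norm_term_le s ?_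
  simpa using norm_normSum_le (u := fun _ => 1) hv n

theorem abscissa_normSum_le {v : Ideal (𝓞 K) → ℂ} (hv : ∀ I, ‖v I‖ ≤ 1) :
    LSeries.abscissaOfAbsConv (normSum v) ≤ 1 :=
  LSeries.abscissaOfAbsConv_le_of_forall_lt_LSeriesSummable fun y hy =>
    summable_normSum hv (by simpa using hy)

theorem summable_normSum_lam {v : Ideal (𝓞 K) → ℂ} (hv : ∀ I, ‖v I‖ ≤ 1) {s : ℂ}
    (hs : 1 < s.re) : LSeriesSummable (normSum fun I => idealLam I * v I) s := by
  have h : LSeriesSummable (LSeries.logMul (normSum fun _ : Ideal (𝓞 K) => 1)) s :=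
    LSeriesSummable_logMul_of_lt_re (lt_of_le_of_lt (abscissa_normSum_le fun _ => by simp)
      (by exact_mod_cast hs))
  refine Summable.of_norm_bounded h.norm fun n => LSeries.norm_term_le s ?_
  rcases eq_or_ne n 0 with rfl | hn
  · simp
  refine (norm_normSum_le (u := idealLam) (fun I => ?_) n).trans ?_
  · rw [norm_mul, Complex.norm_real, Real.norm_of_nonneg (idealLam_nonneg I)]
    exact mul_le_of_le_one_right (idealLam_nonneg I) (hv I)
  · rw [LSeries.logMul, normSum_apply _ hn, normSum_apply _ hn, ← Complex.ofReal_sum,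
      Finset.sum_const, nsmul_one, norm_mul, Complex.norm_natCast, Complex.norm_real,
      Real.norm_of_nonneg (Finset.sum_nonneg fun I _ => idealLam_nonneg I), mul_comm,
      ← Complex.natCast_log, Complex.norm_real, Real.norm_of_nonneg (Real.log_natCast_nonneg n),
      ← nsmul_eq_mul]
    refine Finset.sum_le_card_nsmul _ _ _ fun I hI => ?_
    rw [← mem_idealsOfNorm.1 hI]
    exact idealLam_le (ne_zero_of_mem_idealsOfNorm hn hI)

theorem LSeries_lam_mul {v : Ideal (𝓞 K) → ℂ} (hv : ∀ I, ‖v I‖ ≤ 1)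
    (hm : ∀ I J, I ≠ 0 → J ≠ 0 → v (I * J) = v I * v J) {s : ℂ} (hs : 1 < s.re) :
    LSeries (normSum fun I => idealLam I * v I) s * LSeries (normSum v) s =
      -deriv (LSeries (normSum v)) s := by
  rw [LSeries_deriv (lt_of_le_of_lt (abscissa_normSum_le hv) (by exact_mod_cast hs)), neg_neg,
    ← ArithmeticFunction.LSeries_mul' (summable_normSum_lam hv hs) (summable_normSum hv hs)]
  refine LSeries_congr (fun {n} _ => ?_) s
  rw [normSum_lam_mul hm, LSeries.logMul, Complex.natCast_log]

end IdealCount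

section ImagQuad

variable {K : Type*} [Field K] [NumberField K]

open NumberField ComplexConjugate

omit [NumberField K] in
theorem embedding_eq_or (φ : K →+* ℂ) [NumberField K] (hK : Module.finrank ℚ K = 2)
    {x : K} (hx : (φ x).im ≠ 0) (σ : K →+* ℂ) : σ = φ ∨ σ = (starRingEnd ℂ).comp φ := by
  classical
  have hne : φ ≠ (starRingEnd ℂ).comp φ := fun h => by
    have h1 := congrArg (fun f : K →+* ℂ => (f x).im) h
    simp only [RingHom.comp_apply, conj_im] at h1
    exact hx (by linarith)
  have hcard : Fintype.card (K →+* ℂ) = 2 := by rw [Embeddings.card, hK]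
  by_contra! h
  have h3 : ({σ, φ, (starRingEnd ℂ).comp φ} : Finset (K →+* ℂ)).card ≤ 2 := by
    rw [← hcard]; exact Finset.card_le_univ _
  rw [Finset.card_eq_three.2 ⟨_, _, _, h.1, h.2, hne, rfl⟩] at h3
  lia

theorem absNorm_span_eq_normSq (φ : K →+* ℂ) (hK : Module.finrank ℚ K = 2)
    {x : K} (hx : (φ x).im ≠ 0) (a : 𝓞 K) :
    (Ideal.absNorm (Ideal.span {a}) : ℝ) = normSq (φ a) := by
  classical
  have hne : φ ≠ (starRingEnd ℂ).comp φ := fun h => by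
    have h1 := congrArg (fun f : K →+* ℂ => (f x).im) h
    simp only [RingHom.comp_apply, conj_im] at h1
    exact hx (by linarith)
  have h1 : ((Algebra.norm ℚ (a : K) : ℚ) : ℂ) = ∏ σ : K →+* ℂ, σ a := by
    have := Algebra.norm_eq_prod_embeddings ℚ ℂ (a : K)
    rw [eq_ratCast] at this
    rw [this]
    exact Fintype.prod_equiv (RingHom.equivRatAlgHom K ℂ).symm _ _ fun σ => rfl
  have h2 : (Finset.univ : Finset (K →+* ℂ)) = {φ, (starRingEnd ℂ).comp φ} := by
    ext σ
    simpa using embedding_eq_or φ hK hx σ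
  rw [h2, Finset.prod_pair hne, RingHom.comp_apply, mul_conj] at h1
  rw [Ideal.absNorm_span_singleton]
  have h3 : (((Algebra.norm ℤ a : ℤ) : ℝ)) = normSq (φ a) := by
    have h4 := Algebra.coe_norm_int a
    have h5 : (((Algebra.norm ℤ a : ℤ) : ℚ) : ℂ) = (normSq (φ a) : ℂ) := by rw [h4, h1]
    exact_mod_cast h5
  rw [Nat.cast_natAbs, Int.cast_abs, h3, abs_of_nonneg (normSq_nonneg _)]

theorem finite_units_of_imag (φ : K →+* ℂ) (hK : Module.finrank ℚ K = 2)
    {x : K} (hx : (φ x).im ≠ 0) : Finite (𝓞 K)ˣ := by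
  have h := Embeddings.finite_of_norm_le K ℂ 1
  have h1 : ∀ u : (𝓞 K)ˣ, ((u : 𝓞 K) : K) ∈ {x | IsIntegral ℤ x ∧ ∀ φ : K →+* ℂ, ‖φ x‖ ≤ 1} := by
    intro u
    refine ⟨RingOfIntegers.isIntegral_coe _, fun σ => ?_⟩
    have h2 := absNorm_span_eq_normSq φ hK hx (u : 𝓞 K)
    rw [Ideal.span_singleton_eq_top.2 u.isUnit, Ideal.absNorm_top, Nat.cast_one,
      normSq_eq_norm_sq] at h2
    have h3 : ‖φ (u : 𝓞 K)‖ = 1 := by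
      have := norm_nonneg (φ (u : 𝓞 K))
      nlinarith
    rcases embedding_eq_or φ hK hx σ with rfl | rfl
    · exact h3.le
    · rw [RingHom.comp_apply, Complex.norm_conj]; exact h3.le
  have := h.to_subtype
  refine Finite.of_injective (fun u : (𝓞 K)ˣ => (⟨_, h1 u⟩ :
    {x | IsIntegral ℤ x ∧ ∀ φ : K →+* ℂ, ‖φ x‖ ≤ 1})) fun u v huv => ?_
  simp only [Subtype.mk.injEq] at huv
  exact Units.ext (RingOfIntegers.ext huv)

theorem idealClass_mul_eq_one {J I : Ideal (𝓞 K)} (hJ : J ≠ 0) (hI : I ≠ 0) :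
    idealClass J * idealClass I = 1 ↔ ∃ g : 𝓞 K, J * I = Ideal.span {g} := by
  rw [← idealClass_mul hJ hI, idealClass_eq (mem_nonZeroDivisors_of_ne_zero (mul_ne_zero hJ hI)),
    ClassGroup.mk0_eq_one_iff]
  exact ⟨fun h => h.principal, fun h => ⟨h⟩⟩

/-- Elements of norm `n · N(J)` in `J` correspond to ideals of norm `n` in the class of `J⁻¹`,
up to units. -/
theorem card_elements (C : ClassGroup (𝓞 K)) {J : Ideal (𝓞 K)} (hJ : J ≠ 0)
    (hC : idealClass J * C = 1) {n : ℕ} (hn : n ≠ 0) :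
    (Nat.card {a : J // Ideal.absNorm (Ideal.span {(a : 𝓞 K)}) = n * Ideal.absNorm J} : ℝ) =
      classCount C n * Nat.card (𝓞 K)ˣ := by
  classical
  have hprin : ∀ I : Ideal (𝓞 K), ∃ g : 𝓞 K, I ≠ 0 → idealClass I = C → J * I = Ideal.span {g} := by
    intro I
    by_cases h : I ≠ 0 ∧ idealClass I = C
    · obtain ⟨g, hg⟩ := (idealClass_mul_eq_one hJ h.1).1 (h.2 ▸ hC)
      exact ⟨g, fun _ _ => hg⟩
    · exact ⟨0, fun h1 h2 => absurd ⟨h1, h2⟩ h⟩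
  choose γ hγ using hprin
  set S := (idealsOfNorm K n).filter fun I => idealClass I = C with hS
  have hSmem : ∀ I ∈ S, I ≠ 0 ∧ Ideal.absNorm I = n ∧ idealClass I = C := fun I hI => by
    rw [hS, Finset.mem_filter] at hI
    exact ⟨ne_zero_of_mem_idealsOfNorm hn hI.1, mem_idealsOfNorm.1 hI.1, hI.2⟩
  have hsp : ∀ (I : S) (u : (𝓞 K)ˣ), Ideal.span {γ I * u} = J * I := fun I u => by
    rw [hγ I (hSmem I I.2).1 (hSmem I I.2).2.2, Ideal.span_singleton_mul_right_unit u.isUnit]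
  have hmem : ∀ (I : S) (u : (𝓞 K)ˣ), γ I * u ∈ J := fun I u => by
    exact Ideal.dvd_span_singleton.1 ⟨I, (hsp I u)⟩
  have hcard : Nat.card {a : J // Ideal.absNorm (Ideal.span {(a : 𝓞 K)}) = n * Ideal.absNorm J} =
      Nat.card (S × (𝓞 K)ˣ) := by
    symm
    refine Nat.card_congr (Equiv.ofBijective (fun x => ⟨⟨γ x.1 * x.2, hmem x.1 x.2⟩, ?_⟩) ⟨?_, ?_⟩)
    · rw [hsp, map_mul, (hSmem x.1 x.1.2).2.1, mul_comm]
    · rintro ⟨I, u⟩ ⟨I', u'⟩ h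
      have h1 : γ I * u = γ I' * u' := congrArg (fun y => ((y.1 : J) : 𝓞 K)) h
      have h2 : I = I' := by
        apply Subtype.ext
        apply mul_left_cancel₀ hJ
        rw [← hsp I u, h1, hsp]
      subst h2
      have h3 : γ I ≠ 0 := fun h0 => by
        have := hsp I u
        rw [h0, zero_mul, Ideal.span_singleton_eq_bot.2 rfl] at this
        exact mul_ne_zero hJ (hSmem I I.2).1 this.symm
      rw [Units.ext (mul_left_cancel₀ h3 h1)]
    · rintro ⟨⟨a, ha⟩, haN⟩
      have h1 : J ∣ Ideal.span {a} := Ideal.dvd_span_singleton.2 ha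
      obtain ⟨I, hI⟩ := h1
      have hJN := absNorm_ne_zero hJ
      have h2 : Ideal.absNorm I = n := by
        simp only at haN
        rw [hI, map_mul, mul_comm] at haN
        exact Nat.eq_of_mul_eq_mul_right (Nat.pos_of_ne_zero hJN) haN
      have hI0 : I ≠ 0 := ne_zero_of_mem_idealsOfNorm hn (mem_idealsOfNorm.2 h2)
      have h5 : idealClass I = C :=
        mul_left_cancel (((idealClass_mul_eq_one hJ hI0).2 ⟨a, hI.symm⟩).trans hC.symm)
      have hIS : I ∈ S := by
        rw [hS, Finset.mem_filter, mem_idealsOfNorm]; exact ⟨h2, h5⟩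
      have h6 : Associated (γ I) a := by
        rw [← Ideal.span_singleton_eq_span_singleton, ← hγ I hI0 h5, hI]
      obtain ⟨u, hu⟩ := h6
      exact ⟨(⟨I, hIS⟩, u), Subtype.ext (Subtype.ext hu)⟩
  rw [hcard, Nat.card_prod, Nat.cast_mul, Nat.card_eq_finsetCard]
  rfl

end ImagQuad

section PartialZeta

variable {K : Type*} [Field K] [NumberField K]

open NumberField ComplexConjugate

theorem im_mul_conj_ne_zero (φ : K →+* ℂ) {x : K} (hx : (φ x).im ≠ 0) {J : Ideal (𝓞 K)}
    (hJ : J ≠ 0) (b : Module.Basis (Fin 2) ℤ J) :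
    (φ ((b 0 : 𝓞 K) : K) * conj (φ ((b 1 : 𝓞 K) : K))).im ≠ 0 := by
  intro h0
  obtain ⟨a, haJ, ha0⟩ := Submodule.exists_mem_ne_zero_of_ne_bot hJ
  have hall : ∀ u v : J, (φ ((u : 𝓞 K) : K) * conj (φ ((v : 𝓞 K) : K))).im = 0 := by
    have hrep : ∀ u : J, φ ((u : 𝓞 K) : K) = (b.repr u 0 : ℂ) * φ ((b 0 : 𝓞 K) : K) +
        (b.repr u 1 : ℂ) * φ ((b 1 : 𝓞 K) : K) := fun u => by
      have h1 := b.sum_repr u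
      rw [Fin.sum_univ_two] at h1
      have h2 := congrArg (fun w : J => φ ((w : 𝓞 K) : K)) h1
      simp only [Submodule.coe_add, Submodule.coe_smul_of_tower, zsmul_eq_mul, map_add, map_mul,
        map_intCast] at h2
      exact h2.symm
    intro u v
    rw [hrep u, hrep v]
    simp only [map_add, map_mul, add_im, mul_im, mul_re, conj_re, conj_im, intCast_re, intCast_im,
      add_re, map_intCast] at h0 ⊢
    linear_combination ((b.repr u 0 : ℝ) * (b.repr v 1 : ℝ) - (b.repr u 1 : ℝ) * (b.repr v 0 : ℝ)) * h0
  obtain ⟨y, z, hz, hyz⟩ := IsFractionRing.div_surjective (A := 𝓞 K) x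
  have hz0 : (z : K) ≠ 0 := by
    simpa using nonZeroDivisors.ne_zero hz
  have h1 := hall ⟨a * y, J.mul_mem_right y haJ⟩ ⟨a * z, J.mul_mem_right z haJ⟩
  have hy : ((y : 𝓞 K) : K) = x * z := by
    rw [← hyz]; exact (div_mul_cancel₀ _ hz0).symm
  simp only [map_mul, hy] at h1
  have ha : φ a ≠ 0 := by simpa using ha0
  have hz1 : φ z ≠ 0 := by simpa using hz0
  rw [show φ a * (φ x * φ z) * (conj (φ a) * conj (φ z)) = φ x * ((φ a * conj (φ a)) *
    (φ z * conj (φ z))) by ring, mul_conj, mul_conj, ← ofReal_mul, im_mul_ofReal] at h1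
  exact mul_ne_zero hx (mul_ne_zero (normSq_pos.2 ha).ne' (normSq_pos.2 hz1).ne') h1

/-- The partial zeta functions of an imaginary quadratic field extend meromorphically to `ℂ`, and
vanish at `-1`. -/
theorem exists_partial_zeta (φ : K →+* ℂ) (hK : Module.finrank ℚ K = 2)
    {x : K} (hx : (φ x).im ≠ 0) (C : ClassGroup (𝓞 K)) :
    ∃ G : ℂ → ℂ, Differentiable ℂ G ∧ G (-1) = 0 ∧ ∀ s : ℂ, 1 < s.re →
      LSeries (fun n => (classCount C n : ℂ)) s = G s / (s - 1) := by
  obtain ⟨J', hJ'⟩ := ClassGroup.mk0_surjective C⁻¹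
  obtain ⟨J, hJm⟩ := J'
  have hJ : J ≠ 0 := nonZeroDivisors.ne_zero hJm
  have hC : idealClass J * C = 1 := by rw [idealClass_eq hJm, hJ', inv_mul_cancel]
  have hr : Module.finrank ℤ (𝓞 K) = 2 := by rw [RingOfIntegers.rank, hK]
  let b : Module.Basis (Fin 2) ℤ J :=
    Ideal.selfBasis (Module.finBasisOfFinrankEq ℤ (𝓞 K) hr) J hJ
  have him := im_mul_conj_ne_zero φ hx hJ b
  set ω₁ := φ ((b 0 : 𝓞 K) : K) with hω₁
  set ω₂ := φ ((b 1 : 𝓞 K) : K) with hω₂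
  have hNJ := absNorm_ne_zero hJ
  have hM : (0 : ℝ) < Ideal.absNorm J := Nat.cast_pos.2 (Nat.pos_of_ne_zero hNJ)
  set M : ℝ := ((Ideal.absNorm J : ℕ) : ℝ) with hMdef
  have hω0 : ω₁ ≠ 0 := fun h => him (by rw [h, zero_mul, zero_im])
  obtain ⟨G, hG, hG1, hGs⟩ := exists_epstein_of_pos (A := normSq ω₁ / M)
    (B := 2 * (ω₁ * conj ω₂).re / M) (C := normSq ω₂ / M) (div_pos (normSq_pos.2 hω0) hM) (by
      have h1 : normSq ω₁ * normSq ω₂ = (ω₁ * conj ω₂).re ^ 2 + (ω₁ * conj ω₂).im ^ 2 := by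
        simp only [normSq_apply, mul_re, mul_im, conj_re, conj_im]; ring
      have h2 : 4 * (normSq ω₁ / M) * (normSq ω₂ / M) - (2 * (ω₁ * conj ω₂).re / M) ^ 2 =
          4 * (ω₁ * conj ω₂).im ^ 2 / M ^ 2 := by
        field_simp
        linear_combination 4 * h1
      rw [h2]
      positivity)
  have := finite_units_of_imag φ hK hx
  set w : ℂ := ((Nat.card (𝓞 K)ˣ : ℕ) : ℂ) with hw
  have hw0 : w ≠ 0 := Nat.cast_ne_zero.2 Nat.card_pos.ne'
  refine ⟨fun s => G s / w, hG.div_const w, by simp only [hG1, zero_div], fun s hs => ?_⟩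
  have hdiv : ∀ a : J, Ideal.absNorm J ∣ Ideal.absNorm (Ideal.span {(a : 𝓞 K)}) := fun a =>
    map_dvd _ (Ideal.dvd_span_singleton.2 a.2)
  choose g hg using hdiv
  have hg0 : ∀ a : J, g a = 0 ↔ a = 0 := fun a => by
    rw [← mul_right_inj' hNJ, ← hg, mul_zero, Ideal.absNorm_eq_zero_iff,
      Ideal.span_singleton_eq_bot, ZeroMemClass.coe_eq_zero]
  let e : ℤ × ℤ ≃ J := (b.equivFun.toEquiv.trans (finTwoArrowEquiv ℤ)).symm
  have he : ∀ v, φ ((e v : 𝓞 K) : K) = v.1 * ω₁ + v.2 * ω₂ := fun v => by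
    have h1 : e v = v.1 • b 0 + v.2 • b 1 := by
      show b.equivFun.symm ((finTwoArrowEquiv ℤ).symm v) = _
      rw [Module.Basis.equivFun_symm_apply, Fin.sum_univ_two]
      rfl
    rw [h1]
    simp [hω₁, hω₂]
  have he0 : ∀ v, e v = 0 ↔ v = 0 := fun v => by
    have h1 : e 0 = 0 := by
      show b.equivFun.symm ((finTwoArrowEquiv ℤ).symm 0) = _
      rw [Module.Basis.equivFun_symm_apply, Fin.sum_univ_two]
      simp
    rw [← h1, e.apply_eq_iff_eq]
  have hform : ∀ v, rForm (normSq ω₁ / M) (2 * (ω₁ * conj ω₂).re / M) (normSq ω₂ / M) v =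
      g (e v) := fun v => by
    have h1 := absNorm_span_eq_normSq φ hK hx (e v : 𝓞 K)
    rw [hg, he, Nat.cast_mul, ← hMdef] at h1
    have h2 : (g (e v) : ℝ) = normSq (v.1 * ω₁ + v.2 * ω₂) / M := by
      rw [← h1]; field_simp
    rw [h2, rForm]
    simp only [normSq_apply, mul_re, mul_im, conj_re, conj_im, add_re, add_im, intCast_re,
      intCast_im]
    field_simp
    ring
  have h1 : HasSum (fun a : J => (if g a = 0 then (0 : ℂ) else 1) / (g a : ℂ) ^ s)
      (G s / (s - 1)) := by
    rw [← e.hasSum_iff]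
    refine hasSum_of_eq (fun v => ?_) (hGs s hs)
    simp only [Function.comp_apply, hg0, he0]
    rw [hform, ofReal_natCast]
  have h2 := (Equiv.sigmaFiberEquiv g).hasSum_iff.2 h1
  have h3 : ∀ n : ℕ, HasSum (fun c : {a : J // g a = n} =>
      ((fun a : J => (if g a = 0 then (0 : ℂ) else 1) / (g a : ℂ) ^ s) ∘
        Equiv.sigmaFiberEquiv g) ⟨n, c⟩) (w * LSeries.term (fun n => (classCount C n : ℂ)) s n) := by
    intro n
    rcases eq_or_ne n 0 with rfl | hn
    · rw [LSeries.term_zero, mul_zero]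
      refine hasSum_of_eq (fun c => ?_) hasSum_zero
      simp [c.2]
    have hval : ∀ c : {a : J // g a = n},
        ((fun a : J => (if g a = 0 then (0 : ℂ) else 1) / (g a : ℂ) ^ s) ∘
        Equiv.sigmaFiberEquiv g) ⟨n, c⟩ = 1 / (n : ℂ) ^ s := fun c => by
      simp [c.2, hn]
    have hn0 : 1 / (n : ℂ) ^ s ≠ 0 :=
      one_div_ne_zero ((Complex.cpow_ne_zero_iff_of_exponent_ne_zero (by
        rintro rfl; norm_num at hs)).2 (Nat.cast_ne_zero.2 hn))
    have hfin : Finite {a : J // g a = n} := by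
      by_contra hinf
      rw [not_finite_iff_infinite] at hinf
      have h4 := h2.summable.sigma_factor n
      simp only [hval] at h4
      exact hn0 ((summable_const_iff _).1 h4)
    have hcard : (Nat.card {a : J // g a = n} : ℝ) = classCount C n * Nat.card (𝓞 K)ˣ := by
      rw [← card_elements C hJ hC hn]
      congr 1
      refine Nat.card_congr (Equiv.subtypeEquivRight fun a => ?_)
      rw [hg, mul_comm n, mul_right_inj' hNJ]
    have := Fintype.ofFinite {a : J // g a = n}
    refine hasSum_of_eq (fun c => (hval c).symm) ?_
    have h5 := hasSum_fintype fun _ : {a : J // g a = n} => 1 / (n : ℂ) ^ s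
    rw [Finset.sum_const, Finset.card_univ, ← Nat.card_eq_fintype_card, nsmul_eq_mul] at h5
    have h6 : (Nat.card {a : J // g a = n} : ℂ) = classCount C n * w := by
      rw [hw]; exact_mod_cast congrArg (fun r : ℝ => (r : ℂ)) hcard
    rw [h6] at h5
    rw [LSeries.term_of_ne_zero hn]
    rw [show w * ((classCount C n : ℂ) / (n : ℂ) ^ s) = classCount C n * w * (1 / (n : ℂ) ^ s) by
      ring]
    exact h5
  have h4 := h2.sigma h3
  have h5 : HasSum (LSeries.term (fun n => (classCount C n : ℂ)) s) (w⁻¹ * (G s / (s - 1))) :=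
    hasSum_of_eq (fun n => by rw [inv_mul_cancel_left₀ hw0]) (h4.mul_left w⁻¹)
  rw [LSeries, h5.tsum_eq]
  ring

end PartialZeta

section ClassCharacters

variable {K : Type*} [Field K] [NumberField K]

open NumberField Filter Topology

/-- A character of the class group as a function on ideals. -/
noncomputable def idealChar (ψ : AddChar (Additive (ClassGroup (𝓞 K))) ℂ) (I : Ideal (𝓞 K)) : ℂ :=
  ψ (Additive.ofMul (idealClass I))

theorem idealChar_mul (ψ : AddChar (Additive (ClassGroup (𝓞 K))) ℂ) (I J : Ideal (𝓞 K))
    (hI : I ≠ 0) (hJ : J ≠ 0) : idealChar ψ (I * J) = idealChar ψ I * idealChar ψ J := by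
  rw [idealChar, idealClass_mul hI hJ, ofMul_mul, AddChar.map_add_eq_mul]
  rfl

theorem idealChar_one (ψ : AddChar (Additive (ClassGroup (𝓞 K))) ℂ) : idealChar ψ 1 = 1 := by
  rw [idealChar, idealClass_one, ofMul_one, AddChar.map_zero_eq_one]

theorem norm_idealChar_le (ψ : AddChar (Additive (ClassGroup (𝓞 K))) ℂ) (I : Ideal (𝓞 K)) :
    ‖idealChar ψ I‖ ≤ 1 := (AddChar.norm_apply ψ _).le

variable (K) in
/-- The partial zeta functions extend to the whole plane and vanish at `-1`. -/
def HasPartialZeta : Prop :=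
  ∀ C : ClassGroup (𝓞 K), ∃ G : ℂ → ℂ, Differentiable ℂ G ∧ G (-1) = 0 ∧ ∀ s : ℂ, 1 < s.re →
      LSeries (fun n => (classCount C n : ℂ)) s = G s / (s - 1)

open Classical in
theorem exists_numerator (hz : HasPartialZeta K)
    (ψ : AddChar (Additive (ClassGroup (𝓞 K))) ℂ) :
    ∃ H : ℂ → ℂ, Differentiable ℂ H ∧ H (-1) = 0 ∧
      H 1 = (if ψ = 0 then (Fintype.card (ClassGroup (𝓞 K)) : ℂ) else 0) * classResidue K ∧
      ∀ s : ℂ, 1 < s.re → LSeries (normSum (idealChar ψ)) s = H s / (s - 1) := by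
  choose G hG hG1 hGs using hz
  have hres : ∀ C, G C 1 = classResidue K := fun C => by
    have h1 := tendsto_classCount C
    have h2 : Tendsto (fun s : ℝ => G C s) (𝓝[>] 1) (𝓝 (G C 1)) := by
      have h3 : ContinuousAt (fun s : ℝ => G C s) 1 :=
        ((hG C).continuous.comp continuous_ofReal).continuousAt
      have h4 := h3.tendsto.mono_left (nhdsWithin_le_nhds (s := Set.Ioi 1))
      simpa using h4
    refine tendsto_nhds_unique (h2.congr' ?_) h1
    filter_upwards [self_mem_nhdsWithin] with s hs
    have hs1 : (s : ℂ) - 1 ≠ 0 := by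
      rw [sub_ne_zero]; exact_mod_cast (ne_of_gt hs)
    rw [hGs C s (by simpa using hs), mul_div_cancel₀ _ hs1]
  refine ⟨fun s => ∑ C, ψ (Additive.ofMul C) * G C s,
    Differentiable.fun_sum fun C _ => (hG C).const_mul _, by simp [hG1], ?_, fun s hs => ?_⟩
  · simp only [hres]
    rw [← Finset.sum_mul, ← Fintype.card_additive, ← AddChar.sum_eq_ite ψ]
    congr 1
    exact Fintype.sum_equiv Additive.ofMul _ _ fun _ => rfl
  · rw [Finset.sum_div]
    refine ((hasSum_normSum_class (fun C => ψ (Additive.ofMul C)) hs).LSeries_eq).trans ?_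
    exact Finset.sum_congr rfl fun C _ => by rw [hGs C s hs, mul_div_assoc]

theorem differentiable_dslope {f : ℂ → ℂ} (hf : Differentiable ℂ f) (c : ℂ) :
    Differentiable ℂ (dslope f c) := by
  rw [← differentiableOn_univ] at hf ⊢
  exact (Complex.differentiableOn_dslope univ_mem).2 hf

theorem exists_entire (hz : HasPartialZeta K)
    {ψ : AddChar (Additive (ClassGroup (𝓞 K))) ℂ} (hψ : ψ ≠ 0) :
    ∃ F : ℂ → ℂ, Differentiable ℂ F ∧
      ∀ s : ℂ, 1 < s.re → LSeries (normSum (idealChar ψ)) s = F s := by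
  obtain ⟨H, hH, -, hH1, hHs⟩ := exists_numerator hz ψ
  rw [if_neg hψ, zero_mul] at hH1
  refine ⟨dslope H 1, differentiable_dslope hH 1, fun s hs => ?_⟩
  have hs1 : s ≠ 1 := by rintro rfl; simp at hs
  rw [hHs s hs, dslope_of_ne _ hs1, slope_def_field, hH1, sub_zero]

theorem prod_normSum_lam (S : Finset (AddChar (Additive (ClassGroup (𝓞 K))) ℂ)) (n : ℕ) :
    ((∑ ψ ∈ S, normSum (fun I => idealLam I * idealChar ψ I)) *
      ∏ ψ ∈ S, normSum (idealChar ψ)) n = Real.log n * (∏ ψ ∈ S, normSum (idealChar ψ)) n := by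
  classical
  induction S using Finset.induction_on generalizing n with
  | empty =>
    simp only [Finset.sum_empty, Finset.prod_empty, zero_mul, ArithmeticFunction.zero_apply]
    rcases eq_or_ne n 1 with rfl | hn
    · simp
    · rw [ArithmeticFunction.one_apply_ne hn, mul_zero]
  | insert a S ha ih =>
    rw [Finset.sum_insert ha, Finset.prod_insert ha]
    set f := normSum (idealChar a)
    set P := ∏ ψ ∈ S, normSum (idealChar ψ)
    set Q := ∑ ψ ∈ S, normSum (fun I => idealLam I * idealChar ψ I)
    rw [show (normSum (fun I => idealLam I * idealChar a I) + Q) * (f * P) =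
      (normSum (fun I => idealLam I * idealChar a I) * f) * P + f * (Q * P) by ring,
      ArithmeticFunction.add_apply, ArithmeticFunction.mul_apply, ArithmeticFunction.mul_apply,
      ArithmeticFunction.mul_apply, ← Finset.sum_add_distrib, Finset.mul_sum]
    refine Finset.sum_congr rfl fun x hx => ?_
    obtain ⟨hx1, hx2⟩ := Nat.mem_divisorsAntidiagonal.1 hx
    rw [normSum_lam_mul (idealChar_mul a), ih, ← hx1, Nat.cast_mul,
      Real.log_mul (by rintro h; simp_all) (by rintro h; simp_all)]
    push_cast
    ring

theorem summable_prod (S : Finset (AddChar (Additive (ClassGroup (𝓞 K))) ℂ)) {s : ℂ}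
    (hs : 1 < s.re) : LSeriesSummable (∏ ψ ∈ S, normSum (idealChar ψ) : ArithmeticFunction ℂ) s ∧
      LSeries (∏ ψ ∈ S, normSum (idealChar ψ) : ArithmeticFunction ℂ) s =
        ∏ ψ ∈ S, LSeries (normSum (idealChar ψ)) s := by
  classical
  induction S using Finset.induction_on with
  | empty =>
    simp only [Finset.prod_empty]
    have h1 : (⇑(1 : ArithmeticFunction ℂ) : ℕ → ℂ) = LSeries.delta := by
      ext n; simp [ArithmeticFunction.one_apply, LSeries.delta]
    rw [h1]
    refine ⟨summable_of_ne_finset_zero (s := {1}) fun n hn => ?_, by simp [LSeries_delta]⟩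
    rw [Finset.mem_singleton] at hn
    simp [LSeries.term_def, LSeries.delta, hn]
  | insert a S ha ih =>
    rw [Finset.prod_insert ha, Finset.prod_insert ha]
    have h1 := summable_normSum (norm_idealChar_le a) hs
    exact ⟨ArithmeticFunction.LSeriesSummable_mul h1 ih.1, by
      rw [ArithmeticFunction.LSeries_mul' h1 ih.1, ih.2]⟩

open ComplexOrder in
theorem sum_idealChar_nonneg (I : Ideal (𝓞 K)) :
    0 ≤ ∑ ψ : AddChar (Additive (ClassGroup (𝓞 K))) ℂ, idealChar ψ I := by
  classical
  simp only [idealChar, AddChar.sum_apply_eq_ite]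
  split_ifs
  · exact Nat.cast_nonneg _
  · exact le_rfl

theorem arithmeticFunction_sum_apply {ι : Type*} (S : Finset ι) (f : ι → ArithmeticFunction ℂ)
    (n : ℕ) : (∑ i ∈ S, f i) n = ∑ i ∈ S, f i n := by
  classical
  induction S using Finset.induction_on with
  | empty => simp
  | insert a S ha ih => rw [Finset.sum_insert ha, Finset.sum_insert ha,
      ArithmeticFunction.add_apply, ih]

open ComplexOrder in
theorem sum_normSum_lam_nonneg (n : ℕ) :
    0 ≤ (∑ ψ : AddChar (Additive (ClassGroup (𝓞 K))) ℂ,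
      normSum (fun I => idealLam I * idealChar ψ I)) n := by
  rcases eq_or_ne n 0 with rfl | hn
  · simp
  rw [arithmeticFunction_sum_apply]
  simp only [normSum_apply _ hn]
  rw [Finset.sum_comm]
  refine Finset.sum_nonneg fun I _ => ?_
  rw [← Finset.mul_sum]
  exact mul_nonneg (by exact_mod_cast idealLam_nonneg I) (sum_idealChar_nonneg I)

theorem normSum_lam_one (v : Ideal (𝓞 K) → ℂ) : normSum (fun I => idealLam I * v I) 1 = 0 := by
  rw [normSum_apply _ one_ne_zero]
  refine Finset.sum_eq_zero fun I hI => ?_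
  have h1 := idealLam_le (ne_zero_of_mem_idealsOfNorm one_ne_zero hI)
  rw [mem_idealsOfNorm.1 hI, Nat.cast_one, Real.log_one] at h1
  rw [le_antisymm h1 (idealLam_nonneg I), ofReal_zero, zero_mul]

theorem prod_normSum_one (S : Finset (AddChar (Additive (ClassGroup (𝓞 K))) ℂ)) :
    (∏ ψ ∈ S, normSum (idealChar ψ) : ArithmeticFunction ℂ) 1 = 1 := by
  classical
  induction S using Finset.induction_on with
  | empty => simp
  | insert a S ha ih =>
    rw [Finset.prod_insert ha, ArithmeticFunction.mul_apply_one, ih,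
      normSum_one (idealChar_one a), one_mul]

open ComplexOrder in
theorem prod_normSum_nonneg (n : ℕ) :
    0 ≤ (∏ ψ : AddChar (Additive (ClassGroup (𝓞 K))) ℂ, normSum (idealChar ψ) :
      ArithmeticFunction ℂ) n := by
  induction n using Nat.strong_induction_on with
  | _ n ih =>
  rcases Nat.lt_or_ge n 2 with h2 | h2
  · interval_cases n
    · simp
    · rw [prod_normSum_one]; exact zero_le_one
  have hlog : (0 : ℝ) < Real.log n := Real.log_pos (by exact_mod_cast h2)
  have h := prod_normSum_lam (K := K) Finset.univ n
  have h0 := congrArg (fun x => (((Real.log n)⁻¹ : ℝ) : ℂ) * x) h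
  rw [ofReal_inv, inv_mul_cancel_left₀ (by exact_mod_cast hlog.ne'), ← ofReal_inv] at h0
  rw [← h0]
  refine mul_nonneg (by exact_mod_cast (inv_pos.2 hlog).le) ?_
  rw [ArithmeticFunction.mul_apply]
  refine Finset.sum_nonneg fun x hx => ?_
  obtain ⟨hx1, hx2⟩ := Nat.mem_divisorsAntidiagonal.1 hx
  rcases eq_or_ne x.1 1 with h1 | h1
  · rw [h1, arithmeticFunction_sum_apply, Finset.sum_eq_zero fun ψ _ => normSum_lam_one _, zero_mul]
  · refine mul_nonneg (sum_normSum_lam_nonneg _) (ih _ ?_)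
    have h3 : x.1 ≠ 0 := by rintro h; simp_all
    have h4 : x.2 ≠ 0 := by rintro h; simp_all
    have : 2 ≤ x.1 := by omega
    nlinarith [Nat.pos_of_ne_zero h4]

open ComplexOrder in
/-- The `L`-functions of nontrivial class group characters do not vanish at `1`. -/
theorem entire_ne_zero (hz : HasPartialZeta K)
    {ψ : AddChar (Additive (ClassGroup (𝓞 K))) ℂ} (hψ : ψ ≠ 0) {F : ℂ → ℂ}
    (hF : Differentiable ℂ F)
    (hFs : ∀ s : ℂ, 1 < s.re → LSeries (normSum (idealChar ψ)) s = F s) : F 1 ≠ 0 := by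
  classical
  intro hF1
  obtain ⟨H, hH, hH1, -, hHs⟩ := exists_numerator hz (0 : AddChar (Additive (ClassGroup (𝓞 K))) ℂ)
  have hex : ∀ χ : AddChar (Additive (ClassGroup (𝓞 K))) ℂ, ∃ F : ℂ → ℂ, χ ≠ 0 →
      Differentiable ℂ F ∧ ∀ s : ℂ, 1 < s.re → LSeries (normSum (idealChar χ)) s = F s := fun χ => by
    by_cases h : χ = 0
    · exact ⟨0, fun h' => absurd h h'⟩
    · obtain ⟨F, h1⟩ := exists_entire hz h
      exact ⟨F, fun _ => h1⟩
  choose Fs hFs' using hex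
  set T := (Finset.univ.erase (0 : AddChar (Additive (ClassGroup (𝓞 K))) ℂ)).erase ψ with hT
  have hTne : ∀ χ ∈ T, χ ≠ 0 := fun χ hχ => by
    rw [hT, Finset.mem_erase, Finset.mem_erase] at hχ; exact hχ.2.1
  have hdiff : Differentiable ℂ fun s => H s * dslope F 1 s * ∏ χ ∈ T, Fs χ s :=
    (hH.mul (differentiable_dslope hF 1)).mul
      (Differentiable.fun_finsetProd fun χ hχ => (hFs' χ (hTne χ hχ)).1)
  have hpos := ArithmeticFunction.LSeries_positive_of_differentiable_of_eqOn (x := 1)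
    (a := ∏ ψ : AddChar (Additive (ClassGroup (𝓞 K))) ℂ, normSum (idealChar ψ))
    (fun n => prod_normSum_nonneg n) (by rw [prod_normSum_one]; exact one_pos) hdiff
    (LSeries.abscissaOfAbsConv_le_of_forall_lt_LSeriesSummable fun y hy =>
      (summable_prod _ (by simpa using hy)).1) (fun s hs => by
      have hs' : 1 < s.re := hs
      have hs1 : s ≠ 1 := by rintro rfl; simp at hs'
      have hs2 : s - 1 ≠ 0 := sub_ne_zero.2 hs1
      beta_reduce
      rw [(summable_prod _ hs').2, ← Finset.mul_prod_erase _ _ (Finset.mem_univ 0),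
        ← Finset.mul_prod_erase _ _ (Finset.mem_erase.2 ⟨hψ, Finset.mem_univ _⟩),
        hHs s hs', hFs s hs', ← hT, dslope_of_ne _ hs1, slope_def_field, hF1, sub_zero,
        Finset.prod_congr rfl fun χ hχ => (hFs' χ (hTne χ hχ)).2 s hs']
      ring) (-1)
  simp [hH1] at hpos

end ClassCharacters

section PrimesInClasses

open NumberField Filter Topology

theorem tendsto_log_deriv {L Λ E : ℂ → ℂ} (k : ℕ) (hE : Differentiable ℂ E) (hE1 : E 1 ≠ 0)
    (hL : ∀ s : ℂ, 1 < s.re → L s * (s - 1) ^ k = E s)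
    (hΛ : ∀ s : ℂ, 1 < s.re → Λ s * L s = -deriv L s) :
    Tendsto (fun s : ℝ => ((s : ℂ) - 1) * Λ s) (𝓝[>] 1) (𝓝 (k : ℂ)) := by
  have hcont : ∀ f : ℂ → ℂ, ContinuousAt f 1 → Tendsto (fun s : ℝ => f s) (𝓝[>] 1) (𝓝 (f 1)) :=
    fun f hf => by
    have h3 : ContinuousAt (fun s : ℝ => f s) 1 :=
      ContinuousAt.comp (by simpa using hf) continuous_ofReal.continuousAt
    simpa using h3.tendsto.mono_left (nhdsWithin_le_nhds (s := Set.Ioi 1))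
  have hdE : Differentiable ℂ (deriv E) := by
    rw [← differentiableOn_univ] at hE ⊢
    exact hE.deriv isOpen_univ
  have h1 := hcont (fun s => k - (s - 1) * deriv E s / E s)
    (continuousAt_const.sub (((continuousAt_id.sub continuousAt_const).mul
      hdE.continuous.continuousAt).div hE.continuous.continuousAt hE1))
  have hne := (hcont E hE.continuous.continuousAt).eventually_ne hE1
  rw [sub_self, zero_mul, zero_div, sub_zero] at h1
  refine h1.congr' ?_
  filter_upwards [self_mem_nhdsWithin, hne] with s hs hEs
  have hs' : 1 < (s : ℂ).re := hs
  have hs1 : (s : ℂ) - 1 ≠ 0 := by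
    rw [sub_ne_zero]; rintro h; rw [h] at hs'; simp at hs'
  have hev : L =ᶠ[𝓝 (s : ℂ)] fun z => E z / (z - 1) ^ k := by
    have hU : {z : ℂ | 1 < z.re} ∈ 𝓝 (s : ℂ) :=
      (isOpen_lt continuous_const continuous_re).mem_nhds hs'
    filter_upwards [hU] with z hz
    have hz' : 1 < z.re := hz
    have hz1 : z - 1 ≠ 0 := by
      rw [sub_ne_zero]; rintro rfl; simp at hz'
    rw [← hL z hz', mul_div_cancel_right₀ _ (pow_ne_zero _ hz1)]
  have hd : HasDerivAt (fun z => E z / (z - 1) ^ k)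
      ((deriv E s * (s - 1) ^ k - E s * (k * ((s : ℂ) - 1) ^ (k - 1) * 1)) / ((s - 1) ^ k) ^ 2) s :=
    (hE _).hasDerivAt.div (((hasDerivAt_id _).sub_const 1).pow k) (pow_ne_zero _ hs1)
  have h2 := hΛ s hs'
  rw [hev.deriv_eq, hd.deriv] at h2
  have h3 : (k : ℂ) * ((s : ℂ) - 1) ^ (k - 1) * (s - 1) = k * (s - 1) ^ k := by
    rcases k with _ | k
    · simp
    · rw [Nat.add_sub_cancel, pow_succ, mul_assoc]
  have h4 : Λ s * E s * (s - 1) = -((s - 1) * deriv E s) + k * E s := by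
    rw [← hL s hs']
    have h5 := congrArg (fun x => x * ((s : ℂ) - 1) ^ k * (s - 1)) h2
    beta_reduce at h5
    rw [← mul_assoc, h5, ← hL s hs']
    have hp := pow_ne_zero k hs1
    field_simp
    linear_combination L s * h3
  rw [sub_eq_iff_eq_add, ← sub_eq_iff_eq_add', eq_comm, div_eq_iff hEs]
  linear_combination h4

variable {K : Type*} [Field K] [NumberField K]

open Classical in
theorem tendsto_normSum_lam (hz : HasPartialZeta K)
    (ψ : AddChar (Additive (ClassGroup (𝓞 K))) ℂ) :
    Tendsto (fun s : ℝ => ((s : ℂ) - 1) * LSeries (normSum fun I => idealLam I * idealChar ψ I) s)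
      (𝓝[>] 1) (𝓝 (if ψ = 0 then 1 else 0)) := by
  have hΛ := fun (s : ℂ) (hs : 1 < s.re) =>
    LSeries_lam_mul (norm_idealChar_le ψ) (idealChar_mul ψ) hs
  split_ifs with hψ
  · obtain ⟨H, hH, -, hH1, hHs⟩ := exists_numerator hz ψ
    rw [if_pos hψ] at hH1
    have h := tendsto_log_deriv 1 hH (by
      rw [hH1]
      exact mul_ne_zero (Nat.cast_ne_zero.2 Fintype.card_ne_zero)
        (by exact_mod_cast classResidue_pos.ne')) (fun s hs => by
      have hs1 : s - 1 ≠ 0 := by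
        rw [sub_ne_zero]; rintro rfl; simp at hs
      rw [hHs s hs, pow_one, div_mul_cancel₀ _ hs1]) hΛ
    simpa using h
  · obtain ⟨F, hF, hFs⟩ := exists_entire hz hψ
    have h := tendsto_log_deriv 0 hF (entire_ne_zero hz hψ hF hFs)
      (fun s hs => by rw [hFs s hs, pow_zero, mul_one]) hΛ
    simpa using h

open Classical in
/-- The von Mangoldt sum over ideals of norm `n` in a given class. -/
noncomputable def classLam (C : ClassGroup (𝓞 K)) (n : ℕ) : ℝ :=
  ∑ I ∈ idealsOfNorm K n with idealClass I = C, idealLam I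

theorem sum_char_classLam (C : ClassGroup (𝓞 K)) {n : ℕ} (hn : n ≠ 0) :
    ∑ ψ : AddChar (Additive (ClassGroup (𝓞 K))) ℂ, ψ (-Additive.ofMul C) *
      normSum (fun I => idealLam I * idealChar ψ I) n =
      (Fintype.card (ClassGroup (𝓞 K)) : ℂ) * classLam C n := by
  classical
  simp only [normSum_apply _ hn, Finset.mul_sum]
  rw [Finset.sum_comm, classLam, ofReal_sum, Finset.mul_sum, Finset.sum_filter]
  refine Finset.sum_congr rfl fun I _ => ?_
  have h1 : ∀ ψ : AddChar (Additive (ClassGroup (𝓞 K))) ℂ,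
      ψ (-Additive.ofMul C) * (idealLam I * idealChar ψ I) =
        idealLam I * ψ (-Additive.ofMul C + Additive.ofMul (idealClass I)) := fun ψ => by
    rw [AddChar.map_add_eq_mul, idealChar]; ring
  simp only [h1]
  rw [← Finset.mul_sum, AddChar.sum_apply_eq_ite, Fintype.card_additive]
  by_cases h : idealClass I = C
  · rw [if_pos h, if_pos (by rw [h, neg_add_cancel]), mul_comm]
  · rw [if_neg h, if_neg (fun h' => h (Additive.ofMul.injective (neg_add_eq_zero.1 h')).symm), mul_zero]

theorem tendsto_classLam (hz : HasPartialZeta K) (C : ClassGroup (𝓞 K)) :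
    Tendsto (fun s : ℝ => ((s : ℂ) - 1) * LSeries (fun n => (classLam C n : ℂ)) s)
      (𝓝[>] 1) (𝓝 (Fintype.card (ClassGroup (𝓞 K)) : ℂ)⁻¹) := by
  classical
  have hc0 : (Fintype.card (ClassGroup (𝓞 K)) : ℂ) ≠ 0 := Nat.cast_ne_zero.2 Fintype.card_ne_zero
  have h1 := tendsto_finsetSum Finset.univ fun
    (ψ : AddChar (Additive (ClassGroup (𝓞 K))) ℂ) _ =>
    (tendsto_normSum_lam hz ψ).const_mul (ψ (-Additive.ofMul C))
  have h2 : ∑ ψ : AddChar (Additive (ClassGroup (𝓞 K))) ℂ,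
      ψ (-Additive.ofMul C) * (if ψ = 0 then 1 else 0) = 1 := by
    simp
  rw [h2] at h1
  have h3 := h1.const_mul (Fintype.card (ClassGroup (𝓞 K)) : ℂ)⁻¹
  rw [mul_one] at h3
  refine h3.congr' ?_
  filter_upwards [self_mem_nhdsWithin] with s hs
  have hs' : 1 < (s : ℂ).re := hs
  have h4 := LSeriesHasSum.sum (S := Finset.univ) fun
    (ψ : AddChar (Additive (ClassGroup (𝓞 K))) ℂ) _ =>
    ((summable_normSum_lam (norm_idealChar_le ψ) hs').LSeriesHasSum).smul (ψ (-Additive.ofMul C))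
  have h5 := (h4.smul (Fintype.card (ClassGroup (𝓞 K)) : ℂ)⁻¹).LSeries_eq
  rw [LSeries_congr (g := fun n => (classLam C n : ℂ)) (fun {n} hn => by
    simp only [Pi.smul_apply, Finset.sum_apply, smul_eq_mul]
    rw [sum_char_classLam C hn, inv_mul_cancel_left₀ hc0]) s] at h5
  rw [h5]
  simp only [Finset.mul_sum]
  exact Finset.sum_congr rfl fun ψ _ => by ring

end PrimesInClasses

section PrimePart

open Filter Topology ArithmeticFunction

theorem summable_vonMangoldt_div {s : ℝ} (hs : 1 < s) :
    Summable fun n : ℕ => (vonMangoldt n : ℝ) / (n : ℝ) ^ s := by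
  have h := (ArithmeticFunction.LSeriesSummable_vonMangoldt (s := (s : ℂ)) (by simpa using hs)).norm
  refine h.congr fun n => ?_
  rcases eq_or_ne n 0 with rfl | hn
  · simp
  · rw [LSeries.norm_term_eq, if_neg hn, Complex.norm_real, Real.norm_of_nonneg vonMangoldt_nonneg,
      ofReal_re]

theorem summable_nonprime_vonMangoldt :
    Summable fun n : ℕ => (if n.Prime then 0 else vonMangoldt n : ℝ) / n := by
  refine (vonMangoldt.summable_residueClass_non_primes_div (q := 1) 0).congr fun n => ?_
  have : vonMangoldt.residueClass (0 : ZMod 1) n = vonMangoldt n :=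
    Set.indicator_of_mem (show n ∈ {n : ℕ | (n : ZMod 1) = 0} from
      Subsingleton.elim (n : ZMod 1) 0) _
  rw [this]

variable {a : ℕ → ℝ} {m : ℝ}

theorem summable_div_rpow (ha : ∀ n, n ≠ 0 → 0 ≤ a n) (ham : ∀ n, n ≠ 0 → a n ≤ m * vonMangoldt n)
    {s : ℝ} (hs : 1 < s) : Summable fun n : ℕ => a n / (n : ℝ) ^ s := by
  refine Summable.of_norm_bounded ((summable_vonMangoldt_div hs).mul_left m) fun n => ?_
  rcases eq_or_ne n 0 with rfl | hn
  · simp [Real.zero_rpow (by linarith : s ≠ 0)]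
  · rw [Real.norm_of_nonneg (div_nonneg (ha n hn) (by positivity)), ← mul_div_assoc]
    exact div_le_div_of_nonneg_right (ham n hn) (by positivity)

theorem LSeries_ofReal_eq {s : ℝ} (hs : 1 < s) :
    LSeries (fun n => (a n : ℂ)) s = (∑' n : ℕ, a n / (n : ℝ) ^ s : ℝ) := by
  rw [LSeries, ofReal_tsum]
  refine tsum_congr fun n => ?_
  rcases eq_or_ne n 0 with rfl | hn
  · simp [Real.zero_rpow (by linarith : s ≠ 0)]
  · rw [LSeries.term_of_ne_zero hn, ofReal_div, ofReal_cpow (Nat.cast_nonneg _), ofReal_natCast]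

theorem tendsto_prime_part (ha : ∀ n, n ≠ 0 → 0 ≤ a n)
    (ham : ∀ n, n ≠ 0 → a n ≤ m * vonMangoldt n) {c : ℝ}
    (h : Tendsto (fun s : ℝ => ((s : ℂ) - 1) * LSeries (fun n => (a n : ℂ)) s) (𝓝[>] 1)
      (𝓝 (c : ℂ))) :
    Tendsto (fun s : ℝ => (s - 1) * ∑' n : ℕ, (if n.Prime then a n else 0) / (n : ℝ) ^ s) (𝓝[>] 1)
      (𝓝 c) := by
  have h1 : Tendsto (fun s : ℝ => (s - 1) * ∑' n : ℕ, a n / (n : ℝ) ^ s) (𝓝[>] 1) (𝓝 c) := by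
    have h2 := (Complex.continuous_re.tendsto (c : ℂ)).comp h
    rw [ofReal_re] at h2
    refine h2.congr' ?_
    filter_upwards [self_mem_nhdsWithin] with s hs
    rw [Function.comp_apply, LSeries_ofReal_eq hs, ← ofReal_one, ← ofReal_sub, ← ofReal_mul,
      ofReal_re]
  set B : ℝ := ∑' n : ℕ, m * ((if n.Prime then 0 else vonMangoldt n : ℝ) / n) with hB
  have hp : ∀ n, n ≠ 0 → 0 ≤ (if n.Prime then a n else 0) := fun n hn => by
    split_ifs; exacts [ha n hn, le_rfl]
  have hpm : ∀ n, n ≠ 0 → (if n.Prime then a n else 0) ≤ m * vonMangoldt n := fun n hn => by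
    split_ifs; exacts [ham n hn, (ha n hn).trans (ham n hn)]
  have hq : ∀ n, n ≠ 0 → 0 ≤ (if n.Prime then 0 else a n) := fun n hn => by
    split_ifs; exacts [le_rfl, ha n hn]
  have hqm : ∀ n, n ≠ 0 → (if n.Prime then 0 else a n) ≤ m * vonMangoldt n := fun n hn => by
    split_ifs; exacts [(ha n hn).trans (ham n hn), ham n hn]
  have hsplit : ∀ s : ℝ, 1 < s → ∑' n : ℕ, (if n.Prime then a n else 0) / (n : ℝ) ^ s =
      ∑' n : ℕ, a n / (n : ℝ) ^ s - ∑' n : ℕ, (if n.Prime then 0 else a n) / (n : ℝ) ^ s :=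
    fun s hs => by
    rw [eq_sub_iff_add_eq, ← (summable_div_rpow hp hpm hs).tsum_add (summable_div_rpow hq hqm hs)]
    refine tsum_congr fun n => ?_
    split_ifs <;> ring
  have hnn : ∀ s : ℝ, 1 < s → 0 ≤ ∑' n : ℕ, (if n.Prime then 0 else a n) / (n : ℝ) ^ s :=
    fun s hs => tsum_nonneg fun n => by
      rcases eq_or_ne n 0 with rfl | hn
      · simp [Real.zero_rpow (by linarith : s ≠ 0)]
      · exact div_nonneg (hq n hn) (by positivity)
  have hle : ∀ s : ℝ, 1 < s → ∑' n : ℕ, (if n.Prime then 0 else a n) / (n : ℝ) ^ s ≤ B :=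
    fun s hs => by
    refine (summable_div_rpow hq hqm hs).tsum_le_tsum (fun n => ?_)
      (summable_nonprime_vonMangoldt.mul_left m)
    rcases eq_or_ne n 0 with rfl | hn
    · simp [Real.zero_rpow (by linarith : s ≠ 0)]
    have hn1 : (1 : ℝ) ≤ n := by exact_mod_cast Nat.one_le_iff_ne_zero.2 hn
    split_ifs
    · simp
    · rw [← mul_div_assoc]
      refine (div_le_div_of_nonneg_right (ham n hn) (by positivity)).trans
        (div_le_div_of_nonneg_left ((ha n hn).trans (ham n hn)) (by positivity) ?_)
      conv_lhs => rw [← Real.rpow_one (n : ℝ)]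
      exact Real.rpow_le_rpow_of_exponent_le hn1 hs.le
  have h0 : Tendsto (fun s : ℝ => s - 1) (𝓝[>] 1) (𝓝 0) := by
    have h3 : ContinuousAt (fun s : ℝ => s - 1) 1 := by fun_prop
    simpa using h3.tendsto.mono_left (nhdsWithin_le_nhds (s := Set.Ioi 1))
  have h2 : Tendsto (fun s : ℝ => (s - 1) * ∑' n : ℕ, (if n.Prime then 0 else a n) / (n : ℝ) ^ s)
      (𝓝[>] 1) (𝓝 0) := by
    have h4 := h0.mul_const B
    rw [zero_mul] at h4
    refine tendsto_of_tendsto_of_tendsto_of_le_of_le' tendsto_const_nhds h4 ?_ ?_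
    · filter_upwards [self_mem_nhdsWithin] with s hs
      exact mul_nonneg (sub_nonneg.2 (le_of_lt hs)) (hnn s hs)
    · filter_upwards [self_mem_nhdsWithin] with s hs
      exact mul_le_mul_of_nonneg_left (hle s hs) (sub_nonneg.2 (le_of_lt hs))
  have h5 := h1.sub h2
  rw [sub_zero] at h5
  refine h5.congr' ?_
  filter_upwards [self_mem_nhdsWithin] with s hs
  rw [hsplit s hs, mul_sub]

theorem exists_prime_ne_zero (ha : ∀ n, n ≠ 0 → 0 ≤ a n)
    (ham : ∀ n, n ≠ 0 → a n ≤ m * vonMangoldt n) {c : ℝ} (hc : 0 < c)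
    (h : Tendsto (fun s : ℝ => ((s : ℂ) - 1) * LSeries (fun n => (a n : ℂ)) s) (𝓝[>] 1)
      (𝓝 (c : ℂ))) (B : ℕ) : ∃ q > B, q.Prime ∧ a q ≠ 0 := by
  by_contra! hcon
  have h1 := tendsto_prime_part ha ham h
  have h2 : ∀ s : ℝ, ∑' n : ℕ, (if n.Prime then a n else 0) / (n : ℝ) ^ s =
      ∑ n ∈ Finset.range (B + 1), (if n.Prime then a n else 0) / (n : ℝ) ^ s := fun s => by
    refine tsum_eq_sum fun n hn => ?_
    rw [Finset.mem_range, not_lt] at hn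
    split_ifs with hp
    · rw [hcon n (by omega) hp, zero_div]
    · exact zero_div _
  simp only [h2] at h1
  have h3 : ContinuousAt (fun s : ℝ => (s - 1) *
      ∑ n ∈ Finset.range (B + 1), (if n.Prime then a n else 0) / (n : ℝ) ^ s) 1 := by
    refine (continuousAt_id.sub continuousAt_const).mul (tendsto_finsetSum _ fun n _ => ?_)
    split_ifs with hp
    · have hn : (0 : ℝ) < n := by exact_mod_cast hp.pos
      exact continuousAt_const.div (Real.continuous_const_rpow hn.ne').continuousAt
        (Real.rpow_pos_of_pos hn _).ne'
    · simp only [zero_div]; exact tendsto_const_nhds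
  have h4 := h3.tendsto.mono_left (nhdsWithin_le_nhds (s := Set.Ioi 1))
  rw [sub_self, zero_mul] at h4
  exact hc.ne' (tendsto_nhds_unique h1 h4)

variable {K : Type*} [Field K] [NumberField K]

open NumberField

theorem sum_idealLam_le_vonMangoldt {n : ℕ} (hn : n ≠ 0) :
    ∑ I ∈ idealsOfNorm K n, idealLam I ≤ Module.finrank ℚ K * vonMangoldt n := by
  by_cases h : IsPrimePow n
  · obtain ⟨q, k, hq, hk, rfl⟩ := h
    rw [vonMangoldt_apply_pow hk.ne', vonMangoldt_apply_prime hq.nat_prime]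
    exact sum_idealLam_of_norm_prime_pow_le hq.nat_prime hk.ne'
  · rw [vonMangoldt_eq_zero_iff.2 h, mul_zero]
    refine (Finset.sum_eq_zero fun I hI => ?_).le
    by_contra hI0
    have hP : IsPrimePow I := by
      by_contra hP; exact hI0 (idealLam_eq_zero hP)
    obtain ⟨P, k, hP, hk, rfl⟩ := hP
    have hPm : P.IsMaximal := (Ideal.isPrime_of_prime hP).isMaximal hP.ne_zero
    obtain ⟨q, l, hl, -, hq, hl2⟩ := Ideal.exists_prime_and_absNorm_eq_pow P
    apply h
    rw [← mem_idealsOfNorm.1 hI, map_pow, hl2, ← pow_mul]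
    exact ⟨q, l * k, hq.prime, Nat.mul_pos hl hk, rfl⟩

theorem classLam_nonneg (C : ClassGroup (𝓞 K)) (n : ℕ) : 0 ≤ classLam C n :=
  Finset.sum_nonneg fun I _ => idealLam_nonneg I

open Classical in
theorem classLam_le (C : ClassGroup (𝓞 K)) {n : ℕ} (hn : n ≠ 0) :
    classLam C n ≤ Module.finrank ℚ K * vonMangoldt n :=
  le_trans (Finset.sum_le_sum_of_subset_of_nonneg (Finset.filter_subset _ _)
    fun I _ _ => idealLam_nonneg I) (sum_idealLam_le_vonMangoldt hn)

/-- Every ideal class contains ideals of arbitrarily large prime norm. -/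
theorem exists_ideal_of_prime_norm (hz : HasPartialZeta K) (C : ClassGroup (𝓞 K)) (B : ℕ) :
    ∃ q > B, q.Prime ∧ ∃ I : Ideal (𝓞 K), Ideal.absNorm I = q ∧ idealClass I = C := by
  classical
  have h := tendsto_classLam hz C
  have hc : (0 : ℝ) < (Fintype.card (ClassGroup (𝓞 K)) : ℝ)⁻¹ :=
    inv_pos.2 (Nat.cast_pos.2 Fintype.card_pos)
  obtain ⟨q, hqB, hq, hne⟩ := exists_prime_ne_zero (fun n _ => classLam_nonneg C n)
    (fun n hn => classLam_le C hn) hc (by simpa using h) B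
  obtain ⟨I, hI, -⟩ := Finset.exists_ne_zero_of_sum_ne_zero hne
  rw [Finset.mem_filter, mem_idealsOfNorm] at hI
  exact ⟨q, hqB, hq, I, hI.1, hI.2⟩

end PrimePart

section FormsAndIdeals

open NumberField ComplexConjugate

/-- If forms of discriminant `Δ` are primitive, then orders of discriminant `Δ` are maximal. -/
theorem Prim.dvd_of_norm {Δ : ℤ} (hprim : Prim Δ) (hΔ0 : Δ ≠ 0) {b : ℤ} (hb : (4 : ℤ) ∣ Δ - b ^ 2)
    {u t n : ℤ} (h : Δ * u ^ 2 - t ^ 2 = 4 * n * Δ) : Δ ∣ t := by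
  obtain ⟨g, r, s, hg, hrs, ht, hs⟩ : ∃ g r s : ℤ, g ≠ 0 ∧ IsCoprime r s ∧ t = g * r ∧ Δ = g * s := by
    have h1 : (Int.gcd t Δ : ℤ) ≠ 0 := by
      simp [Int.gcd_eq_zero_iff, hΔ0]
    obtain ⟨r, hr⟩ := Int.gcd_dvd_left t Δ
    obtain ⟨s, hs⟩ := Int.gcd_dvd_right t Δ
    refine ⟨Int.gcd t Δ, r, s, h1, ?_, hr, hs⟩
    have h2 := Int.gcd_eq_gcd_ab t Δ
    refine ⟨Int.gcdA t Δ, Int.gcdB t Δ, mul_left_cancel₀ h1 ?_⟩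
    linear_combination -h2 + Int.gcdA t Δ * (-hr) + Int.gcdB t Δ * (-hs)
  have hs0 : s ≠ 0 := by rintro rfl; exact hΔ0 (by rw [hs, mul_zero])
  have h1 : s * u ^ 2 - g * r ^ 2 = 4 * n * s := mul_left_cancel₀ hg (by
    rw [ht, hs] at h; linear_combination h)
  have h2 : s ∣ g := by
    have h3 : s ∣ r ^ 2 * g := ⟨u ^ 2 - 4 * n, by linear_combination -h1⟩
    exact (hrs.symm.pow_right).dvd_of_dvd_mul_left h3
  obtain ⟨g', rfl⟩ := h2
  have h3 : u ^ 2 - g' * r ^ 2 = 4 * n := mul_left_cancel₀ hs0 (by linear_combination h1)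
  obtain ⟨B, hB⟩ : ∃ B : ℤ, (4 : ℤ) ∣ B ^ 2 - g' := by
    rcases Int.even_or_odd r with ⟨k, rfl⟩ | ⟨k, rfl⟩
    · have hsodd : Odd s := by
        by_contra hs2
        obtain ⟨m, rfl⟩ := Int.not_odd_iff_even.1 hs2
        have h4 := Int.isUnit_iff.1 (hrs.isUnit_of_dvd' ⟨k, (two_mul k).symm⟩ ⟨m, (two_mul m).symm⟩)
        omega
      obtain ⟨m, rfl⟩ := hsodd
      refine ⟨b, ?_⟩
      obtain ⟨w, hw⟩ := hb
      exact ⟨-w + g' * (m ^ 2 + m), by linear_combination -hw + hs⟩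
    · exact ⟨u, n + g' * (k ^ 2 + k), by linear_combination h3⟩
  obtain ⟨C, hC⟩ := hB
  have h4 := hprim ⟨s, s * B, s * C⟩ (by
    simp only [BQF.disc]
    rw [hs]; linear_combination s ^ 2 * hC) s dvd_rfl (dvd_mul_right _ _) (dvd_mul_right _ _)
  rw [ht, hs]
  obtain ⟨v, hv⟩ := h4.dvd (a := r)
  exact ⟨v, by rw [hv]; ring⟩

variable {K : Type*} [Field K] [NumberField K]

theorem sqD_re_im (Δ : ℤ) : (sqD Δ).re = 0 ∧ (sqD Δ).im = Real.sqrt (-(Δ : ℝ)) := by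
  simp [sqD]

/-- The ring of integers of an imaginary quadratic field has the expected `ℤ`-basis. -/
theorem exists_int_repr (φ : K →+* ℂ) (hK : Module.finrank ℚ K = 2) {Δ : ℤ} (hΔ : Δ < 0)
    (hprim : Prim Δ) {x : 𝓞 K} (hx : φ x = sqD Δ) {b : ℤ} (hb : (4 : ℤ) ∣ Δ - b ^ 2) (z : 𝓞 K) :
    ∃ m n : ℤ, φ z = m + n * ((-b + sqD Δ) / 2) := by
  set r : ℝ := Real.sqrt (-(Δ : ℝ)) with hr
  have hΔ' : (0 : ℝ) < -(Δ : ℝ) := by have : (Δ : ℝ) < 0 := by exact_mod_cast hΔ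
                                      linarith
  have hr0 : 0 < r := Real.sqrt_pos.2 hΔ'
  have hr2 : r ^ 2 = -(Δ : ℝ) := Real.sq_sqrt hΔ'.le
  obtain ⟨hs1, hs2⟩ := sqD_re_im Δ
  have hxim : (φ (x : K)).im ≠ 0 := by rw [hx, hs2]; exact hr0.ne'
  have hN := fun a : 𝓞 K => absNorm_span_eq_normSq φ hK hxim a
  set n₀ : ℕ := Ideal.absNorm (Ideal.span {z}) with hn₀
  have h0 : (n₀ : ℝ) = (φ z).re ^ 2 + (φ z).im ^ 2 := by
    rw [hn₀, hN, normSq_apply]; ring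
  obtain ⟨u, hu⟩ : ∃ u : ℤ, (u : ℝ) = 2 * (φ z).re := by
    refine ⟨Ideal.absNorm (Ideal.span {z + 1}) - n₀ - 1, ?_⟩
    push_cast
    rw [hN, h0, show φ ((z + 1 : 𝓞 K) : K) = φ z + 1 by simp, normSq_apply]
    simp only [add_re, one_re, add_im, one_im]
    ring
  obtain ⟨t, ht⟩ : ∃ t : ℤ, (t : ℝ) = 2 * (φ z).im * r := by
    refine ⟨Ideal.absNorm (Ideal.span {z + x}) - n₀ + Δ, ?_⟩
    push_cast
    rw [hN, h0, show φ ((z + x : 𝓞 K) : K) = φ z + φ x by simp, hx, normSq_apply]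
    simp only [add_re, add_im, hs1, hs2, ← hr]
    linear_combination hr2
  have h1 : Δ * u ^ 2 - t ^ 2 = 4 * n₀ * Δ := by
    have h2 : (Δ : ℝ) * (u : ℝ) ^ 2 - (t : ℝ) ^ 2 = 4 * (n₀ : ℝ) * Δ := by
      rw [hu, ht, h0]; linear_combination (-4) * (φ z).im ^ 2 * hr2
    exact_mod_cast h2
  obtain ⟨v, hv⟩ := hprim.dvd_of_norm hΔ.ne hb h1
  have hv' : 2 * (φ z).im = -v * r := by
    rw [hv] at ht
    push_cast at ht
    refine mul_right_cancel₀ hr0.ne' ?_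
    rw [← ht]; linear_combination (v : ℝ) * hr2
  have h3 : u ^ 2 - Δ * v ^ 2 = 4 * n₀ := mul_left_cancel₀ hΔ.ne (by
    rw [hv] at h1; linear_combination h1)
  obtain ⟨k, hk⟩ : (2 : ℤ) ∣ u - v * b := by
    obtain ⟨w, hw⟩ := hb
    have h4 : (2 : ℤ) ∣ (u - v * b) * (u - v * b) :=
      ⟨2 * n₀ + 2 * w * v ^ 2 + v ^ 2 * b ^ 2 - u * v * b, by linear_combination h3 + v ^ 2 * hw⟩
    exact (Int.prime_two.dvd_or_dvd h4).elim id id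
  refine ⟨k, -v, ?_⟩
  have hk' : (u : ℝ) - v * b = 2 * k := by exact_mod_cast hk
  apply Complex.ext
  · have h5 : ((((-b : ℂ) + sqD Δ) / 2)).re = -b / 2 := by
      rw [show (2 : ℂ) = ((2 : ℝ) : ℂ) by norm_num, div_ofReal_re]
      simp [hs1]
    rw [add_re, mul_re, h5, intCast_re, intCast_re, intCast_im, zero_mul, sub_zero]
    push_cast
    linarith
  · have h5 : ((((-b : ℂ) + sqD Δ) / 2)).im = r / 2 := by
      rw [show (2 : ℂ) = ((2 : ℝ) : ℂ) by norm_num, div_ofReal_im]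
      simp [hs2, hr]
    rw [add_im, mul_im, h5, intCast_im, intCast_re, intCast_im, zero_mul, add_zero, zero_add]
    push_cast
    linarith

theorem exists_theta (φ : K →+* ℂ) {Δ : ℤ} (hΔ : Δ < 0) {x : 𝓞 K} (hx : φ x = sqD Δ) {b n : ℤ}
    (hb : Δ = b ^ 2 - 4 * n) : ∃ θ : 𝓞 K, φ θ = (-b + sqD Δ) / 2 := by
  have hx2 : ((x : 𝓞 K) : K) ^ 2 = Δ := φ.injective (by
    rw [map_pow, hx, sqD_sq hΔ, map_intCast])
  have hint : IsIntegral ℤ ((((x : 𝓞 K) : K) - b) / 2) := by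
    refine ⟨Polynomial.X ^ 2 + Polynomial.C b * Polynomial.X + Polynomial.C n, ?_, ?_⟩
    · monicity!
    · simp only [Polynomial.eval₂_add, Polynomial.eval₂_pow, Polynomial.eval₂_X,
        Polynomial.eval₂_mul, Polynomial.eval₂_C, algebraMap_int_eq, Int.coe_castRingHom]
      have h3 : ((Δ : ℤ) : K) = b ^ 2 - 4 * n := by rw [hb]; push_cast; ring
      linear_combination (1 / 4) * hx2 + (1 / 4) * h3
  refine ⟨⟨_, hint⟩, ?_⟩
  show φ ((((x : 𝓞 K) : K) - b) / 2) = _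
  rw [map_div₀, map_sub, hx, map_intCast, map_ofNat]
  ring

/-- Primitive positive definite forms represent arbitrarily large primes. -/
theorem exists_prime_represents (φ : K →+* ℂ) (hK : Module.finrank ℚ K = 2) {Δ : ℤ} (hΔ : Δ < 0)
    (hprim : Prim Δ) {x : 𝓞 K} (hx : φ x = sqD Δ) {Q : BQF} (ha : 0 < Q.a) (hQ : Q.disc = Δ)
    (B : ℕ) : ∃ l > B, l.Prime ∧ Q.Represents l := by
  obtain ⟨a, b, c⟩ := Q
  simp only [BQF.disc] at ha hQ
  obtain ⟨hs1, hs2⟩ := sqD_re_im Δ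
  have hΔ' : (0 : ℝ) < -(Δ : ℝ) := by have : (Δ : ℝ) < 0 := by exact_mod_cast hΔ
                                      linarith
  have hxim : (φ (x : K)).im ≠ 0 := by rw [hx, hs2]; exact (Real.sqrt_pos.2 hΔ').ne'
  have hN := fun a : 𝓞 K => absNorm_span_eq_normSq φ hK hxim a
  have hz : HasPartialZeta K := fun C => exists_partial_zeta φ hK hxim C
  have hb : (4 : ℤ) ∣ Δ - b ^ 2 := ⟨-(a * c), by linear_combination -hQ⟩
  obtain ⟨θ, hθ⟩ := exists_theta φ hΔ hx (b := b) (n := a * c) (by linear_combination -hQ)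
  have hrepr := fun z => exists_int_repr φ hK hΔ hprim hx hb z
  have hθ2 : (φ θ) ^ 2 = -b * φ θ - a * c := by
    rw [hθ]
    have h1 := sqD_sq hΔ
    have h2 : (Δ : ℂ) = b ^ 2 - 4 * a * c := by rw [← hQ]; push_cast; ring
    linear_combination (1 / 4) * h1 + (1 / 4) * h2
  have hform : ∀ X Y : ℤ, normSq (a * X + Y * φ θ) =
      ((a * (a * X ^ 2 - b * X * Y + c * Y ^ 2) : ℤ) : ℝ) := fun X Y => by
    have h1 : (φ θ).re = -b / 2 := by
      rw [hθ, show (2 : ℂ) = ((2 : ℝ) : ℂ) by norm_num, div_ofReal_re]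
      simp [hs1]
    have h2 : (φ θ).im = Real.sqrt (-(Δ : ℝ)) / 2 := by
      rw [hθ, show (2 : ℂ) = ((2 : ℝ) : ℂ) by norm_num, div_ofReal_im]
      simp [hs2]
    have h3 : Real.sqrt (-(Δ : ℝ)) ^ 2 = 4 * a * c - b ^ 2 := by
      rw [Real.sq_sqrt hΔ'.le, ← hQ]; push_cast; ring
    rw [normSq_apply]
    simp only [add_re, add_im, mul_re, mul_im, intCast_re, intCast_im, h1, h2]
    push_cast
    linear_combination (1 / 4) * (Y : ℝ) ^ 2 * h3
  set I : Ideal (𝓞 K) := Ideal.span {(a : 𝓞 K), θ} with hI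
  have hmem : ∀ w ∈ I, ∃ X Y : ℤ, φ ((w : 𝓞 K) : K) = a * X + Y * φ θ := fun w hw => by
    obtain ⟨u, v, rfl⟩ := Ideal.mem_span_pair.1 hw
    obtain ⟨m, n, h1⟩ := hrepr u
    obtain ⟨m', n', h2⟩ := hrepr v
    rw [← hθ] at h1 h2
    refine ⟨m - n' * c, a * n + m' - n' * b, ?_⟩
    have h3 : φ ((u * (a : 𝓞 K) + v * θ : 𝓞 K) : K) = φ u * a + φ v * φ θ := by simp
    rw [h3, h1, h2]
    push_cast
    linear_combination (n' : ℂ) * hθ2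
  have haI : (a : 𝓞 K) ∈ I := Ideal.subset_span (by simp)
  have hθI : θ ∈ I := Ideal.subset_span (by simp)
  have ha0 : (a : 𝓞 K) ≠ 0 := by exact_mod_cast ha.ne'
  have hI0 : I ≠ 0 := fun h => ha0 (by rw [h] at haI; exact haI)
  have key : ∀ B : ℕ, ∃ l > B, l.Prime ∧ ∃ X Y : ℤ,
      (l : ℤ) * Ideal.absNorm I = a * (a * X ^ 2 - b * X * Y + c * Y ^ 2) := fun B => by
    obtain ⟨l, hlB, hl, J, hJ, hJC⟩ := exists_ideal_of_prime_norm hz (idealClass I)⁻¹ B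
    have hJ0 : J ≠ 0 := by
      rintro rfl
      rw [map_zero] at hJ
      exact hl.ne_zero hJ.symm
    obtain ⟨g, hg⟩ := (idealClass_mul_eq_one hJ0 hI0).1 (by rw [hJC, inv_mul_cancel])
    have hgI : g ∈ I := Ideal.dvd_span_singleton.1 ⟨J, by rw [← hg, mul_comm]⟩
    obtain ⟨X, Y, hXY⟩ := hmem g hgI
    refine ⟨l, hlB, hl, X, Y, ?_⟩
    have h1 := hN g
    rw [← hg, map_mul, hJ, hXY, hform] at h1
    exact_mod_cast h1
  have hdvd : ∀ X Y : ℤ, (Ideal.absNorm I : ℤ) ∣ a * (a * X ^ 2 - b * X * Y + c * Y ^ 2) :=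
    fun X Y => by
    have h1 : Ideal.absNorm I ∣ Ideal.absNorm (Ideal.span {(a * X + Y * θ : 𝓞 K)}) :=
      map_dvd _ (Ideal.dvd_span_singleton.2 (I.add_mem (I.mul_mem_right _ haI)
        (I.mul_mem_left _ hθI)))
    have h2 := hN (a * X + Y * θ : 𝓞 K)
    rw [show φ ((a * X + Y * θ : 𝓞 K) : K) = a * X + Y * φ θ by simp, hform] at h2
    have h3 : (Ideal.absNorm (Ideal.span {(a * X + Y * θ : 𝓞 K)}) : ℤ) =
        a * (a * X ^ 2 - b * X * Y + c * Y ^ 2) := by exact_mod_cast h2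
    rw [← h3]
    exact_mod_cast h1
  have hNI : (Ideal.absNorm I : ℤ) = a := by
    refine Int.dvd_antisymm (Int.natCast_nonneg _) ha.le ?_ ?_
    · have h1 := hdvd 1 0
      have h2 := hdvd 0 1
      have h3 := hdvd 1 1
      obtain ⟨k1, h1⟩ := h1
      obtain ⟨k2, h2⟩ := h2
      obtain ⟨k3, h3⟩ := h3
      have hg := hprim ⟨a, b, c⟩ hQ (Int.gcd (Int.gcd a b) c)
        ((Int.gcd_dvd_left _ _).trans (Int.gcd_dvd_left _ _))
        ((Int.gcd_dvd_left _ _).trans (Int.gcd_dvd_right _ _)) (Int.gcd_dvd_right _ _)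
      have h4 := Int.gcd_eq_gcd_ab a b
      have h5 := Int.gcd_eq_gcd_ab (Int.gcd a b) c
      obtain ⟨w, hw⟩ := hg.exists_right_inv
      set u1 := Int.gcdA a b
      set u2 := Int.gcdB a b
      set u3 := Int.gcdA (Int.gcd a b) c
      set u4 := Int.gcdB (Int.gcd a b) c
      refine ⟨w * (u3 * u1 * k1 + u3 * u2 * (k1 + k2 - k3) + u4 * k2), ?_⟩
      linear_combination -a * hw + a * w * h5 + a * w * u3 * h4 + w * u3 * u1 * h1 +
        w * u3 * u2 * (h1 + h2 - h3) + w * u4 * h2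
    · obtain ⟨l, hlB, hl, X, Y, h1⟩ := key a.natAbs
      have h2 : IsCoprime a l := by
        rw [Int.isCoprime_iff_gcd_eq_one, Int.gcd, Int.natAbs_natCast]
        exact Nat.Coprime.symm ((Nat.Prime.coprime_iff_not_dvd hl).2
          fun h => absurd (Nat.le_of_dvd (by omega) h) (by omega))
      exact h2.dvd_of_dvd_mul_left ⟨_, h1⟩
  obtain ⟨l, hlB, hl, X, Y, h1⟩ := key B
  refine ⟨l, hlB, hl, X, -Y, ?_⟩
  rw [hNI] at h1
  refine mul_left_cancel₀ ha.ne' ?_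
  linear_combination -h1

theorem exists_quadratic_field {Δ : ℤ} (hΔ : Δ < 0) :
    ∃ (F : IntermediateField ℚ ℂ) (_ : NumberField F) (x : 𝓞 F),
      Module.finrank ℚ F = 2 ∧ algebraMap F ℂ x = sqD Δ := by
  have hsq := sqD_sq hΔ
  have hintZ : IsIntegral ℤ (sqD Δ) := by
    refine ⟨Polynomial.X ^ 2 - Polynomial.C Δ, by monicity!, ?_⟩
    simp only [Polynomial.eval₂_sub, Polynomial.eval₂_pow, Polynomial.eval₂_X,
      Polynomial.eval₂_C, algebraMap_int_eq, Int.coe_castRingHom, hsq, sub_self]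
  have hint : IsIntegral ℚ (sqD Δ) := hintZ.tower_top
  have hfin := IntermediateField.adjoin.finiteDimensional hint
  have hnf : NumberField (IntermediateField.adjoin ℚ {sqD Δ}) := ⟨⟩
  refine ⟨IntermediateField.adjoin ℚ {sqD Δ}, hnf,
    ⟨IntermediateField.AdjoinSimple.gen ℚ (sqD Δ), ?_⟩, ?_, ?_⟩
  · have h := (isIntegral_algebraMap_iff (R := ℤ)
      (A := IntermediateField.adjoin ℚ {sqD Δ}) (B := ℂ)
      (algebraMap (IntermediateField.adjoin ℚ {sqD Δ}) ℂ).injective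
      (x := IntermediateField.AdjoinSimple.gen ℚ (sqD Δ))).1
    rw [IntermediateField.AdjoinSimple.algebraMap_gen] at h
    exact h hintZ
  · rw [IntermediateField.adjoin.finrank hint]
    refine le_antisymm ?_ ((minpoly.two_le_natDegree_iff hint).2 ?_)
    · have hdeg : (Polynomial.X ^ 2 - Polynomial.C (Δ : ℚ)).natDegree = 2 :=
        Polynomial.natDegree_X_pow_sub_C
      rw [← hdeg]
      refine Polynomial.natDegree_le_of_dvd (minpoly.dvd ℚ _ ?_)
        (Polynomial.X_pow_sub_C_ne_zero two_pos _)
      simp only [map_sub, map_pow, Polynomial.aeval_X, Polynomial.aeval_C, hsq]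
      simp
    · rintro ⟨y, hy⟩
      have h1 := congrArg Complex.im hy
      have h2 : (0 : ℝ) < -(Δ : ℝ) := by
        have : (Δ : ℝ) < 0 := by exact_mod_cast hΔ
        linarith
      rw [(sqD_re_im Δ).2, eq_ratCast, ratCast_im] at h1
      exact (Real.sqrt_pos.2 h2).ne h1
  · exact IntermediateField.AdjoinSimple.algebraMap_gen ℚ (sqD Δ)

theorem BQF.mem.exists_prime_represents {N : ℤ} (hN : 0 < N) (hprim : Prim (-N)) {Q : BQF}
    (hQ : Q.mem N) (B : ℕ) : ∃ l > B, l.Prime ∧ Q.Represents l := by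
  obtain ⟨F, hF, x, hK, hx⟩ := exists_quadratic_field (Δ := -N) (by omega)
  exact _root_.exists_prime_represents (algebraMap F ℂ) hK (by omega) hprim hx hQ.1.1 hQ.2 B

end FormsAndIdeals

section ZetaPole

open NumberField Filter Topology ArithmeticFunction

variable {K : Type*} [Field K] [NumberField K]

/-- The von Mangoldt sum over all ideals of norm `n`. -/
noncomputable def totLam (K : Type*) [Field K] [NumberField K] (n : ℕ) : ℝ :=
  ∑ I ∈ idealsOfNorm K n, idealLam I

theorem totLam_nonneg (n : ℕ) : 0 ≤ totLam K n := Finset.sum_nonneg fun I _ => idealLam_nonneg I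

theorem totLam_le {n : ℕ} (hn : n ≠ 0) : totLam K n ≤ Module.finrank ℚ K * vonMangoldt n :=
  sum_idealLam_le_vonMangoldt hn

theorem LSeries_normSum_lam (s : ℂ) :
    LSeries (normSum fun I : Ideal (𝓞 K) => idealLam I * 1) s =
      LSeries (fun n => (totLam K n : ℂ)) s :=
  LSeries_congr (fun {n} hn => by
    rw [normSum_apply _ hn, totLam, ofReal_sum]
    simp only [mul_one]) s

theorem tendsto_LSeries_normSum_one :
    Tendsto (fun s : ℝ => ((s : ℂ) - 1) * LSeries (normSum fun _ : Ideal (𝓞 K) => 1) s) (𝓝[>] 1)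
      (𝓝 ((Fintype.card (ClassGroup (𝓞 K)) * classResidue K : ℝ) : ℂ)) := by
  have h := tendsto_finsetSum Finset.univ fun C (_ : C ∈ Finset.univ) =>
    tendsto_classCount (K := K) C
  rw [Finset.sum_const, Finset.card_univ, nsmul_eq_mul] at h
  push_cast
  refine h.congr' ?_
  filter_upwards [self_mem_nhdsWithin] with s hs
  rw [← Finset.mul_sum, ((hasSum_normSum_class (K := K) (fun _ => 1) (s := (s : ℂ))
    (by simpa using hs))).LSeries_eq]
  simp only [one_mul]

/-- The logarithmic derivative of the Dedekind zeta function blows up at most like `1/(s-1)`. -/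
theorem not_eventually_le_totLam {c : ℝ} (hc : 1 < c) :
    ¬ ∀ᶠ s : ℝ in 𝓝[>] 1, c ≤ (s - 1) * ∑' n : ℕ, totLam K n / (n : ℝ) ^ s := by
  intro hev
  set Z : ℂ → ℂ := LSeries (normSum fun _ : Ideal (𝓞 K) => 1) with hZ
  have hv : ∀ I : Ideal (𝓞 K), ‖(fun _ => 1 : Ideal (𝓞 K) → ℂ) I‖ ≤ 1 := fun _ => by simp
  set κ : ℝ := Fintype.card (ClassGroup (𝓞 K)) * classResidue K with hκ
  have hκ0 : 0 < κ := mul_pos (Nat.cast_pos.2 Fintype.card_pos) classResidue_pos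
  have h1 : Tendsto (fun s : ℝ => (s - 1) * (Z s).re) (𝓝[>] 1) (𝓝 κ) := by
    have h := (continuous_re.tendsto _).comp (tendsto_LSeries_normSum_one (K := K))
    rw [ofReal_re] at h
    refine h.congr fun s => ?_
    have h0 : (s : ℂ) - 1 = ((s - 1 : ℝ) : ℂ) := by push_cast; rfl
    rw [Function.comp, h0, re_ofReal_mul]
  have h2 : Tendsto (fun s : ℝ => (Z s).re * (s - 1) ^ c) (𝓝[>] 1) (𝓝 0) := by
    have h3 : Tendsto (fun s : ℝ => (s - 1) ^ (c - 1)) (𝓝[>] 1) (𝓝 0) := by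
      have h4 : ContinuousAt (fun s : ℝ => (s - 1) ^ (c - 1)) 1 :=
        (continuousAt_id.sub continuousAt_const).rpow_const (Or.inr (by linarith))
      have h5 := h4.tendsto.mono_left (nhdsWithin_le_nhds (s := Set.Ioi 1))
      simpa [Real.zero_rpow (by linarith : c - 1 ≠ 0)] using h5
    have h4 := h1.mul h3
    rw [mul_zero] at h4
    refine h4.congr' ?_
    filter_upwards [self_mem_nhdsWithin] with s hs
    have hs0 : 0 < s - 1 := sub_pos.2 hs
    have h5 : (s - 1) ^ c = (s - 1) * (s - 1) ^ (c - 1) := by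
      rw [Real.rpow_sub_one hs0.ne', mul_div_cancel₀ _ hs0.ne']
    rw [h5]; ring
  have hder : ∀ s : ℝ, 1 < s → HasDerivAt (fun s : ℝ => (Z s).re)
      (-((∑' n : ℕ, totLam K n / (n : ℝ) ^ s) * (Z s).re)) s := fun s hs => by
    have h3 := LSeries_lam_mul (K := K) hv (fun _ _ _ _ => (mul_one _).symm) (s := (s : ℂ))
      (by simpa using hs)
    rw [LSeries_normSum_lam, LSeries_ofReal_eq hs] at h3
    have h4 : DifferentiableAt ℂ Z s := (LSeries_analyticOnNhd _ _
      (lt_of_le_of_lt (abscissa_normSum_le hv) (by exact_mod_cast hs))).differentiableAt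
    have h5 := h4.hasDerivAt.real_of_complex
    rw [← neg_eq_iff_eq_neg.2 h3, neg_re, re_ofReal_mul] at h5
    exact h5
  obtain ⟨δ, hδ, hδc⟩ := mem_nhdsGT_iff_exists_Ioo_subset.1
    (hev.and (h1.eventually (lt_mem_nhds hκ0)))
  have hpos : ∀ s ∈ Set.Ioo 1 δ, 0 < (Z s).re := fun s hs =>
    (mul_pos_iff_of_pos_left (sub_pos.2 hs.1)).1 (hδc hs).2
  have hanti : AntitoneOn (fun s : ℝ => (Z s).re * (s - 1) ^ c) (Set.Ioo 1 δ) := by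
    have hd : ∀ s ∈ Set.Ioo 1 δ, HasDerivAt (fun s : ℝ => (Z s).re * (s - 1) ^ c)
        (-((∑' n : ℕ, totLam K n / (n : ℝ) ^ s) * (Z s).re) * (s - 1) ^ c +
          (Z s).re * (1 * c * (s - 1) ^ (c - 1))) s := fun s hs =>
      (hder s hs.1).mul (((hasDerivAt_id s).sub_const 1).rpow_const
        (Or.inl (sub_pos.2 hs.1).ne'))
    refine antitoneOn_of_deriv_nonpos (convex_Ioo _ _)
      (fun s hs => (hd s hs).continuousAt.continuousWithinAt)
      (fun s hs => (hd s (interior_subset hs)).differentiableAt.differentiableWithinAt)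
      fun s hs => ?_
    replace hs := interior_subset hs
    have hs0 : 0 < s - 1 := sub_pos.2 hs.1
    have h5 : (s - 1) ^ c = (s - 1) * (s - 1) ^ (c - 1) := by
      rw [Real.rpow_sub_one hs0.ne', mul_div_cancel₀ _ hs0.ne']
    rw [(hd s hs).deriv, h5]
    have h6 := (hδc hs).1
    have h7 : 0 < (Z s).re * (s - 1) ^ (c - 1) := mul_pos (hpos s hs) (Real.rpow_pos_of_pos hs0 _)
    nlinarith
  have hδ1 : (1 : ℝ) < δ := hδ
  set s₀ := (1 + δ) / 2 with hs₀
  have hs₀m : s₀ ∈ Set.Ioo 1 δ := ⟨by rw [hs₀]; linarith, by rw [hs₀]; linarith⟩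
  have hlow : 0 < (Z s₀).re * (s₀ - 1) ^ c :=
    mul_pos (hpos _ hs₀m) (Real.rpow_pos_of_pos (sub_pos.2 hs₀m.1) _)
  refine absurd (ge_of_tendsto h2 ?_) (not_le.2 hlow)
  filter_upwards [Ioo_mem_nhdsGT hs₀m.1] with s hs
  exact hanti ⟨hs.1, hs.2.trans hs₀m.2⟩ hs₀m hs.2.le

/-- Splitting of almost all primes having a degree one factor in a quadratic field
bounds the degree. -/
theorem finrank_le_two {F : Type*} [Field F] [NumberField F] (hz : HasPartialZeta K)
    (hK : Module.finrank ℚ K = 2) {B : ℕ} (h : ∀ q > B, q.Prime → totLam K q ≠ 0 →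
      totLam F q = Module.finrank ℚ F * Real.log q) : Module.finrank ℚ F ≤ 2 := by
  by_contra! hm
  set m : ℝ := ((Module.finrank ℚ F : ℕ) : ℝ) with hmdef
  have hm3 : (3 : ℝ) ≤ m := by rw [hmdef]; exact_mod_cast hm
  have hle : ∀ n, n ≠ 0 → totLam K n ≤ 2 * vonMangoldt n := fun n hn => by
    have := totLam_le (K := K) hn
    rwa [hK] at this
  have hT := tendsto_prime_part (a := totLam K) (m := 2) (c := 1) (fun n _ => totLam_nonneg n) hle
    (by
      have h0 := tendsto_normSum_lam hz 0
      rw [if_pos rfl] at h0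
      simp only [idealChar, AddChar.zero_apply, LSeries_normSum_lam] at h0
      simpa using h0)
  set C : ℝ := ∑ n ∈ Finset.range (B + 1), totLam K n with hC
  have hmain : ∀ s : ℝ, 1 < s → m / 2 * (∑' n : ℕ, (if n.Prime then totLam K n else 0) /
      (n : ℝ) ^ s - C) ≤ ∑' n : ℕ, totLam F n / (n : ℝ) ^ s := fun s hs => by
    have hsF := summable_div_rpow (a := totLam F) (fun n _ => totLam_nonneg n)
      (fun n hn => totLam_le hn) hs
    have hsK := summable_div_rpow (a := fun n => if n.Prime then totLam K n else 0)
      (m := 2) (fun n _ => by split_ifs; exacts [totLam_nonneg n, le_rfl]) (fun n hn => by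
        split_ifs
        · exact hle n hn
        · exact mul_nonneg zero_le_two vonMangoldt_nonneg) hs
    have hsC : HasSum (fun n => if n ∈ Finset.range (B + 1) then totLam K n else 0) C := by
      have h0 := hasSum_sum_of_ne_finset_zero (L := SummationFilter.unconditional ℕ)
        (f := fun n => if n ∈ Finset.range (B + 1) then totLam K n else 0)
        (s := Finset.range (B + 1)) fun n hn => if_neg hn
      rwa [Finset.sum_congr rfl fun n hn => if_pos hn] at h0
    rw [← hsC.tsum_eq, ← hsK.tsum_sub hsC.summable, ← tsum_mul_left]
    refine ((hsK.sub hsC.summable).mul_left _).tsum_le_tsum (fun n => ?_) hsF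
    have hm0 : 0 ≤ m / 2 := by linarith
    have hpow : 0 ≤ (n : ℝ) ^ s := Real.rpow_nonneg n.cast_nonneg _
    have hF0 : 0 ≤ totLam F n / (n : ℝ) ^ s := div_nonneg (totLam_nonneg n) hpow
    have hC0 : 0 ≤ (if n ∈ Finset.range (B + 1) then totLam K n else 0) := by
      split_ifs
      exacts [totLam_nonneg n, le_rfl]
    by_cases hn : n.Prime ∧ totLam K n ≠ 0
    · rw [if_pos hn.1]
      have hn1 : (1 : ℝ) ≤ (n : ℝ) ^ s :=
        Real.one_le_rpow (by exact_mod_cast hn.1.one_le) (by linarith)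
      by_cases hnB : n ∈ Finset.range (B + 1)
      · rw [if_pos hnB]
        refine le_trans (mul_nonpos_of_nonneg_of_nonpos hm0 (sub_nonpos.2 ?_)) hF0
        exact div_le_self (totLam_nonneg n) hn1
      · rw [if_neg hnB, sub_zero, h n (by simpa [Nat.lt_succ_iff] using hnB) hn.1 hn.2,
          ← mul_div_assoc]
        refine div_le_div_of_nonneg_right ?_ hpow
        have h0 := hle n hn.1.ne_zero
        rw [vonMangoldt_apply_prime hn.1] at h0
        nlinarith
    · have h0 : (if n.Prime then totLam K n else 0) = 0 := by
        split_ifs with hnp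
        · by_contra h0
          exact hn ⟨hnp, h0⟩
        · rfl
      rw [h0, zero_div, zero_sub]
      exact le_trans (mul_nonpos_of_nonneg_of_nonpos hm0 (neg_nonpos.2 hC0)) hF0
  refine not_eventually_le_totLam (K := F) (c := 5 / 4) (by norm_num) ?_
  have hlim : Tendsto (fun s : ℝ => m / 2 * ((s - 1) * ∑' n : ℕ,
      (if n.Prime then totLam K n else 0) / (n : ℝ) ^ s - (s - 1) * C)) (𝓝[>] 1)
      (𝓝 (m / 2 * (1 - 0))) := by
    refine (hT.sub ?_).const_mul _
    have h4 : ContinuousAt (fun s : ℝ => (s - 1) * C) 1 := by fun_prop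
    simpa using h4.tendsto.mono_left (nhdsWithin_le_nhds (s := Set.Ioi 1))
  filter_upwards [hlim.eventually (lt_mem_nhds (show (5 / 4 : ℝ) < m / 2 * (1 - 0) by linarith)),
    self_mem_nhdsWithin] with s hs hs1
  have h5 := mul_le_mul_of_nonneg_left (hmain s hs1) (sub_pos.2 hs1).le
  linarith

end ZetaPole

section Splitting

open NumberField ArithmeticFunction

variable {F : Type*} [Field F] [NumberField F]

theorem natCast_ideal_ne_zero {q : ℕ} (hq : q ≠ 0) : Ideal.span {(q : 𝓞 F)} ≠ 0 := by
  rw [Ideal.zero_eq_bot, Ne, Ideal.span_singleton_eq_bot]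
  exact_mod_cast hq

theorem intCast_mem_iff_dvd {P : Ideal (𝓞 F)} [P.IsPrime] {q : ℕ} (hq : q.Prime)
    (hqP : (q : 𝓞 F) ∈ P) (n : ℤ) : (n : 𝓞 F) ∈ P ↔ (q : ℤ) ∣ n := by
  constructor
  · intro hn
    by_contra h
    obtain ⟨u, v, huv⟩ := (Nat.prime_iff_prime_int.1 hq).coprime_iff_not_dvd.2 h
    refine Ideal.IsPrime.ne_top ‹_› ((Ideal.eq_top_iff_one P).2 ?_)
    have h1 : (1 : 𝓞 F) = u * q + v * n := by exact_mod_cast congrArg (Int.cast (R := 𝓞 F)) huv.symm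
    rw [h1]
    exact P.add_mem (P.mul_mem_left _ hqP) (P.mul_mem_left _ hn)
  · rintro ⟨k, rfl⟩
    push_cast
    exact P.mul_mem_right _ hqP

theorem exists_absNorm_eq_pow {P : Ideal (𝓞 F)} (hP : P.IsPrime) {q : ℕ} (hq : q.Prime)
    (hqP : (q : 𝓞 F) ∈ P) : ∃ n, 0 < n ∧ Ideal.absNorm P = q ^ n := by
  have hP0 : P ≠ ⊥ := by
    rintro rfl
    exact hq.ne_zero (by exact_mod_cast (Ideal.mem_bot.1 hqP))
  have hmax : P.IsMaximal := hP.isMaximal hP0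
  obtain ⟨p, n, hn, hpP, hp, h⟩ := Ideal.exists_prime_and_absNorm_eq_pow P
  have h1 := (intCast_mem_iff_dvd hq hqP p).1 (by exact_mod_cast hpP)
  have h2 : q = p := (Nat.prime_dvd_prime_iff_eq hq hp).1 (by exact_mod_cast h1)
  exact ⟨n, hn, by rw [h, h2]⟩

theorem totLam_eq_of_split {q : ℕ} (hq : q.Prime)
    (h1 : ∀ P : Ideal (𝓞 F), P.IsPrime → (q : 𝓞 F) ∈ P → Ideal.absNorm P = q)
    (h2 : ∀ P : Ideal (𝓞 F), P.IsPrime → (q : 𝓞 F) ∈ P → ¬ P ^ 2 ∣ Ideal.span {(q : 𝓞 F)}) :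
    totLam F q = Module.finrank ℚ F * Real.log q := by
  classical
  refine le_antisymm ?_ ?_
  · have h := totLam_le (K := F) hq.ne_zero
    rwa [vonMangoldt_apply_prime hq] at h
  · have h := sum_idealLam (natCast_ideal_ne_zero (F := F) hq.ne_zero)
    rw [absNorm_natCast, Nat.cast_pow, Real.log_pow] at h
    rw [← h, ← Finset.sum_filter_ne_zero]
    refine Finset.sum_le_sum_of_subset_of_nonneg (fun J hJ => ?_) fun J _ _ => idealLam_nonneg J
    obtain ⟨hJ, hJ0⟩ := Finset.mem_filter.1 hJ
    rw [mem_idealDivisors (natCast_ideal_ne_zero hq.ne_zero)] at hJ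
    have hpp : IsPrimePow J := not_not.1 fun h => hJ0 (idealLam_eq_zero h)
    obtain ⟨P, k, hP, hk, rfl⟩ := hpp
    have hPp : P.IsPrime := Ideal.isPrime_of_prime hP
    have hqP : (q : 𝓞 F) ∈ P := Ideal.dvd_span_singleton.1 ((dvd_pow_self P hk.ne').trans hJ)
    have hk1 : k = 1 := by
      by_contra hk1
      exact h2 P hPp hqP ((pow_dvd_pow P (by omega)).trans hJ)
    rw [mem_idealsOfNorm, hk1, pow_one]
    exact h1 P hPp hqP

theorem exists_forall_not_sq_dvd (F : Type*) [Field F] [NumberField F] : ∃ B : ℕ, ∀ q > B, q.Prime →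
    ∀ P : Ideal (𝓞 F), P.IsPrime → (q : 𝓞 F) ∈ P → ¬ P ^ 2 ∣ Ideal.span {(q : 𝓞 F)} := by
  have h0 : differentIdeal ℤ (𝓞 F) ≠ ⊥ := differentIdeal_ne_bot
  refine ⟨Ideal.absNorm (differentIdeal ℤ (𝓞 F)), fun q hqB hq P hP hqP h => ?_⟩
  have hqm : (Ideal.span {(q : ℤ)}).IsMaximal :=
    PrincipalIdealRing.isMaximal_of_irreducible (Nat.prime_iff_prime_int.1 hq).irreducible
  have h1 := pow_sub_one_dvd_differentIdeal ℤ (p := Ideal.span {(q : ℤ)}) P 2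
    (by rw [Ne, Ideal.span_singleton_eq_bot]; exact_mod_cast hq.ne_zero)
    (by rw [Ideal.map_span, Set.image_singleton]; simpa using h)
  rw [show 2 - 1 = 1 from rfl, pow_one] at h1
  obtain ⟨n, hn, h2⟩ := exists_absNorm_eq_pow hP hq hqP
  have h3 : q ∣ Ideal.absNorm (differentIdeal ℤ (𝓞 F)) :=
    (dvd_pow_self q hn.ne').trans (h2 ▸ map_dvd Ideal.absNorm h1)
  exact absurd (Nat.le_of_dvd (Nat.pos_of_ne_zero (absNorm_ne_zero h0)) h3) (by omega)

theorem exists_int_mul_mem_adjoin {s : Set (𝓞 F)}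
    (hs : IntermediateField.adjoin ℚ ((fun x : 𝓞 F => (x : F)) '' s) = ⊤) (x : 𝓞 F) :
    ∃ n : ℤ, n ≠ 0 ∧ n * x ∈ Algebra.adjoin ℤ s := by
  have hx : (x : F) ∈ Algebra.adjoin ℚ ((fun x : 𝓞 F => (x : F)) '' s) := by
    rw [← IntermediateField.adjoin_toSubalgebra, hs]
    trivial
  suffices h : ∀ z ∈ Algebra.adjoin ℚ ((fun x : 𝓞 F => (x : F)) '' s),
      ∃ n : ℤ, n ≠ 0 ∧ ∃ y ∈ Algebra.adjoin ℤ s, (n : F) * z = (y : F) by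
    obtain ⟨n, hn, y, hy, h⟩ := h x hx
    refine ⟨n, hn, ?_⟩
    have : (n : 𝓞 F) * x = y := RingOfIntegers.ext (by simpa using h)
    rwa [this]
  intro z hz
  induction hz using Algebra.adjoin_induction with
  | mem z hz =>
    obtain ⟨y, hy, rfl⟩ := hz
    exact ⟨1, one_ne_zero, y, Algebra.subset_adjoin hy, by simp⟩
  | algebraMap r =>
    refine ⟨r.den, by exact_mod_cast r.den_ne_zero, (r.num : 𝓞 F), intCast_mem _ _, ?_⟩
    have h1 : ((r.den : ℚ) * r) = r.num := Rat.den_mul_eq_num r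
    have h2 := congrArg (algebraMap ℚ F) h1
    rw [map_mul, map_natCast, map_intCast] at h2
    simpa only [Int.cast_natCast, map_intCast] using h2
  | add a b _ _ ha hb =>
    obtain ⟨m, hm, y, hy, h1⟩ := ha
    obtain ⟨n, hn, w, hw, h2⟩ := hb
    refine ⟨m * n, mul_ne_zero hm hn, n * y + m * w, add_mem (mul_mem (intCast_mem _ _) hy)
      (mul_mem (intCast_mem _ _) hw), ?_⟩
    push_cast
    simp only [map_intCast, ← h1, ← h2]
    ring
  | mul a b _ _ ha hb =>
    obtain ⟨m, hm, y, hy, h1⟩ := ha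
    obtain ⟨n, hn, w, hw, h2⟩ := hb
    refine ⟨m * n, mul_ne_zero hm hn, y * w, mul_mem hy hw, ?_⟩
    push_cast
    simp only [← h1, ← h2]
    ring

theorem exists_forall_absNorm_eq {s : Set (𝓞 F)}
    (hs : IntermediateField.adjoin ℚ ((fun x : 𝓞 F => (x : F)) '' s) = ⊤) : ∃ B : ℕ, ∀ q > B,
      q.Prime → ∀ P : Ideal (𝓞 F), P.IsPrime → (q : 𝓞 F) ∈ P → (∀ x ∈ s, x ^ q - x ∈ P) →
        Ideal.absNorm P = q := by
  classical
  obtain ⟨S, hS⟩ := (Module.Finite.fg_top : (⊤ : Submodule ℤ (𝓞 F)).FG)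
  choose f hf0 hf using exists_int_mul_mem_adjoin hs
  set M : ℤ := ∏ x ∈ S, f x with hM
  have hM0 : M ≠ 0 := Finset.prod_ne_zero_iff.2 fun x _ => hf0 x
  refine ⟨M.natAbs, fun q hqM hq P hP hqP hsP => ?_⟩
  have hfact : Fact q.Prime := ⟨hq⟩
  have hMP : (M : 𝓞 F) ∉ P := fun h => by
    have h1 := (intCast_mem_iff_dvd hq hqP M).1 h
    have h2 := Nat.le_of_dvd (Int.natAbs_pos.2 hM0) (Int.natCast_dvd.1 h1)
    omega
  have hchar : CharP (𝓞 F ⧸ P) q := by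
    refine (CharP.charP_iff_prime_eq_zero hq).2 ?_
    rw [← map_natCast (Ideal.Quotient.mk P), Ideal.Quotient.eq_zero_iff_mem]
    exact hqP
  set A : Subring (𝓞 F ⧸ P) := (frobenius (𝓞 F ⧸ P) q).eqLocus (RingHom.id _) with hA
  have hAm : ∀ r, r ∈ A ↔ r ^ q = r := fun r => Iff.rfl
  have hadj : ∀ y ∈ Algebra.adjoin ℤ s, Ideal.Quotient.mk P y ∈ A := by
    have h1 : Algebra.adjoin ℤ s ≤ subalgebraOfSubring (A.comap (Ideal.Quotient.mk P)) :=
      Algebra.adjoin_le fun x hx => by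
        show Ideal.Quotient.mk P x ∈ A
        rw [hAm, ← map_pow, Ideal.Quotient.eq]
        exact hsP x hx
    exact fun y hy => h1 hy
  have hSA : ∀ x ∈ S, Ideal.Quotient.mk P x ∈ A := fun x hx => by
    obtain ⟨k, hk⟩ := Finset.dvd_prod_of_mem f hx
    have h1 : Ideal.Quotient.mk P ((M : 𝓞 F) * x) ∈ A := hadj _ (by
      rw [hM, hk, mul_comm (f x) k]
      push_cast
      rw [mul_assoc]
      exact mul_mem (intCast_mem _ _) (hf x))
    have h2 : Ideal.Quotient.mk P (M : 𝓞 F) ∈ A := by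
      rw [map_intCast]; exact intCast_mem _ _
    rw [hAm] at h1 h2 ⊢
    rw [map_mul, mul_pow, h2] at h1
    exact mul_left_cancel₀ (fun h => hMP (Ideal.Quotient.eq_zero_iff_mem.1 h)) h1
  have hall : ∀ r : 𝓞 F ⧸ P, r ^ q = r := fun r => by
    obtain ⟨x, rfl⟩ := Ideal.Quotient.mk_surjective r
    have hx : x ∈ Submodule.span ℤ (S : Set (𝓞 F)) := hS ▸ Submodule.mem_top
    rw [← hAm]
    induction hx using Submodule.span_induction with
    | mem x hx => exact hSA x hx
    | zero => rw [_root_.map_zero]; exact zero_mem _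
    | add x y _ _ hx hy => rw [map_add]; exact add_mem hx hy
    | smul n x _ hx => rw [map_zsmul]; exact zsmul_mem hx n
  obtain ⟨n, hn, h1⟩ := exists_absNorm_eq_pow hP hq hqP
  have hcard : Ideal.absNorm P ≤ q := by
    have h2 : Ideal.absNorm P = Nat.card (𝓞 F ⧸ P) := rfl
    have hfin : Finite (𝓞 F ⧸ P) := Nat.finite_of_card_ne_zero (by
      rw [← h2, h1]; exact pow_ne_zero _ hq.ne_zero)
    have hft := Fintype.ofFinite (𝓞 F ⧸ P)
    have hdeg : (Polynomial.X ^ q - Polynomial.X : Polynomial (𝓞 F ⧸ P)).natDegree = q := by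
      rw [Polynomial.natDegree_sub_eq_left_of_natDegree_lt, Polynomial.natDegree_X_pow]
      rw [Polynomial.natDegree_X_pow, Polynomial.natDegree_X]
      exact hq.one_lt
    have hne : (Polynomial.X ^ q - Polynomial.X : Polynomial (𝓞 F ⧸ P)) ≠ 0 := fun h => by
      rw [h, Polynomial.natDegree_zero] at hdeg
      exact hq.ne_zero hdeg.symm
    rw [h2, Nat.card_eq_fintype_card, ← Finset.card_univ, ← hdeg]
    refine le_trans (Finset.card_le_card fun r _ => ?_)
      ((Multiset.toFinset_card_le _).trans (Polynomial.card_roots' _))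
    rw [Multiset.mem_toFinset, Polynomial.mem_roots hne]
    simp [Polynomial.IsRoot, hall r]
  rw [h1] at hcard ⊢
  rw [le_antisymm (not_lt.1 fun h => absurd ((Nat.pow_lt_pow_iff_right hq.one_lt).2 h)
    (by rw [pow_one]; omega)) (Nat.succ_le_of_lt hn), pow_one]

end Splitting

section Rationality

open NumberField

theorem exists_sq_of_totLam_ne_zero {K : Type*} [Field K] [NumberField K] {Δ : ℤ} {x : 𝓞 K}
    (hx : x ^ 2 = Δ) {q : ℕ} (hq : q.Prime) (h : totLam K q ≠ 0) : ∃ b : ℤ, (q : ℤ) ∣ b ^ 2 - Δ := by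
  obtain ⟨I, hI, hI0⟩ := Finset.exists_ne_zero_of_sum_ne_zero h
  rw [mem_idealsOfNorm] at hI
  have hcard : Nat.card (𝓞 K ⧸ I) = q := hI
  have hfact : Fact q.Prime := ⟨hq⟩
  have hIp : I.IsPrime := by
    refine Ideal.isPrime_of_irreducible_absNorm ?_
    rw [hI]
    exact hq
  have hqI : (q : 𝓞 K) ∈ I := hI ▸ Ideal.absNorm_mem I
  have h1 : Ideal.Quotient.mk I x ∈ AddSubgroup.zmultiples (1 : 𝓞 K ⧸ I) := by
    rw [zmultiples_eq_top_of_prime_card hcard one_ne_zero]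
    trivial
  obtain ⟨b, hb⟩ := AddSubgroup.mem_zmultiples_iff.1 h1
  refine ⟨b, (intCast_mem_iff_dvd hq hqI _).1 ?_⟩
  rw [← Ideal.Quotient.eq_zero_iff_mem]
  push_cast
  rw [← hx, map_sub, map_pow, map_pow, ← hb]
  simp

/-- Congruences modulo primes of a subfield of `ℂ` follow from those in the ring of all
algebraic integers. -/
theorem mem_of_forall_mem_Zb {F : IntermediateField ℚ ℂ} (P : Ideal (𝓞 F)) [P.IsPrime]
    {q : ℕ} (hqP : (q : 𝓞 F) ∈ P) {x : 𝓞 F} {y : Zb} (hy : (y : ℂ) = algebraMap F ℂ x)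
    (h : ∀ I : Ideal Zb, I.IsPrime → (q : Zb) ∈ I → y ∈ I) : x ∈ P := by
  let f : 𝓞 F →+* Zb :=
    { toFun := fun z => ⟨algebraMap F ℂ z, (RingOfIntegers.isIntegral_coe z).map
        ((algebraMap F ℂ).toIntAlgHom)⟩
      map_one' := by apply Subtype.ext; simp
      map_zero' := by apply Subtype.ext; simp
      map_add' := fun a b => by apply Subtype.ext; simp
      map_mul' := fun a b => by apply Subtype.ext; simp }
  have hinj : Function.Injective f := fun a b hab =>
    RingOfIntegers.ext ((algebraMap F ℂ).injective
      (by have h1 := congrArg Subtype.val hab; exact h1))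
  let _ : Algebra (𝓞 F) Zb := f.toAlgebra
  have hint : Algebra.IsIntegral (𝓞 F) Zb := ⟨fun z => by
    have h1 : IsIntegral ℤ z := Algebra.IsIntegral.isIntegral z
    exact h1.tower_top⟩
  obtain ⟨Q, -, hQ, hQP⟩ := Ideal.exists_ideal_over_prime_of_isIntegral (S := Zb) P ⊥ (by
    change RingHom.ker f ≤ P
    rw [(RingHom.injective_iff_ker_eq_bot f).1 hinj]
    exact bot_le)
  rw [← hQP, Ideal.mem_comap] at hqP ⊢
  rw [map_natCast] at hqP
  have hxy : algebraMap (𝓞 F) Zb x = y := Subtype.ext hy.symm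
  rw [hxy]
  exact h Q hQ hqP

/-- A real algebraic integer which is fixed by Frobenius at almost all primes where `Δ < 0` is
a square is rational. -/
theorem exists_rat_of_frobenius {Δ : ℤ} (hΔ : Δ < 0) {β : Zb} (hβ : (β : ℂ).im = 0) {B : ℕ}
    (h : ∀ q > B, q.Prime → (∃ b : ℤ, (q : ℤ) ∣ b ^ 2 - Δ) →
      ∀ I : Ideal Zb, I.IsPrime → (q : Zb) ∈ I → β ^ q - β ∈ I) : ∃ r : ℚ, (β : ℂ) = r := by
  obtain ⟨K, hK, x, hK2, hx⟩ := exists_quadratic_field hΔ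
  have hsq := sqD_sq hΔ
  have hΔ' : (0 : ℝ) < -(Δ : ℝ) := by
    have : (Δ : ℝ) < 0 := by exact_mod_cast hΔ
    linarith
  have him : (sqD Δ).im ≠ 0 := by rw [(sqD_re_im Δ).2]; exact (Real.sqrt_pos.2 hΔ').ne'
  have hz : HasPartialZeta K := fun C =>
    exists_partial_zeta (algebraMap K ℂ) hK2 (by rw [hx]; exact him) C
  have hx2 : x ^ 2 = Δ := RingOfIntegers.ext ((algebraMap K ℂ).injective (by
    change (algebraMap K ℂ (x : K)) ^ 2 = _
    rw [hx, hsq]; simp))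
  have hδint : IsIntegral ℤ (sqD Δ) := by
    rw [← hx]
    exact (RingOfIntegers.isIntegral_coe x).map ((algebraMap K ℂ).toIntAlgHom)
  have hβint : IsIntegral ℤ (β : ℂ) := β.2
  have hfin : FiniteDimensional ℚ (IntermediateField.adjoin ℚ {(β : ℂ), sqD Δ}) :=
    IntermediateField.finiteDimensional_adjoin fun z hz => by
      rcases hz with rfl | rfl
      exacts [hβint.tower_top, hδint.tower_top]
  set F := IntermediateField.adjoin ℚ {(β : ℂ), sqD Δ} with hF
  have hnf : NumberField F := ⟨⟩
  have hβF : (β : ℂ) ∈ F := IntermediateField.subset_adjoin _ _ (by simp)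
  have hδF : sqD Δ ∈ F := IntermediateField.subset_adjoin _ _ (by simp)
  have hlift : ∀ z : ℂ, IsIntegral ℤ z → z ∈ F → ∃ w : 𝓞 F, algebraMap F ℂ w = z :=
    fun z hz hzF => ⟨⟨⟨z, hzF⟩, (isIntegral_algebraMap_iff (R := ℤ) (A := F) (B := ℂ)
      (algebraMap F ℂ).injective (x := ⟨z, hzF⟩)).1 hz⟩, rfl⟩
  obtain ⟨b, hb⟩ := hlift _ hβint hβF
  obtain ⟨δ, hδ⟩ := hlift _ hδint hδF
  have hadj : IntermediateField.adjoin ℚ ((fun x : 𝓞 F => (x : F)) '' {b, δ}) = ⊤ := by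
    have himg : (fun x : 𝓞 F => (x : F)) '' {b, δ} = {(b : F), (δ : F)} := Set.image_pair ..
    have h1 : ∀ i : Algebra ℚ F,
        @IntermediateField.adjoin ℚ _ F _ i {(b : F), (δ : F)} = ⊤ := fun i => by
      obtain rfl : i = F.algebra' := Subsingleton.elim _ _
      apply IntermediateField.lift_injective F
      rw [IntermediateField.lift_top, IntermediateField.lift_adjoin, Set.image_pair]
      exact congrArg (IntermediateField.adjoin ℚ) (congrArg₂ (fun u v : ℂ => ({u, v} : Set ℂ)) hb hδ)
    rw [himg]
    exact h1 _
  obtain ⟨B₁, hB₁⟩ := exists_forall_absNorm_eq hadj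
  obtain ⟨B₂, hB₂⟩ := exists_forall_not_sq_dvd F
  have hδ2 : δ ^ 2 = Δ := RingOfIntegers.ext ((algebraMap F ℂ).injective (by
    change (algebraMap F ℂ (δ : F)) ^ 2 = _
    rw [hδ, hsq]; simp))
  have hrank := finrank_le_two (F := F) hz hK2 (B := B + B₁ + B₂ + 2 + Δ.natAbs)
    fun q hqB hq hqK => by
      obtain ⟨c, hc⟩ := exists_sq_of_totLam_ne_zero hx2 hq hqK
      refine totLam_eq_of_split hq (fun P hP hqP => hB₁ q (by omega) hq P hP hqP ?_)
        (hB₂ q (by omega) hq)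
      intro y hy
      obtain rfl | rfl : y = b ∨ y = δ := hy
      · refine mem_of_forall_mem_Zb P hqP (y := β ^ q - β) (by
          change (β : ℂ) ^ q - β = (algebraMap F ℂ (y : F)) ^ q - algebraMap F ℂ (y : F)
          rw [hb]) ?_
        exact h q (by omega) hq ⟨c, hc⟩
      · obtain ⟨k, hk⟩ := hq.odd_of_ne_two (by omega)
        have hdvd : (q : ℤ) ∣ Δ ^ k - 1 := by
          have hfact : Fact q.Prime := ⟨hq⟩
          have hc' : (c : ZMod q) ^ 2 = (Δ : ZMod q) := by
            have := (ZMod.intCast_zmod_eq_zero_iff_dvd _ _).2 hc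
            push_cast at this
            linear_combination this
          have hΔq : (Δ : ZMod q) ≠ 0 := fun h0 => by
            have h1 := (ZMod.intCast_zmod_eq_zero_iff_dvd _ _).1 h0
            have h2 := Nat.le_of_dvd (Int.natAbs_pos.2 hΔ.ne) (Int.natCast_dvd.1 h1)
            omega
          have hc0 : (c : ZMod q) ≠ 0 := fun h0 => hΔq (by rw [← hc', h0]; simp)
          have hF := ZMod.pow_card_sub_one_eq_one hc0
          rw [show q - 1 = 2 * k by omega, pow_mul, hc'] at hF
          rw [← ZMod.intCast_zmod_eq_zero_iff_dvd]
          push_cast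
          rw [hF, sub_self]
        have h1 : y ^ q - y = ((Δ ^ k - 1 : ℤ) : 𝓞 F) * y := by
          rw [hk, pow_succ, pow_mul, hδ2]; push_cast; ring
        rw [h1]
        exact P.mul_mem_right _ ((intCast_mem_iff_dvd hq hqP _).2 hdvd)
  have hdep : ¬ LinearIndependent ℚ ![(1 : F), (b : F), (δ : F)] := fun hli => by
    have := hli.fintype_card_le_finrank
    rw [Fintype.card_fin] at this
    omega
  obtain ⟨g, hg, i, hi⟩ := Fintype.not_linearIndependent_iff.1 hdep
  have h2 : (g 0 : ℂ) + g 1 * β + g 2 * sqD Δ = 0 := by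
    have h3 := congrArg (algebraMap F ℂ) hg
    rw [Fin.sum_univ_three] at h3
    simp only [Matrix.cons_val_zero, Matrix.cons_val_one, Matrix.cons_val, Algebra.smul_def,
      map_add, map_mul, map_zero, mul_one, hb, hδ, eq_ratCast, map_ratCast] at h3
    exact h3
  have h3 : g 2 = 0 := by
    have h4 := congrArg Complex.im h2
    simp only [add_im, mul_im, ratCast_im, ratCast_re, hβ, zero_im, zero_mul, mul_zero,
      add_zero, zero_add] at h4
    exact_mod_cast (mul_eq_zero.1 h4).resolve_right him
  have h4 : g 1 ≠ 0 := fun h4 => by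
    have h5 : g 0 = 0 := by
      rw [h3, h4] at h2
      simpa using h2
    fin_cases i
    exacts [hi h5, hi h4, hi h3]
  refine ⟨-g 0 / g 1, ?_⟩
  rw [h3] at h2
  have h5 : (g 1 : ℂ) ≠ 0 := by exact_mod_cast h4
  push_cast
  rw [eq_div_iff h5]
  push_cast at h2
  linear_combination h2

end Rationality

section TwistedTrace

theorem isIntegral_jpStar_root {p : ℕ} (hp : Good p) {N β : ℤ} (hN : 0 < N)
    (hprim : Prim (-N)) {Q : BQF} (hQ : Q.memN N p β) : IsIntegral ℤ (jpStar p Q.root) := by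
  have hdisc := hQ.disc
  simp only [BQF.disc] at hdisc
  have hQ₀ : BQF.mem N ⟨1, Q.b, Q.a * Q.c⟩ := by
    have : BQF.disc ⟨1, Q.b, Q.a * Q.c⟩ = -N := by simp only [BQF.disc]; linarith
    exact ⟨⟨one_pos, by rw [this]; linarith⟩, this⟩
  obtain ⟨l, hlp, hl, x, y, hxy⟩ := hQ₀.exists_prime_represents hN hprim p
  obtain ⟨A, hA⟩ := hQ.2.1
  have hpl : p.Coprime l := ((Nat.coprime_primes hp.prime hl).2 (by omega))
  have hα := hQ.posDef.root_im_pos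
  have hroot := hQ.posDef.root_eq
  refine isIntegral_jpStar_of_fixed hp hl hpl hα (A := x) (B := -(Q.c * y)) (C := A * y)
    (D := x + Q.b * y) ?_ ?_
  · rw [← hxy]
    linear_combination Q.c * y ^ 2 * -hA
  · have hne : ((p * (A * y) : ℤ) * Q.root + (x + Q.b * y : ℤ) : ℂ) ≠ 0 := by
      refine den_ne_zero hα ?_
      by_contra! h
      have ha : Q.a ≠ 0 := hQ.posDef.1.ne'
      have hy : y = 0 := by
        have h1 : Q.a * y = 0 := by rw [hA]; linear_combination h.1
        exact (mul_eq_zero.1 h1).resolve_left ha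
      have hx : x = 0 := by simpa [hy] using h.2
      rw [hx, hy] at hxy
      have := hl.pos
      simp at hxy
      omega
    rw [mob, div_eq_iff hne]
    have hA' : (Q.a : ℂ) = p * A := by exact_mod_cast hA
    rw [hA'] at hroot
    push_cast
    linear_combination -(y : ℂ) * hroot

theorem exists_int_of_isIntegral {r : ℚ} (h : IsIntegral ℤ (r : ℂ)) : ∃ n : ℤ, (r : ℂ) = n := by
  have h1 : IsIntegral ℤ r := (isIntegral_algebraMap_iff (R := ℤ) (A := ℚ) (B := ℂ)
    (algebraMap ℚ ℂ).injective (x := r)).1 h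
  obtain ⟨n, hn⟩ := IsIntegrallyClosed.isIntegral_iff.1 h1
  exact ⟨n, by rw [← hn]; simp⟩

theorem dvd_of_isIntegral_of_mul_eq {a m : ℤ} (ha : a ≠ 0) {z : ℂ} (hz : IsIntegral ℤ z)
    (h : z * a = m) : a ∣ m := by
  have ha' : (a : ℂ) ≠ 0 := by exact_mod_cast ha
  have hzr : z = ((m / a : ℚ) : ℂ) := by
    push_cast
    rw [eq_div_iff ha', h]
  rw [hzr] at hz
  obtain ⟨n, hn⟩ := exists_int_of_isIntegral hz
  refine ⟨n, ?_⟩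
  have : (m : ℂ) = a * n := by rw [← h, hzr, hn, mul_comm]
  exact_mod_cast this

/-- Divisibility in the ring of integers of `ℚ(√D)`. -/
theorem exists_eq_int_mul_sqrt {D : ℤ} (hD : IsFundamentalDiscriminant D) (hD0 : 0 < D)
    {s m : ℤ} {t u : ℂ} (ht : IsIntegral ℤ t) (hu : IsIntegral ℤ u) (h : 2 * u = s + t)
    (hm : t * Real.sqrt D = m) : ∃ n : ℤ, t = n * Real.sqrt D := by
  have hDR : (0 : ℝ) < D := by exact_mod_cast hD0
  have hsq : (Real.sqrt D : ℂ) ^ 2 = D := by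
    rw [← ofReal_pow, Real.sq_sqrt hDR.le]; simp
  have hs0 : (Real.sqrt D : ℂ) ≠ 0 := by
    exact_mod_cast (Real.sqrt_pos.2 hDR).ne'
  have h1 : D ∣ m ^ 2 := dvd_of_isIntegral_of_mul_eq hD0.ne' (ht.pow 2) (by
    push_cast
    rw [← hm, mul_pow, hsq])
  suffices h2 : D ∣ m by
    obtain ⟨n, hn⟩ := h2
    refine ⟨n, mul_right_cancel₀ hs0 ?_⟩
    rw [hm, hn]
    push_cast
    linear_combination -(n : ℂ) * hsq
  rcases hD with ⟨-, hsf⟩ | ⟨h4, hsf, hmod⟩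
  · exact (hsf.dvd_pow_iff_dvd two_ne_zero).1 h1
  · obtain ⟨E, rfl⟩ : (4 : ℤ) ∣ D := Int.dvd_of_emod_eq_zero h4
    rw [Int.mul_ediv_cancel_left _ four_ne_zero] at hsf hmod
    have hE0 : E ≠ 0 := hsf.ne_zero
    obtain ⟨k, rfl⟩ : (2 : ℤ) ∣ m := by
      refine Int.prime_two.dvd_of_dvd_pow (n := 2) (Dvd.dvd.trans ⟨2 * E, by ring⟩ h1)
    have h2 : E ∣ k := by
      refine (hsf.dvd_pow_iff_dvd two_ne_zero).1 ?_
      refine Int.dvd_of_mul_dvd_mul_left four_ne_zero (?_ : 4 * E ∣ 4 * k ^ 2)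
      convert h1 using 1
      ring
    obtain ⟨j, rfl⟩ := h2
    have ht2 : t ^ 2 = E * j ^ 2 := by
      have h3 : t ^ 2 * ((4 * E : ℤ) : ℂ) = ((2 * (E * j) : ℤ) : ℂ) ^ 2 := by
        rw [← hsq, ← hm, mul_pow]
      push_cast at h3
      have hE' : (4 * E : ℂ) ≠ 0 := by exact_mod_cast (mul_ne_zero four_ne_zero hE0)
      refine mul_right_cancel₀ hE' ?_
      linear_combination h3
    have h3 : (4 : ℤ) ∣ s ^ 2 - E * j ^ 2 := by
      refine dvd_of_isIntegral_of_mul_eq four_ne_zero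
        (z := u * (s - u)) (hu.mul ((isIntegral_algebraMap (A := ℂ) (x := s)).sub hu)) ?_
      push_cast
      linear_combination -(2 * u - s + t) * h - ht2
    have h4 : (2 : ℤ) ∣ j := by
      by_contra hj
      have hj2 : j ^ 2 % 4 = 1 := by
        obtain ⟨i, rfl⟩ : Odd j := Int.not_even_iff_odd.1 fun h => hj h.two_dvd
        ring_nf; omega
      have hs2 : s ^ 2 % 4 = 0 ∨ s ^ 2 % 4 = 1 := by
        rcases Int.even_or_odd' s with ⟨i, rfl | rfl⟩
        · left; ring_nf; omega
        · right; ring_nf; omega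
      have h5 : (E * j ^ 2) % 4 = E % 4 := by rw [Int.mul_emod, hj2]; simp
      omega
    obtain ⟨i, rfl⟩ := h4
    exact ⟨i, by ring⟩

end TwistedTrace

section Assembly

theorem exists_int_of_frobenius {Δ : ℤ} (hΔ : Δ < 0) {β : Zb} (hβ : (β : ℂ).im = 0) {B : ℕ}
    (h : ∀ q > B, q.Prime → (∃ b : ℤ, (q : ℤ) ∣ b ^ 2 - Δ) →
      ∀ I : Ideal Zb, I.IsPrime → (q : Zb) ∈ I → β ^ q - β ∈ I) : ∃ n : ℤ, (β : ℂ) = n := by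
  obtain ⟨r, hr⟩ := exists_rat_of_frobenius hΔ hβ h
  obtain ⟨n, hn⟩ := exists_int_of_isIntegral (r := r) (hr ▸ β.2)
  exact ⟨n, hr.trans hn⟩

/-- Euler's criterion turns a congruence twisted by `(D/q)` into one for the multiple by `√D`. -/
theorem mul_sqrt_pow_sub_mem {D : ℤ} {δ : Zb} (hδ : δ ^ 2 = D) {q : ℕ} (hq : q.Prime)
    (hq2 : q ≠ 2) {I : Ideal Zb} (hqI : (q : Zb) ∈ I) {S : Zb}
    (h : S - jacobiSym D q * S ^ q ∈ I) :
    (S * δ) ^ q - S * δ ∈ I := by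
  obtain ⟨k, hk⟩ := hq.odd_of_ne_two hq2
  have hfact : Fact q.Prime := ⟨hq⟩
  have h1 : (q : ℤ) ∣ D ^ k - jacobiSym D q := by
    rw [← ZMod.intCast_zmod_eq_zero_iff_dvd, ← jacobiSym.legendreSym.to_jacobiSym]
    push_cast
    rw [legendreSym.eq_pow, show q / 2 = k by omega, sub_self]
  obtain ⟨m, hm⟩ := h1
  have h3 : (D : Zb) ^ k - jacobiSym D q = q * m := by
    exact_mod_cast congrArg (Int.cast (R := Zb)) hm
  have h4 : (S * δ) ^ q - S * δ =
      q * (m * S ^ q * δ) - (S - jacobiSym D q * S ^ q) * δ := by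
    have h5 : δ ^ q = D ^ k * δ := by rw [hk, pow_succ, pow_mul, hδ]
    rw [mul_pow, h5]
    linear_combination S ^ q * δ * h3
  rw [h4]
  exact I.sub_mem (I.mul_mem_right _ hqI) (I.mul_mem_right _ h)

end Assembly

/-- **Integrality of normalized twisted traces.**
Let `p` be a prime with `p − 1 ∣ 24`, and `D > 1`, `−d < 0` coprime fundamental
discriminants, both congruent to squares mod `4p`.  Let `R` be a set of
representatives for `𝒬_{dD,p,β}/Γ₀(p)` and `χ = χ_{D,−d}` the genus character.
Then `(1/√D)·t^{(p)}(D,d)` is a rational integer, where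
`t^{(p)}(D,d) = ∑_{Q ∈ 𝒬_{dD,p,β}/Γ₀(p)} χ(Q)·j_p*(α_Q)`. -/
theorem twisted_trace_integral (p : ℕ) (hp : p.Prime) (hp24 : (p : ℤ) - 1 ∣ 24)
    (D d : ℤ) (hD1 : 1 < D) (hd : 0 < d)
    (hDfund : IsFundamentalDiscriminant D) (hdfund : IsFundamentalDiscriminant (-d))
    (hcop : IsCoprime D d)
    (hDsq : ∃ s : ℤ, s ^ 2 ≡ D [ZMOD (4 * p)])
    (hdsq : ∃ s : ℤ, s ^ 2 ≡ -d [ZMOD (4 * p)])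
    (β : ℤ) (hβ : β ^ 2 ≡ -(d * D) [ZMOD (4 * p)])
    -- `R` is a set of representatives of `𝒬_{dD,p,β}/Γ₀(p)`
    (R : Finset BQF)
    (hRmem : ∀ Q ∈ R, Q.memN (d * D) p β)
    (hRineq : ∀ Q ∈ R, ∀ Q' ∈ R, Q ≠ Q' →
      ¬ BQF.equiv (CongruenceSubgroup.Gamma0 p) Q Q')
    (hRcover : ∀ Q : BQF, Q.memN (d * D) p β →
      ∃ Q' ∈ R, BQF.equiv (CongruenceSubgroup.Gamma0 p) Q Q')
    -- `χ` is the genus character `χ_{D,−d}`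
    (χ : BQF → ℤ)
    (hχpm : ∀ Q : BQF, Q.mem (d * D) → χ Q = 1 ∨ χ Q = -1)
    (hχ : ∀ Q : BQF, Q.mem (d * D) → ∀ q : ℕ, q.Prime → Q.Represents q →
      ¬ (q : ℤ) ∣ D * d → χ Q = kronecker D q) :
    ∃ n : ℤ,
      (∑ Q ∈ R, (χ Q : ℂ) * jpStar p Q.root) = (n : ℂ) * Real.sqrt D := by
  have hgood := good_of_dvd hp hp24
  have hN : 0 < d * D := mul_pos hd (by linarith)
  have hΔ : -(d * D) < 0 := by linarith
  have hprim := prim_of_isFundamentalDiscriminant hDfund hdfund hcop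
  obtain ⟨E, E', hEE', hE4, hEsf, hEcop, hEs, hE's, hDE⟩ :=
    exists_odd_part hDfund hdfund hcop hDsq hdsq
  have hrep : ∀ Q : BQF, Q.mem (d * D) → ∀ B : ℕ, ∃ l > B, l.Prime ∧ Q.Represents l :=
    fun Q hQ => hQ.exists_prime_represents hN hprim
  have hχE : ∀ Q : BQF, Q.mem (d * D) → ∀ l : ℕ, l.Prime → l ≠ 2 → Q.Represents l →
      ¬ (l : ℤ) ∣ d * D → χ Q = jacobiSym E l := fun Q hQ l hl hl2 hQl hlN => by
    rw [hχ Q hQ l hl hQl (by rwa [mul_comm D d]), kronecker_prime D hl hl2]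
    refine hDE l ?_
    rw [← hQ.2]
    exact hQl.jacobiSym_disc hl (by rwa [hQ.2, dvd_neg])
  have hRineq' : ∀ Q ∈ R, ∀ Q' ∈ R, Q ≠ Q' → ¬ BQF.Eqv p Q Q' := fun Q hQ Q' hQ' hne h =>
    hRineq Q hQ Q' hQ' hne (BQF.equiv_iff.2 h)
  have hRcover' : ∀ Q : BQF, Q.memN (d * D) p β → ∃ Q' ∈ R, BQF.Eqv p Q Q' := fun Q hQ => by
    obtain ⟨Q', hQ', h⟩ := hRcover Q hQ
    exact ⟨Q', hQ', BQF.equiv_iff.1 h⟩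
  have hint : ∀ Q : BQF, Q.memN (d * D) p β → IsIntegral ℤ (jpStar p Q.root) :=
    fun Q hQ => isIntegral_jpStar_root hgood hN hprim hQ
  have hχe : ∀ Q Q' : BQF, Q.memN (d * D) p β → BQF.Eqv p Q Q' → χ Q' = χ Q :=
    fun Q Q' hQ h => genus_of_eqv hrep hN hχE hQ.1 (hQ.of_eqv h).1 h
  have hχd : ∀ Q : BQF, Q.memN (d * D) p β → χ (Q.dual p) = χ Q := fun Q hQ =>
    genus_dual hp hrep hN hE4 hEsf hEcop hEs hE's hEE' hχE hQ.1 hQ.2.1 (hQ.dual hp.pos).1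
  have hsum : ∀ w : BQF → ℤ, IsIntegral ℤ (∑ Q ∈ R, (w Q : ℂ) * jpStar p Q.root) := fun w =>
    IsIntegral.sum _ fun Q hQ =>
      (isIntegral_algebraMap (A := ℂ) (x := w Q)).mul (hint Q (hRmem Q hQ))
  have hDR : (0 : ℝ) < D := by exact_mod_cast (by linarith : 0 < D)
  have hδ2 : (Real.sqrt D : ℂ) ^ 2 = D := by
    rw [← ofReal_pow, Real.sq_sqrt hDR.le]; simp
  let δ : Zb := ⟨Real.sqrt D, IsIntegral.of_pow two_pos (by
    rw [hδ2]; exact isIntegral_algebraMap (A := ℂ) (x := D))⟩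
  have hδ : δ ^ 2 = D := Subtype.ext hδ2
  let S : Zb := ⟨∑ Q ∈ R, ((1 : ℤ) : ℂ) * jpStar p Q.root, hsum fun _ => 1⟩
  let T : Zb := ⟨∑ Q ∈ R, (χ Q : ℂ) * jpStar p Q.root, hsum χ⟩
  have hqN : ∀ q : ℕ, q > p + 2 + (d * D).natAbs → ¬ (q : ℤ) ∣ -(d * D) := fun q hq h => by
    rw [dvd_neg, Int.natCast_dvd] at h
    have := Nat.le_of_dvd (Int.natAbs_pos.2 hN.ne') h
    omega
  have hcopq : ∀ q : ℕ, q.Prime → q > p + 2 + (d * D).natAbs → p.Coprime q := fun q hq hqB =>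
    (Nat.coprime_primes hp hq).2 (by omega)
  obtain ⟨s, hs⟩ : ∃ s : ℤ, (S : ℂ) = s := by
    refine exists_int_of_frobenius hΔ (B := p + 2 + (d * D).natAbs)
      (Complex.conj_eq_iff_im.1 (conj_sum_eq hgood hRmem hRineq' hRcover'
        (fun _ _ _ _ => rfl) fun _ _ => rfl)) fun q hqB hq ⟨b, hb⟩ I hI hqI => ?_
    have h1 := frob_sum hgood hN hprim hq (by omega) (hcopq q hq hqB) (hqN q hqB) hb hint hRmem
      hRineq' hRcover' (w := fun _ => 1) (fun _ _ => Or.inl rfl) (fun _ _ _ _ => rfl) (ε := 1)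
      (fun _ _ _ => rfl) (Or.inl rfl) hqI (S := S) rfl
    rw [Int.cast_one, one_mul] at h1
    rw [← neg_sub]
    exact I.neg_mem h1
  obtain ⟨m, hm⟩ : ∃ m : ℤ, ((T * δ : Zb) : ℂ) = m := by
    refine exists_int_of_frobenius hΔ (B := p + 2 + (d * D).natAbs) ?_
      fun q hqB hq ⟨b, hb⟩ I hI hqI => ?_
    · have h1 : (T : ℂ).im = 0 := Complex.conj_eq_iff_im.1
        (conj_sum_eq hgood hRmem hRineq' hRcover' hχe hχd)
      change ((T : ℂ) * Real.sqrt D).im = 0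
      rw [Complex.im_mul_ofReal, h1, zero_mul]
    · have hcopN : IsCoprime (-(d * D)) (q : ℤ) :=
        ((Nat.prime_iff_prime_int.1 hq).coprime_iff_not_dvd.2 (hqN q hqB)).symm
      have hDEq := hDE q (jacobiSym_eq_one_of_sq' hcopN hb)
      have hD0 : jacobiSym D q = 1 ∨ jacobiSym D q = -1 := by
        refine jacobiSym.eq_one_or_neg_one (Int.isCoprime_iff_gcd_eq_one.1 ?_)
        exact (IsCoprime.neg_left_iff _ _).1 hcopN |>.of_mul_left_right
      refine mul_sqrt_pow_sub_mem hδ hq (by omega) hqI ?_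
      refine frob_sum hgood hN hprim hq (by omega) (hcopq q hq hqB) (hqN q hqB) hb hint hRmem
        hRineq' hRcover' (fun Q hQ => hχpm Q hQ.1) hχe (fun Q hQ hqc => ?_) hD0 hqI rfl
      rw [hDEq]
      exact genus_shift hrep hN hE4 hEE' hχE hq (by omega) (hqN q hqB) hQ.1 hqc
        (hQ.shift (by exact_mod_cast hq.pos) hqc).1
  have hu : IsIntegral ℤ (∑ Q ∈ R with χ Q = 1, jpStar p Q.root) :=
    IsIntegral.sum _ fun Q hQ => hint Q (hRmem Q (Finset.mem_filter.1 hQ).1)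
  refine exists_eq_int_mul_sqrt hDfund (by linarith) (s := s) (m := m) (hsum χ) hu ?_ hm
  rw [← hs]
  change _ = ∑ Q ∈ R, ((1 : ℤ) : ℂ) * jpStar p Q.root + _
  rw [Finset.sum_filter, Finset.mul_sum, ← Finset.sum_add_distrib]
  refine Finset.sum_congr rfl fun Q hQ => ?_
  rcases hχpm Q (hRmem Q hQ).1 with h | h <;> rw [h] <;> norm_num
  ring
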